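/- Let R be a reduced elliptic root system of rank l ≥ 2 with fundamental-set Π ∪ {a}, associated maps k, g, and elliptic Lie algebra 𝔤^ω = 𝔤(Π,k,g,ω) for a tuning ω. Then: the set of non-isotropic elements of ℛ^ω equals R; dim 𝔤^ω_μ = 1 for every μ ∈ R; 𝔤^ω_0 = 𝔥^ω and dim 𝔥^ω = l+2; every isotropic element of ℛ^ω lies in ℤδ ⊕ ℤa; and for every m ∈ ℤ ∖ {0}, dim 𝔤^ω_{ma} = |{α ∈ Π : k(α) divides m}|. -/

import Mathlib

/- ## Preliminaries: extended affine root systems (Saito) -/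

noncomputable section

open Set

/-- The reflection `s_v : z ↦ z - (v^∨, z) v = z - (2 (v,z)/(v,v)) v` associated to a
bilinear form `B` and a vector `v`.  (When `B v v = 0` this is the identity, by the
`division by zero = 0` convention; reflections are only ever used at non-isotropic `v`.) -/
def srefl {V : Type*} [AddCommGroup V] [Module ℝ V]
    (B : LinearMap.BilinForm ℝ V) (v : V) : Module.End ℝ V :=
  LinearMap.id - (((2 * (B v v)⁻¹) • (B v)).smulRight v)

/-- The Weyl group `W_S` generated by the reflections in the elements of `S`
(realized as the multiplicative closure; each generator is an involution, so this
agrees with the generated group). -/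
def weyl {V : Type*} [AddCommGroup V] [Module ℝ V]
    (B : LinearMap.BilinForm ℝ V) (S : Set V) : Submonoid (Module.End ℝ V) :=
  Submonoid.closure (srefl B '' S)

/-- The orbit `W_S · α`. -/
def worbit {V : Type*} [AddCommGroup V] [Module ℝ V]
    (B : LinearMap.BilinForm ℝ V) (S : Set V) (α : V) : Set V :=
  {v | ∃ w ∈ weyl B S, w α = v}

/-- `V⁰`, the set of isotropic vectors. -/
def nullSet {V : Type*} [AddCommGroup V] [Module ℝ V]
    (B : LinearMap.BilinForm ℝ V) : Set V := {v | B v v = 0}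

/-- `ℤR`, the subgroup of `V` generated by `R`. -/
def zspan {V : Type*} [AddCommGroup V] (R : Set V) : AddSubgroup V :=
  AddSubgroup.closure R

/-- `ℤ≥0 Π`, the set of nonnegative-integer linear combinations of elements of `Π`. -/
def nnspan {V : Type*} [AddCommMonoid V] (P : Set V) : Set V :=
  (AddSubmonoid.closure P : Set V)

/-- `(R, V)` is an `n`-extended affine root system of rank `l` (K. Saito). -/
structure IsEARS {V : Type*} [AddCommGroup V] [Module ℝ V]
    (B : LinearMap.BilinForm ℝ V) (R : Set V) (l n : ℕ) : Prop where
  rank_pos : 1 ≤ l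
  findim : FiniteDimensional ℝ V
  symm : ∀ u v, B u v = B v u
  posSemidef : ∀ v, 0 ≤ B v v
  dim_eq : Module.finrank ℝ V = l + n
  null_eq : nullSet B = (LinearMap.ker B : Set V)
  dim_null : Module.finrank ℝ (LinearMap.ker B) = n
  /-- (AX1), first half -/
  root_nonisotropic : ∀ α ∈ R, B α α ≠ 0
  /-- (AX1), second half -/
  span_eq_top : Submodule.span ℝ R = ⊤
  /-- (AX2) -/
  free : Module.Free ℤ (zspan R)
  /-- (AX2) -/
  rank_eq : Module.finrank ℤ (zspan R) = l + n
  /-- (AX3): `(α^∨, β) ∈ ℤ` -/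
  integral : ∀ α ∈ R, ∀ β ∈ R, ∃ m : ℤ, 2 * B α β = (m : ℝ) * B α α
  /-- (AX4) -/
  reflect : ∀ α ∈ R, srefl B α '' R = R
  /-- (AX5) -/
  connected : ∀ S' ⊆ R, S'.Nonempty → S' ≠ R → ∃ x ∈ S', ∃ y ∈ R \ S', B x y ≠ 0

/-- `R` is reduced, i.e. `R ∩ 2R = ∅`. -/
def IsReducedRS {V : Type*} [AddCommGroup V] [Module ℝ V] (R : Set V) : Prop :=
  ∀ α ∈ R, (2 : ℤ) • α ∉ R

/-- `Π₀` is a base (with `m` elements) of the root system `R₀`: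
`Π₀ ⊆ R₀`, `Π₀` consists of `m` linearly independent elements, and
`R₀ = (R₀ ∩ ℤ≥0 Π₀) ∪ (R₀ ∩ ℤ≤0 Π₀)`. -/
def IsBaseSet {M : Type*} [AddCommGroup M] [Module ℝ M] (R₀ P₀ : Set M) (m : ℕ) : Prop :=
  P₀ ⊆ R₀ ∧ P₀.Finite ∧ P₀.ncard = m ∧
  LinearIndependent ℝ ((↑) : P₀ → M) ∧
  R₀ = (R₀ ∩ nnspan P₀) ∪ (R₀ ∩ (-(nnspan P₀)))

/-- The bilinear form induced on a quotient `V ⧸ W` by a form vanishing on `W`. -/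
def quotForm {V : Type*} [AddCommGroup V] [Module ℝ V]
    (W : Submodule ℝ V) (B : LinearMap.BilinForm ℝ V)
    (h1 : ∀ w ∈ W, B w = 0) (h2 : ∀ v : V, ∀ w ∈ W, B v w = 0) :
    LinearMap.BilinForm ℝ (V ⧸ W) :=
  Submodule.liftQ W
    { toFun := fun v => Submodule.liftQ W (B v) (fun w hw => LinearMap.mem_ker.mpr (h2 v w hw))
      map_add' := fun u v => by
        ext x
        simp
      map_smul' := fun c v => by
        ext x
        simp }
    (fun w hw => by
      simp only [LinearMap.mem_ker]
      ext x
      simp [h1 w hw])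

end

/-- A fundamental-set `Π ∪ {a}` of a reduced elliptic root system `R` of rank `l`:
(FS1) `a ∈ (ℤR)⁰` and `(ℤR)⁰ = ℤa ⊕ ℤb` for some `b`;
(FS2) `|Π| = l+1`, `Π ⊆ R` and `π_a(Π)` is a base of the affine root system `π_a(R)`. -/
def IsFundamentalSet {V : Type*} [AddCommGroup V] [Module ℝ V]
    (B : LinearMap.BilinForm ℝ V) (R : Set V) (l : ℕ) (P : Set V) (a : V) : Prop :=
  a ∈ zspan R ∧ B a a = 0 ∧
  (∃ b : V, b ∈ zspan R ∧ B b b = 0 ∧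
    ((zspan R : Set V) ∩ nullSet B = {v | ∃ m n : ℤ, v = m • a + n • b}) ∧
    (∀ m n : ℤ, m • a + n • b = 0 → m = 0 ∧ n = 0)) ∧
  P ⊆ R ∧ P.Finite ∧ P.ncard = l + 1 ∧
  IsBaseSet ((Submodule.span ℝ {a}).mkQ '' R) ((Submodule.span ℝ {a}).mkQ '' P) (l + 1)

/-- The subset `⋃_{ε=±1} ((εα + ℤ kα a) ∪ (2εα + gα·kα a))` of the plane `ℝα ⊕ ℝa`;
here `gα : Bool`, with `false` encoding `g(α) = ∅` and `true` encoding `g(α) = 2ℤ+1`. -/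
def kgLine {V : Type*} [AddCommGroup V] (a α : V) (kα : ℕ) (gα : Bool) : Set V :=
  {v | ∃ ε m : ℤ, (ε = 1 ∨ ε = -1) ∧ v = ε • α + (m * kα) • a} ∪
  {v | gα = true ∧ ∃ ε m : ℤ, (ε = 1 ∨ ε = -1) ∧ Odd m ∧ v = (2 * ε) • α + (m * kα) • a}

/-- `k : Π → ℕ` and `g : Π → {∅, 2ℤ+1}` are the maps associated to the fundamental-set
`Π ∪ {a}`, i.e. `R ∩ (ℝα ⊕ ℝa) = ⋃_{ε=±1} ((εα + ℤ k(α) a) ∪ (2εα + g(α)k(α)a))`. -/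
def IsKG {V : Type*} [AddCommGroup V] [Module ℝ V]
    (R : Set V) (a : V) (P : Set V) (k : V → ℕ) (g : V → Bool) : Prop :=
  ∀ α ∈ P, 0 < k α ∧
    R ∩ (Submodule.span ℝ {α, a} : Set V) = kgLine a α (k α) (g α)

/-- `c(α) = 1` if `g(α) = ∅`, `c(α) = 2` if `g(α) = 2ℤ+1`. -/
def cMap {V : Type*} (g : V → Bool) (α : V) : ℕ := if g α then 2 else 1

/-- `α* := c(α)·α + k(α)·a`. -/
def starMap {V : Type*} [AddCommGroup V] (a : V) (k : V → ℕ) (g : V → Bool) (α : V) : V :=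
  (cMap g α : ℤ) • α + (k α : ℤ) • a

/-- `B₊ := {α, α* | α ∈ Π}`. -/
def bplus {V : Type*} [AddCommGroup V] (a : V) (P : Set V) (k : V → ℕ) (g : V → Bool) :
    Set V :=
  P ∪ (starMap a k g '' P)

/-- `B := B₊ ∪ (−B₊)`. -/
def bfull {V : Type*} [AddCommGroup V] (a : V) (P : Set V) (k : V → ℕ) (g : V → Bool) :
    Set V :=
  bplus a P k g ∪ (-(bplus a P k g))

/-- The set `R(Π,k,g) = ⋃_{w ∈ W_Π} ⋃_{α ∈ Π} ((w(α) + ℤk(α)a) ∪ (w(2α) + g(α)k(α)a))`. -/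
def kgUnion {V : Type*} [AddCommGroup V] [Module ℝ V]
    (B : LinearMap.BilinForm ℝ V) (P : Set V) (a : V) (k : V → ℕ) (g : V → Bool) :
    Set V :=
  {v | ∃ w ∈ weyl B P, ∃ α ∈ P,
    (∃ m : ℤ, v = w α + (m * k α) • a) ∨
    (g α = true ∧ ∃ m : ℤ, Odd m ∧ v = w ((2 : ℤ) • α) + (m * k α) • a)}

noncomputable section

/-- `ω : 𝒜 → ℂ^×` is a tuning: it is nonzero on
`𝒜 = {(α,β) : (α,β^∨) = -1}` and `ω(α,β)ω(β,α) = 1` whenever also `(α^∨,β) = -1`. -/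
def IsTuning {V : Type*} [AddCommGroup V] [Module ℝ V]
    (B : LinearMap.BilinForm ℝ V) (P : Set V) (ω : V → V → ℂ) : Prop :=
  ∀ α ∈ P, ∀ β ∈ P,
    (2 * B α β = -(B β β) → ω α β ≠ 0) ∧
    (2 * B α β = -(B β β) → 2 * B α β = -(B α α) → ω α β * ω β α = 1)

/-- `δ = δ(Π)`: a positive-integer combination of the elements of `Π` with
`ℤδ = (ℤΠ)⁰`. -/
def IsDelta {V : Type*} [AddCommGroup V] [Module ℝ V]
    (B : LinearMap.BilinForm ℝ V) (P : Set V) (δ : V) : Prop :=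
  (∃ s : Finset V, (s : Set V) = P ∧
    ∃ c : V → ℕ, (∀ α ∈ s, 0 < c α) ∧ δ = ∑ α ∈ s, (c α : ℤ) • α) ∧
  (AddSubgroup.closure {δ} : Set V) = (AddSubgroup.closure P : Set V) ∩ nullSet B

end

noncomputable section

/- ## The elliptic Lie algebra `𝔤(Π, k, g, ω)` presented by (SR1)–(SR9) -/

open TensorProduct

/-- The complexification `V^ℂ = ℂ ⊗_ℝ V`. -/
abbrev Vc (V : Type*) [AddCommGroup V] [Module ℝ V] : Type _ := ℂ ⊗[ℝ] V

/-- `v^∨ := 2v/(v,v)`. -/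
def vee {V : Type*} [AddCommGroup V] [Module ℝ V]
    (B : LinearMap.BilinForm ℝ V) (v : V) : V := (2 / B v v) • v

/-- The exponent `x_{μ,ν} = 1 - ((μ^∨,ν) - |(μ^∨,ν)|)/2` (a positive integer since
`(μ^∨,ν) ∈ ℤ`). -/
def xExp {V : Type*} [AddCommGroup V] [Module ℝ V]
    (B : LinearMap.BilinForm ℝ V) (μ ν : V) : ℕ :=
  1 + ⌈-(2 * B μ ν / B μ μ)⌉₊

/-- The type of generators of the presented elliptic Lie algebra:
`h_σ` for `σ ∈ V^ℂ` and `E_μ` for `μ ∈ B = B₊ ∪ (−B₊)`. -/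
def EllGen {V : Type*} [AddCommGroup V] [Module ℝ V]
    (a : V) (P : Set V) (k : V → ℕ) (g : V → Bool) : Type _ :=
  Vc V ⊕ ↥(bfull a P k g)

/-- The generator `h_σ` inside the free Lie algebra. -/
def hFree {V : Type*} [AddCommGroup V] [Module ℝ V]
    (a : V) (P : Set V) (k : V → ℕ) (g : V → Bool) (σ : Vc V) :
    FreeLieAlgebra ℂ (EllGen a P k g) :=
  FreeLieAlgebra.of ℂ (Sum.inl σ)

open scoped Classical in
/-- The generator `E_μ` inside the free Lie algebra (`0` if `μ ∉ B`; the relations only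
ever use it at points of `B`). -/
def eFree {V : Type*} [AddCommGroup V] [Module ℝ V]
    (a : V) (P : Set V) (k : V → ℕ) (g : V → Bool) (μ : V) :
    FreeLieAlgebra ℂ (EllGen a P k g) :=
  if h : μ ∈ bfull a P k g then FreeLieAlgebra.of ℂ (Sum.inr ⟨μ, h⟩) else 0

/-- The relations (SR1)–(SR9) of Definition 5.2, as elements of the free Lie algebra. -/
def ellRels {V : Type*} [AddCommGroup V] [Module ℝ V]
    (B : LinearMap.BilinForm ℝ V) (a : V) (P : Set V) (k : V → ℕ) (g : V → Bool)
    (ω : V → V → ℂ) : Set (FreeLieAlgebra ℂ (EllGen a P k g)) :=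
  -- (SR1)
  {z | ∃ (x y : ℂ) (σ τ : Vc V),
    z = x • hFree a P k g σ + y • hFree a P k g τ - hFree a P k g (x • σ + y • τ)} ∪
  -- (SR2)
  {z | ∃ σ τ : Vc V, z = ⁅hFree a P k g σ, hFree a P k g τ⁆} ∪
  -- (SR3)
  {z | ∃ σ : Vc V, ∃ μ ∈ bfull a P k g,
    z = ⁅hFree a P k g σ, eFree a P k g μ⁆
      - (LinearMap.BilinForm.baseChange ℂ B σ ((1 : ℂ) ⊗ₜ[ℝ] μ)) • eFree a P k g μ} ∪
  -- (SR4)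
  {z | ∃ μ ∈ bplus a P k g,
    z = ⁅eFree a P k g μ, eFree a P k g (-μ)⁆
      - hFree a P k g ((1 : ℂ) ⊗ₜ[ℝ] vee B μ)} ∪
  -- (SR5)
  {z | ∃ μ ∈ bfull a P k g, ∃ ν ∈ bfull a P k g, μ ≠ ν ∧ ν ≠ -μ ∧
    z = ((LieAlgebra.ad ℂ _ (eFree a P k g μ)) ^ xExp B μ ν) (eFree a P k g ν)} ∪
  -- (SR6)
  {z | ∃ α ∈ P, ∃ β ∈ P, 2 * B α β = -(B β β) ∧
    z = (cMap g α : ℂ) •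
          ((LieAlgebra.ad ℂ _ (eFree a P k g (starMap a k g α))) ^ (k β / k α))
            (eFree a P k g β)
      - ω α β •
          ((LieAlgebra.ad ℂ _ (eFree a P k g α)) ^ (cMap g α * (k β / k α)))
            (eFree a P k g (starMap a k g β))} ∪
  -- (SR7)
  {z | ∃ α ∈ P, ∃ β ∈ P, 2 * B α β = -(B β β) ∧
    z = ((-1 : ℂ) ^ (cMap g α + 1) * (cMap g α : ℂ)) •
          ((LieAlgebra.ad ℂ _ (eFree a P k g (-(starMap a k g α)))) ^ (k β / k α))
            (eFree a P k g (-β))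
      - (ω α β)⁻¹ •
          ((LieAlgebra.ad ℂ _ (eFree a P k g (-α))) ^ (cMap g α * (k β / k α)))
            (eFree a P k g (-(starMap a k g β)))} ∪
  -- (SR8)
  {z | ∃ α ∈ P, ∃ β ∈ P, 2 * B α β = -(B β β) ∧ ∃ i : ℕ, 1 ≤ i ∧ i ≤ k β / k α - 1 ∧
    z = ((LieAlgebra.ad ℂ _ (eFree a P k g α)) ^ i)
          (((LieAlgebra.ad ℂ _ (eFree a P k g (starMap a k g α))) ^ (k β / k α - i))
            (eFree a P k g β))} ∪
  -- (SR9)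
  {z | ∃ α ∈ P, ∃ β ∈ P, 2 * B α β = -(B β β) ∧ ∃ i : ℕ, 1 ≤ i ∧ i ≤ k β / k α - 1 ∧
    z = ((LieAlgebra.ad ℂ _ (eFree a P k g (-α))) ^ i)
          (((LieAlgebra.ad ℂ _ (eFree a P k g (-(starMap a k g α)))) ^ (k β / k α - i))
            (eFree a P k g (-β)))}

/-- The Lie ideal generated by the relations (SR1)–(SR9). -/
def ellIdeal {V : Type*} [AddCommGroup V] [Module ℝ V]
    (B : LinearMap.BilinForm ℝ V) (a : V) (P : Set V) (k : V → ℕ) (g : V → Bool)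
    (ω : V → V → ℂ) : LieIdeal ℂ (FreeLieAlgebra ℂ (EllGen a P k g)) :=
  LieSubmodule.lieSpan ℂ _ (ellRels B a P k g ω)

/-- The elliptic Lie algebra `𝔤(Π,k,g,ω)`, presented by generators and the relations
(SR1)–(SR9). -/
abbrev EllipticLieAlg {V : Type*} [AddCommGroup V] [Module ℝ V]
    (B : LinearMap.BilinForm ℝ V) (a : V) (P : Set V) (k : V → ℕ) (g : V → Bool)
    (ω : V → V → ℂ) : Type _ :=
  FreeLieAlgebra ℂ (EllGen a P k g) ⧸ ellIdeal B a P k g ω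

/-- The element `h_σ` of the elliptic Lie algebra. -/
def hbar {V : Type*} [AddCommGroup V] [Module ℝ V]
    (B : LinearMap.BilinForm ℝ V) (a : V) (P : Set V) (k : V → ℕ) (g : V → Bool)
    (ω : V → V → ℂ) (σ : Vc V) : EllipticLieAlg B a P k g ω :=
  LieSubmodule.Quotient.mk (N := ellIdeal B a P k g ω) (hFree a P k g σ)

/-- The element `E_μ` of the elliptic Lie algebra. -/
def ebar {V : Type*} [AddCommGroup V] [Module ℝ V]
    (B : LinearMap.BilinForm ℝ V) (a : V) (P : Set V) (k : V → ℕ) (g : V → Bool)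
    (ω : V → V → ℂ) (μ : V) : EllipticLieAlg B a P k g ω :=
  LieSubmodule.Quotient.mk (N := ellIdeal B a P k g ω) (eFree a P k g μ)

open scoped Classical in
/-- `gr` is the `ℤR`-grading `𝔤 = ⊕_{σ ∈ ℤR} 𝔤_σ` of the elliptic Lie algebra
(indexed by `V`, supported on `ℤR`), with `E_μ ∈ 𝔤_μ` and `h_σ ∈ 𝔤_0`. -/
def IsEllGrading {V : Type*} [AddCommGroup V] [Module ℝ V]
    (B : LinearMap.BilinForm ℝ V) (R : Set V) (a : V) (P : Set V) (k : V → ℕ)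
    (g : V → Bool) (ω : V → V → ℂ)
    (gr : V → Submodule ℂ (EllipticLieAlg B a P k g ω)) : Prop :=
  DirectSum.IsInternal gr ∧
  (∀ σ τ : V, ∀ x ∈ gr σ, ∀ y ∈ gr τ, ⁅x, y⁆ ∈ gr (σ + τ)) ∧
  (∀ σ : V, gr σ ≠ ⊥ → σ ∈ zspan R) ∧
  (∀ σ : Vc V, hbar B a P k g ω σ ∈ gr 0) ∧
  (∀ μ ∈ bfull a P k g, ebar B a P k g ω μ ∈ gr μ)

end

open LieAlgebra

section SlTwo
variable {L : Type*} [LieRing L] [LieAlgebra ℂ L]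

/-- A copy of `sl2` acting locally nilpotently. -/
structure SLTwo (e f h : L) : Prop where
  ef : ⁅e, f⁆ = h
  he : ⁅h, e⁆ = (2 : ℂ) • e
  hf : ⁅h, f⁆ = -((2 : ℂ) • f)
  ne : ∀ v : L, ∃ n : ℕ, (ad ℂ L e ^ n) v = 0
  nf : ∀ v : L, ∃ n : ℕ, (ad ℂ L f ^ n) v = 0

namespace SLTwo
variable {e f h : L}

theorem swap (S : SLTwo e f h) : SLTwo f e (-h) where
  ef := by rw [← S.ef, lie_skew]
  he := by rw [neg_lie, S.hf, neg_neg]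
  hf := by rw [neg_lie, S.he]
  ne := S.nf
  nf := S.ne

theorem weight_pow (S : SLTwo e f h) {v : L} {z : ℂ} (hv : ⁅h, v⁆ = z • v) (n : ℕ) :
    ⁅h, (ad ℂ L e ^ n) v⁆ = (z + 2 * n) • (ad ℂ L e ^ n) v := by
  induction n with
  | zero => simp [hv]
  | succ n ih =>
    rw [pow_succ', Module.End.mul_apply, ad_apply, leibniz_lie, ih, S.he, smul_lie, lie_smul]
    push_cast; module

theorem f_pow (S : SLTwo e f h) {v : L} {z : ℂ} (hv : ⁅h, v⁆ = z • v) (n : ℕ) :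
    ⁅f, (ad ℂ L e ^ (n+1)) v⁆ =
      (ad ℂ L e ^ (n+1)) ⁅f, v⁆ - ((n+1) * (z + n)) • (ad ℂ L e ^ n) v := by
  have hfe : ⁅f, e⁆ = -h := by rw [← S.ef, lie_skew]
  induction n with
  | zero =>
    simp only [zero_add, pow_one, ad_apply, pow_zero, Module.End.one_apply]
    rw [leibniz_lie, hfe, neg_lie, hv]; push_cast; module
  | succ n ih =>
    have hp : ⁅e, (ad ℂ L e ^ n) v⁆ = (ad ℂ L e ^ (n+1)) v := by
      rw [pow_succ', Module.End.mul_apply, ad_apply]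
    rw [pow_succ' _ (n+1), Module.End.mul_apply, Module.End.mul_apply, ad_apply, ad_apply,
      leibniz_lie, hfe, neg_lie, S.weight_pow hv, ih, lie_sub, lie_smul, hp]
    push_cast; module

theorem inj (S : SLTwo e f h) (n : ℕ) {v : L} (hv : ⁅h, v⁆ = (-(n:ℂ)) • v)
    (he : (ad ℂ L e ^ n) v = 0) : v = 0 := by
  obtain ⟨s, hs⟩ := S.nf v
  induction s generalizing n v with
  | zero => simpa using hs
  | succ s ih =>
    have hu : ⁅f, v⁆ = 0 := by
      refine ih (n+2) ?_ ?_ ?_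
      · rw [leibniz_lie, hv, S.hf]; push_cast; simp only [lie_smul, neg_lie, smul_lie]; module
      · have h1 := S.f_pow hv (n+1)
        have h2 : ∀ m, (ad ℂ L e ^ (m+n)) v = 0 := fun m => by
          rw [pow_add, Module.End.mul_apply, he, map_zero]
        rw [show n+1+1 = 2+n by ring, h2, show n+1 = 1+n by ring, h2] at h1
        rw [show n+2 = 2+n by ring]
        simpa using h1.symm
      · rw [pow_succ, Module.End.mul_apply] at hs; exact hs
    have key : ∀ N, N ≤ n → (ad ℂ L e ^ N) v = 0 → v = 0 := by
      intro N
      induction N with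
      | zero => intro _ h; simpa using h
      | succ N ihN =>
        intro hN h0
        refine ihN (by omega) ?_
        have h1 := S.f_pow hv N
        rw [h0, hu, lie_zero, map_zero, zero_sub, eq_comm, neg_eq_zero, smul_eq_zero] at h1
        rcases h1 with h1 | h1
        · exfalso
          rcases mul_eq_zero.1 h1 with h2 | h2
          · exact Nat.cast_add_one_ne_zero N h2
          · have : (N:ℂ) = n := by linear_combination h2
            have := Nat.cast_injective this; omega
        · exact h1
    exact key n le_rfl he

theorem inj' (S : SLTwo e f h) (n : ℕ) {v : L} (hv : ⁅h, v⁆ = (n:ℂ) • v)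
    (hf : (ad ℂ L f ^ n) v = 0) : v = 0 :=
  S.swap.inj n (by rw [neg_lie, hv, neg_smul]) hf

/-- killed by `e`, negative weight -/
theorem kill_e (S : SLTwo e f h) (n : ℕ) {v : L} (hv : ⁅h, v⁆ = (-((n+1:ℕ):ℂ)) • v)
    (he : ⁅e, v⁆ = 0) : v = 0 :=
  S.inj (n+1) hv (by rw [pow_succ, Module.End.mul_apply, ad_apply, he, map_zero])

theorem kill_f (S : SLTwo e f h) (n : ℕ) {v : L} (hv : ⁅h, v⁆ = ((n+1:ℕ):ℂ) • v)
    (he : ⁅f, v⁆ = 0) : v = 0 :=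
  S.swap.kill_e n (by rw [neg_lie, hv, neg_smul]) he

/-- killed by `f`, weight zero -/
theorem zero_f (S : SLTwo e f h) {v : L} (hv : ⁅h, v⁆ = 0) (hf : ⁅f, v⁆ = 0) : ⁅e, v⁆ = 0 := by
  refine S.kill_f 1 ?_ ?_
  · rw [leibniz_lie, hv, S.he, lie_zero, smul_lie]; push_cast; module
  · rw [leibniz_lie, hf, ← lie_skew f e, S.ef, neg_lie, hv, lie_zero]; simp

theorem zero_e (S : SLTwo e f h) {v : L} (hv : ⁅h, v⁆ = 0) (he : ⁅e, v⁆ = 0) : ⁅f, v⁆ = 0 :=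
  S.swap.zero_f (by rw [neg_lie, hv, neg_zero]) he

end SLTwo

/-- local nilpotency from generators -/
theorem locNil_of_gen (e : L) (T : Set L) (hT : LieSubalgebra.lieSpan ℂ L T = ⊤)
    (h : ∀ t ∈ T, ∃ n : ℕ, (ad ℂ L e ^ n) t = 0) (v : L) : ∃ n : ℕ, (ad ℂ L e ^ n) v = 0 := by
  have h1 : LieSubalgebra.lieSpan ℂ L T ≤ LieSubalgebra.engel ℂ e := by
    rw [LieSubalgebra.lieSpan_le]; intro t ht
    exact (LieSubalgebra.mem_engel_iff ℂ e t).2 (h t ht)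
  rw [hT] at h1
  exact (LieSubalgebra.mem_engel_iff ℂ e v).1 (h1 trivial)

end SlTwo

open LieAlgebra

section LoopSeq
variable {L : Type*} [LieRing L] [LieAlgebra ℂ L]

theorem shift_seq {M : Type*} [AddCommGroup M] [Module ℂ M] (A A' : Module.End ℂ M)
    (hc : ∀ v, A (A' v) = A' (A v)) (v : M) (hv : A' (A v) = v) :
    ∃ s : ℤ → M, s 0 = v ∧ (∀ n, A (s n) = s (n+1)) ∧ (∀ n, A' (s n) = s (n-1)) := by
  have h1 : ∀ n : ℕ, A' ((A ^ (n+1)) v) = (A ^ n) v := by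
    intro n
    induction n with
    | zero => simpa using hv
    | succ n ih => rw [pow_succ', Module.End.mul_apply, ← hc, ih, pow_succ', Module.End.mul_apply]
  have h2 : ∀ n : ℕ, A ((A' ^ (n+1)) v) = (A' ^ n) v := by
    intro n
    induction n with
    | zero => simpa [hc] using hv
    | succ n ih => rw [pow_succ', Module.End.mul_apply, hc, ih, pow_succ', Module.End.mul_apply]
  refine ⟨fun n => if 0 ≤ n then (A ^ n.toNat) v else (A' ^ (-n).toNat) v, by simp, ?_, ?_⟩
  · intro n
    rcases lt_or_ge n 0 with h | h
    · obtain ⟨m, rfl⟩ : ∃ m : ℕ, n = -((m:ℤ)+1) := ⟨(-n-1).toNat, by omega⟩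
      have e1 : (- -((m:ℤ)+1)).toNat = m+1 := by omega
      simp only [not_le.2 h, if_false, e1, h2]
      rcases m with _ | m
      · simp
      · have : ¬ (0 ≤ -(((m+1:ℕ):ℤ)+1) + 1) := by omega
        have e2 : (-(-(((m+1:ℕ):ℤ)+1) + 1)).toNat = m+1 := by omega
        simp only [this, if_false, e2]
    · have h' : 0 ≤ n+1 := by omega
      have e1 : (n+1).toNat = n.toNat+1 := by omega
      simp only [h, h', if_true, e1, pow_succ', Module.End.mul_apply]
  · intro n
    rcases lt_or_ge 0 n with h | h
    · obtain ⟨m, rfl⟩ : ∃ m : ℕ, n = ((m:ℤ)+1) := ⟨(n-1).toNat, by omega⟩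
      have h3 : 0 ≤ (m:ℤ)+1 := by omega
      have e1 : ((m:ℤ)+1).toNat = m+1 := by omega
      simp [h3, e1, h1]
    · have h' : ¬ (0 ≤ n-1) := by omega
      have e1 : (-(n-1)).toNat = (-n).toNat+1 := by omega
      rcases eq_or_lt_of_le h with h0 | h0
      · subst h0; simp
      · simp only [not_le.2 h0, h', if_false, e1, pow_succ', Module.End.mul_apply]

/-- The eigenvalue `d_m`. -/
def dd (D : ℕ) (m : ℤ) : ℂ := if Even m then 2 else D

theorem dd_add_two (D : ℕ) (m : ℤ) : dd D (m+2) = dd D m := by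
  unfold dd; simp

theorem dd_neg (D : ℕ) (m : ℤ) : dd D (-m) = dd D m := by
  unfold dd; simp

@[simp] theorem dd_one (D : ℕ) : dd D 1 = D := by simp [dd]
@[simp] theorem dd_negone (D : ℕ) : dd D (-1) = D := by simp [dd]
@[simp] theorem dd_zero (D : ℕ) : dd D 0 = 2 := by simp [dd]
@[simp] theorem dd_two (D : ℕ) : dd D 2 = 2 := by simp [dd]

/-- Loop type relations. -/
structure LoopRel (D : ℕ) (e f h : ℤ → L) (c : L) : Prop where
  ef : ∀ m n, ⁅e m, f n⁆ = h (m+n) + (if m+n=0 then (m:ℂ) • c else 0)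
  he : ∀ m n, ⁅h m, e n⁆ = dd D m • e (m+n)
  hf : ∀ m n, ⁅h m, f n⁆ = -(dd D m • f (m+n))

/-- Preliminary data -/
structure PreLoop (D : ℕ) (e f h : ℤ → L) (c : L) : Prop where
  Dpos : 0 < D
  cc : ∀ v : L, ⁅c, v⁆ = 0
  s0 : SLTwo (e 0) (f 0) (h 0)
  s1 : SLTwo (e 1) (f (-1)) (h 0 + c)
  hdef : ∀ n, 0 ≤ n → h n = ⁅e n, f 0⁆
  hdef' : ∀ n, n ≤ 0 → h n = ⁅e 0, f n⁆
  h1e : ∀ n, ⁅h 1, e n⁆ = (D:ℂ) • e (n+1)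
  h1f : ∀ n, ⁅h 1, f n⁆ = -((D:ℂ) • f (n+1))
  hme : ∀ n, ⁅h (-1), e n⁆ = (D:ℂ) • e (n-1)
  hmf : ∀ n, ⁅h (-1), f n⁆ = -((D:ℂ) • f (n-1))
  h1m : ⁅h 1, h (-1)⁆ = (D:ℂ) • c

namespace PreLoop
variable {D : ℕ} {e f h : ℤ → L} {c : L}

theorem D0 (p : PreLoop D e f h c) : (D:ℂ) ≠ 0 := by exact_mod_cast p.Dpos.ne'

theorem hm' (p : PreLoop D e f h c) : ⁅e 0, f (-1)⁆ = h (-1) := (p.hdef' _ (by norm_num)).symm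

theorem cc' (p : PreLoop D e f h c) (v : L) : ⁅v, c⁆ = 0 := by rw [← lie_skew, p.cc, neg_zero]

theorem h1x (p : PreLoop D e f h c) (m n : ℤ) :
    ⁅h 1, ⁅e m, f n⁆⁆ = (D:ℂ) • (⁅e (m+1), f n⁆ - ⁅e m, f (n+1)⁆) := by
  rw [leibniz_lie, p.h1e, p.h1f, smul_lie, lie_neg, lie_smul]; module

theorem hmx (p : PreLoop D e f h c) (m n : ℤ) :
    ⁅h (-1), ⁅e m, f n⁆⁆ = (D:ℂ) • (⁅e (m-1), f n⁆ - ⁅e m, f (n-1)⁆) := by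
  rw [leibniz_lie, p.hme, p.hmf, smul_lie, lie_neg, lie_smul]; module

theorem smul_cancel (p : PreLoop D e f h c) {x y : L} (hh : (D:ℂ) • x = (D:ℂ) • y) : x = y :=
  smul_right_injective L p.D0 hh

theorem h0_h1 (p : PreLoop D e f h c) : ⁅h 0, h 1⁆ = 0 := by
  have := p.s1.he
  rw [add_lie, p.cc, add_zero] at this
  rw [p.hdef 1 (by norm_num), leibniz_lie, this, p.s0.hf]; simp

theorem h0_hm (p : PreLoop D e f h c) : ⁅h 0, h (-1)⁆ = 0 := by
  have := p.s1.hf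
  rw [add_lie, p.cc, add_zero] at this
  rw [← p.hm', leibniz_lie, this, p.s0.he]; simp

theorem h0e (p : PreLoop D e f h c) (n : ℤ) : ⁅h 0, e n⁆ = (2:ℂ) • e n := by
  induction n using Int.induction_on with
  | zero => exact p.s0.he
  | succ n ih =>
    apply p.smul_cancel
    rw [← lie_smul, ← p.h1e, leibniz_lie, p.h0_h1, ih, lie_smul, p.h1e, zero_lie]; module
  | pred n ih =>
    apply p.smul_cancel
    rw [← lie_smul, ← p.hme, leibniz_lie, p.h0_hm, ih, lie_smul, p.hme, zero_lie]; module

theorem h0f (p : PreLoop D e f h c) (n : ℤ) : ⁅h 0, f n⁆ = -((2:ℂ) • f n) := by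
  induction n using Int.induction_on with
  | zero => exact p.s0.hf
  | succ n ih =>
    apply p.smul_cancel
    have h1 : (D:ℂ) • f (n+1) = - ⁅h 1, f n⁆ := by rw [p.h1f, neg_neg]
    rw [← lie_smul, h1, lie_neg, leibniz_lie, p.h0_h1, ih, lie_neg, lie_smul, p.h1f, zero_lie]
    module
  | pred n ih =>
    apply p.smul_cancel
    have h1 : (D:ℂ) • f (-n-1) = - ⁅h (-1), f (-n)⁆ := by rw [p.hmf, neg_neg]
    rw [← lie_smul, h1, lie_neg, leibniz_lie, p.h0_hm, ih, lie_neg, lie_smul, p.hmf, zero_lie]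
    module

theorem base0 (p : PreLoop D e f h c) (m : ℤ) :
    ⁅e m, f (-m)⁆ = h 0 + (m:ℂ) • c ∧ ⁅e m, f (-m-1)⁆ = h (-1) := by
  have h0m : ∀ m : ℤ, ⁅h (-1), h 0 + (m:ℂ) • c⁆ = 0 := fun m => by
    rw [lie_add, lie_smul, p.cc', ← lie_skew, p.h0_hm]; simp
  induction m using Int.induction_on with
  | zero => simp [p.s0.ef, p.hm']
  | succ m ih =>
    obtain ⟨i1, i2⟩ := ih
    have h1 := p.h1x m (-m-1)
    rw [i2, p.h1m, sub_add_cancel, i1] at h1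
    have h2 := p.smul_cancel h1
    have h3 : ⁅e ((m:ℤ)+1), f (-((m:ℤ)+1))⁆ = h 0 + (((m:ℤ)+1:ℤ):ℂ) • c := by
      rw [neg_add', eq_comm, ← sub_eq_zero]; 
      have h4 := sub_eq_iff_eq_add.1 h2.symm
      rw [h4]; push_cast; module
    refine ⟨h3, ?_⟩
    have h5 := p.hmx (m+1) (-((m:ℤ)+1))
    rw [h3, h0m, eq_comm, smul_eq_zero, or_iff_right p.D0, sub_eq_zero, add_sub_cancel_right] at h5
    rw [← h5, neg_add', i2]
  | pred m ih =>
    obtain ⟨i1, i2⟩ := ih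
    have h5 := p.hmx (-m) (- -(m:ℤ))
    rw [i1, h0m, eq_comm, smul_eq_zero, or_iff_right p.D0, sub_eq_zero, i2] at h5
    have e1 : -(-(m:ℤ)-1)-1 = - -(m:ℤ) := by ring
    refine ⟨?_, by rw [e1]; exact h5⟩
    have h1 := p.h1x (-m-1) (- -(m:ℤ))
    rw [h5, p.h1m, sub_add_cancel, i1] at h1
    have h2 := p.smul_cancel h1
    have e2 : -(-(m:ℤ)-1) = - -(m:ℤ)+1 := by ring
    rw [e2, ← sub_eq_zero, ← sub_eq_zero.2 h2]; push_cast; module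

theorem base1 (p : PreLoop D e f h c) (m n : ℤ) (hmn : m + n = 1) : ⁅e m, f n⁆ = h 1 := by
  obtain rfl : n = 1 - m := by omega
  have key : ∀ m : ℤ, ⁅e (m+1), f (1-(m+1))⁆ = ⁅e m, f (1-m)⁆ := by
    intro m
    have h1 := p.h1x m (-m)
    rw [(p.base0 m).1, lie_add, lie_smul, p.cc', ← lie_skew, p.h0_h1, eq_comm] at h1
    simp only [neg_zero, smul_zero, add_zero, smul_eq_zero, or_iff_right p.D0, sub_eq_zero] at h1
    rw [show 1-(m+1) = -m by ring, h1, show 1 - m = -m+1 by ring]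
  clear hmn
  induction m using Int.induction_on with
  | zero => have := key 0; simp only [zero_add, sub_self, sub_zero] at this ⊢; rw [← this, p.hdef _ (by norm_num)]
  | succ m ih => rw [key, ih]
  | pred m ih => rw [← key, sub_add_cancel]; exact ih

/-- The centralizer lemma. -/
theorem cent (p : PreLoop D e f h c) {Y : L} (h1 : ⁅Y, e 0⁆ = 0) (h2 : ⁅Y, f (-1)⁆ = 0)
    (h3 : ⁅Y, h 0⁆ = 0) (n : ℤ) : ⁅Y, e n⁆ = 0 ∧ ⁅Y, f n⁆ = 0 := by
  have h3' : ⁅h 0, Y⁆ = 0 := by rw [← lie_skew, h3, neg_zero]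
  have f0 : ⁅Y, f 0⁆ = 0 := by
    refine p.s0.kill_e 1 ?_ ?_
    · rw [leibniz_lie, h3', p.s0.hf]; simp
    · rw [leibniz_lie, ← lie_skew (e 0) Y, h1, p.s0.ef, h3]; simp
  have e1 : ⁅Y, e 1⁆ = 0 := by
    refine p.s1.kill_f 1 ?_ ?_
    · rw [leibniz_lie, add_lie, h3', p.s1.he, p.cc]; simp
    · rw [leibniz_lie, ← lie_skew (f (-1)) Y, h2, ← lie_skew (f (-1)), p.s1.ef, lie_neg, lie_add, h3,
        p.cc']; simp
  have k1 : ⁅Y, h 1⁆ = 0 := by rw [p.hdef _ (by norm_num), leibniz_lie, e1, f0]; simp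
  have km : ⁅Y, h (-1)⁆ = 0 := by rw [← p.hm', leibniz_lie, h1, h2]; simp
  induction n using Int.induction_on with
  | zero => exact ⟨h1, f0⟩
  | succ n ih =>
    constructor <;> apply p.smul_cancel <;> rw [← lie_smul]
    · rw [← p.h1e, leibniz_lie, k1, ih.1]; simp
    · rw [← neg_neg ((D:ℂ) • _), ← p.h1f, lie_neg, leibniz_lie, k1, ih.2]; simp
  | pred n ih =>
    constructor <;> apply p.smul_cancel <;> rw [← lie_smul]
    · rw [← p.hme, leibniz_lie, km, ih.1]; simp
    · rw [← neg_neg ((D:ℂ) • _), ← p.hmf, lie_neg, leibniz_lie, km, ih.2]; simp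

end PreLoop
end LoopSeq

open LieAlgebra

section LoopSeq
variable {L : Type*} [LieRing L] [LieAlgebra ℂ L]
namespace PreLoop
variable {D : ℕ} {e f h : ℤ → L} {c : L}

theorem xm (p : PreLoop D e f h c) (m n : ℤ) (hmn : m + n = 0) :
    ⁅e m, f n⁆ = h 0 + (m:ℂ) • c := by
  obtain rfl : n = -m := by omega
  exact (p.base0 m).1

/-- level `s` knowledge -/
def Lev (D : ℕ) (e f h : ℤ → L) (s : ℤ) : Prop :=
  (∀ r : ℤ, -1 ≤ r → r ≤ s → ∀ q, ⁅h r, e q⁆ = dd D r • e (r+q) ∧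
    ⁅h r, f q⁆ = -(dd D r • f (r+q))) ∧
  (∀ m n : ℤ, 1 ≤ m+n → m+n ≤ s+1 → ⁅e m, f n⁆ = h (m+n))

theorem lev_one (p : PreLoop D e f h c) : Lev D e f h 1 := by
  constructor
  · intro r h1 h2 q
    obtain rfl | rfl | rfl : r = -1 ∨ r = 0 ∨ r = 1 := by omega
    · rw [p.hme, p.hmf, dd_negone, show q - 1 = -1+q by ring]; exact ⟨rfl, rfl⟩
    · rw [p.h0e, p.h0f, dd_zero, zero_add]; exact ⟨rfl, rfl⟩
    · rw [p.h1e, p.h1f, dd_one, add_comm]; exact ⟨rfl, rfl⟩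
  · intro m n h1 h2
    obtain h3 | h3 : m + n = 1 ∨ m + n = 2 := by omega
    · rw [p.base1 m n h3, h3]
    · obtain rfl : n = 2 - m := by omega
      have key : ∀ m : ℤ, ⁅e (m+1), f (2-(m+1))⁆ = ⁅e m, f (2-m)⁆ := by
        intro m
        have h1 := p.h1x m (1-m)
        rw [p.base1 _ _ (by ring), lie_self, eq_comm, smul_eq_zero, or_iff_right p.D0,
          sub_eq_zero] at h1
        rw [show 2-(m+1) = 1-m by ring, h1, show 2-m = 1-m+1 by ring]
      have k2 : ∀ m : ℤ, ⁅e m, f (2-m)⁆ = ⁅e 0, f (2-0)⁆ := by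
        intro m
        induction m using Int.induction_on with
        | zero => rfl
        | succ m ih => rw [key, ih]
        | pred m ih => rw [← key, sub_add_cancel]; exact ih
      rw [h3, p.hdef 2 (by norm_num), k2, ← k2 2]; simp

/-- the key step -/
theorem lev_step (p : PreLoop D e f h c) {s : ℤ} (hs : 1 ≤ s) (hl : Lev D e f h s) :
    Lev D e f h (s+1) := by
  obtain ⟨hA, hX⟩ := hl
  have hE : ∀ r : ℤ, -1 ≤ r → r ≤ s → ∀ q, ⁅h r, e q⁆ = dd D r • e (r+q) :=
    fun r a b q => (hA r a b q).1
  have hF : ∀ r : ℤ, -1 ≤ r → r ≤ s → ∀ q, ⁅h r, f q⁆ = -(dd D r • f (r+q)) :=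
    fun r a b q => (hA r a b q).2
  have sk : ∀ x y : L, ⁅x, y⁆ = -⁅y, x⁆ := fun x y => (lie_skew x y).symm
  -- reduction to vanishing of `y`
  have hX' : ∀ (m n : ℤ) (v : L), m + n = s - 1 → ⁅⁅e m, f n⁆, v⁆ = ⁅h (s-1), v⁆ := by
    intro m n v hmn
    rcases eq_or_lt_of_le hs with h1 | h1
    · rw [p.xm m n (by omega), ← h1, add_lie, smul_lie, p.cc]; simp
    · rw [hX m n (by omega) (by omega), hmn]
  have H_of : ∀ q, ⁅e (q+2), e q⁆ = 0 → ⁅h (s+1), e q⁆ = dd D (s+1) • e (s+1+q) := by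
    intro q hq
    have h1 : h (s+1) = ⁅e (q+2), f (s-1-q)⁆ := by
      rw [hX _ _ (by omega) (by omega)]; congr 1; ring
    rw [h1, lie_lie, sk (f _) (e q), lie_neg, sk (e (q+2)) ⁅_,_⁆, neg_neg, hX' _ _ _ (by ring), hq,
      hE _ (by omega) (by omega), ← dd_add_two, lie_zero, sub_zero]
    congr 2 <;> ring
  have G_of : ∀ q, ⁅f (q+2), f q⁆ = 0 → ⁅h (s+1), f q⁆ = -(dd D (s+1) • f (s+1+q)) := by
    intro q hq
    have h1 : h (s+1) = ⁅e (s-1-q), f (q+2)⁆ := by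
      rw [hX _ _ (by omega) (by omega)]; congr 1; ring
    rw [h1, lie_lie, hq, lie_zero, zero_sub, sk (f (q+2)), neg_neg, hX' _ _ _ (by ring),
      hF _ (by omega) (by omega), ← dd_add_two]
    congr 3 <;> ring
  have hmh : ⁅h (-1), h (s+1)⁆ = 0 := by
    rw [p.hdef (s+1) (by omega), p.hmx, hX _ _ (by omega) (by omega), hX _ _ (by omega) (by omega)]
    ring_nf; simp
  have Hlow : ∀ q, ⁅h (s+1), e q⁆ = dd D (s+1) • e (s+1+q) →
      ⁅h (s+1), e (q-1)⁆ = dd D (s+1) • e (s+1+(q-1)) := by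
    intro q hq
    apply p.smul_cancel
    rw [← lie_smul, ← p.hme, leibniz_lie, sk (h (s+1)) (h (-1)), hmh, hq, lie_smul, p.hme, neg_zero, zero_lie, zero_add,
      smul_comm, add_sub_assoc]
  have Glow : ∀ q, ⁅h (s+1), f q⁆ = -(dd D (s+1) • f (s+1+q)) →
      ⁅h (s+1), f (q-1)⁆ = -(dd D (s+1) • f (s+1+(q-1))) := by
    intro q hq
    apply p.smul_cancel
    rw [← lie_smul, ← neg_neg ((D:ℂ) • f (q-1)), ← p.hmf, lie_neg, leibniz_lie, sk _ (h (-1)), hmh,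
      hq, lie_neg, lie_smul, p.hmf, neg_zero, zero_lie, zero_add, add_sub_assoc]
    module
  have wt4 : ∀ m n, ⁅h 0 + c, ⁅e m, e n⁆⁆ = ((3+1:ℕ):ℂ) • ⁅e m, e n⁆ := by
    intro m n
    rw [add_lie, p.cc, leibniz_lie, p.h0e, p.h0e, smul_lie, lie_smul]; push_cast; module
  have wt4' : ∀ m n, ⁅h 0, ⁅f m, f n⁆⁆ = (-((3+1:ℕ):ℂ)) • ⁅f m, f n⁆ := by
    intro m n
    rw [leibniz_lie, p.h0f, p.h0f, neg_lie, smul_lie, lie_neg, lie_smul]; push_cast; module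
  have h0h2 : ⁅h 2, h 0⁆ = 0 := by
    rw [sk, p.hdef 2 (by norm_num), leibniz_lie, p.h0e, p.h0f, smul_lie, lie_neg, lie_smul]; simp
  -- H(0)
  have y20 : ⁅e 2, e 0⁆ = 0 := by
    refine p.s1.kill_f 3 (wt4 _ _) ?_
    rw [leibniz_lie, sk (f (-1)) (e 2), sk (f (-1)) (e 0), p.base1 _ _ (by norm_num), neg_lie, p.h1e, p.hm',
      lie_neg, sk (e 2) (h (-1)), p.hme]; norm_num
  have H0 := H_of 0 (by simpa using y20)
  have yf1 : ⁅f 1, f (-1)⁆ = 0 := by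
    refine p.s0.kill_e 3 (wt4' _ _) ?_
    rw [leibniz_lie, p.base1 _ _ (by norm_num), p.h1f, p.hm', sk (f 1) (h (-1)), p.hmf]; norm_num
  have Gm := G_of (-1) (by simpa using yf1)
  have y31 : ⁅e 3, e 1⁆ = 0 := by
    have hb : ⁅f (-1), ⁅e 3, e 1⁆⁆ = -⁅h 2, e 1⁆ + (2:ℂ) • e 3 := by
      rw [leibniz_lie, sk (f (-1)) (e 3), sk (f (-1)) (e 1), hX _ _ (by norm_num) (by omega), p.xm 1 (-1) (by norm_num),
        lie_neg, sk (e 3) (_ + _), add_lie, smul_lie, p.cc, p.h0e, neg_lie]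
      norm_num
    rcases eq_or_lt_of_le hs with h1 | h1
    · subst h1
      refine p.s1.inj' 4 (wt4 _ _) ?_
      have h2 : ⁅f (-1), ⁅f (-1), ⁅e 3, e 1⁆⁆⁆ = 0 := by
        rw [hb, lie_add, lie_neg, leibniz_lie, sk (f (-1)) (h 2), sk (f (-1)) (e 1), p.xm 1 (-1) (by norm_num)]
        norm_num at Gm
        rw [Gm, lie_smul, sk (f (-1)) (e 3), hX _ _ (by norm_num) (by omega), lie_neg, lie_add, h0h2,
          lie_smul, p.cc', neg_neg, smul_lie, sk (f 1) (e 1), hX _ _ (by norm_num) (by omega)]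
        norm_num
      rw [show 4 = 2+1+1 by norm_num, pow_succ, Module.End.mul_apply, pow_succ, Module.End.mul_apply,
        ad_apply, ad_apply, h2, map_zero]
    · refine p.s1.kill_f 3 (wt4 _ _) ?_
      rw [hb, hE 2 (by norm_num) (by omega)]; norm_num
  have H1 := H_of 1 (by simpa using y31)
  have yf2 : ⁅f 2, f 0⁆ = 0 := by
    have hb : ⁅e 0, ⁅f 2, f 0⁆⁆ = ⁅h 2, f 0⁆ + (2:ℂ) • f 2 := by
      rw [leibniz_lie, p.s0.ef, hX _ _ (by norm_num) (by omega), sk (f 2) (h 0), p.h0f]; norm_num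
    rcases eq_or_lt_of_le hs with h1 | h1
    · subst h1
      refine p.s0.inj 4 (wt4' _ _) ?_
      have h2 : ⁅e 0, ⁅e 0, ⁅f 2, f 0⁆⁆⁆ = 0 := by
        norm_num at H0
        rw [hb, lie_add, leibniz_lie, sk (e 0) (h 2), H0, p.s0.ef, h0h2, lie_smul,
          hX _ _ (by norm_num) (by omega), neg_lie, smul_lie, ← p.hdef _ (by norm_num)]
        norm_num
      rw [show 4 = 2+1+1 by norm_num, pow_succ, Module.End.mul_apply, pow_succ, Module.End.mul_apply,
        ad_apply, ad_apply, h2, map_zero]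
    · refine p.s0.kill_e 3 (wt4' _ _) ?_
      rw [hb, hF 2 (by norm_num) (by omega)]; norm_num
  have G0 := G_of 0 (by simpa using yf2)
  -- the element z
  set z := ⁅h 1, h (s+1)⁆ with hz
  have ze : ∀ q, ⁅h (s+1), e q⁆ = dd D (s+1) • e (s+1+q) →
      (⁅z, e q⁆ = 0 ↔ ⁅h (s+1), e (q+1)⁆ = dd D (s+1) • e (s+1+(q+1))) := by
    intro q hq
    rw [hz, lie_lie, hq, p.h1e, lie_smul, lie_smul, p.h1e, smul_comm, ← smul_sub, smul_eq_zero,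
      or_iff_right p.D0, sub_eq_zero, add_assoc, eq_comm]
  have zf : ∀ q, ⁅h (s+1), f q⁆ = -(dd D (s+1) • f (s+1+q)) →
      (⁅z, f q⁆ = 0 ↔ ⁅h (s+1), f (q+1)⁆ = -(dd D (s+1) • f (s+1+(q+1)))) := by
    intro q hq
    rw [hz, lie_lie, hq, p.h1f, lie_neg, lie_neg, lie_smul, lie_smul, p.h1f, sub_neg_eq_add, smul_neg,
      neg_neg, smul_comm, ← smul_add, smul_eq_zero, or_iff_right p.D0, add_assoc (s+1), add_comm,
      add_eq_zero_iff_eq_neg]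
  have z0 : ⁅z, h 0⁆ = 0 := by
    rw [sk, hz, leibniz_lie, p.h0_h1, p.hdef (s+1) (by omega), leibniz_lie (h 0) (e _), p.h0e, p.h0f, smul_lie,
      lie_neg, lie_smul]; simp
  have zc := p.cent (Y := z) ((ze 0 H0).2 (by simpa using H1)) ((zf (-1) Gm).2 (by simpa using G0)) z0
  have HA : ∀ q, ⁅h (s+1), e q⁆ = dd D (s+1) • e (s+1+q) := by
    intro q
    induction q using Int.induction_on with
    | zero => exact H0
    | succ q ih => exact (ze _ ih).1 (zc _).1
    | pred q ih => exact Hlow _ ih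
  have GA : ∀ q, ⁅h (s+1), f q⁆ = -(dd D (s+1) • f (s+1+q)) := by
    intro q
    induction q using Int.induction_on with
    | zero => exact G0
    | succ q ih => exact (zf _ ih).1 (zc _).2
    | pred q ih => exact Glow _ ih
  have diff : ∀ m : ℤ, (D:ℂ) • (⁅e (m+1), f (s+2-(m+1))⁆ - ⁅e m, f (s+2-m)⁆) = z := by
    intro m
    have h1 := p.h1x m (s+1-m)
    rw [hX _ _ (by omega) (by omega), show m+(s+1-m) = s+1 by ring, ← hz] at h1
    rw [h1, show s+2-(m+1) = s+1-m by ring, show s+2-m = s+1-m+1 by ring]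
  have lin : ∀ m : ℤ, (D:ℂ) • ⁅e m, f (s+2-m)⁆ = (D:ℂ) • ⁅e 0, f (s+2-0)⁆ + (m:ℂ) • z := by
    intro m
    induction m using Int.induction_on with
    | zero => simp
    | succ m ih =>
      have := diff m
      rw [smul_sub, sub_eq_iff_eq_add, ih] at this
      rw [this]; push_cast; module
    | pred m ih =>
      have := diff (-m-1)
      rw [sub_add_cancel, smul_sub, ih] at this
      rw [← sub_eq_zero]
      rw [← sub_eq_zero] at this
      rw [← neg_eq_zero, ← this]; push_cast; module
  have hz0 : z = 0 := by
    have h1 : (D:ℂ) • ⁅h (s+1), h 1⁆ = (dd D (s+1) * (s+1)) • z := by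
      rw [p.hdef 1 (by norm_num), leibniz_lie, HA, GA, smul_lie, lie_neg, lie_smul]
      have l1 := lin (s+2)
      have l2 := lin 1
      rw [show s+2-(s+2) = 0 by ring] at l1
      rw [show s+2-1 = s+1+0 by ring] at l2
      rw [show s+1+1 = s+2 by ring, smul_add, smul_neg, smul_comm, l1, smul_comm (D:ℂ), l2]
      push_cast; module
    rw [sk, ← hz, smul_neg, ← sub_eq_zero, ← neg_smul, ← sub_smul, smul_eq_zero] at h1
    refine h1.resolve_left ?_
    have hD := p.Dpos
    obtain ⟨s, rfl⟩ : ∃ t : ℕ, s = t := ⟨s.toNat, by omega⟩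
    unfold dd
    intro h2
    have h3 : ((D + (if Even ((s:ℤ)+1) then 2 else D) * (s+1) : ℕ) : ℂ) = 0 := by
      push_cast; split_ifs at h2 ⊢ <;> (push_cast at h2 ⊢; linear_combination -h2)
    have := Nat.cast_eq_zero.1 h3
    omega
  constructor
  · intro r h1 h2 q
    rcases eq_or_lt_of_le h2 with h3 | h3
    · subst h3; exact ⟨HA q, GA q⟩
    · exact hA r h1 (by omega) q
  · intro m n h1 h2
    rcases eq_or_lt_of_le h2 with h3 | h3
    · obtain rfl : n = s+2-m := by omega
      rw [show m + (s+2-m) = s+2 by ring, p.hdef _ (by omega)]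
      apply p.smul_cancel
      have l1 := lin (s+2)
      rw [show s+2-(s+2) = 0 by ring] at l1
      rw [lin, l1, hz0, smul_zero, smul_zero]
    · exact hX m n h1 (by omega)

theorem lev_all (p : PreLoop D e f h c) (s : ℤ) (hs : 1 ≤ s) : Lev D e f h s := by
  obtain ⟨n, rfl⟩ : ∃ n : ℕ, s = n + 1 := ⟨(s-1).toNat, by omega⟩
  clear hs
  induction n with
  | zero => simpa using p.lev_one
  | succ n ih => push_cast; exact p.lev_step (by omega) ih

/-- the mirror-swap symmetry -/
theorem sigma (p : PreLoop D e f h c) :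
    PreLoop D (fun n => f (-n)) (fun n => e (-n)) (fun n => -h (-n)) (-c) where
  Dpos := p.Dpos
  cc v := by rw [neg_lie, p.cc, neg_zero]
  s0 := by simpa using p.s0.swap
  s1 := by have := p.s1.swap; simp only [neg_add] at this; simpa using this
  hdef n hn := by rw [neg_zero, ← lie_skew, p.hdef' (-n) (by omega)]
  hdef' n hn := by rw [neg_zero, ← lie_skew, p.hdef (-n) (by omega)]
  h1e n := by rw [neg_lie, p.hmf, neg_neg]; congr 2; ring
  h1f n := by rw [neg_lie, p.hme]; congr 3; ring
  hme n := by rw [neg_neg, neg_lie, p.h1f, neg_neg]; congr 2; ring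
  hmf n := by rw [neg_neg, neg_lie, p.h1e]; congr 3; ring
  h1m := by rw [neg_neg, neg_lie, lie_neg, neg_neg, ← lie_skew, p.h1m, smul_neg]

end PreLoop
end LoopSeq

open LieAlgebra

section LoopSeq
variable {L : Type*} [LieRing L] [LieAlgebra ℂ L]

namespace LoopRel
variable {D : ℕ} {e f h : ℤ → L} {c : L}

theorem fe (p : LoopRel D e f h c) (m n : ℤ) :
    ⁅f n, e m⁆ = -(h (m+n) + (if m+n=0 then (m:ℂ) • c else 0)) := by
  rw [← p.ef, lie_skew]

theorem map {L' : Type*} [LieRing L'] [LieAlgebra ℂ L'] (p : LoopRel D e f h c) (φ : L →ₗ⁅ℂ⁆ L') :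
    LoopRel D (fun n => φ (e n)) (fun n => φ (f n)) (fun n => φ (h n)) (φ c) where
  ef m n := by rw [← LieHom.map_lie, p.ef, map_add]; split_ifs <;> simp
  he m n := by rw [← LieHom.map_lie, p.he, map_smul]
  hf m n := by rw [← LieHom.map_lie, p.hf, map_neg, map_smul]
end LoopRel

namespace PreLoop
variable {D : ℕ} {e f h : ℤ → L} {c : L}

theorem loopRel (p : PreLoop D e f h c) : LoopRel D e f h c := by
  have pos := fun s hs => p.lev_all s hs
  have neg := fun s hs => p.sigma.lev_all s hs
  refine ⟨fun m n => ?_, fun m n => ?_, fun m n => ?_⟩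
  · rcases lt_trichotomy (m+n) 0 with hs | hs | hs
    · have := (neg (-(m+n)) (by omega)).2 (-n) (-m) (by omega) (by omega)
      simp only [neg_neg] at this
      rw [← lie_skew, this, neg_neg, if_neg (by omega), add_zero]; congr 1; ring
    · rw [p.xm m n hs, if_pos hs, hs]
    · rw [(pos (m+n) (by omega)).2 m n (by omega) (by omega), if_neg (by omega), add_zero]
  · rcases lt_or_ge m 0 with hs | hs
    · have := ((neg (-m) (by omega)).1 (-m) (by omega) (by omega) (-n)).2
      simp only [neg_neg, neg_lie, dd_neg] at this
      rw [neg_inj] at this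
      rw [this]; congr 2; ring
    · exact ((pos (m+1) (by omega)).1 m (by omega) (by omega) n).1
  · rcases lt_or_ge m 0 with hs | hs
    · have := ((neg (-m) (by omega)).1 (-m) (by omega) (by omega) (-n)).1
      simp only [neg_neg, neg_lie, dd_neg] at this
      have h3 : -(-m + -n) = m + n := by ring
      rw [h3, neg_eq_iff_eq_neg] at this
      exact this
    · exact ((pos (m+1) (by omega)).1 m (by omega) (by omega) n).2

theorem ee (p : PreLoop D e f h c) (m n : ℤ) (hmn : D = 2 ∨ Even (m+n)) : ⁅e m, e n⁆ = 0 := by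
  have q := p.loopRel
  refine p.s0.kill_f 3 ?_ ?_
  · rw [leibniz_lie, p.h0e, p.h0e, smul_lie, lie_smul]; push_cast; module
  · have h1 : ∀ m n, ⁅⁅f 0, e m⁆, e n⁆ = -(dd D m • e (m+n)) := by
      intro m n
      rw [q.fe, neg_lie, add_lie, add_zero, q.he]
      split_ifs <;> simp [p.cc]
    have h2 : ⁅e m, ⁅f 0, e n⁆⁆ = -⁅⁅f 0, e n⁆, e m⁆ := (lie_skew _ _).symm
    have h3 : dd D m = dd D n := by
      rcases hmn with h | h
      · subst h; simp [dd]
      · have := Int.even_add.1 h; simp [dd, this]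
    rw [leibniz_lie, h1, h2, h1, h3, add_comm n m]; simp

theorem eee (p : PreLoop D e f h c) (q m n : ℤ) : ⁅e q, ⁅e m, e n⁆⁆ = 0 := by
  rcases Int.even_or_odd (m+n) with hev | hodd
  · rw [p.ee m n (Or.inr hev), lie_zero]
  have r := p.loopRel
  have key : ∀ t : ℤ, Odd (q+t) → ⁅f t, ⁅e q, ⁅e m, e n⁆⁆⁆ = 0 := by
    intro t ht
    have h1 : ⁅⁅f t, e q⁆, ⁅e m, e n⁆⁆ = 0 := by
      have hne : q + t ≠ 0 := by rintro h; rw [h] at ht; simp at ht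
      rw [r.fe, if_neg hne, add_zero, neg_lie, leibniz_lie, r.he, r.he, smul_lie, lie_smul,
        p.ee (q+t+m) n (Or.inr ?_), p.ee m (q+t+n) (Or.inr ?_)]
      · simp
      · have := ht.add_odd hodd; rw [show m+(q+t+n) = q+t+(m+n) by ring]; exact this
      · have := ht.add_odd hodd; rw [show q+t+m+n = q+t+(m+n) by ring]; exact this
    have h2 : ∀ m n, ⁅⁅f t, e m⁆, e n⁆ = -(dd D (m+t) • e (m+t+n)) := by
      intro m n
      rw [r.fe, neg_lie, add_lie, r.he]
      split_ifs <;> simp [p.cc]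
    have h3 : ⁅e m, ⁅f t, e n⁆⁆ = -⁅⁅f t, e n⁆, e m⁆ := (lie_skew _ _).symm
    have h4 : ⁅e q, e (m+t+n)⁆ = 0 := p.ee _ _ (Or.inr (by
      have := ht.add_odd hodd; rw [show q+(m+t+n) = q+t+(m+n) by ring]; exact this))
    rw [leibniz_lie, h1, zero_add, leibniz_lie (f t), h3, h2, h2, show n+t+m = m+t+n by ring]
    simp [h4]
  have wt : ⁅h 0, ⁅e q, ⁅e m, e n⁆⁆⁆ = ((5+1:ℕ):ℂ) • ⁅e q, ⁅e m, e n⁆⁆ := by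
    rw [leibniz_lie, leibniz_lie (h 0), p.h0e, p.h0e, p.h0e]
    simp only [smul_lie, lie_smul, lie_add]; push_cast; module
  rcases Int.even_or_odd q with hq | hq
  · refine p.s1.kill_f 5 ?_ (key (-1) (by simpa using hq.add_odd (by decide : Odd (-1:ℤ))))
    rw [add_lie, p.cc, add_zero, wt]
  · exact p.s0.kill_f 5 wt (key 0 (by simpa using hq))

theorem ff (p : PreLoop D e f h c) (m n : ℤ) (hmn : D = 2 ∨ Even (m+n)) : ⁅f m, f n⁆ = 0 := by
  have := p.sigma.ee (-m) (-n) (by rwa [← neg_add, even_neg])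
  simpa using this

theorem fff (p : PreLoop D e f h c) (q m n : ℤ) : ⁅f q, ⁅f m, f n⁆⁆ = 0 := by
  have := p.sigma.eee (-q) (-m) (-n)
  simpa using this

end PreLoop

/-- Construction of the loop sequences. -/
theorem exists_preLoop (D : ℕ) (hD : 0 < D) (e0 f0 e1 g1 h0 c : L) (cc : ∀ v : L, ⁅c, v⁆ = 0)
    (s0 : SLTwo e0 f0 h0) (s1 : SLTwo e1 g1 (h0 + c))
    (r1 : ⁅⁅e1, f0⁆, e0⁆ = (D:ℂ) • e1) (r2 : ⁅⁅e1, f0⁆, g1⁆ = -((D:ℂ) • f0))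
    (r3 : ⁅⁅e0, g1⁆, e1⁆ = (D:ℂ) • e0) (r4 : ⁅⁅e0, g1⁆, f0⁆ = -((D:ℂ) • g1)) :
    ∃ e f h : ℤ → L, PreLoop D e f h c ∧ e 0 = e0 ∧ f 0 = f0 ∧ h 0 = h0 ∧ e 1 = e1 ∧
      f (-1) = g1 := by
  have D0 : (D:ℂ) ≠ 0 := by exact_mod_cast hD.ne'
  set h1 := ⁅e1, f0⁆ with hh1
  set hm := ⁅e0, g1⁆ with hhm
  have h1m : ⁅h1, hm⁆ = (D:ℂ) • c := by
    rw [hhm, leibniz_lie, r1, r2, smul_lie, lie_neg, lie_smul, s0.ef, s1.ef]; module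
  have comm : ∀ v : L, ⁅h1, ⁅hm, v⁆⁆ = ⁅hm, ⁅h1, v⁆⁆ := by
    intro v
    rw [leibniz_lie, h1m, smul_lie, cc]; simp
  obtain ⟨e, e_0, eA, eB⟩ := shift_seq ((D:ℂ)⁻¹ • ad ℂ L h1) ((D:ℂ)⁻¹ • ad ℂ L hm)
    (by intro v; simp [comm]) e0 (by simp [r1, r3, D0])
  obtain ⟨f, f_0, fA, fB⟩ := shift_seq ((-(D:ℂ)⁻¹) • ad ℂ L h1) ((-(D:ℂ)⁻¹) • ad ℂ L hm)
    (by intro v; simp [comm]) f0 (by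
      have h3 : ⁅h1, ⁅hm, f0⁆⁆ = (D:ℂ) • (D:ℂ) • f0 := by rw [r4, lie_neg, lie_smul, r2]; simp
      simp [← comm, h3, D0])
  have e_1 : e 1 = e1 := by
    have := eA 0; rw [e_0, zero_add] at this; rw [← this]; simp [r1, D0]
  have f_m : f (-1) = g1 := by
    have := fB 0; rw [f_0, zero_sub] at this; rw [← this]; simp [r4, D0]
  have x1 : ∀ n, ⁅h1, e n⁆ = (D:ℂ) • e (n+1) := fun n => by rw [← eA]; simp [D0]
  have x2 : ∀ n, ⁅hm, e n⁆ = (D:ℂ) • e (n-1) := fun n => by rw [← eB]; simp [D0]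
  have x3 : ∀ n, ⁅h1, f n⁆ = -((D:ℂ) • f (n+1)) := fun n => by rw [← fA]; simp [D0]
  have x4 : ∀ n, ⁅hm, f n⁆ = -((D:ℂ) • f (n-1)) := fun n => by rw [← fB]; simp [D0]
  refine ⟨e, f, fun n => if 0 ≤ n then ⁅e n, f 0⁆ else ⁅e 0, f n⁆, ?_, e_0, f_0, ?_, e_1, f_m⟩
  · have k1 : (if (0:ℤ) ≤ 1 then ⁅e 1, f 0⁆ else ⁅e 0, f 1⁆) = h1 := by
      rw [if_pos (by norm_num), e_1, f_0]
    have km : (if (0:ℤ) ≤ -1 then ⁅e (-1), f 0⁆ else ⁅e 0, f (-1)⁆) = hm := by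
      rw [if_neg (by norm_num), e_0, f_m]
    have k0 : (if (0:ℤ) ≤ 0 then ⁅e 0, f 0⁆ else ⁅e 0, f 0⁆) = h0 := by
      rw [if_pos le_rfl, e_0, f_0, s0.ef]
    refine ⟨hD, cc, ?_, ?_, ?_, ?_, ?_, ?_, ?_, ?_, ?_⟩
    · beta_reduce; rw [k0, e_0, f_0]; exact s0
    · beta_reduce; rw [k0, e_1, f_m]; exact s1
    · intro n hn; simp [hn]
    · intro n hn
      rcases eq_or_lt_of_le hn with h | h
      · subst h; simp
      · simp [not_le.2 h]
    · beta_reduce; rw [k1]; exact x1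
    · beta_reduce; rw [k1]; exact x3
    · beta_reduce; rw [km]; exact x2
    · beta_reduce; rw [km]; exact x4
    · beta_reduce; rw [k1, km]; exact h1m
  · simp [e_0, f_0, s0.ef]

/-- The loop data inside the big algebra. -/
structure Loop (D : ℕ) (e f h : ℤ → L) (c : L) : Prop extends LoopRel D e f h c where
  Dpos : 0 < D
  cc : ∀ v : L, ⁅c, v⁆ = 0
  s0 : SLTwo (e 0) (f 0) (h 0)
  cent : ∀ Y : L, ⁅Y, e 0⁆ = 0 → ⁅Y, f (-1)⁆ = 0 → ⁅Y, h 0⁆ = 0 → ∀ n, ⁅Y, e n⁆ = 0 ∧ ⁅Y, f n⁆ = 0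
  cent' : ∀ Y : L, ⁅Y, f 0⁆ = 0 → ⁅Y, e 1⁆ = 0 → ⁅Y, h 0⁆ = 0 → ∀ n, ⁅Y, e n⁆ = 0 ∧ ⁅Y, f n⁆ = 0
  ee : ∀ m n : ℤ, (D = 2 ∨ Even (m+n)) → ⁅e m, e n⁆ = 0
  ff : ∀ m n : ℤ, (D = 2 ∨ Even (m+n)) → ⁅f m, f n⁆ = 0
  eee : ∀ q m n : ℤ, ⁅e q, ⁅e m, e n⁆⁆ = 0
  fff : ∀ q m n : ℤ, ⁅f q, ⁅f m, f n⁆⁆ = 0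

/-- The case `c(α) = 1`. -/
theorem exists_loop_one (e0 f0 e1 g1 h0 c : L) (cc : ∀ v : L, ⁅c, v⁆ = 0)
    (s0 : SLTwo e0 f0 h0) (s1 : SLTwo e1 g1 (h0 + c)) (ee : ⁅e0, e1⁆ = 0) (ff : ⁅f0, g1⁆ = 0) :
    ∃ e f h : ℤ → L, Loop 2 e f h c ∧ e 0 = e0 ∧ f 0 = f0 ∧ h 0 = h0 ∧ e 1 = e1 ∧
      f (-1) = g1 := by
  have sk : ∀ x y : L, ⁅x, y⁆ = -⁅y, x⁆ := fun x y => (lie_skew x y).symm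
  have a1 : ⁅h0, e1⁆ = (2:ℂ) • e1 := by rw [← s1.he, add_lie, cc, add_zero]
  have a2 : ⁅h0, g1⁆ = -((2:ℂ) • g1) := by rw [← s1.hf, add_lie, cc, add_zero]
  have cc' : ∀ v : L, ⁅v, c⁆ = 0 := fun v => by rw [sk, cc, neg_zero]
  obtain ⟨e, f, h, p, E0, F0, H0, E1, F1⟩ := exists_preLoop 2 (by norm_num) e0 f0 e1 g1 h0 c cc s0 s1
    (by rw [lie_lie, sk f0 e0, s0.ef, sk e1 e0, ee, lie_neg, sk e1 h0, a1]; simp)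
    (by rw [lie_lie, ff, s1.ef, sk f0, add_lie, cc, s0.hf]; simp)
    (by rw [lie_lie, sk g1 e1, s1.ef, ee, lie_neg, lie_add, cc', sk e0 h0, s0.he]; simp)
    (by rw [lie_lie, sk g1 f0, ff, s0.ef, sk g1 h0, a2]; simp)
  refine ⟨e, f, h, ⟨p.loopRel, p.Dpos, cc, p.s0, fun Y a b d => p.cent a b d, fun Y a b d n => ?_,
    p.ee, p.ff, p.eee, p.fff⟩, E0, F0, H0, E1, F1⟩
  have := p.sigma.cent (Y := Y) (by simpa using a) (by simpa using b) (by rw [neg_zero, lie_neg, d, neg_zero]) (-n)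
  simp only [neg_neg] at this
  exact ⟨this.2, this.1⟩

theorem nilC (Z F : L) (h1 : ⁅Z, ⁅Z, F⁆⁆ = 0) (h2 : (ad ℂ L F ^ 5) Z = 0) :
    (ad ℂ L ⁅F, Z⁆ ^ 4) F = 0 := by
  set A := ad ℂ L F with hA
  set C := ad ℂ L ⁅F, Z⁆ with hC
  set X := ad ℂ L Z with hX
  have x1 : ∀ v, X (A v) = A (X v) - C v := by
    intro v; simp only [hA, hC, hX, ad_apply, lie_lie]; abel
  have x0 : X ⁅F, Z⁆ = 0 := by
    rw [hX, ad_apply, ← lie_skew F Z, lie_neg, h1, neg_zero]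
  have x2 : ∀ v, X (C v) = C (X v) := by
    intro v
    have := lie_lie Z ⁅F, Z⁆ v
    rw [← ad_apply ℂ L Z, ← hX, x0, zero_lie] at this
    simp only [hC, hX, ad_apply]; exact (sub_eq_zero.1 this.symm)
  have x3 : C ⁅F, Z⁆ = 0 := by rw [hC, ad_apply, lie_self]
  have h3 : A (A (A (A ⁅F, Z⁆))) = 0 := by
    rw [← h2]; simp [pow_succ, hA]
  have h4 : X (X (X (A (A (A (A ⁅F, Z⁆)))))) = 0 := by rw [h3]; simp
  simp only [x1, x2, x0, x3, map_sub, map_zero, zero_sub, sub_zero, sub_neg_eq_add, neg_sub,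
    map_neg, neg_zero, map_add] at h4
  have h5 : (6:ℂ) • C (C (C (A ⁅F, Z⁆))) = 0 := by
    rw [← neg_eq_zero, ← h4]; module
  have h6 := (smul_eq_zero.1 h5).resolve_left (by norm_num)
  have h7 : C F = - A ⁅F, Z⁆ := by simp only [hC, hA, ad_apply]; rw [lie_skew]
  simp only [pow_succ, pow_zero, one_mul, Module.End.mul_apply, h7, map_neg, h6, neg_zero]

theorem ad_val {K : LieSubalgebra ℂ L} (x v : K) (n : ℕ) :
    (((ad ℂ K x ^ n) v : K) : L) = (ad ℂ L x ^ n) v := by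
  induction n with
  | zero => simp
  | succ n ih =>
    rw [pow_succ', pow_succ', Module.End.mul_apply, Module.End.mul_apply, ad_apply, ad_apply,
      LieSubalgebra.coe_bracket, ih]

theorem SLTwo.restrict {K : LieSubalgebra ℂ L} {e f h : K} (s : SLTwo (e:L) (f:L) (h:L)) :
    SLTwo e f h where
  ef := Subtype.ext s.ef
  he := Subtype.ext s.he
  hf := Subtype.ext s.hf
  ne v := by obtain ⟨n, hn⟩ := s.ne v; exact ⟨n, Subtype.ext (by rw [ad_val, hn]; rfl)⟩
  nf v := by obtain ⟨n, hn⟩ := s.nf v; exact ⟨n, Subtype.ext (by rw [ad_val, hn]; rfl)⟩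

end LoopSeq

open LieAlgebra

section LoopTwo
variable {L : Type*} [LieRing L] [LieAlgebra ℂ L]

theorem lie_lie_zero {Y x y : L} (h1 : ⁅Y, x⁆ = 0) (h2 : ⁅Y, y⁆ = 0) : ⁅Y, ⁅x, y⁆⁆ = 0 := by
  rw [leibniz_lie, h1, h2]; simp

theorem lie_smul_cancel {Y x : L} {D : ℂ} (hD : D ≠ 0) (h : ⁅Y, D • x⁆ = 0) : ⁅Y, x⁆ = 0 := by
  rw [lie_smul] at h; exact (smul_eq_zero.1 h).resolve_left hD

/-- `Y` commutes with `e n`, `f n` as soon as it commutes with one of each and `h (±1)`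
up to a central element. -/
theorem LoopRel.cent_h {D : ℕ} {e f h : ℤ → L} {c : L} (r : LoopRel D e f h c) (hD : 0 < D)
    {Y : L} (h1 : ∀ v : L, ⁅⁅Y, h 1⁆, v⁆ = 0) (hm : ∀ v : L, ⁅⁅Y, h (-1)⁆, v⁆ = 0) :
    (⁅Y, e 0⁆ = 0 → ∀ n, ⁅Y, e n⁆ = 0) ∧ (⁅Y, f 0⁆ = 0 → ∀ n, ⁅Y, f n⁆ = 0) := by
  have D0 : (D:ℂ) ≠ 0 := by exact_mod_cast hD.ne'
  constructor
  · intro h0 n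
    induction n using Int.induction_on with
    | zero => exact h0
    | succ n ih =>
      refine lie_smul_cancel D0 ?_
      have := r.he 1 n
      rw [dd_one, add_comm 1] at this
      rw [← this, leibniz_lie, h1, ih]; simp
    | pred n ih =>
      refine lie_smul_cancel D0 ?_
      have := r.he (-1) (-n)
      rw [dd_negone, add_comm (-1)] at this
      rw [sub_eq_add_neg, ← this, leibniz_lie, hm, ih]; simp
  · intro h0 n
    induction n using Int.induction_on with
    | zero => exact h0
    | succ n ih =>
      refine lie_smul_cancel (neg_ne_zero.2 D0) ?_
      have := r.hf 1 n
      rw [dd_one, add_comm 1] at this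
      rw [neg_smul, ← this, leibniz_lie, h1, ih]; simp
    | pred n ih =>
      refine lie_smul_cancel (neg_ne_zero.2 D0) ?_
      have := r.hf (-1) (-n)
      rw [dd_negone, add_comm (-1)] at this
      rw [sub_eq_add_neg, neg_smul, ← this, leibniz_lie, hm, ih]; simp

theorem LoopRel.cent_all {D : ℕ} {e f h : ℤ → L} {c : L} (r : LoopRel D e f h c) (hD : 0 < D)
    {Y : L} (a0 : ⁅Y, e 0⁆ = 0) (b0 : ⁅Y, f 0⁆ = 0) (a1 : ⁅Y, e 1⁆ = 0) (b1 : ⁅Y, f (-1)⁆ = 0)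
    (n : ℤ) : ⁅Y, e n⁆ = 0 ∧ ⁅Y, f n⁆ = 0 := by
  have h1 : ⁅Y, h 1⁆ = 0 := by
    have := r.ef 1 0
    simp at this
    rw [← this]; exact lie_lie_zero a1 b0
  have hm : ⁅Y, h (-1)⁆ = 0 := by
    have := r.ef 0 (-1)
    simp at this
    rw [← this]; exact lie_lie_zero a0 b1
  have := r.cent_h hD (Y := Y) (by simp [h1]) (by simp [hm])
  exact ⟨this.1 a0 n, this.2 b0 n⟩

/-- The case `c(α) = 2`. -/
theorem exists_loop_two (E F H Z Z' HZ c : L) (cc : ∀ v : L, ⁅c, v⁆ = 0)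
    (s0 : SLTwo E F H) (sz : SLTwo Z Z' HZ) (hHZ : HZ = (2:ℂ)⁻¹ • H + (4:ℂ)⁻¹ • c)
    (EZ : ⁅E, Z⁆ = 0) (FZ : ⁅F, Z'⁆ = 0)
    (E5 : (ad ℂ L E ^ 5) Z' = 0) (F5 : (ad ℂ L F ^ 5) Z = 0)
    (ZZF : ⁅Z, ⁅Z, F⁆⁆ = 0) (ZZE : ⁅Z', ⁅Z', E⁆⁆ = 0) :
    ∃ e f h : ℤ → L, Loop 6 e f h c ∧ e 0 = E ∧ f 0 = F ∧ h 0 = H ∧ e 1 = ⁅F, Z⁆ ∧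
      f (-1) = ⁅Z', E⁆ ∧ ⁅e 0, e 1⁆ = (4:ℂ) • Z ∧ ⁅f 0, f (-1)⁆ = -((4:ℂ) • Z') ∧
      ⁅H, Z⁆ = (4:ℂ) • Z ∧ ⁅H, Z'⁆ = -((4:ℂ) • Z') := by
  have sk : ∀ x y : L, ⁅x, y⁆ = -⁅y, x⁆ := fun x y => (lie_skew x y).symm
  have cc' : ∀ v : L, ⁅v, c⁆ = 0 := fun v => by rw [sk, cc, neg_zero]
  have hH : H = (2:ℂ) • HZ - (2:ℂ)⁻¹ • c := by rw [hHZ]; module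
  have HZv : ∀ v : L, ⁅HZ, v⁆ = (2:ℂ)⁻¹ • ⁅H, v⁆ := by
    intro v; rw [hHZ, add_lie, smul_lie, smul_lie, cc]; simp
  have Hv : ∀ v : L, ⁅H, v⁆ = (2:ℂ) • ⁅HZ, v⁆ := by
    intro v; rw [HZv]; module
  have wZ : ⁅H, Z⁆ = (4:ℂ) • Z := by rw [Hv, sz.he]; module
  have wZ' : ⁅H, Z'⁆ = -((4:ℂ) • Z') := by rw [Hv, sz.hf]; module
  have wE : ⁅HZ, E⁆ = E := by rw [HZv, s0.he]; module
  have wF : ⁅HZ, F⁆ = -F := by rw [HZv, s0.hf]; module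
  set e1 := ⁅F, Z⁆ with he1
  set g1 := ⁅Z', E⁆ with hg1
  have We1 : ⁅H, e1⁆ = (2:ℂ) • e1 := by
    rw [he1, leibniz_lie, wZ, s0.hf, neg_lie, smul_lie, lie_smul]; module
  have Wg1 : ⁅H, g1⁆ = -((2:ℂ) • g1) := by
    rw [hg1, leibniz_lie, wZ', s0.he, neg_lie, smul_lie, lie_smul]; module
  have Ee1 : ⁅E, e1⁆ = (4:ℂ) • Z := by
    rw [he1, leibniz_lie, s0.ef, wZ, EZ]; simp
  have Fg1 : ⁅F, g1⁆ = -((4:ℂ) • Z') := by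
    rw [hg1, leibniz_lie, FZ, sk F E, s0.ef, lie_neg, sk Z' H, wZ']; simp
  have e1Z' : ⁅e1, Z'⁆ = F := by
    rw [he1, lie_lie, sz.ef, FZ, sk F, wF]; simp
  have Zg1 : ⁅Z, g1⁆ = E := by
    rw [hg1, leibniz_lie, sz.ef, wE, sk Z E, EZ]; simp
  have e1g1 : ⁅e1, g1⁆ = H + c := by
    rw [hg1, leibniz_lie, e1Z', sk F E, s0.ef, sk e1 E, Ee1, lie_neg, lie_smul, sk Z' Z, sz.ef,
      hHZ]; module
  have r1 : ⁅⁅e1, F⁆, E⁆ = ((6:ℕ):ℂ) • e1 := by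
    rw [lie_lie, sk F E, s0.ef, sk e1 E, Ee1, lie_neg, lie_neg, sk e1 H, We1, lie_smul, ← he1]
    push_cast; module
  have r2 : ⁅⁅e1, F⁆, g1⁆ = -(((6:ℕ):ℂ) • F) := by
    rw [lie_lie, Fg1, e1g1, lie_add, cc', sk F H, s0.hf, lie_neg, lie_smul, e1Z']
    push_cast; module
  have r3 : ⁅⁅E, g1⁆, e1⁆ = ((6:ℕ):ℂ) • E := by
    rw [lie_lie, sk g1 e1, e1g1, Ee1, lie_neg, lie_add, cc', sk E H, s0.he, lie_smul, sk g1 Z, Zg1]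
    push_cast; module
  have r4 : ⁅⁅E, g1⁆, F⁆ = -(((6:ℕ):ℂ) • g1) := by
    rw [lie_lie, sk g1 F, Fg1, s0.ef, neg_neg, lie_smul, sk E Z', ← hg1, sk g1 H, Wg1]
    push_cast; module
  set T : Set L := {E, F, Z, Z'} with hT
  set K := LieSubalgebra.lieSpan ℂ L T with hK
  have mem : ∀ t ∈ T, t ∈ K := fun t ht => LieSubalgebra.subset_lieSpan ht
  have mE : E ∈ K := mem _ (by simp [hT])
  have mF : F ∈ K := mem _ (by simp [hT])
  have mZ : Z ∈ K := mem _ (by simp [hT])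
  have mZ' : Z' ∈ K := mem _ (by simp [hT])
  have mH : H ∈ K := by rw [← s0.ef]; exact K.lie_mem mE mF
  have mHZ : HZ ∈ K := by rw [← sz.ef]; exact K.lie_mem mZ mZ'
  have mc : c ∈ K := by
    have : c = (4:ℂ) • HZ - (2:ℂ) • H := by rw [hHZ]; module
    rw [this]; exact K.sub_mem (K.smul_mem _ mHZ) (K.smul_mem _ mH)
  have me1 : e1 ∈ K := K.lie_mem mF mZ
  have mg1 : g1 ∈ K := K.lie_mem mZ' mE
  have nil : ∀ x : L, (∀ t ∈ T, ∃ n : ℕ, (ad ℂ L x ^ n) t = 0) → ∀ v ∈ K,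
      ∃ n : ℕ, (ad ℂ L x ^ n) v = 0 := by
    intro x hx v hv
    have h1 : K ≤ LieSubalgebra.engel ℂ x := by
      rw [hK, LieSubalgebra.lieSpan_le]; intro t ht
      exact (LieSubalgebra.mem_engel_iff ℂ x t).2 (hx t ht)
    exact (LieSubalgebra.mem_engel_iff ℂ x v).1 (h1 hv)
  have e1Z : ⁅e1, Z⁆ = 0 := by rw [sk e1 Z, he1, sk F Z, lie_neg, ZZF]; simp
  have g1Z : ⁅g1, Z'⁆ = 0 := by rw [sk g1 Z', hg1, ZZE]; simp
  have e1F : (ad ℂ L e1 ^ 4) F = 0 := nilC Z F ZZF F5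
  have g1E : (ad ℂ L g1 ^ 4) E = 0 := by
    have := nilC Z' E ZZE E5
    rw [sk E Z', ← hg1, map_neg, Even.neg_pow (by decide)] at this
    exact this
  have ne1 : ∀ v ∈ K, ∃ n : ℕ, (ad ℂ L e1 ^ n) v = 0 := by
    refine nil e1 ?_
    rintro t (h | h | h | h) <;> rw [h]
    · refine ⟨2, ?_⟩
      simp only [pow_succ, pow_zero, one_mul, Module.End.mul_apply, ad_apply]
      rw [sk e1 E, Ee1, lie_neg, lie_smul, e1Z]; simp
    · exact ⟨4, e1F⟩
    · exact ⟨1, by simpa using e1Z⟩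
    · refine ⟨5, ?_⟩
      rw [pow_succ, Module.End.mul_apply, ad_apply, e1Z']; exact e1F
  have ng1 : ∀ v ∈ K, ∃ n : ℕ, (ad ℂ L g1 ^ n) v = 0 := by
    refine nil g1 ?_
    rintro t (h | h | h | h) <;> rw [h]
    · exact ⟨4, g1E⟩
    · refine ⟨2, ?_⟩
      simp only [pow_succ, pow_zero, one_mul, Module.End.mul_apply, ad_apply]
      rw [sk g1 F, Fg1, neg_neg, lie_smul, g1Z]; simp
    · refine ⟨5, ?_⟩
      rw [pow_succ, Module.End.mul_apply, ad_apply, sk g1 Z, Zg1, map_neg, g1E, neg_zero]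
    · exact ⟨1, by simpa using g1Z⟩
  have s0K : SLTwo (⟨E, mE⟩ : K) ⟨F, mF⟩ ⟨H, mH⟩ := SLTwo.restrict s0
  have s1K : SLTwo (⟨e1, me1⟩ : K) ⟨g1, mg1⟩ (⟨H, mH⟩ + ⟨c, mc⟩) :=
    { ef := Subtype.ext e1g1
      he := Subtype.ext (by
        change ⁅H + c, e1⁆ = (2:ℂ) • e1
        rw [add_lie, cc, add_zero, We1])
      hf := Subtype.ext (by
        change ⁅H + c, g1⁆ = -((2:ℂ) • g1)
        rw [add_lie, cc, add_zero, Wg1])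
      ne := fun v => by
        obtain ⟨n, hn⟩ := ne1 v v.2; exact ⟨n, Subtype.ext (by rw [ad_val, hn]; rfl)⟩
      nf := fun v => by
        obtain ⟨n, hn⟩ := ng1 v v.2; exact ⟨n, Subtype.ext (by rw [ad_val, hn]; rfl)⟩ }
  obtain ⟨e, f, h, p, E0, F0, H0, E1, F1⟩ := exists_preLoop (L := K) 6 (by norm_num)
    ⟨E, mE⟩ ⟨F, mF⟩ ⟨e1, me1⟩ ⟨g1, mg1⟩ ⟨H, mH⟩ ⟨c, mc⟩ (fun v => Subtype.ext (cc v)) s0K s1K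
    (Subtype.ext r1) (Subtype.ext r2) (Subtype.ext r3) (Subtype.ext r4)
  have rel := p.loopRel.map K.incl
  have vE0 : ((e 0 : K) : L) = E := by rw [E0]
  have vF0 : ((f 0 : K) : L) = F := by rw [F0]
  have vH0 : ((h 0 : K) : L) = H := by rw [H0]
  have vE1 : ((e 1 : K) : L) = e1 := by rw [E1]
  have vF1 : ((f (-1) : K) : L) = g1 := by rw [F1]
  refine ⟨fun n => e n, fun n => f n, fun n => h n,
    { toLoopRel := rel, Dpos := by norm_num, cc := cc, s0 := ?_, cent := ?_, cent' := ?_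
      ee := fun m n hh => congrArg Subtype.val (p.ee m n hh)
      ff := fun m n hh => congrArg Subtype.val (p.ff m n hh)
      eee := fun q m n => congrArg Subtype.val (p.eee q m n)
      fff := fun q m n => congrArg Subtype.val (p.fff q m n) },
    vE0, vF0, vH0, vE1, vF1, ?_, ?_, wZ, wZ'⟩
  · beta_reduce; rw [vE0, vF0, vH0]; exact s0
  · beta_reduce; rw [vE0, vF1, vH0]
    intro Y yE yg yH n
    have yH' : ⁅H, Y⁆ = 0 := by rw [sk, yH, neg_zero]
    have yF : ⁅Y, F⁆ = 0 := by rw [sk, s0.zero_e yH' (by rw [sk, yE, neg_zero]), neg_zero]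
    have yZ' : ⁅Y, Z'⁆ = 0 := by
      refine lie_smul_cancel (D := -4) (by norm_num) ?_
      rw [neg_smul, ← Fg1]; exact lie_lie_zero yF yg
    have yZ : ⁅Y, Z⁆ = 0 := by
      rw [sk, sz.zero_f (by rw [HZv, yH', smul_zero]) (by rw [sk, yZ', neg_zero]), neg_zero]
    refine rel.cent_all (by norm_num) (Y := Y) ?_ ?_ ?_ ?_ n
    · simpa [vE0] using yE
    · simpa [vF0] using yF
    · simpa [vE1] using lie_lie_zero yF yZ
    · simpa [vF1] using yg
  · beta_reduce; rw [vF0, vE1, vH0]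
    intro Y yF yg yH n
    have yH' : ⁅H, Y⁆ = 0 := by rw [sk, yH, neg_zero]
    have yE : ⁅Y, E⁆ = 0 := by rw [sk, s0.zero_f yH' (by rw [sk, yF, neg_zero]), neg_zero]
    have yZ : ⁅Y, Z⁆ = 0 := by
      refine lie_smul_cancel (D := 4) (by norm_num) ?_
      rw [← Ee1]; exact lie_lie_zero yE yg
    have yZ' : ⁅Y, Z'⁆ = 0 := by
      rw [sk, sz.zero_e (by rw [HZv, yH', smul_zero]) (by rw [sk, yZ, neg_zero]), neg_zero]
    refine rel.cent_all (by norm_num) (Y := Y) ?_ ?_ ?_ ?_ n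
    · simpa [vE0] using yE
    · simpa [vF0] using yF
    · simpa [vE1] using yg
    · simpa [vF1] using lie_lie_zero yZ' yE
  · beta_reduce; rw [vE0, vE1]; exact Ee1
  · beta_reduce; rw [vF0, vF1]; exact Fg1

end LoopTwo

open LieAlgebra

section PairGen
variable {L : Type*} [LieRing L] [LieAlgebra ℂ L]

theorem dd_ne {D : ℕ} (hD : 0 < D) (r : ℤ) : dd D r ≠ 0 := by
  unfold dd; split_ifs
  · norm_num
  · exact_mod_cast hD.ne'

namespace Loop
variable {D : ℕ} {e f h : ℤ → L} {c : L}

theorem sigma (p : Loop D e f h c) :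
    Loop D (fun n => f (-n)) (fun n => e (-n)) (fun n => -h (-n)) (-c) where
  ef m n := by
    have : -n + -m = -(m+n) := by ring
    rw [← lie_skew, p.ef, this, neg_add]; simp only [neg_eq_zero]
    split_ifs with h
    · have : n = -m := by omega
      subst this; simp
    · simp
  he m n := by rw [neg_lie, p.hf, neg_neg, dd_neg, neg_add]
  hf m n := by rw [neg_lie, p.he, dd_neg, neg_add]
  Dpos := p.Dpos
  cc v := by rw [neg_lie, p.cc, neg_zero]
  s0 := by simpa using p.s0.swap
  cent Y a b d n := by
    simp only [neg_zero, neg_neg, lie_neg, neg_eq_zero] at a b d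
    exact (p.cent' Y a b d (-n)).symm
  cent' Y a b d n := by
    simp only [neg_zero, lie_neg, neg_eq_zero] at a b d
    exact (p.cent Y a b d (-n)).symm
  ee m n hh := p.ff _ _ (by rwa [← neg_add, even_neg])
  ff m n hh := p.ee _ _ (by rwa [← neg_add, even_neg])
  eee q m n := p.fff _ _ _
  fff q m n := p.eee _ _ _

theorem hdef (p : Loop D e f h c) (n : ℤ) : h n = ⁅e n, f 0⁆ := by
  rw [p.ef, add_zero]; split_ifs with hn
  · simp [hn]
  · simp

theorem cc' (p : Loop D e f h c) (v : L) : ⁅v, c⁆ = 0 := by rw [← lie_skew, p.cc, neg_zero]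

theorem hh (p : Loop D e f h c) (m n : ℤ) :
    ⁅h m, h n⁆ = -(if n+m=0 then (dd D m * n) • c else 0) := by
  rw [p.hdef n, leibniz_lie, p.he, p.hf, smul_lie, lie_neg, lie_smul, p.ef, p.ef]
  simp only [add_zero, add_comm m n, zero_add, smul_add]
  split_ifs with hh
  · have : n = -m := by omega
    subst this; push_cast; simp [mul_smul]
  · simp

theorem hh_cent (p : Loop D e f h c) (m n : ℤ) (v : L) : ⁅⁅h m, h n⁆, v⁆ = 0 := by
  rw [p.hh]; split_ifs <;> simp [p.cc]

theorem hh0 (p : Loop D e f h c) (m : ℤ) : ⁅h m, h 0⁆ = 0 := by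
  rw [p.hh]; split_ifs <;> simp

theorem shiftY (p : Loop D e f h c) {Y : L} (r : ℤ) (t : ℂ) (y0 : ⁅Y, h 0⁆ = 0)
    (y1 : ∀ v : L, ⁅⁅Y, h 1⁆, v⁆ = 0) (ym : ∀ v : L, ⁅⁅Y, h (-1)⁆, v⁆ = 0)
    (ye : ⁅Y, e 0⁆ = t • e r) :
    (∀ n, ⁅Y, e n⁆ = t • e (n+r)) ∧ ∀ n, ⁅Y, f n⁆ = -(t • f (n+r)) := by
  have d0 := dd_ne p.Dpos r
  have z0 : ⁅Y - (t / dd D r) • h r, e 0⁆ = 0 := by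
    rw [sub_lie, smul_lie, p.he, ye, smul_smul, div_mul_cancel₀ _ d0, add_zero, sub_self]
  have zh : ⁅h 0, Y - (t / dd D r) • h r⁆ = 0 := by
    rw [← lie_skew, sub_lie, y0, smul_lie, p.hh0]; simp
  have zf : ⁅Y - (t / dd D r) • h r, f 0⁆ = 0 := by
    rw [← lie_skew, p.s0.zero_e zh (by rw [← lie_skew, z0, neg_zero]), neg_zero]
  have := p.cent_h p.Dpos (Y := Y - (t / dd D r) • h r)
    (by intro v; rw [sub_lie, sub_lie, y1, smul_lie, smul_lie, p.hh_cent]; simp)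
    (by intro v; rw [sub_lie, sub_lie, ym, smul_lie, smul_lie, p.hh_cent]; simp)
  constructor
  · intro n
    have h1 := this.1 z0 n
    rw [sub_lie, sub_eq_zero, smul_lie, p.he, smul_smul, div_mul_cancel₀ _ d0] at h1
    rw [h1, add_comm]
  · intro n
    have h1 := this.2 zf n
    rw [sub_lie, sub_eq_zero, smul_lie, p.hf, smul_neg, smul_smul, div_mul_cancel₀ _ d0] at h1
    rw [h1, add_comm]

end Loop

/-- Induction over a lattice. -/
theorem lattice_ind {M : Type*} [AddCommGroup M] [Module ℂ M] (X : ℤ → ℤ → M)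
    (D : ℂ) (r : ℕ) (s t s' t' : ℂ) (hD : D ≠ 0)
    (hc : (s = 0 ∧ s' = 0) ∨ (r = 1 ∧ 2 * D ≠ s * t ∧ 2 * D ≠ s' * t'))
    (A : ∀ p q, X p q = 0 → D • X (p+1) q + s • X p (q+1) = 0)
    (B : ∀ p q, X p q = 0 → t • X (p+r) q + (2:ℂ) • X p (q+1) = 0)
    (A' : ∀ p q, X p q = 0 → D • X (p-1) q + s' • X p (q-1) = 0)
    (B' : ∀ p q, X p q = 0 → t' • X (p-r) q + (2:ℂ) • X p (q-1) = 0)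
    (h0 : X 0 0 = 0) (p q : ℤ) : X p q = 0 := by
  have key : (∀ p q, X p q = 0 → X (p+1) q = 0 ∧ X p (q+1) = 0) ∧
      (∀ p q, X p q = 0 → X (p-1) q = 0 ∧ X p (q-1) = 0) := by
    rcases hc with ⟨rfl, rfl⟩ | ⟨rfl, h1, h2⟩
    · have a1 : ∀ p q, X p q = 0 → X (p+1) q = 0 := fun p q h => by
        have := A p q h; simpa [hD] using this
      have a2 : ∀ p q, X p q = 0 → X (p-1) q = 0 := fun p q h => by
        have := A' p q h; simpa [hD] using this
      have b1 : ∀ n : ℕ, ∀ p q, X p q = 0 → X (p+n) q = 0 := by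
        intro n; induction n with
        | zero => simp
        | succ n ih => intro p q h; have := a1 _ _ (ih p q h); push_cast; rwa [← add_assoc]
      have b2 : ∀ n : ℕ, ∀ p q, X p q = 0 → X (p-n) q = 0 := by
        intro n; induction n with
        | zero => simp
        | succ n ih =>
          intro p q h; have := a2 _ _ (ih p q h); push_cast; rwa [sub_sub] at this
      refine ⟨fun p q h => ⟨a1 p q h, ?_⟩, fun p q h => ⟨a2 p q h, ?_⟩⟩
      · have := B p q h
        rw [b1 r p q h] at this; simpa using this
      · have := B' p q h
        rw [b2 r p q h] at this; simpa using this
    · have solve : ∀ (s t : ℂ) (x y : M), 2 * D ≠ s * t → D • x + s • y = 0 →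
          t • x + (2:ℂ) • y = 0 → x = 0 ∧ y = 0 := by
        intro s t x y hne e1 e2
        have h3 : (2 * D - s * t) • x = 0 := by
          have : (2 * D - s * t) • x = (2:ℂ) • (D • x + s • y) - s • (t • x + (2:ℂ) • y) := by module
          rw [this, e1, e2]; simp
        have hx := (smul_eq_zero.1 h3).resolve_left (sub_ne_zero.2 hne)
        subst hx
        simp at e2; exact ⟨rfl, e2⟩
      exact ⟨fun p q h => solve s t _ _ h1 (A p q h) (by simpa using B p q h),
        fun p q h => solve s' t' _ _ h2 (A' p q h) (by simpa using B' p q h)⟩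
  have row : ∀ p, X p 0 = 0 := by
    intro p
    induction p using Int.induction_on with
    | zero => exact h0
    | succ n ih => exact (key.1 _ _ ih).1
    | pred n ih => exact (key.2 _ _ ih).1
  induction q using Int.induction_on with
  | zero => exact row p
  | succ n ih => exact (key.1 _ _ ih).2
  | pred n ih => exact (key.2 _ _ ih).2

/-- Two loops with their weights. -/
structure PairBase (D m : ℕ) (e f h : ℤ → L) (c : L) (e' f' h' : ℤ → L) (c' : L) : Prop where
  l1 : Loop D e f h c
  l2 : Loop 2 e' f' h' c'
  w1 : ∀ n, ⁅h 0, e' n⁆ = -((m:ℂ) • e' n)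
  w2 : ∀ n, ⁅h 0, f' n⁆ = (m:ℂ) • f' n
  w3 : ∀ n, ⁅h' 0, e n⁆ = -e n
  w4 : ∀ n, ⁅h' 0, f n⁆ = f n
  x1 : ⁅e 0, f' 0⁆ = 0
  x2 : ⁅f 0, e' 0⁆ = 0
  x3 : ⁅f 0, e' 1⁆ = 0
  x4 : ⁅e 0, f' (-1)⁆ = 0

/-- Shift operators in the positive direction. -/
structure Half (r : ℕ) (s t w : ℂ) (e f h e' f' h' : ℤ → L) : Prop where
  a1 : ∀ n, ⁅h 1, e' n⁆ = s • e' (n+1)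
  a2 : ∀ n, ⁅h 1, f' n⁆ = -(s • f' (n+1))
  a3 : ∀ n, ⁅h' 1, e n⁆ = t • e (n+r)
  a4 : ∀ n, ⁅h' 1, f n⁆ = -(t • f (n+r))
  th : ⁅e r, e' 0⁆ = w • ⁅e 0, e' 1⁆

/-- Conclusion for a pair. -/
structure PairConcl (e f h e' f' h' : ℤ → L) : Prop where
  ef : ∀ p q, ⁅e p, f' q⁆ = 0
  fe : ∀ p q, ⁅f p, e' q⁆ = 0
  he : ∀ p q, ⁅h p, e' q⁆ ∈ Submodule.span ℂ (Set.range e')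
  hf : ∀ p q, ⁅h p, f' q⁆ ∈ Submodule.span ℂ (Set.range f')
  he' : ∀ p q, ⁅h' p, e q⁆ ∈ Submodule.span ℂ (Set.range e)
  hf' : ∀ p q, ⁅h' p, f q⁆ ∈ Submodule.span ℂ (Set.range f)

namespace PairBase
variable {D m : ℕ} {e f h e' f' h' : ℤ → L} {c c' : L}

theorem sigma (p : PairBase D m e f h c e' f' h' c') :
    PairBase D m (fun n => f (-n)) (fun n => e (-n)) (fun n => -h (-n)) (-c)
      (fun n => f' (-n)) (fun n => e' (-n)) (fun n => -h' (-n)) (-c') where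
  l1 := p.l1.sigma
  l2 := p.l2.sigma
  w1 n := by rw [neg_zero, neg_lie, p.w2]
  w2 n := by rw [neg_zero, neg_lie, p.w1, neg_neg]
  w3 n := by rw [neg_zero, neg_lie, p.w4]
  w4 n := by rw [neg_zero, neg_lie, p.w3, neg_neg]
  x1 := by simpa using p.x2
  x2 := by simpa using p.x1
  x3 := by simpa using p.x4
  x4 := by simpa using p.x3

theorem hh0 (p : PairBase D m e f h c e' f' h' c') (n : ℤ) : ⁅h n, h' 0⁆ = 0 := by
  rw [← lie_skew, p.l1.hdef, leibniz_lie, p.w3, p.w4, neg_lie, neg_add_cancel, neg_zero]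

theorem hh0' (p : PairBase D m e f h c e' f' h' c') (n : ℤ) : ⁅h' n, h 0⁆ = 0 := by
  rw [← lie_skew, p.l2.hdef, leibniz_lie, p.w1, p.w2]; simp

/-- `[h n, e' q]` in terms of `[e n, e' q]`. -/
theorem he_eq (p : PairBase D m e f h c e' f' h' c') {n q : ℤ} (hf : ⁅f 0, e' q⁆ = 0) :
    ⁅h n, e' q⁆ = -⁅f 0, ⁅e n, e' q⁆⁆ := by
  rw [p.l1.hdef, lie_lie, hf]; simp

theorem he_zero (p : PairBase D m e f h c e' f' h' c') {q : ℤ} (hf : ⁅f 0, e' q⁆ = 0) :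
    ⁅f 0, ⁅e 0, e' q⁆⁆ = (m:ℂ) • e' q := by
  rw [← neg_eq_iff_eq_neg.2 (p.he_eq (n := 0) hf), p.w1, neg_neg]

theorem he'_eq (p : PairBase D m e f h c e' f' h' c') {n q : ℤ} (hf : ⁅f' 0, e q⁆ = 0) :
    ⁅h' n, e q⁆ = ⁅f' 0, ⁅e q, e' n⁆⁆ := by
  rw [p.l2.hdef, lie_lie, hf, ← lie_skew (e q) (e' n), lie_zero, zero_sub, lie_neg]

theorem he'_zero (p : PairBase D m e f h c e' f' h' c') {q : ℤ} (hf : ⁅f' 0, e q⁆ = 0) :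
    ⁅f' 0, ⁅e q, e' 0⁆⁆ = - e q := by
  rw [← p.he'_eq (n := 0) hf, p.w3]

end PairBase

/-- all `[e p, f' q]` vanish -/
theorem pair_ef {D m : ℕ} {e f h e' f' h' : ℤ → L} {c c' : L}
    (p : PairBase D m e f h c e' f' h' c') {r : ℕ} {s t w s' t' w' : ℂ}
    (a : Half r s t w e f h e' f' h')
    (b : Half r s' t' w' (fun n => f (-n)) (fun n => e (-n)) (fun n => -h (-n))
      (fun n => f' (-n)) (fun n => e' (-n)) (fun n => -h' (-n)))
    (hc : (s = 0 ∧ s' = 0) ∨ (r = 1 ∧ 2 * (D:ℂ) ≠ s * t ∧ 2 * (D:ℂ) ≠ s' * t')) (i j : ℤ) :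
    ⁅e i, f' j⁆ = 0 := by
  have b2 : ∀ n, ⁅h (-1), f' n⁆ = -(s' • f' (n-1)) := fun n => by
    have := b.a1 (-n); simp only [neg_neg, neg_lie] at this
    rw [← neg_eq_iff_eq_neg, this]; congr 2; ring
  have b3 : ∀ n, ⁅h' (-1), e n⁆ = t' • e (n-r) := fun n => by
    have := b.a4 (-n); simp only [neg_neg, neg_lie, neg_inj] at this
    rw [this]; congr 2; ring
  have D0 : (D:ℂ) ≠ 0 := by exact_mod_cast p.l1.Dpos.ne'
  refine lattice_ind (fun i j => ⁅e i, f' j⁆) (D:ℂ) r (-s) (-t) (-s') (-t') D0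
    (by rcases hc with hc | hc
        · left; simpa using hc
        · right; simpa using hc) ?_ ?_ ?_ ?_ p.x1 i j
  · intro i j hij
    have h1 : ⁅h 1, ⁅e i, f' j⁆⁆ = 0 := by rw [hij, lie_zero]
    rw [leibniz_lie, p.l1.he, a.a2, dd_one, smul_lie, lie_neg, lie_smul, add_comm 1 i] at h1
    rw [neg_smul]; exact h1
  · intro i j hij
    have h1 : ⁅h' 1, ⁅e i, f' j⁆⁆ = 0 := by rw [hij, lie_zero]
    rw [leibniz_lie, p.l2.hf, a.a3, dd_one, smul_lie, lie_neg, lie_smul, add_comm 1 j] at h1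
    rw [neg_smul, ← neg_eq_zero, ← h1]; push_cast; module
  · intro i j hij
    have h1 : ⁅h (-1), ⁅e i, f' j⁆⁆ = 0 := by rw [hij, lie_zero]
    rw [leibniz_lie, p.l1.he, b2, dd_negone, smul_lie, lie_neg, lie_smul, add_comm (-1) i] at h1
    rw [neg_smul]; exact h1
  · intro i j hij
    have h1 : ⁅h' (-1), ⁅e i, f' j⁆⁆ = 0 := by rw [hij, lie_zero]
    rw [leibniz_lie, p.l2.hf, b3, dd_negone, smul_lie, lie_neg, lie_smul, add_comm (-1) j] at h1
    rw [neg_smul, ← neg_eq_zero, ← h1, sub_eq_add_neg j]; push_cast; module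

theorem pair_th {D m : ℕ} {e f h e' f' h' : ℤ → L} {c c' : L}
    (p : PairBase D m e f h c e' f' h' c') {r : ℕ} {s t w s' t' w' : ℂ}
    (a : Half r s t w e f h e' f' h')
    (b : Half r s' t' w' (fun n => f (-n)) (fun n => e (-n)) (fun n => -h (-n))
      (fun n => f' (-n)) (fun n => e' (-n)) (fun n => -h' (-n)))
    (hc : (s = 0 ∧ s' = 0) ∨ (r = 1 ∧ 2 * (D:ℂ) ≠ s * t ∧ 2 * (D:ℂ) ≠ s' * t')) (i j : ℤ) :
    ⁅e (i+r), e' j⁆ = w • ⁅e i, e' (j+1)⁆ := by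
  have b1 : ∀ n, ⁅h (-1), e' n⁆ = s' • e' (n-1) := fun n => by
    have := b.a2 (-n); simp only [neg_neg, neg_lie, neg_inj] at this
    rw [this]; congr 2; ring
  have b3 : ∀ n, ⁅h' (-1), e n⁆ = t' • e (n-r) := fun n => by
    have := b.a4 (-n); simp only [neg_neg, neg_lie, neg_inj] at this
    rw [this]; congr 2; ring
  have D0 : (D:ℂ) ≠ 0 := by exact_mod_cast p.l1.Dpos.ne'
  rw [← sub_eq_zero]
  refine lattice_ind (fun i j => ⁅e (i+r), e' j⁆ - w • ⁅e i, e' (j+1)⁆) (D:ℂ) r s t s' t' D0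
    hc ?_ ?_ ?_ ?_ (by simpa [sub_eq_zero] using a.th) i j
  · intro i j hij
    have h1 : ⁅h 1, ⁅e (i+r), e' j⁆ - w • ⁅e i, e' (j+1)⁆⁆ = 0 := by beta_reduce at hij; rw [hij, lie_zero]
    rw [lie_sub, lie_smul, leibniz_lie, leibniz_lie (h 1), p.l1.he, p.l1.he, a.a1, a.a1, dd_one] at h1
    simp only [smul_lie, lie_smul] at h1
    rw [show 1 + (i+(r:ℤ)) = i+1+r by ring, add_comm 1 i] at h1
    rw [← h1]; module
  · intro i j hij
    have h1 : ⁅h' 1, ⁅e (i+r), e' j⁆ - w • ⁅e i, e' (j+1)⁆⁆ = 0 := by beta_reduce at hij; rw [hij, lie_zero]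
    rw [lie_sub, lie_smul, leibniz_lie, leibniz_lie (h' 1), p.l2.he, p.l2.he, a.a3, a.a3, dd_one] at h1
    simp only [smul_lie, lie_smul] at h1
    rw [show 1 + (j+1) = j+1+1 by ring, add_comm 1 j] at h1
    rw [← h1]; push_cast; module
  · intro i j hij
    have h1 : ⁅h (-1), ⁅e (i+r), e' j⁆ - w • ⁅e i, e' (j+1)⁆⁆ = 0 := by beta_reduce at hij; rw [hij, lie_zero]
    rw [lie_sub, lie_smul, leibniz_lie, leibniz_lie (h (-1)), p.l1.he, p.l1.he, b1, b1, dd_negone] at h1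
    simp only [smul_lie, lie_smul] at h1
    rw [show -1 + (i+(r:ℤ)) = i-1+r by ring, show -1 + i = i-1 by ring,
      show j+1-1 = j-1+1 by ring] at h1
    rw [← h1]; module
  · intro i j hij
    have h1 : ⁅h' (-1), ⁅e (i+r), e' j⁆ - w • ⁅e i, e' (j+1)⁆⁆ = 0 := by beta_reduce at hij; rw [hij, lie_zero]
    rw [lie_sub, lie_smul, leibniz_lie, leibniz_lie (h' (-1)), p.l2.he, p.l2.he, b3, b3, dd_negone] at h1
    simp only [smul_lie, lie_smul] at h1
    rw [show -1 + (j+1) = j-1+1 by ring, show -1 + j = j-1 by ring,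
      show i+(r:ℤ)-r = i-r+r by ring] at h1
    rw [← h1]; push_cast; module

theorem pair_span {D m : ℕ} {e f h e' f' h' : ℤ → L} {c c' : L}
    (p : PairBase D m e f h c e' f' h' c') {r : ℕ} {s t w s' t' w' : ℂ}
    (a : Half r s t w e f h e' f' h')
    (b : Half r s' t' w' (fun n => f (-n)) (fun n => e (-n)) (fun n => -h (-n))
      (fun n => f' (-n)) (fun n => e' (-n)) (fun n => -h' (-n)))
    (hc : (s = 0 ∧ s' = 0) ∨ (r = 1 ∧ 2 * (D:ℂ) ≠ s * t ∧ 2 * (D:ℂ) ≠ s' * t')) (w0 : w ≠ 0)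
    (hr : r = 1 ∨ r = 2 ∨ r = 3) :
    (∀ i j, ⁅h i, e' j⁆ ∈ Submodule.span ℂ (Set.range e')) ∧
    (∀ i j, ⁅h' i, e j⁆ ∈ Submodule.span ℂ (Set.range e)) := by
  have EF := pair_ef p a b hc
  have TH := pair_th p a b hc
  have FE : ∀ i j, ⁅f i, e' j⁆ = 0 := by
    intro i j
    have := pair_ef p.sigma b (r := r) (s' := s) (t' := t) (w' := w)
      (by simpa using a) (by
        rcases hc with ⟨h1, h2⟩ | ⟨h1, h2, h3⟩
        · exact Or.inl ⟨h2, h1⟩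
        · exact Or.inr ⟨h1, h3, h2⟩) (-i) (-j)
    simpa using this
  have b1 : ∀ n, ⁅h (-1), e' n⁆ = s' • e' (n-1) := fun n => by
    have := b.a2 (-n); simp only [neg_neg, neg_lie, neg_inj] at this
    rw [this]; congr 2; ring
  have mem : ∀ n, e' n ∈ Submodule.span ℂ (Set.range e') := fun n => Submodule.subset_span ⟨n, rfl⟩
  have mem' : ∀ n, e n ∈ Submodule.span ℂ (Set.range e) := fun n => Submodule.subset_span ⟨n, rfl⟩
  constructor
  · have step : ∀ i j, ⁅h (i+r), e' j⁆ = w • ⁅h i, e' (j+1)⁆ := by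
      intro i j
      rw [p.he_eq (FE 0 _), p.he_eq (FE 0 _), TH, lie_smul, smul_neg]
    have z0 : ∀ j, ⁅h 0, e' j⁆ ∈ Submodule.span ℂ (Set.range e') := fun j => by
      rw [p.w1]; exact Submodule.neg_mem _ (Submodule.smul_mem _ _ (mem _))
    have z1 : ∀ j, ⁅h 1, e' j⁆ ∈ Submodule.span ℂ (Set.range e') := fun j => by
      rw [a.a1]; exact (Submodule.smul_mem _ _ (mem _))
    have zm : ∀ j, ⁅h (-1), e' j⁆ ∈ Submodule.span ℂ (Set.range e') := fun j => by
      rw [b1]; exact (Submodule.smul_mem _ _ (mem _))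
    have up : ∀ i, (∀ j, ⁅h i, e' j⁆ ∈ Submodule.span ℂ (Set.range e')) →
        (∀ j, ⁅h (i+r), e' j⁆ ∈ Submodule.span ℂ (Set.range e')) := fun i hi j => by
      rw [step]; exact Submodule.smul_mem _ _ (hi _)
    have down : ∀ i, (∀ j, ⁅h i, e' j⁆ ∈ Submodule.span ℂ (Set.range e')) →
        (∀ j, ⁅h (i-r), e' j⁆ ∈ Submodule.span ℂ (Set.range e')) := fun i hi j => by
      have := step (i-r) (j-1)
      rw [sub_add_cancel, sub_add_cancel] at this
      rw [← inv_smul_smul₀ w0 ⁅h (i-r), e' j⁆, ← this]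
      exact Submodule.smul_mem _ _ (hi _)
    have all : ∀ (x : ℤ), (∀ j, ⁅h x, e' j⁆ ∈ Submodule.span ℂ (Set.range e')) → ∀ k : ℤ,
        (∀ j, ⁅h (x + k * r), e' j⁆ ∈ Submodule.span ℂ (Set.range e')) := by
      intro x hx k
      induction k using Int.induction_on with
      | zero => simpa using hx
      | succ n ih => rw [add_mul, one_mul, ← add_assoc]; exact up _ ih
      | pred n ih => rw [sub_mul, one_mul, ← add_sub_assoc]; exact down _ ih
    intro i
    have hx : ∃ x k : ℤ, (x = 0 ∨ x = 1 ∨ x = -1) ∧ i = x + k * r := by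
      rcases hr with rfl | rfl | rfl
      · exact ⟨0, i, by simp, by simp⟩
      · refine ⟨i % 2, i / 2, by omega, by push_cast; omega⟩
      · refine ⟨(i+1) % 3 - 1, (i+1) / 3, by omega, by push_cast; omega⟩
    obtain ⟨x, k, hx, rfl⟩ := hx
    refine all x ?_ k
    rcases hx with rfl | rfl | rfl
    · exact z0
    · exact z1
    · exact zm
  · have step : ∀ i j, ⁅h' i, e (j+r)⁆ = w • ⁅h' (i+1), e j⁆ := by
      intro i j
      rw [p.he'_eq (by rw [← lie_skew, EF, neg_zero]), p.he'_eq (by rw [← lie_skew, EF, neg_zero]),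
        TH, lie_smul]
    intro i
    induction i using Int.induction_on with
    | zero => intro j; rw [p.w3]; exact Submodule.neg_mem _ (mem' _)
    | succ n ih =>
      intro j
      rw [← inv_smul_smul₀ w0 ⁅h' (n+1), e j⁆, ← step]
      exact Submodule.smul_mem _ _ (ih _)
    | pred n ih =>
      intro j
      have := step (-n-1) (j-r)
      rw [sub_add_cancel, sub_add_cancel] at this
      rw [this]
      exact Submodule.smul_mem _ _ (ih _)

theorem pair_concl {D m : ℕ} {e f h e' f' h' : ℤ → L} {c c' : L}
    (p : PairBase D m e f h c e' f' h' c') {r : ℕ} {s t w s' t' w' : ℂ}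
    (a : Half r s t w e f h e' f' h')
    (b : Half r s' t' w' (fun n => f (-n)) (fun n => e (-n)) (fun n => -h (-n))
      (fun n => f' (-n)) (fun n => e' (-n)) (fun n => -h' (-n)))
    (hc : (s = 0 ∧ s' = 0) ∨ (r = 1 ∧ 2 * (D:ℂ) ≠ s * t ∧ 2 * (D:ℂ) ≠ s' * t')) (w0 : w ≠ 0)
    (w0' : w' ≠ 0) (hr : r = 1 ∨ r = 2 ∨ r = 3) :
    PairConcl e f h e' f' h' := by
  have hc' : (s' = 0 ∧ s = 0) ∨ (r = 1 ∧ 2 * (D:ℂ) ≠ s' * t' ∧ 2 * (D:ℂ) ≠ s * t) := by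
    rcases hc with ⟨h1, h2⟩ | ⟨h1, h2, h3⟩
    · exact Or.inl ⟨h2, h1⟩
    · exact Or.inr ⟨h1, h3, h2⟩
  have sp := pair_span p a b hc w0 hr
  have sp' := pair_span p.sigma b (r := r) (s' := s) (t' := t) (w' := w) (by simpa using a) hc' w0' hr
  have fe := pair_ef p.sigma b (r := r) (s' := s) (t' := t) (w' := w) (by simpa using a) hc'
  have rg : ∀ u : ℤ → L, Set.range (fun n => u (-n)) = Set.range u := fun u =>
    (Equiv.neg ℤ).surjective.range_comp u
  refine ⟨pair_ef p a b hc, fun i j => by simpa using fe (-i) (-j), sp.1, fun i j => ?_, sp.2,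
    fun i j => ?_⟩
  · have := sp'.1 (-i) (-j)
    simp only [neg_neg, neg_lie, neg_mem_iff, rg] at this; exact this
  · have := sp'.2 (-i) (-j)
    simp only [neg_neg, neg_lie, neg_mem_iff, rg] at this; exact this

end PairGen

open LieAlgebra

section PairCases
variable {L : Type*} [LieRing L] [LieAlgebra ℂ L]

theorem Loop.shift_cent {D : ℕ} {e f h : ℤ → L} {c : L} (p : Loop D e f h c) {Y : L} {s : ℂ} {d : ℤ}
    (h1 : ∀ n, ⁅Y, e n⁆ = s • e (n+d)) (h2 : ∀ n, ⁅Y, f n⁆ = -(s • f (n+d))) (k : ℤ) (v : L) :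
    ⁅⁅h k, Y⁆, v⁆ = 0 := by
  rw [← lie_skew (h k) Y, p.hdef k, leibniz_lie, h1, h2, smul_lie, lie_neg, lie_smul, p.ef, p.ef]
  simp only [add_zero, zero_add]
  split_ifs <;> simp [p.cc, add_lie]

namespace PairBase
variable {D m : ℕ} {e f h e' f' h' : ℤ → L} {c c' : L}

theorem half_left (p : PairBase D m e f h c e' f' h' c') {r : ℕ} {s s' w : ℂ}
    (a1 : ∀ n, ⁅h 1, e' n⁆ = s • e' (n+1)) (a2 : ∀ n, ⁅h 1, f' n⁆ = -(s • f' (n+1)))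
    (b1 : ∀ n, ⁅h (-1), e' n⁆ = s' • e' (n-1)) (b2 : ∀ n, ⁅h (-1), f' n⁆ = -(s' • f' (n-1)))
    (w0 : w ≠ 0) (th : ⁅e r, e' 0⁆ = w • ⁅e 0, e' 1⁆) (fe : ⁅f' 0, e r⁆ = 0) :
    Half r s (-w⁻¹) w e f h e' f' h' := by
  have key := p.l1.shiftY (Y := h' 1) r (-w⁻¹) (p.hh0' 1)
    (p.l2.shift_cent a1 a2 1) (p.l2.shift_cent (d := -1) b1 b2 1) (by
      rw [p.he'_eq (by rw [← lie_skew, p.x1, neg_zero]), ← inv_smul_smul₀ w0 ⁅e 0, e' 1⁆, ← th,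
        lie_smul, p.he'_zero fe, smul_neg, neg_smul])
  exact ⟨a1, a2, key.1, key.2, th⟩

theorem half_right (p : PairBase D m e f h c e' f' h' c') {t t' w : ℂ}
    (a1 : ∀ n, ⁅h' 1, e n⁆ = t • e (n+1)) (a2 : ∀ n, ⁅h' 1, f n⁆ = -(t • f (n+1)))
    (b1 : ∀ n, ⁅h' (-1), e n⁆ = t' • e (n-1)) (b2 : ∀ n, ⁅h' (-1), f n⁆ = -(t' • f (n-1)))
    (th : ⁅e 1, e' 0⁆ = w • ⁅e 0, e' 1⁆) :
    Half 1 (-(w*m)) t w e f h e' f' h' := by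
  have key := p.l2.shiftY (Y := h 1) 1 (-(w*m)) (p.hh0 1)
    (p.l1.shift_cent a1 a2 1) (p.l1.shift_cent (d := -1) b1 b2 1) (by
      rw [p.he_eq p.x2, th, lie_smul, p.he_zero p.x3]; module)
  exact ⟨key.1, key.2, a1, a2, th⟩

end PairBase

/-- Case A: `r = 1`, `c = 1`. -/
structure PairA (m : ℕ) (w : ℂ) (e f h : ℤ → L) (c : L) (e' f' h' : ℤ → L) (c' : L) : Prop
    extends PairBase 2 m e f h c e' f' h' c' where
  y1 : ⁅e 1, f' 0⁆ = 0
  y2 : ⁅e 1, f' (-1)⁆ = 0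
  y3 : ⁅f (-1), e' 0⁆ = 0
  y4 : ⁅f (-1), e' 1⁆ = 0
  w0 : w ≠ 0
  th : ⁅e 1, e' 0⁆ = w • ⁅e 0, e' 1⁆
  th' : ⁅f (-1), f' 0⁆ = w⁻¹ • ⁅f 0, f' (-1)⁆

namespace PairA
variable {m : ℕ} {w : ℂ} {e f h e' f' h' : ℤ → L} {c c' : L}

theorem sigma (p : PairA m w e f h c e' f' h' c') :
    PairA m w⁻¹ (fun n => f (-n)) (fun n => e (-n)) (fun n => -h (-n)) (-c)
      (fun n => f' (-n)) (fun n => e' (-n)) (fun n => -h' (-n)) (-c') where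
  toPairBase := p.toPairBase.sigma
  y1 := by simpa using p.y3
  y2 := by simpa using p.y4
  y3 := by simpa using p.y1
  y4 := by simpa using p.y2
  w0 := inv_ne_zero p.w0
  th := by simpa using p.th'
  th' := by simpa using p.th

theorem a12 (p : PairA m w e f h c e' f' h' c') :
    (∀ n, ⁅h 1, e' n⁆ = (-(w*m)) • e' (n+1)) ∧ (∀ n, ⁅h 1, f' n⁆ = -((-(w*m)) • f' (n+1))) := by
  have e0 : ⁅h 1, e' 0⁆ = (-(w*m)) • e' 1 := by
    rw [p.he_eq p.x2, p.th, lie_smul, p.he_zero p.x3]; module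
  have f0 : ⁅h 1, f' (-1)⁆ = (w*m) • f' 0 := by
    have h3 : ⁅f 0, f' (-1)⁆ = w • ⁅f (-1), f' 0⁆ := by rw [p.th', smul_inv_smul₀ p.w0]
    rw [p.l1.hdef, lie_lie, p.y2, h3, lie_smul, leibniz_lie, p.y1, p.l1.ef]
    simp [add_lie, p.l1.cc, p.w2, mul_smul]
  have key := p.l2.cent (h 1 - (-(w*m)/2) • h' 1)
    (by rw [sub_lie, smul_lie, p.l2.he, e0, dd_one, add_zero]; push_cast; module)
    (by rw [sub_lie, smul_lie, p.l2.hf, f0, dd_one]; norm_num; module)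
    (by rw [sub_lie, smul_lie, p.l2.hh0, p.hh0]; simp)
  constructor
  · intro n
    have := (key n).1
    rw [sub_lie, sub_eq_zero, smul_lie, p.l2.he, dd_one] at this
    rw [this, add_comm 1 n]; push_cast; module
  · intro n
    have := (key n).2
    rw [sub_lie, sub_eq_zero, smul_lie, p.l2.hf, dd_one] at this
    rw [this, add_comm 1 n]; push_cast; module

theorem half (p : PairA m w e f h c e' f' h' c') :
    Half 1 (-(w*m)) (-w⁻¹) w e f h e' f' h' := by
  have q := p.sigma.a12
  refine p.half_left (r := 1) (s' := -(w⁻¹*m)) p.a12.1 p.a12.2 (fun n => ?_) (fun n => ?_) p.w0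
    (by simpa using p.th) (by rw [← lie_skew]; simp only [Nat.cast_one]; rw [p.y1, neg_zero])
  · have := q.2 (-n); simp only [neg_neg, neg_lie, neg_inj] at this
    rw [this]; congr 2; ring
  · have := q.1 (-n); simp only [neg_neg, neg_lie] at this
    rw [← neg_eq_iff_eq_neg, this]; congr 2; ring

theorem concl (p : PairA m w e f h c e' f' h' c') (hm : m ≤ 3) : PairConcl e f h e' f' h' := by
  have key : ∀ x : ℂ, x ≠ 0 → 2 * ((2:ℕ):ℂ) ≠ -(x * m) * (-x⁻¹) := by
    intro x hx h
    have h2 : -(x * m) * (-x⁻¹) = m := by field_simp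
    rw [h2] at h; norm_cast at h; omega
  exact pair_concl p.toPairBase p.half p.sigma.half
    (Or.inr ⟨rfl, key _ p.w0, key _ p.sigma.w0⟩) p.w0 p.sigma.w0 (Or.inl rfl)

end PairA

/-- Case B: `r = 1`, `c = 2`. -/
structure PairB (w : ℂ) (Z Z' HZ : L) (e f h : ℤ → L) (c : L) (e' f' h' : ℤ → L) (c' : L) : Prop
    extends PairBase 6 2 e f h c e' f' h' c' where
  w0 : w ≠ 0
  sz : SLTwo Z Z' HZ
  hz : ∀ v : L, ⁅HZ, v⁆ = (2:ℂ)⁻¹ • ⁅h 0, v⁆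
  e1 : e 1 = ⁅f 0, Z⁆
  f1 : f (-1) = ⁅Z', e 0⁆
  z1 : ⁅e 0, e 1⁆ = (4:ℂ) • Z
  z2 : ⁅f 0, f (-1)⁆ = -((4:ℂ) • Z')
  y1 : ⁅Z, f' 0⁆ = 0
  y2 : ⁅Z, f' (-1)⁆ = 0
  y3 : ⁅Z', e' 0⁆ = 0
  y4 : ⁅Z', e' 1⁆ = 0
  s6 : (2:ℂ) • ⁅Z, e' 0⁆ = w • ⁅e 0, ⁅e 0, e' 1⁆⁆
  s7 : (-2:ℂ) • ⁅Z', f' 0⁆ = w⁻¹ • ⁅f 0, ⁅f 0, f' (-1)⁆⁆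
  s5 : ⁅e 0, ⁅e 0, ⁅e 0, e' 1⁆⁆⁆ = 0
  s5' : ⁅f 0, ⁅f 0, ⁅f 0, f' (-1)⁆⁆⁆ = 0

namespace PairB
variable {w : ℂ} {Z Z' HZ : L} {e f h e' f' h' : ℤ → L} {c c' : L}

theorem sigma (p : PairB w Z Z' HZ e f h c e' f' h' c') :
    PairB w⁻¹ (-Z') (-Z) (-HZ) (fun n => f (-n)) (fun n => e (-n)) (fun n => -h (-n)) (-c)
      (fun n => f' (-n)) (fun n => e' (-n)) (fun n => -h' (-n)) (-c') where
  toPairBase := p.toPairBase.sigma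
  w0 := inv_ne_zero p.w0
  sz := by
    have := p.sz.swap
    refine ⟨by rw [lie_neg, neg_lie, neg_neg]; exact this.ef, by rw [lie_neg, this.he, smul_neg],
      by rw [lie_neg, this.hf, smul_neg], ?_, ?_⟩
    · intro v; obtain ⟨n, hn⟩ := this.ne v
      refine ⟨n, ?_⟩; rw [map_neg, neg_pow, Module.End.mul_apply, hn, map_zero]
    · intro v; obtain ⟨n, hn⟩ := this.nf v
      refine ⟨n, ?_⟩; rw [map_neg, neg_pow, Module.End.mul_apply, hn, map_zero]
  hz v := by rw [neg_lie, p.hz, neg_zero, neg_lie, smul_neg]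
  e1 := by rw [p.f1, neg_zero, lie_neg, lie_skew]
  f1 := by rw [neg_neg, p.e1, neg_zero, neg_lie, lie_skew]
  z1 := by rw [neg_zero, p.z2, smul_neg]
  z2 := by rw [neg_zero, neg_neg, p.z1, smul_neg, neg_neg]
  y1 := by rw [neg_lie]; simp only [neg_zero, neg_neg]; rw [p.y3, neg_zero]
  y2 := by rw [neg_lie]; simp only [neg_zero, neg_neg]; rw [p.y4, neg_zero]
  y3 := by rw [neg_lie]; simp only [neg_zero, neg_neg]; rw [p.y1, neg_zero]
  y4 := by rw [neg_lie]; rw [p.y2, neg_zero]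
  s6 := by have := p.s7; simp only [neg_zero]; rw [← this, neg_lie]; module
  s7 := by have := p.s6; simp only [neg_zero, neg_neg, inv_inv]; rw [← this, neg_lie]; module
  s5 := by simpa using p.s5'
  s5' := by simpa using p.s5

theorem th (p : PairB w Z Z' HZ e f h c e' f' h' c') : ⁅e 1, e' 0⁆ = w • ⁅e 0, e' 1⁆ := by
  have h1 : ⁅f 0, (2:ℂ) • ⁅Z, e' 0⁆⁆ = (2:ℂ) • ⁅e 1, e' 0⁆ := by
    rw [lie_smul, leibniz_lie, p.x2, ← p.e1, lie_zero, add_zero]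
  have fe : ⁅f 0, e 0⁆ = -h 0 := by rw [← lie_skew, ← p.l1.hdef]
  have h2 : ⁅f 0, ⁅e 0, ⁅e 0, e' 1⁆⁆⁆ = (2:ℂ) • ⁅e 0, e' 1⁆ := by
    rw [leibniz_lie, p.he_zero p.x3, fe, neg_lie, leibniz_lie, p.w1, p.l1.he, lie_neg,
      lie_smul, dd_zero, smul_lie, zero_add]; push_cast; module
  rw [p.s6, lie_smul, h2] at h1
  have h3 := congrArg (fun x => (2:ℂ)⁻¹ • x) h1
  simp only [smul_smul] at h3
  rw [inv_mul_cancel₀ (by norm_num), one_smul] at h3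
  rw [← h3]; congr 1; ring

theorem fe1 (p : PairB w Z Z' HZ e f h c e' f' h' c') : ⁅f' 0, e 1⁆ = 0 := by
  have sk : ∀ x y : L, ⁅x, y⁆ = -⁅y, x⁆ := fun x y => (lie_skew x y).symm
  have h1 : ⁅Z, ⁅f' 0, f 0⁆⁆ = 0 := by
    refine p.sz.zero_f ?_ ?_
    · rw [p.hz, leibniz_lie, p.w2, p.l1.hf, dd_zero, lie_neg, lie_smul, smul_lie, zero_add]
      push_cast; module
    · have h3 : ⁅Z', f' 0⁆ = (-2:ℂ)⁻¹ • w⁻¹ • ⁅f 0, ⁅f 0, f' (-1)⁆⁆ := by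
        rw [← p.s7, inv_smul_smul₀ (by norm_num)]
      have h4 : ⁅Z', f 0⁆ = 0 := by
        refine (smul_eq_zero.1 ?_).resolve_left (show (4:ℂ) ≠ 0 by norm_num)
        have h6 := p.l1.fff 0 0 (-1)
        rw [p.z2, lie_neg, lie_smul, neg_eq_zero] at h6
        rw [sk, smul_neg, h6, neg_zero]
      rw [leibniz_lie, h4, lie_zero, add_zero, h3, smul_lie, smul_lie, sk, p.s5']; simp
  rw [p.e1, leibniz_lie, sk (f' 0) Z, p.y1, sk, h1]; simp

theorem a34 (p : PairB w Z Z' HZ e f h c e' f' h' c') :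
    (∀ n, ⁅h' 1, e n⁆ = (-w⁻¹) • e (n+1)) ∧ (∀ n, ⁅h' 1, f n⁆ = -((-w⁻¹) • f (n+1))) := by
  have sk : ∀ x y : L, ⁅x, y⁆ = -⁅y, x⁆ := fun x y => (lie_skew x y).symm
  have e0 : ⁅h' 1, e 0⁆ = (-w⁻¹) • e 1 := by
    rw [p.he'_eq (by rw [← lie_skew, p.x1, neg_zero]), ← inv_smul_smul₀ p.w0 ⁅e 0, e' 1⁆, ← p.th,
        lie_smul, p.he'_zero p.fe1, smul_neg, neg_smul]
  have hZ : ⁅h' 1, Z'⁆ = 0 := by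
    have h3 : ⁅Z', f' 0⁆ = (-2:ℂ)⁻¹ • w⁻¹ • ⁅f 0, ⁅f 0, f' (-1)⁆⁆ := by
      rw [← p.s7, inv_smul_smul₀ (by norm_num)]
    have x3' : ⁅e' 1, f 0⁆ = 0 := by rw [sk, p.x3, neg_zero]
    have h5 : ⁅e' 1, ⁅f 0, ⁅f 0, f' (-1)⁆⁆⁆ = 0 := by
      rw [leibniz_lie (e' 1), x3', leibniz_lie (e' 1), x3', p.l2.ef]
      simp only [zero_lie, zero_add]
      norm_num
      rw [p.l2.cc', sk (f 0) (h' 0), p.w4]; simp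
    rw [p.l2.hdef, lie_lie, sk (e' 1) Z', p.y4, sk (f' 0) Z', h3]
    simp [h5]
  set Y := h' 1 - (-w⁻¹/6) • h 1 with hY
  have y0 : ⁅Y, e 0⁆ = 0 := by
    rw [hY, sub_lie, smul_lie, p.l1.he, e0, dd_one, add_zero]; push_cast; module
  have yh : ⁅Y, h 0⁆ = 0 := by rw [hY, sub_lie, smul_lie, p.l1.hh0, p.hh0']; simp
  have yf : ⁅Y, f 0⁆ = 0 := by
    rw [sk, p.l1.s0.zero_e (by rw [sk, yh, neg_zero]) (by rw [sk, y0, neg_zero]), neg_zero]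
  have h1Z : ⁅h 1, Z'⁆ = 0 := by
    refine lie_smul_cancel (D := -4) (by norm_num) ?_
    rw [neg_smul, ← p.z2, leibniz_lie, p.l1.hf, p.l1.hf, neg_lie, smul_lie, lie_neg, lie_smul,
      p.l1.ff _ _ (Or.inr (by decide)), p.l1.ff _ _ (Or.inr (by decide))]; simp
  have yZ : ⁅Y, Z'⁆ = 0 := by rw [hY, sub_lie, smul_lie, h1Z, hZ]; simp
  have key := p.l1.cent Y y0 (by rw [p.f1]; exact lie_lie_zero yZ y0) yh
  constructor
  · intro n
    have := (key n).1
    rw [hY, sub_lie, sub_eq_zero, smul_lie, p.l1.he, dd_one] at this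
    rw [this, add_comm 1 n]; push_cast; module
  · intro n
    have := (key n).2
    rw [hY, sub_lie, sub_eq_zero, smul_lie, p.l1.hf, dd_one] at this
    rw [this, add_comm 1 n]; push_cast; module

theorem half (p : PairB w Z Z' HZ e f h c e' f' h' c') :
    Half 1 (-(w*(2:ℕ))) (-w⁻¹) w e f h e' f' h' := by
  have q := p.sigma.a34
  refine p.half_right (t' := -(w⁻¹)⁻¹) p.a34.1 p.a34.2 (fun n => ?_) (fun n => ?_) p.th
  · have := q.2 (-n); simp only [neg_neg, neg_lie, neg_inj] at this
    rw [this]; congr 2; ring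
  · have := q.1 (-n); simp only [neg_neg, neg_lie] at this
    rw [← neg_eq_iff_eq_neg, this]; congr 2; ring

theorem concl (p : PairB w Z Z' HZ e f h c e' f' h' c') : PairConcl e f h e' f' h' := by
  have key : ∀ x : ℂ, x ≠ 0 → 2 * ((6:ℕ):ℂ) ≠ -(x * (2:ℕ)) * (-x⁻¹) := by
    intro x hx h
    have h2 : -(x * (2:ℕ)) * (-x⁻¹) = (2:ℕ) := by field_simp
    rw [h2] at h; norm_num at h
  exact pair_concl p.toPairBase p.half p.sigma.half
    (Or.inr ⟨rfl, key _ p.w0, key _ p.sigma.w0⟩) p.w0 p.sigma.w0 (Or.inl rfl)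

end PairB

end PairCases

open LieAlgebra

section PairCaseC
variable {L : Type*} [LieRing L] [LieAlgebra ℂ L]

/-- Case C: `r = m > 1`. -/
structure PairC (m : ℕ) (w : ℂ) (e f h : ℤ → L) (c : L) (e' f' h' : ℤ → L) (c' : L) : Prop
    extends PairBase 2 m e f h c e' f' h' c' where
  hm : m = 2 ∨ m = 3
  w0 : w ≠ 0
  s6 : (ad ℂ L (e 1) ^ m) (e' 0) = w • (ad ℂ L (e 0) ^ m) (e' 1)
  s7 : (ad ℂ L (f (-1)) ^ m) (f' 0) = w⁻¹ • (ad ℂ L (f 0) ^ m) (f' (-1))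
  s8 : ∀ i, 1 ≤ i → i ≤ m - 1 → (ad ℂ L (e 0) ^ i) ((ad ℂ L (e 1) ^ (m-i)) (e' 0)) = 0
  s9 : ∀ i, 1 ≤ i → i ≤ m - 1 → (ad ℂ L (f 0) ^ i) ((ad ℂ L (f (-1)) ^ (m-i)) (f' 0)) = 0
  q5 : (ad ℂ L (e 1) ^ (m+1)) (e' 0) = 0
  q5' : (ad ℂ L (f (-1)) ^ (m+1)) (f' 0) = 0

namespace PairC
variable {m : ℕ} {w : ℂ} {e f h e' f' h' : ℤ → L} {c c' : L}

theorem sigma (p : PairC m w e f h c e' f' h' c') :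
    PairC m w⁻¹ (fun n => f (-n)) (fun n => e (-n)) (fun n => -h (-n)) (-c)
      (fun n => f' (-n)) (fun n => e' (-n)) (fun n => -h' (-n)) (-c') where
  toPairBase := p.toPairBase.sigma
  hm := p.hm
  w0 := inv_ne_zero p.w0
  s6 := by simp only [neg_zero]; exact p.s7
  s7 := by simp only [neg_zero, neg_neg, inv_inv]; exact p.s6
  s8 := by simp only [neg_zero]; exact p.s9
  s9 := by simp only [neg_zero, neg_neg]; exact p.s8
  q5 := by simp only [neg_zero]; exact p.q5'
  q5' := by simp only [neg_zero, neg_neg]; exact p.q5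

theorem ecomm (p : PairC m w e f h c e' f' h' c') (i j : ℤ) (v : L) :
    ⁅e i, ⁅e j, v⁆⁆ = ⁅e j, ⁅e i, v⁆⁆ := by
  rw [leibniz_lie, p.l1.ee _ _ (Or.inl rfl), zero_lie, zero_add]

theorem ecomm_pow (p : PairC m w e f h c e' f' h' c') (i j : ℤ) (n : ℕ) (v : L) :
    (ad ℂ L (e i) ^ n) ⁅e j, v⁆ = ⁅e j, (ad ℂ L (e i) ^ n) v⁆ := by
  induction n with
  | zero => rfl
  | succ n ih => rw [pow_succ', Module.End.mul_apply, ih, Module.End.mul_apply, ad_apply, ad_apply,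
      p.ecomm]

theorem C1 (p : PairC m w e f h c e' f' h' c') {u : L} (n : ℤ) (hu : ⁅h 0, u⁆ = -((m:ℂ) • u))
    (fu : ⁅f 0, u⁆ = 0) (eu : (ad ℂ L (e 0) ^ (m-1)) ⁅e n, u⁆ = 0) : ⁅h n, u⁆ = 0 := by
  obtain ⟨k, rfl⟩ : ∃ k, m = k + 2 := ⟨m - 2, by rcases p.hm with rfl | rfl <;> rfl⟩
  have fe : ⁅f 0, ⁅e n, u⁆⁆ = -⁅h n, u⁆ := by rw [p.l1.hdef n, lie_lie, fu, lie_zero, zero_sub, neg_neg]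
  have h1 : ⁅h 0, ⁅e n, u⁆⁆ = (-(k:ℂ)) • ⁅e n, u⁆ := by
    rw [leibniz_lie, hu, p.l1.he, dd_zero, zero_add, smul_lie, lie_neg, lie_smul]
    push_cast; module
  have h2 := p.l1.s0.f_pow h1 k
  rw [show k + 2 - 1 = k + 1 by omega] at eu
  rw [eu, lie_zero, fe] at h2
  have h3 : (ad ℂ L (e 0) ^ (k+1)) ⁅h n, u⁆ = 0 := by
    rw [neg_add_cancel, mul_zero, zero_smul, sub_zero, map_neg] at h2
    exact neg_eq_zero.1 h2.symm
  refine p.l1.s0.inj (k+2) ?_ (by rw [pow_succ', Module.End.mul_apply, h3, map_zero])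
  rw [leibniz_lie, hu, ← lie_skew (h 0) (h n), p.l1.hh0, lie_neg, lie_smul, neg_zero, zero_lie, zero_add, neg_smul]

theorem C2 (p : PairC m w e f h c e' f' h' c') {v : L} (fv : ⁅f 0, v⁆ = 0) (hv : ⁅h 1, v⁆ = 0)
    (n : ℕ) : ⁅h 1, (ad ℂ L (e 1) ^ (n+1)) v⁆ = (2*(n+1):ℂ) • (ad ℂ L (e 1) ^ n) ⁅e 2, v⁆ ∧
      ⁅f 0, (ad ℂ L (e 1) ^ (n+2)) v⁆ = (-((n+2)*(n+1)):ℂ) • (ad ℂ L (e 1) ^ n) ⁅e 2, v⁆ := by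
  have he : ⁅h 1, e 1⁆ = (2:ℂ) • e 2 := by rw [p.l1.he, dd_one]; norm_num
  have fe : ⁅f 0, e 1⁆ = -h 1 := by rw [← lie_skew, ← p.l1.hdef]
  have H : ∀ n : ℕ,
      ⁅h 1, (ad ℂ L (e 1) ^ (n+1)) v⁆ = (2*(n+1):ℂ) • (ad ℂ L (e 1) ^ n) ⁅e 2, v⁆ := by
    intro n
    induction n with
    | zero => simp [leibniz_lie (h 1), hv, he]
    | succ n ih =>
      rw [pow_succ', Module.End.mul_apply, ad_apply, leibniz_lie, ih, he, smul_lie, ← p.ecomm_pow,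
        lie_smul, ← ad_apply (R := ℂ) (L := L) (e 1), ← Module.End.mul_apply, ← pow_succ']
      push_cast; module
  refine ⟨H n, ?_⟩
  induction n with
  | zero =>
    have h1 : ⁅f 0, ⁅e 1, v⁆⁆ = 0 := by rw [leibniz_lie, fe, neg_lie, hv, fv]; simp
    rw [pow_succ', Module.End.mul_apply, ad_apply, leibniz_lie, fe, neg_lie, H, pow_succ',
      Module.End.mul_apply, pow_zero, ad_apply, Module.End.one_apply v, h1]
    simp
  | succ n ih =>
    rw [pow_succ', Module.End.mul_apply, ad_apply, leibniz_lie, ih, fe, neg_lie, H,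
      lie_smul, ← ad_apply (R := ℂ) (L := L) (e 1), ← Module.End.mul_apply, ← pow_succ']
    push_cast; module

theorem h1v (p : PairC m w e f h c e' f' h' c') : ⁅h 1, e' 0⁆ = 0 := by
  refine p.C1 1 (p.w1 0) p.x2 ?_
  have := p.s8 (m-1) (by rcases p.hm with rfl | rfl <;> simp) le_rfl
  rwa [show m - (m-1) = 1 by rcases p.hm with rfl | rfl <;> rfl, pow_one] at this

theorem key6 (p : PairC m w e f h c e' f' h' c') :
    (-((m:ℂ)*(m-1))) • (ad ℂ L (e 1) ^ (m-2)) ⁅e 2, e' 0⁆ =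
      (w * m) • (ad ℂ L (e 0) ^ (m-1)) (e' 1) := by
  have h0 := p.s6
  have h1 := p.C2 p.x2 p.h1v (m-2)
  have h2 := p.l1.s0.f_pow (v := e' 1) (z := -m) (by rw [p.w1, neg_smul]) (m-1)
  obtain ⟨k, rfl⟩ : ∃ k, m = k + 2 := ⟨m - 2, by rcases p.hm with rfl | rfl <;> rfl⟩
  simp only [show k + 2 - 2 = k by omega, show k + 2 - 1 = k + 1 by omega] at *
  have h3 := congrArg (fun x => ⁅f 0, x⁆) h0
  simp only [lie_smul] at h3
  rw [h1.2, h2, p.x3, map_zero] at h3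
  convert h3 using 1
  · push_cast; module
  · push_cast; module

theorem h1v1 (p : PairC m w e f h c e' f' h' c') : ⁅h 1, e' 1⁆ = 0 := by
  refine p.C1 1 (p.w1 1) p.x3 ?_
  have h0 := p.key6
  have h1 := (p.C2 p.x2 p.h1v (m-1)).2
  rw [p.ecomm_pow]
  obtain ⟨k, rfl⟩ : ∃ k, m = k + 2 := ⟨m - 2, by rcases p.hm with rfl | rfl <;> rfl⟩
  have q := p.q5
  simp only [show k + 2 - 2 = k by omega, show k + 2 - 1 = k + 1 by omega] at *
  rw [show k + 1 + 2 = k + 2 + 1 by omega, q, lie_zero] at h1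
  have h2 : (ad ℂ L (e 1) ^ (k+1)) ⁅e 2, e' 0⁆ = 0 := by
    refine (smul_eq_zero.1 h1.symm).resolve_left ?_
    refine neg_ne_zero.2 ?_; norm_cast
  have h3 := congrArg (fun x => ⁅e 1, x⁆) h0
  simp only [lie_smul] at h3
  rw [← ad_apply (R := ℂ) (L := L) (e 1), ← Module.End.mul_apply, ← pow_succ', h2, smul_zero] at h3
  refine (smul_eq_zero.1 h3.symm).resolve_left (mul_ne_zero p.w0 ?_)
  norm_cast

theorem h1cent (p : PairC m w e f h c e' f' h' c') (n : ℤ) : ⁅h 1, e' n⁆ = 0 ∧ ⁅h 1, f' n⁆ = 0 := by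
  refine p.l2.cent' (h 1) ?_ p.h1v1 (p.hh0 1) n
  rw [← lie_skew, p.l2.s0.zero_e (by rw [← lie_skew, p.hh0, neg_zero])
    (by rw [← lie_skew, p.h1v, neg_zero]), neg_zero]

theorem th (p : PairC m w e f h c e' f' h' c') :
    ∃ w' : ℂ, w' ≠ 0 ∧ ⁅e m, e' 0⁆ = w' • ⁅e 0, e' 1⁆ := by
  have h0 := p.key6
  rcases p.hm with rfl | rfl
  · refine ⟨-w, neg_ne_zero.2 p.w0, ?_⟩
    simp at h0
    have := congrArg (fun x => (-2:ℂ)⁻¹ • x) h0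
    simp only [smul_smul] at this
    norm_num at this
    rw [smul_smul] at this
    norm_num at this
    push_cast
    rw [this]; module
  · refine ⟨w, p.w0, ?_⟩
    have s1 := p.s8 1 (by norm_num) (by norm_num)
    have s2 := p.s8 2 (by norm_num) (by norm_num)
    simp only [pow_succ, pow_zero, one_mul, Module.End.mul_apply, ad_apply,
      show 3 - 1 = 2 by rfl, show 3 - 2 = 1 by rfl] at s1 s2 h0
    have he : ∀ n, ⁅h 1, e n⁆ = (2:ℂ) • e (1+n) := by intro n; rw [p.l1.he, dd_one]; norm_num
    have s3 : ⁅e 0, ⁅e 0, ⁅e 2, e' 0⁆⁆⁆ = 0 := by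
      have h3 := congrArg (fun x => ⁅h 1, x⁆) s2
      simp only [leibniz_lie (h 1), he, p.h1v, smul_lie, lie_smul, lie_zero, lie_add] at h3
      norm_num at h3
      rw [p.ecomm 1 0, s1] at h3
      simpa using h3
    have h2v : ⁅h 2, e' 0⁆ = 0 := p.C1 2 (p.w1 0) p.x2 (by
      simpa only [show 3 - 1 = 2 by rfl, pow_succ, pow_zero, one_mul, Module.End.mul_apply, ad_apply] using s3)
    have fe : ∀ n, ⁅f 0, e n⁆ = -h n := fun n => by rw [← lie_skew, ← p.l1.hdef]
    have h4 := congrArg (fun x => ⁅f 0, x⁆) h0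
    simp only [lie_smul] at h4
    have h5 : ⁅f 0, ⁅e 1, ⁅e 2, e' 0⁆⁆⁆ = (-2:ℂ) • ⁅e 3, e' 0⁆ := by
      rw [leibniz_lie, leibniz_lie (f 0), fe, fe, neg_lie, neg_lie, p.x2, h2v, leibniz_lie (h 1),
        p.h1v, he, smul_lie]; norm_num
    have h6 : ⁅f 0, ⁅e 0, ⁅e 0, e' 1⁆⁆⁆ = (4:ℂ) • ⁅e 0, e' 1⁆ := by
      rw [leibniz_lie, p.he_zero p.x3, fe, neg_lie, leibniz_lie (h 0), p.w1, p.l1.he, lie_neg,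
        lie_smul, dd_zero, smul_lie, zero_add]; push_cast; module
    rw [h5, h6] at h4
    have := congrArg (fun x => (12:ℂ)⁻¹ • x) h4
    simp only [smul_smul] at this
    push_cast at this ⊢
    rw [show (12:ℂ)⁻¹ * (-(3 * (3-1)) * -2) = 1 by norm_num, one_smul] at this
    rw [this]; congr 1; ring

theorem fe (p : PairC m w e f h c e' f' h' c') (n : ℕ) : ⁅f' 0, e n⁆ = 0 := by
  induction n with
  | zero => rw [← lie_skew]; simp only [Nat.cast_zero]; rw [p.x1, neg_zero]
  | succ n ih =>
    have h1 := congrArg (fun x => ⁅h 1, x⁆) ih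
    simp only [leibniz_lie (h 1), (p.h1cent 0).2, zero_lie, zero_add, p.l1.he, lie_smul, dd_one,
      lie_zero] at h1
    have h2 := (smul_eq_zero.1 h1).resolve_left (by norm_num)
    rw [← h2, add_comm]; push_cast; rfl

theorem half (p : PairC m w e f h c e' f' h' c') :
    ∃ w' : ℂ, w' ≠ 0 ∧ Half m 0 (-w'⁻¹) w' e f h e' f' h' := by
  obtain ⟨w', w0, th⟩ := p.th
  have q := p.sigma.h1cent
  refine ⟨w', w0, p.half_left (r := m) (s' := 0) (fun n => ?_) (fun n => ?_) (fun n => ?_)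
    (fun n => ?_) w0 th (p.fe m)⟩
  · rw [(p.h1cent n).1, zero_smul]
  · rw [(p.h1cent n).2, zero_smul, neg_zero]
  · have := (q (-n)).2; simp only [neg_neg, neg_lie, neg_eq_zero] at this
    rw [this, zero_smul]
  · have := (q (-n)).1; simp only [neg_neg, neg_lie, neg_eq_zero] at this
    rw [this, zero_smul, neg_zero]

theorem concl (p : PairC m w e f h c e' f' h' c') : PairConcl e f h e' f' h' := by
  obtain ⟨w1, w10, h1⟩ := p.half
  obtain ⟨w2, w20, h2⟩ := p.sigma.half
  exact pair_concl p.toPairBase h1 h2 (Or.inl ⟨rfl, rfl⟩) w10 w20 (Or.inr p.hm)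

end PairC
end PairCaseC

open LieAlgebra

section Unlinked
variable {L : Type*} [LieRing L] [LieAlgebra ℂ L]

theorem PairConcl.symm {e f h e' f' h' : ℤ → L} (p : PairConcl e f h e' f' h') :
    PairConcl e' f' h' e f h where
  ef i j := by rw [← lie_skew, p.fe, neg_zero]
  fe i j := by rw [← lie_skew, p.ef, neg_zero]
  he := p.he'
  hf := p.hf'
  he' := p.he
  hf' := p.hf

theorem pairU_concl {D D' : ℕ} {e f h e' f' h' : ℤ → L} {c c' : L}
    (l1 : Loop D e f h c) (l2 : Loop D' e' f' h' c')
    (hyp : ∀ x ∈ ({e 0, f (-1), h 0} : Set L), ∀ y ∈ ({e' 0, f' (-1), h' 0} : Set L), ⁅y, x⁆ = 0) :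
    PairConcl e f h e' f' h' := by
  have sk : ∀ {x y : L}, ⁅x, y⁆ = 0 → ⁅y, x⁆ = 0 := fun h => by rw [← lie_skew, h, neg_zero]
  have s1 : ∀ y ∈ ({e' 0, f' (-1), h' 0} : Set L), ∀ n, ⁅y, e n⁆ = 0 ∧ ⁅y, f n⁆ = 0 :=
    fun y hy n => l1.cent y (hyp _ (by simp) y hy) (hyp _ (by simp) y hy) (hyp _ (by simp) y hy) n
  have s2 : ∀ m n, ⁅e m, e' n⁆ = 0 ∧ ⁅e m, f' n⁆ = 0 := fun m n =>
    l2.cent (e m) (sk (s1 _ (by simp) m).1) (sk (s1 _ (by simp) m).1) (sk (s1 _ (by simp) m).1) n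
  have s3 : ∀ m n, ⁅f m, e' n⁆ = 0 ∧ ⁅f m, f' n⁆ = 0 := fun m n =>
    l2.cent (f m) (sk (s1 _ (by simp) m).2) (sk (s1 _ (by simp) m).2) (sk (s1 _ (by simp) m).2) n
  refine ⟨fun i j => (s2 i j).2, fun i j => (s3 i j).1, fun i j => ?_, fun i j => ?_, fun i j => ?_,
    fun i j => ?_⟩
  · rw [l1.hdef, lie_lie, (s3 _ _).1, (s2 _ _).1]; simp
  · rw [l1.hdef, lie_lie, (s3 _ _).2, (s2 _ _).2]; simp
  · rw [l2.hdef, lie_lie, sk (s2 _ _).1, sk (s2 _ _).2]; simp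
  · rw [l2.hdef, lie_lie, sk (s3 _ _).1, sk (s3 _ _).2]; simp

end Unlinked

section Words
variable {L : Type*} [LieRing L] [LieAlgebra ℂ L] {X : Type*}

/-- right-normed words -/
def wd (e : X → L) : X → List X → L
  | i, [] => e i
  | i, j :: w => ⁅e i, wd e j w⁆

def wdSpan (e : X → L) : Submodule ℂ L := Submodule.span ℂ (Set.range fun p : X × List X => wd e p.1 p.2)

theorem wd_mem (e : X → L) (i : X) (w : List X) : wd e i w ∈ wdSpan e :=
  Submodule.subset_span ⟨(i, w), rfl⟩

theorem span_le_wdSpan (e : X → L) : Submodule.span ℂ (Set.range e) ≤ wdSpan e := by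
  rw [Submodule.span_le]; rintro _ ⟨i, rfl⟩; exact wd_mem e i []

theorem wd_e_mem (e : X → L) (i : X) {v : L} (hv : v ∈ wdSpan e) : ⁅e i, v⁆ ∈ wdSpan e := by
  induction hv using Submodule.span_induction with
  | mem x hx => obtain ⟨⟨j, w⟩, rfl⟩ := hx; exact wd_mem e i (j :: w)
  | zero => simp
  | add x y _ _ h1 h2 => rw [lie_add]; exact add_mem h1 h2
  | smul c x _ h1 => rw [lie_smul]; exact Submodule.smul_mem _ _ h1

theorem span_e_mem (e : X → L) {u v : L} (hu : u ∈ Submodule.span ℂ (Set.range e))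
    (hv : v ∈ wdSpan e) : ⁅u, v⁆ ∈ wdSpan e := by
  induction hu using Submodule.span_induction with
  | mem x hx => obtain ⟨j, rfl⟩ := hx; exact wd_e_mem e j hv
  | zero => simp
  | add x y _ _ h1 h2 => rw [add_lie]; exact add_mem h1 h2
  | smul c x _ h1 => rw [smul_lie]; exact Submodule.smul_mem _ _ h1

theorem wd_h_mem (e : X → L) (H : Submodule ℂ L)
    (hH : ∀ h ∈ H, ∀ i, ⁅h, e i⁆ ∈ Submodule.span ℂ (Set.range e)) {h v : L} (hh : h ∈ H)
    (hv : v ∈ wdSpan e) : ⁅h, v⁆ ∈ wdSpan e := by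
  induction hv using Submodule.span_induction with
  | mem x hx =>
    obtain ⟨⟨j, w⟩, rfl⟩ := hx
    dsimp only
    induction w generalizing j with
    | nil => exact span_le_wdSpan e (hH h hh j)
    | cons k w ih =>
      rw [wd, leibniz_lie]
      exact add_mem (span_e_mem e (hH h hh j) (wd_mem e k w)) (wd_e_mem e j (ih k))
  | zero => simp
  | add x y _ _ h1 h2 => rw [lie_add]; exact add_mem h1 h2
  | smul c x _ h1 => rw [lie_smul]; exact Submodule.smul_mem _ _ h1

theorem wd_f_mem (e : X → L) (H : Submodule ℂ L)
    (hH : ∀ h ∈ H, ∀ i, ⁅h, e i⁆ ∈ Submodule.span ℂ (Set.range e)) {f : L}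
    (hf : ∀ i, ⁅f, e i⁆ ∈ H) {v : L}
    (hv : v ∈ wdSpan e) : ⁅f, v⁆ ∈ wdSpan e ⊔ H := by
  induction hv using Submodule.span_induction with
  | mem x hx =>
    obtain ⟨⟨j, w⟩, rfl⟩ := hx
    dsimp only
    induction w generalizing j with
    | nil => exact (le_sup_right : H ≤ _) (hf j)
    | cons k w ih =>
      rw [wd, leibniz_lie]
      refine add_mem ((le_sup_left : wdSpan e ≤ _) (wd_h_mem e H hH (hf j) (wd_mem e k w))) ?_
      obtain ⟨y, hy, z, hz, hyz⟩ := Submodule.mem_sup.1 (ih k)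
      rw [← hyz, lie_add, ← lie_skew (e j) z]
      refine (le_sup_left : wdSpan e ≤ _) (add_mem (wd_e_mem e j hy) (neg_mem ?_))
      exact span_le_wdSpan e (hH z hz j)
  | zero => simp
  | add x y _ _ h1 h2 => rw [lie_add]; exact add_mem h1 h2
  | smul c x _ h1 => rw [lie_smul]; exact Submodule.smul_mem _ _ h1

/-- triangular decomposition (spanning) -/
theorem triangular (e f : X → L) (H : Submodule ℂ L) (G : Set L)
    (hG : LieSubalgebra.lieSpan ℂ L G = ⊤)
    (hGs : ∀ x ∈ G, x ∈ (Submodule.span ℂ (Set.range e) ⊔ H ⊔ Submodule.span ℂ (Set.range f)) ∨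
      (∃ y z, (y ∈ Set.range e ∧ z ∈ Set.range e ∨ y ∈ Set.range f ∧ z ∈ Set.range f) ∧
        ∃ s : ℂ, x = s • ⁅y, z⁆))
    (hef : ∀ i j, ⁅e i, f j⁆ ∈ H)
    (he : ∀ h ∈ H, ∀ i, ⁅h, e i⁆ ∈ Submodule.span ℂ (Set.range e))
    (hf : ∀ h ∈ H, ∀ i, ⁅h, f i⁆ ∈ Submodule.span ℂ (Set.range f))
    (hh : ∀ h ∈ H, ∀ h' ∈ H, ⁅h, h'⁆ ∈ H) : wdSpan e ⊔ H ⊔ wdSpan f = ⊤ := by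
  set M := wdSpan e ⊔ H ⊔ wdSpan f with hM
  have me : wdSpan e ≤ M := le_sup_left.trans le_sup_left
  have mh : H ≤ M := le_sup_right.trans le_sup_left
  have mf : wdSpan f ≤ M := le_sup_right
  have decomp : ∀ (u : L), (∀ v ∈ wdSpan e, ⁅u, v⁆ ∈ M) → (∀ v ∈ H, ⁅u, v⁆ ∈ M) →
      (∀ v ∈ wdSpan f, ⁅u, v⁆ ∈ M) → ∀ v ∈ M, ⁅u, v⁆ ∈ M := by
    intro u h1 h2 h3 v hv
    obtain ⟨y, hy, z, hz, rfl⟩ := Submodule.mem_sup.1 hv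
    obtain ⟨y1, hy1, y2, hy2, rfl⟩ := Submodule.mem_sup.1 hy
    rw [lie_add, lie_add]
    exact add_mem (add_mem (h1 _ hy1) (h2 _ hy2)) (h3 _ hz)
  have hfe : ∀ i j, ⁅f j, e i⁆ ∈ H := fun i j => by rw [← lie_skew]; exact neg_mem (hef i j)
  have Me : ∀ i, ∀ v ∈ M, ⁅e i, v⁆ ∈ M := fun i => decomp _ (fun v hv => me (wd_e_mem e i hv))
    (fun v hv => by
      rw [← lie_skew]; exact neg_mem (me (span_le_wdSpan e (he v hv i))))
    (fun v hv => by
      have := wd_f_mem f H hf (hef i) hv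
      exact (sup_le mf mh : wdSpan f ⊔ H ≤ M) this)
  have Mf : ∀ i, ∀ v ∈ M, ⁅f i, v⁆ ∈ M := fun i => decomp _ (fun v hv => by
      have := wd_f_mem e H he (fun j => hfe j i) hv
      exact (sup_le me mh : wdSpan e ⊔ H ≤ M) this)
    (fun v hv => by
      rw [← lie_skew]; exact neg_mem (mf (span_le_wdSpan f (hf v hv i))))
    (fun v hv => mf (wd_e_mem f i hv))
  have Mh : ∀ h ∈ H, ∀ v ∈ M, ⁅h, v⁆ ∈ M := fun h hh' => decomp _
    (fun v hv => me (wd_h_mem e H he hh' hv)) (fun v hv => mh (hh h hh' v hv))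
    (fun v hv => mf (wd_h_mem f H hf hh' hv))
  let S : LieSubalgebra ℂ L :=
    { carrier := {u | ∀ v ∈ M, ⁅u, v⁆ ∈ M}
      add_mem' := fun {x y} hx hy v hv => by rw [add_lie]; exact add_mem (hx v hv) (hy v hv)
      zero_mem' := fun v _ => by simp
      smul_mem' := fun c x hx v hv => by rw [smul_lie]; exact M.smul_mem c (hx v hv)
      lie_mem' := fun {x y} hx hy v hv => by
        rw [lie_lie]; exact sub_mem (hx _ (hy v hv)) (hy _ (hx v hv)) }
  have Se : Submodule.span ℂ (Set.range e) ≤ S.toSubmodule := by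
    rw [Submodule.span_le]; rintro _ ⟨i, rfl⟩; exact Me i
  have Sf : Submodule.span ℂ (Set.range f) ≤ S.toSubmodule := by
    rw [Submodule.span_le]; rintro _ ⟨i, rfl⟩; exact Mf i
  have Sh : H ≤ S.toSubmodule := fun h hh' => Mh h hh'
  have GS : G ⊆ S := by
    intro x hx
    rcases hGs x hx with h | ⟨y, z, hyz, s, rfl⟩
    · exact (sup_le (sup_le Se Sh) Sf) h
    · refine S.smul_mem s ?_
      rcases hyz with ⟨⟨i, rfl⟩, ⟨j, rfl⟩⟩ | ⟨⟨i, rfl⟩, ⟨j, rfl⟩⟩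
      · exact S.lie_mem (Me i) (Me j)
      · exact S.lie_mem (Mf i) (Mf j)
  have GM : G ⊆ M := by
    intro x hx
    rcases hGs x hx with h | ⟨y, z, hyz, s, rfl⟩
    · exact (sup_le (sup_le ((span_le_wdSpan e).trans me) mh) ((span_le_wdSpan f).trans mf)) h
    · refine M.smul_mem s ?_
      rcases hyz with ⟨⟨i, rfl⟩, ⟨j, rfl⟩⟩ | ⟨⟨i, rfl⟩, ⟨j, rfl⟩⟩
      · exact me (wd_mem e i [j])
      · exact mf (wd_mem f i [j])
  have St : ∀ u : L, u ∈ S := by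
    have : LieSubalgebra.lieSpan ℂ L G ≤ S := LieSubalgebra.lieSpan_le.2 GS
    rw [hG] at this
    exact fun u => this (LieSubalgebra.mem_top u)
  let K : LieSubalgebra ℂ L := { M with lie_mem' := fun {x y} _ hy => St x y hy }
  have : LieSubalgebra.lieSpan ℂ L G ≤ K := LieSubalgebra.lieSpan_le.2 GM
  rw [hG] at this
  exact eq_top_iff.2 fun u _ => this (LieSubalgebra.mem_top u)

end Words

/-- homogeneous spanning families span the components -/
theorem gr_eq_span {L V T : Type*} [AddCommGroup L] [Module ℂ L] [DecidableEq V]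
    {gr : V → Submodule ℂ L} (hg : DirectSum.IsInternal gr) (t : T → L) (deg : T → V)
    (ht : ∀ x, t x ∈ gr (deg x)) (hs : Submodule.span ℂ (Set.range t) = ⊤) (σ : V) :
    gr σ = Submodule.span ℂ (t '' {x | deg x = σ}) := by
  set S : V → Submodule ℂ L := fun σ => Submodule.span ℂ (t '' {x | deg x = σ}) with hS
  have le : ∀ σ, S σ ≤ gr σ := by
    intro σ; rw [hS, Submodule.span_le]; rintro _ ⟨x, hx, rfl⟩; rw [← hx.out]; exact ht x
  refine le_antisymm ?_ (le σ)
  have ind := hg.submodule_iSupIndep σ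
  have top : (⊤ : Submodule ℂ L) ≤ S σ ⊔ ⨆ (τ) (_ : τ ≠ σ), gr τ := by
    rw [← hs, Submodule.span_le]
    rintro _ ⟨x, rfl⟩
    by_cases h : deg x = σ
    · exact (le_sup_left : S σ ≤ _) (Submodule.subset_span ⟨x, h, rfl⟩)
    · refine (le_sup_right : (⨆ (τ) (_ : τ ≠ σ), gr τ) ≤ _) ?_
      exact (le_iSup₂_of_le (deg x) h le_rfl : gr (deg x) ≤ _) (ht x)
  intro v hv
  obtain ⟨y, hy, z, hz, rfl⟩ := Submodule.mem_sup.1 (top (Submodule.mem_top (x := v)))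
  have hz' : z ∈ gr σ := by
    have := sub_mem hv (le σ hy); rwa [add_sub_cancel_left] at this
  have := (Submodule.disjoint_def.1 ind) z hz' hz
  rw [this, add_zero]; exact hy

open Set

section Roots

/-- the hypotheses on the root system -/
structure Setup {V : Type*} [AddCommGroup V] [Module ℝ V] (B : LinearMap.BilinForm ℝ V) (R : Set V)
    (l : ℕ) (P : Set V) (a : V) (k : V → ℕ) (g : V → Bool) : Prop where
  hl : 2 ≤ l
  hE : IsEARS B R l 2
  hred : IsReducedRS R
  hfs : IsFundamentalSet B R l P a
  hkg : IsKG R a P k g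

/-- linear combination of simple roots and `a` -/
noncomputable def lc {V : Type*} [AddCommGroup V] [Module ℝ V] {P : Set V} [Fintype P] (a : V) (n : P → ℝ)
    (r : ℝ) : V := ∑ i, n i • (i : V) + r • a

variable {V : Type*} [AddCommGroup V] [Module ℝ V] {B : LinearMap.BilinForm ℝ V} {R : Set V}
    {l : ℕ} {P : Set V} {a : V} {k : V → ℕ} {g : V → Bool}

theorem srefl_apply (v z : V) : srefl B v z = z - (2 * (B v v)⁻¹ * B v z) • v := by
  simp [srefl]

namespace Setup

theorem Ba (S : Setup B R l P a k g) (v : V) : B a v = 0 := by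
  have : a ∈ (LinearMap.ker B : Set V) := S.hE.null_eq ▸ S.hfs.2.1
  have h2 : B a = 0 := this
  rw [h2]; rfl

theorem Ba' (S : Setup B R l P a k g) (v : V) : B v a = 0 := by rw [S.hE.symm, S.Ba]

theorem a0 (S : Setup B R l P a k g) : a ≠ 0 := by
  rintro rfl
  obtain ⟨b, _, _, _, h⟩ := S.hfs.2.2.1
  have := (h 1 0 (by simp)).1
  omega

theorem PR (S : Setup B R l P a k g) {α : V} (h : α ∈ P) : α ∈ R := S.hfs.2.2.2.1 h

theorem pos (S : Setup B R l P a k g) {α : V} (h : α ∈ R) : 0 < B α α :=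
  lt_of_le_of_ne (S.hE.posSemidef α) (Ne.symm (S.hE.root_nonisotropic α h))

theorem posP (S : Setup B R l P a k g) (i : P) : 0 < B (i:V) i := S.pos (S.PR i.2)

theorem injP (S : Setup B R l P a k g) : InjOn (Submodule.span ℝ {a}).mkQ P := by
  obtain ⟨_, _, _, _, hf, hc, hb⟩ := S.hfs
  apply Set.injOn_of_ncard_image_eq _ hf
  rw [hb.2.2.1, hc]

theorem linInd (S : Setup B R l P a k g) :
    LinearIndependent ℝ (fun i : P => (Submodule.span ℝ {a}).mkQ (i : V)) := by
  obtain ⟨_, _, _, _, hf, hc, hb⟩ := S.hfs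
  exact (linearIndepOn_iff_image (R := ℝ) S.injP).2 hb.2.2.2.1

variable [Fintype P]

theorem lc_zero (S : Setup B R l P a k g) {n : P → ℝ} {r : ℝ} (h : lc a n r = 0) :
    n = 0 ∧ r = 0 := by
  have h1 := congrArg (Submodule.span ℝ {a}).mkQ h
  have ha : (Submodule.span ℝ {a}).mkQ a = 0 := by
    rw [Submodule.mkQ_apply, Submodule.Quotient.mk_eq_zero]; exact Submodule.mem_span_singleton_self a
  simp only [lc, map_add, map_sum, map_smul, ha, smul_zero, add_zero, map_zero] at h1
  have h2 := Fintype.linearIndependent_iff.1 S.linInd n h1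
  have h3 : n = 0 := funext h2
  refine ⟨h3, ?_⟩
  rw [h3] at h
  simpa [lc, S.a0] using h

theorem lc_inj (S : Setup B R l P a k g) {n n' : P → ℝ} {r r' : ℝ} (h : lc a n r = lc a n' r') :
    n = n' ∧ r = r' := by
  have : lc a (n - n') (r - r') = 0 := by
    have h2 := sub_eq_zero.2 h
    rw [← h2]; simp only [lc, Pi.sub_apply, sub_smul, Finset.sum_sub_distrib]; abel
  obtain ⟨h1, h2⟩ := S.lc_zero this
  exact ⟨sub_eq_zero.1 h1, sub_eq_zero.1 h2⟩

theorem lc_single [DecidableEq P] (i : P) (x r : ℝ) : lc a (Pi.single i x) r = x • (i:V) + r • a := by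
  simp [lc, Pi.single_apply]

theorem lc_add (n n' : P → ℝ) (r r' : ℝ) : lc a n r + lc a n' r' = lc a (n + n') (r + r') := by
  simp only [lc, Pi.add_apply, add_smul, Finset.sum_add_distrib]; abel

theorem lc_smul (c : ℝ) (n : P → ℝ) (r : ℝ) : c • lc a n r = lc a (c • n) (c * r) := by
  simp only [lc, Pi.smul_apply, smul_add, Finset.smul_sum, smul_smul, smul_eq_mul]

theorem B_lc (S : Setup B R l P a k g) (v : V) (n : P → ℝ) (r : ℝ) :
    B v (lc a n r) = ∑ i, n i * B v i := by
  simp [lc, S.Ba']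

theorem root_form (S : Setup B R l P a k g) {β : V} (h : β ∈ R) :
    ∃ ε : ℝ, (ε = 1 ∨ ε = -1) ∧ ∃ (n : P → ℕ) (r : ℝ), β = ε • lc a (fun i => (n i : ℝ)) r := by
  have hb := S.hfs.2.2.2.2.2.2.2.2.2.2
  have key : ∀ x ∈ nnspan ((Submodule.span ℝ {a}).mkQ '' P), ∃ n : P → ℕ,
      x = (Submodule.span ℝ {a}).mkQ (lc a (fun i => (n i : ℝ)) 0) := by
    classical
    intro x hx
    induction hx using AddSubmonoid.closure_induction with
    | mem x hx =>
      obtain ⟨y, hy, rfl⟩ := hx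
      refine ⟨Pi.single ⟨y, hy⟩ 1, ?_⟩
      congr 1
      have : (fun i => ((Pi.single ⟨y, hy⟩ 1 : P → ℕ) i : ℝ)) = Pi.single ⟨y, hy⟩ 1 := by
        ext i; by_cases h : i = ⟨y, hy⟩
        · subst h; simp
        · simp [h]
      rw [this, lc_single]; simp
    | zero => exact ⟨0, by simp [lc]⟩
    | add x y _ _ h1 h2 =>
      obtain ⟨n, rfl⟩ := h1
      obtain ⟨m, rfl⟩ := h2
      refine ⟨n + m, ?_⟩
      rw [← map_add, lc_add]; congr 2
      · ext i; simp
      · simp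
  have fin : ∀ (v w : V), (Submodule.span ℝ {a}).mkQ v = (Submodule.span ℝ {a}).mkQ w →
      ∃ r : ℝ, v = w + r • a := by
    intro v w h
    rw [← sub_eq_zero, ← map_sub, Submodule.mkQ_apply, Submodule.Quotient.mk_eq_zero,
      Submodule.mem_span_singleton] at h
    obtain ⟨r, hr⟩ := h
    exact ⟨r, by rw [hr]; abel⟩
  have h1 : (Submodule.span ℝ {a}).mkQ β ∈ (Submodule.span ℝ {a}).mkQ '' R := ⟨β, h, rfl⟩
  rw [hb] at h1
  rcases h1 with ⟨_, h1⟩ | ⟨_, h1⟩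
  · obtain ⟨n, hn⟩ := key _ h1
    obtain ⟨r, hr⟩ := fin _ _ hn
    refine ⟨1, Or.inl rfl, n, r, ?_⟩
    rw [hr]; simp [lc]
  · obtain ⟨n, hn⟩ := key _ h1
    rw [← map_neg] at hn
    obtain ⟨r, hr⟩ := fin _ _ hn
    refine ⟨-1, Or.inr rfl, n, r, ?_⟩
    rw [← neg_neg β, hr]; simp [lc]; abel

theorem refl_mem (S : Setup B R l P a k g) {α β : V} (hα : α ∈ R) (hβ : β ∈ R) :
    srefl B α β ∈ R := by
  have := S.hE.reflect α hα
  rw [← this]; exact ⟨β, hβ, rfl⟩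

theorem srefl_inv (S : Setup B R l P a k g) {α : V} (hα : α ∈ R) (v : V) :
    srefl B α (srefl B α v) = v := by
  have := (S.pos hα).ne'
  simp only [srefl_apply, map_sub, map_smul, smul_eq_mul]
  rw [mul_assoc 2 _ (B α α), inv_mul_cancel₀ this]
  module

theorem neg_mem (S : Setup B R l P a k g) {α : V} (hα : α ∈ R) : -α ∈ R := by
  have := S.refl_mem hα hα
  rw [srefl_apply] at this
  have h := (S.pos hα).ne'
  rw [mul_assoc, inv_mul_cancel₀ h, mul_one, two_smul] at this
  simpa using this

/-- Descent. -/
theorem descent (S : Setup B R l P a k g) (T Pr : V → Prop) (hT : ∀ σ, T σ → B σ σ ≠ 0)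
    (form : ∀ σ, T σ → ∃ ε : ℝ, (ε = 1 ∨ ε = -1) ∧ ∃ (n : P → ℕ) (r : ℝ),
      σ = ε • lc a (fun i => (n i : ℝ)) r)
    (stab : ∀ σ, T σ → ∀ i : P, T (srefl B i σ))
    (inv : ∀ σ, T σ → ∀ i : P, Pr (srefl B i σ) → Pr σ)
    (base : ∀ (i : P) (p r : ℝ), T (p • (i:V) + r • a) → Pr (p • (i:V) + r • a)) :
    ∀ σ, T σ → Pr σ := by
  classical
  suffices H : ∀ (N : ℕ) (ε : ℝ), (ε = 1 ∨ ε = -1) → ∀ (n : P → ℕ) (r : ℝ), ∑ i, n i = N →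
      T (ε • lc a (fun i => (n i : ℝ)) r) → Pr (ε • lc a (fun i => (n i : ℝ)) r) by
    intro σ hσ
    obtain ⟨ε, hε, n, r, rfl⟩ := form σ hσ
    exact H _ ε hε n r rfl hσ
  intro N
  induction N using Nat.strong_induction_on with
  | _ N ih =>
  intro ε hε n r hN hσ
  have ee : ε * ε = 1 := by rcases hε with rfl | rfl <;> norm_num
  set τ := lc a (fun i => (n i : ℝ)) r with hτ
  have hpos : 0 < B τ τ := by
    refine lt_of_le_of_ne (S.hE.posSemidef _) (fun h => hT _ hσ ?_)
    simp [← h]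
  have : ∃ i : P, 0 < (n i : ℝ) * B τ i := by
    by_contra! hc
    have h1 : B τ τ ≤ 0 := by
      conv_lhs => rw [hτ]
      rw [S.B_lc, ← hτ]; exact Finset.sum_nonpos fun i _ => hc i
    linarith
  obtain ⟨i, hi⟩ := this
  have hτi : 0 < B τ i := by
    by_contra! hc
    have := mul_nonpos_of_nonneg_of_nonpos (Nat.cast_nonneg (α := ℝ) (n i)) hc
    linarith
  have hni : n i ≠ 0 := by rintro h; simp [h] at hi
  by_cases hj : ∃ j, j ≠ i ∧ n j ≠ 0
  · obtain ⟨j, hji, hnj⟩ := hj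
    refine inv _ hσ i ?_
    have h1 := stab _ hσ i
    obtain ⟨ε', hε', n', r', h2⟩ := form _ h1
    set q := 2 * (B (i:V) i)⁻¹ * B i τ with hq
    have hq0 : 0 < q := by
      have := S.posP i
      rw [hq, S.hE.symm i τ]; positivity
    have h3 : srefl B i (ε • τ) = ε • lc a ((fun i => (n i : ℝ)) - Pi.single i q) r := by
      rw [srefl_apply, map_smul, smul_eq_mul]
      have : lc a ((fun i => (n i : ℝ)) - Pi.single i q) r = τ - q • (i:V) := by
        have h5 := lc_add (a := a) ((fun i => (n i : ℝ)) - Pi.single i q) (Pi.single i q) r 0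
        rw [sub_add_cancel, add_zero, lc_single, ← hτ] at h5
        rw [← h5]; simp
      rw [this, hq, smul_sub, smul_smul]; congr 2; ring
    have h4 := h3.symm.trans h2
    rw [lc_smul, lc_smul] at h4
    have h5 := (S.lc_inj h4).1
    have h6 : ε' = ε := by
      have := congrFun h5 j
      simp only [Pi.smul_apply, Pi.sub_apply, Pi.single_eq_of_ne hji, sub_zero, smul_eq_mul] at this
      have p1 : (0:ℝ) < n j := by exact_mod_cast Nat.pos_of_ne_zero hnj
      have p2 : (0:ℝ) ≤ n' j := Nat.cast_nonneg _
      rcases hε with rfl | rfl <;> rcases hε' with rfl | rfl <;> first | rfl | (exfalso; linarith)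
    subst h6
    have h7 : (fun i => (n i : ℝ)) - Pi.single i q = fun i => (n' i : ℝ) := by
      have h8 := congrArg (fun x => ε' • x) h5
      simpa [smul_smul, ee] using h8
    rw [h2]
    refine ih (∑ i, n' i) ?_ ε' hε' n' r' rfl (h2 ▸ h1)
    rw [← hN]
    refine Finset.sum_lt_sum (fun j _ => ?_) ⟨i, Finset.mem_univ _, ?_⟩
    · have := congrFun h7 j
      simp only [Pi.sub_apply] at this
      by_cases hj : j = i
      · subst hj; simp at this
        have : (n' j : ℝ) ≤ n j := by linarith
        exact_mod_cast this
      · rw [Pi.single_eq_of_ne hj, sub_zero] at this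
        exact le_of_eq (by exact_mod_cast this.symm)
    · have := congrFun h7 i
      simp at this
      have : (n' i : ℝ) < n i := by linarith
      exact_mod_cast this
  · push Not at hj
    have : ε • τ = (ε * n i) • (i:V) + (ε * r) • a := by
      have h1 : (fun i => (n i : ℝ)) = Pi.single i (n i : ℝ) := by
        ext j; by_cases h : j = i
        · subst h; simp
        · simp [h, hj j h]
      rw [hτ, h1, lc_single, smul_add, smul_smul, smul_smul]
    rw [this] at hσ ⊢
    exact base i _ _ hσ

end Setup
end Roots

open Set

section Roots
variable {V : Type*} [AddCommGroup V] [Module ℝ V] {B : LinearMap.BilinForm ℝ V} {R : Set V}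
    {l : ℕ} {P : Set V} {a : V} {k : V → ℕ} {g : V → Bool} 

namespace Setup

theorem two_lc (S : Setup B R l P a k g) {i j : P} (hij : i ≠ j) {x y r x' y' r' : ℝ}
    (h : x • (i:V) + y • (j:V) + r • a = x' • (i:V) + y' • (j:V) + r' • a) :
    x = x' ∧ y = y' ∧ r = r' := by
  classical
  haveI : Fintype P := S.hfs.2.2.2.2.1.fintype
  have key : ∀ x y r : ℝ, x • (i:V) + y • (j:V) + r • a =
      lc a (Pi.single i x + Pi.single j y) r := by
    intro x y r
    have := lc_add (a := a) (Pi.single i x) (Pi.single j y) r 0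
    rw [add_zero] at this
    rw [← this, lc_single, lc_single]; simp only [zero_smul]; abel
  rw [key, key] at h
  obtain ⟨h1, h2⟩ := S.lc_inj h
  have e1 := congrFun h1 i
  have e2 := congrFun h1 j
  simp [hij, hij.symm] at e1 e2
  exact ⟨e1, e2, h2⟩

theorem one_lc (S : Setup B R l P a k g) {i : P} {x r x' r' : ℝ}
    (h : x • (i:V) + r • a = x' • (i:V) + r' • a) : x = x' ∧ r = r' := by
  classical
  haveI : Fintype P := S.hfs.2.2.2.2.1.fintype
  rw [← lc_single, ← lc_single] at h
  obtain ⟨h1, h2⟩ := S.lc_inj h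
  have e1 := congrFun h1 i
  simp at e1
  exact ⟨e1, h2⟩

theorem k_pos (S : Setup B R l P a k g) (i : P) : 0 < k i := (S.hkg i i.2).1

theorem line_iff (S : Setup B R l P a k g) (i : P) (x r : ℝ) :
    x • (i:V) + r • a ∈ R ↔ x • (i:V) + r • a ∈ kgLine a (i:V) (k i) (g i) := by
  rw [← (S.hkg i i.2).2]
  refine ⟨fun h => ⟨h, ?_⟩, fun h => h.1⟩
  rw [SetLike.mem_coe, Submodule.mem_span_pair]
  exact ⟨x, r, rfl⟩

theorem line_one (S : Setup B R l P a k g) (i : P) (r : ℝ) :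
    (i:V) + r • a ∈ R ↔ ∃ m : ℤ, r = m * k i := by
  have := S.line_iff i 1 r
  rw [one_smul] at this
  rw [this]
  constructor
  · rintro (⟨ε, m, hε, h⟩ | ⟨_, ε, m, hε, _, h⟩)
    · refine ⟨m, ?_⟩
      have h1 : (1:ℝ) • (i:V) + r • a = (ε:ℝ) • (i:V) + ((m * k i : ℤ):ℝ) • a := by
        rw [one_smul, h, Int.cast_smul_eq_zsmul, Int.cast_smul_eq_zsmul]
      rw [(S.one_lc h1).2]; push_cast; rfl
    · exfalso
      have h1 : (1:ℝ) • (i:V) + r • a = ((2*ε:ℤ):ℝ) • (i:V) + ((m * k i : ℤ):ℝ) • a := by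
        rw [one_smul, h, Int.cast_smul_eq_zsmul, Int.cast_smul_eq_zsmul]
      have := (S.one_lc h1).1
      have : (1:ℤ) = 2 * ε := by exact_mod_cast this
      omega
  · rintro ⟨m, rfl⟩
    left
    refine ⟨1, m, Or.inl rfl, ?_⟩
    rw [one_smul, ← Int.cast_smul_eq_zsmul ℝ]; push_cast; rfl

theorem mem_one (S : Setup B R l P a k g) (i : P) (m : ℤ) : (i:V) + ((m:ℝ) * k i) • a ∈ R :=
  (S.line_one i _).2 ⟨m, rfl⟩

theorem mem_two (S : Setup B R l P a k g) (i : P) (hg : g i = true) :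
    (2:ℝ) • (i:V) + (k i : ℝ) • a ∈ R := by
  rw [S.line_iff]
  right
  refine ⟨hg, 1, 1, Or.inl rfl, by decide, ?_⟩
  rw [← Int.cast_smul_eq_zsmul ℝ, ← Int.cast_smul_eq_zsmul ℝ]; push_cast; simp

theorem cartan (S : Setup B R l P a k g) {i j : P} (hij : i ≠ j) :
    ∃ n : ℕ, 2 * B (i:V) j = -(n * B (i:V) i) := by
  classical
  haveI : Fintype P := S.hfs.2.2.2.2.1.fintype
  obtain ⟨m, hm⟩ := S.hE.integral i (S.PR i.2) j (S.PR j.2)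
  have h1 := S.refl_mem (S.PR i.2) (S.PR j.2)
  obtain ⟨ε, hε, n, r, h⟩ := S.root_form h1
  have hp := (S.posP i).ne'
  have h2 : srefl B (i:V) j = lc a (Pi.single j 1 + Pi.single i (-m:ℝ)) 0 := by
    have := lc_add (a := a) (Pi.single j (1:ℝ)) (Pi.single i (-m:ℝ)) 0 0
    rw [add_zero] at this
    rw [← this, lc_single, lc_single, srefl_apply]
    have : 2 * (B (i:V) i)⁻¹ * B (i:V) j = m := by field_simp; linarith
    rw [this]; module
  rw [h2, lc_smul] at h
  have h3 := (S.lc_inj h).1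
  have e1 := congrFun h3 i
  have e2 := congrFun h3 j
  simp [hij, hij.symm] at e1 e2
  have p1 : (0:ℝ) ≤ n i := Nat.cast_nonneg _
  have p2 : (0:ℝ) ≤ n j := Nat.cast_nonneg _
  rcases hε with rfl | rfl
  · refine ⟨n i, ?_⟩
    rw [hm]; rw [one_mul] at e1; rw [← e1]; ring
  · linarith

theorem B_nonpos (S : Setup B R l P a k g) {i j : P} (hij : i ≠ j) : B (i:V) j ≤ 0 := by
  obtain ⟨n, hn⟩ := S.cartan hij
  have := S.posP i
  have h2 : 0 ≤ (n:ℝ) * B (i:V) i := by positivity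
  linarith

/-- the simple roots are connected -/
theorem conn (S : Setup B R l P a k g) (Q : Set P) (h1 : Q.Nonempty) (h2 : Qᶜ.Nonempty) :
    ∃ i ∈ Q, ∃ j ∈ Qᶜ, B (i:V) j ≠ 0 := by
  classical
  haveI : Fintype P := S.hfs.2.2.2.2.1.fintype
  by_contra! hc
  let U : Set P → Submodule ℝ V := fun Q => Submodule.span ℝ (((↑) : P → V) '' Q) ⊔ Submodule.span ℝ {a}
  have aU : ∀ Q : Set P, a ∈ U Q := fun (Q : Set P) =>
    (le_sup_right : _ ≤ U Q) (Submodule.mem_span_singleton_self a)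
  have iU : ∀ (Q : Set P) (i : P), i ∈ Q → (i:V) ∈ U Q := fun (Q : Set P) (i : P) hi =>
    (le_sup_left : _ ≤ U Q) (Submodule.subset_span ⟨i, hi, rfl⟩)
  have ort1 : ∀ (Q : Set P) (v : V), (∀ i ∈ Q, B v i = 0) → ∀ w ∈ U Q, B v w = 0 := by
    intro Q v hv
    have : U Q ≤ LinearMap.ker (B v) := by
      refine sup_le (Submodule.span_le.2 ?_) (Submodule.span_le.2 ?_)
      · rintro _ ⟨i, hi, rfl⟩; exact hv i hi
      · rintro _ rfl; exact S.Ba' v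
    exact fun w hw => this hw
  have all : ∀ σ, σ ∈ R → σ ∈ U Q ∨ σ ∈ U Qᶜ := by
    refine S.descent (fun σ => σ ∈ R) (fun σ => σ ∈ U Q ∨ σ ∈ U Qᶜ) (fun σ h => (S.pos h).ne')
      (fun σ h => S.root_form h) (fun σ h i => S.refl_mem (S.PR i.2) h) ?_ ?_
    · intro σ hσ i h
      have hinv := S.srefl_inv (S.PR i.2) σ
      set τ := srefl B i σ
      rw [srefl_apply] at hinv
      by_cases hi : i ∈ Q
      · rcases h with h | h
        · left; rw [← hinv]; exact sub_mem h (Submodule.smul_mem _ _ (iU _ _ hi))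
        · right; rw [← hinv, ort1 Qᶜ (i:V) (fun j hj => hc i hi j hj) τ h]; simpa using h
      · rcases h with h | h
        · left; rw [← hinv, ort1 Q (i:V) (fun j hj => by rw [S.hE.symm]; exact hc j hj i hi) τ h]
          simpa using h
        · right; rw [← hinv]; exact sub_mem h (Submodule.smul_mem _ _ (iU _ _ hi))
    · intro i p r _
      by_cases hi : i ∈ Q
      · left; exact add_mem (Submodule.smul_mem _ _ (iU _ _ hi)) (Submodule.smul_mem _ _ (aU _))
      · right; exact add_mem (Submodule.smul_mem _ _ (iU _ _ hi)) (Submodule.smul_mem _ _ (aU _))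
  have ort : ∀ x ∈ U Q, ∀ y ∈ U Qᶜ, B x y = 0 := by
    intro x hx y hy
    refine ort1 Qᶜ x (fun j hj => ?_) y hy
    rw [S.hE.symm]
    exact ort1 Q j (fun i hi => by rw [S.hE.symm]; exact hc i hi j hj) x hx
  obtain ⟨i, hi⟩ := h1
  obtain ⟨j, hj⟩ := h2
  obtain ⟨x, hx, y, hy, hxy⟩ := S.hE.connected (R ∩ U Q) inter_subset_left
    ⟨i, S.PR i.2, iU _ _ hi⟩ (fun h => by
      have : (j:V) ∈ R ∩ U Q := h.ge (S.PR j.2)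
      exact (S.posP j).ne' (ort _ this.2 _ (iU _ _ hj)))
  rcases all y hy.1 with h | h
  · exact hy.2 ⟨hy.1, h⟩
  · exact hxy (ort _ hx.2 _ h)

/-- data of linked pairs -/
theorem linked (S : Setup B R l P a k g) {i j : P} (hij : i ≠ j) (h : B (i:V) j ≠ 0) :
    (∃ m : ℕ, (m = 1 ∨ m = 2 ∨ m = 3) ∧ 2 * B (i:V) j = -(B (j:V) j) ∧
      2 * B (i:V) j = -(m * B (i:V) i)) ∨
    (∃ m : ℕ, (m = 1 ∨ m = 2 ∨ m = 3) ∧ 2 * B (j:V) i = -(B (i:V) i) ∧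
      2 * B (j:V) i = -(m * B (j:V) j)) := by
  haveI : Fintype P := S.hfs.2.2.2.2.1.fintype
  obtain ⟨n, hn⟩ := S.cartan hij
  obtain ⟨m, hm⟩ := S.cartan hij.symm
  have sy := S.hE.symm j i
  have pi := S.posP i
  have pj := S.posP j
  set x := B (i:V) i with hx
  set y := B (j:V) j with hy
  set b := B (i:V) j with hb
  rw [sy] at hm
  have n0 : n ≠ 0 := by rintro rfl; apply h; simpa using hn
  have m0 : m ≠ 0 := by rintro rfl; apply h; simpa using hm
  have e4 : 4 * b * b = (n*m:ℕ) * (x * y) := by push_cast; linear_combination (2*b) * hn - n * x * hm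
  have psd : 0 ≤ B (y • (i:V) - b • (j:V)) (y • (i:V) - b • (j:V)) := S.hE.posSemidef _
  have ex : B (y • (i:V) - b • (j:V)) (y • (i:V) - b • (j:V)) = y * (x * y - b * b) := by
    simp only [map_sub, map_smul, LinearMap.sub_apply, LinearMap.smul_apply, smul_eq_mul, ← hx, ← hy,
      ← hb, sy]; ring
  have lt4 : n * m < 4 := by
    by_contra! hc
    have hc' : (4:ℝ) ≤ (n*m:ℕ) := by exact_mod_cast hc
    have xy : 0 < x * y := mul_pos pi pj
    have h1 : x * y ≤ b * b := by nlinarith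
    have h0 : B (y • (i:V) - b • (j:V)) (y • (i:V) - b • (j:V)) = 0 := by
      apply le_antisymm _ psd
      rw [ex]; nlinarith
    have hk : (y • (i:V) - b • (j:V)) ∈ (LinearMap.ker B : Set V) := S.hE.null_eq ▸ h0
    have hk' : B (y • (i:V) - b • (j:V)) = 0 := hk
    have hz : ∀ v, y * B (i:V) v = b * B (j:V) v := by
      intro v
      have := congrArg (fun f => f v) hk'
      simpa [sub_eq_zero] using this
    have bneg : b < 0 := lt_of_le_of_ne (S.B_nonpos hij) h
    have hcompl : ({i, j} : Set P)ᶜ.Nonempty := by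
      by_contra hne
      rw [Set.not_nonempty_iff_eq_empty, Set.compl_empty_iff] at hne
      have h5 : P.ncard ≤ 2 := by
        rw [← Nat.card_coe_set_eq, ← Set.ncard_univ, ← hne]
        rw [Set.ncard_pair hij]
      have h6 := S.hfs.2.2.2.2.2.1
      have h7 := S.hl
      omega
    obtain ⟨p, hp, q, hq, hpq⟩ := S.conn {i, j} ⟨i, by simp⟩ hcompl
    simp only [mem_compl_iff, mem_insert_iff, mem_singleton_iff, not_or] at hq hp
    have z := hz q
    have b1 := S.B_nonpos (i := i) (j := q) (Ne.symm hq.1)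
    have b2 := S.B_nonpos (i := j) (j := q) (Ne.symm hq.2)
    have z1 : B (i:V) q = 0 := by nlinarith
    have z2 : B (j:V) q = 0 := by nlinarith
    rcases hp with rfl | rfl
    · exact hpq z1
    · exact hpq z2
  have cases : (m = 1 ∧ (n = 1 ∨ n = 2 ∨ n = 3)) ∨ (n = 1 ∧ (m = 1 ∨ m = 2 ∨ m = 3)) := by
    have : n < 4 := by nlinarith [Nat.pos_of_ne_zero m0]
    have : m < 4 := by nlinarith [Nat.pos_of_ne_zero n0]
    interval_cases n <;> interval_cases m <;> simp_all
  rcases cases with ⟨rfl, hc⟩ | ⟨rfl, hc⟩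
  · left; exact ⟨n, hc, by simpa using hm, hn⟩
  · right
    refine ⟨m, hc, ?_, by rw [sy]; exact hm⟩
    rw [sy]; simpa using hn

theorem srefl_shift (S : Setup B R l P a k g) (u z : V) (r q : ℝ) (h : 2 * B u z = q * B u u)
    (hu : B u u ≠ 0) : srefl B (u + r • a) z = z - q • (u + r • a) := by
  rw [srefl_apply]
  congr 2
  simp only [map_add, map_smul, LinearMap.add_apply, LinearMap.smul_apply, S.Ba, S.Ba', smul_eq_mul,
    mul_zero, add_zero]
  field_simp; linarith

theorem k_data (S : Setup B R l P a k g) {i j : P} (hij : i ≠ j) {m : ℕ}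
    (hm : m = 1 ∨ m = 2 ∨ m = 3)
    (h1 : 2 * B (i:V) j = -(B (j:V) j)) (h2 : 2 * B (i:V) j = -(m * B (i:V) i)) :
    (k j = k i ∨ k j = m * k i) ∧ g j = false ∧ (g i = true → m = 2 ∧ k j = k i) := by
  haveI : Fintype P := S.hfs.2.2.2.2.1.fintype
  have pi := S.posP i
  have pj := S.posP j
  have sy := S.hE.symm j i
  have ki := S.k_pos i
  have kj := S.k_pos j
  have d1 : k i ∣ k j := by
    have r1 := S.refl_mem (S.mem_one j 1) (S.PR i.2)
    rw [S.srefl_shift _ _ _ (-1) (by rw [sy]; linarith) pj.ne'] at r1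
    have r2 := S.refl_mem (S.mem_one j 0) r1
    rw [S.srefl_shift (j:V) _ _ 1 (by simp [S.Ba', sy]; linarith) pj.ne'] at r2
    have e : (i:V) - (-1:ℝ) • ((j:V) + (((1:ℤ):ℝ) * (k j:ℝ)) • a) - (1:ℝ) • ((j:V) + (((0:ℤ):ℝ) * (k j:ℝ)) • a) =
      (i:V) + (k j:ℝ) • a := by push_cast; module
    rw [e, S.line_one] at r2
    obtain ⟨z, hz⟩ := r2
    have : (k j : ℤ) = z * k i := by exact_mod_cast hz
    exact_mod_cast Dvd.intro_left z this.symm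
  have d2 : k j ∣ m * k i := by
    have r1 := S.refl_mem (S.mem_one i 1) (S.PR j.2)
    rw [S.srefl_shift _ _ _ (-m) (by linarith) pi.ne'] at r1
    have r2 := S.refl_mem (S.mem_one i 0) r1
    rw [S.srefl_shift (i:V) _ _ m (by simp [S.Ba']; linarith) pi.ne'] at r2
    have e : (j:V) - (-m:ℝ) • ((i:V) + (((1:ℤ):ℝ) * (k i:ℝ)) • a) - (m:ℝ) • ((i:V) + (((0:ℤ):ℝ) * (k i:ℝ)) • a) =
      (j:V) + (m * k i:ℝ) • a := by push_cast; module
    rw [e, S.line_one] at r2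
    obtain ⟨z, hz⟩ := r2
    have : ((m * k i : ℕ) : ℤ) = z * k j := by exact_mod_cast hz
    exact_mod_cast Dvd.intro_left z this.symm
  refine ⟨?_, ?_, ?_⟩
  · obtain ⟨r, hr⟩ := d1
    rw [hr, mul_comm m] at d2
    have := Nat.dvd_of_mul_dvd_mul_left ki d2
    rcases hm with rfl | rfl | rfl
    · left; rw [hr, Nat.dvd_one.1 this, mul_one]
    · rcases (Nat.dvd_prime Nat.prime_two).1 this with rfl | rfl
      · left; rw [hr, mul_one]
      · right; rw [hr, mul_comm]
    · rcases (Nat.dvd_prime Nat.prime_three).1 this with rfl | rfl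
      · left; rw [hr, mul_one]
      · right; rw [hr, mul_comm]
  · by_contra hg
    obtain ⟨z, hz⟩ := S.hE.integral _ (S.mem_two j (by simpa using hg)) _ (S.PR i.2)
    simp [S.Ba, S.Ba', sy] at hz
    have : (-1:ℝ) = 2 * z := by
      apply mul_right_cancel₀ pj.ne'; linarith
    have : (-1:ℤ) = 2 * z := by exact_mod_cast this
    omega
  · intro hg
    have hR := S.mem_two i hg
    obtain ⟨z, hz⟩ := S.hE.integral _ hR _ (S.PR j.2)
    simp [S.Ba, S.Ba'] at hz
    have : -(m:ℝ) = 2 * z := by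
      apply mul_right_cancel₀ pi.ne'; linarith
    have : -(m:ℤ) = 2 * z := by exact_mod_cast this
    have m2 : m = 2 := by omega
    subst m2
    refine ⟨rfl, ?_⟩
    have r1 := S.refl_mem hR (S.PR j.2)
    rw [S.srefl_shift _ _ _ (-1) (by simp; push_cast at h2; linarith) (by simp [pi.ne'])] at r1
    have r2 := S.refl_mem (S.mem_one i 0) r1
    rw [S.srefl_shift (i:V) _ _ 2 (by simp [S.Ba']; push_cast at h2; linarith) pi.ne'] at r2
    have e : (j:V) - (-1:ℝ) • ((2:ℝ) • (i:V) + (k i:ℝ) • a) - (2:ℝ) • ((i:V) + (((0:ℤ):ℝ) * (k i:ℝ)) • a) =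
      (j:V) + (k i:ℝ) • a := by push_cast; module
    rw [e, S.line_one] at r2
    obtain ⟨z, hz⟩ := r2
    have : (k i : ℤ) = z * k j := by exact_mod_cast hz
    have d3 : k j ∣ k i := by exact_mod_cast Dvd.intro_left z this.symm
    exact Nat.dvd_antisymm d3 d1

end Setup
end Roots

open Set LieAlgebra TensorProduct

/-- A Lie algebra with elements satisfying (SR1)-(SR9). -/
structure Ell {V : Type*} [AddCommGroup V] [Module ℝ V] {L : Type*} [LieRing L] [LieAlgebra ℂ L]
    (B : LinearMap.BilinForm ℝ V) (a : V) (P : Set V) (k : V → ℕ) (g : V → Bool)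
    (ω : V → V → ℂ) (hb : Vc V → L) (eb : V → L) : Prop where
  s1 : ∀ (x y : ℂ) (σ τ : Vc V), x • hb σ + y • hb τ = hb (x • σ + y • τ)
  s2 : ∀ σ τ : Vc V, ⁅hb σ, hb τ⁆ = 0
  s3 : ∀ σ : Vc V, ∀ μ ∈ bfull a P k g, ⁅hb σ, eb μ⁆ =
    (LinearMap.BilinForm.baseChange ℂ B σ ((1 : ℂ) ⊗ₜ[ℝ] μ)) • eb μ
  s4 : ∀ μ ∈ bplus a P k g, ⁅eb μ, eb (-μ)⁆ = hb ((1 : ℂ) ⊗ₜ[ℝ] vee B μ)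
  s5 : ∀ μ ∈ bfull a P k g, ∀ ν ∈ bfull a P k g, μ ≠ ν → ν ≠ -μ →
    (ad ℂ L (eb μ) ^ xExp B μ ν) (eb ν) = 0
  s6 : ∀ α ∈ P, ∀ β ∈ P, 2 * B α β = -(B β β) →
    (cMap g α : ℂ) • (ad ℂ L (eb (starMap a k g α)) ^ (k β / k α)) (eb β) =
      ω α β • (ad ℂ L (eb α) ^ (cMap g α * (k β / k α))) (eb (starMap a k g β))
  s7 : ∀ α ∈ P, ∀ β ∈ P, 2 * B α β = -(B β β) →
    ((-1 : ℂ) ^ (cMap g α + 1) * (cMap g α : ℂ)) •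
        (ad ℂ L (eb (-(starMap a k g α))) ^ (k β / k α)) (eb (-β)) =
      (ω α β)⁻¹ • (ad ℂ L (eb (-α)) ^ (cMap g α * (k β / k α))) (eb (-(starMap a k g β)))
  s8 : ∀ α ∈ P, ∀ β ∈ P, 2 * B α β = -(B β β) → ∀ i : ℕ, 1 ≤ i → i ≤ k β / k α - 1 →
    (ad ℂ L (eb α) ^ i) ((ad ℂ L (eb (starMap a k g α)) ^ (k β / k α - i)) (eb β)) = 0
  s9 : ∀ α ∈ P, ∀ β ∈ P, 2 * B α β = -(B β β) → ∀ i : ℕ, 1 ≤ i → i ≤ k β / k α - 1 →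
    (ad ℂ L (eb (-α)) ^ i) ((ad ℂ L (eb (-(starMap a k g α))) ^ (k β / k α - i)) (eb (-β))) = 0

section EllAlg
variable {V : Type*} [AddCommGroup V] [Module ℝ V] {B : LinearMap.BilinForm ℝ V}
    {P : Set V} {a : V} {k : V → ℕ} {g : V → Bool} {ω : V → V → ℂ}

theorem mk_ad_pow (x y : FreeLieAlgebra ℂ (EllGen a P k g)) (n : ℕ) :
    (LieSubmodule.Quotient.mk (N := ellIdeal B a P k g ω) ((ad ℂ _ x ^ n) y) : EllipticLieAlg B a P k g ω) =
    (ad ℂ (EllipticLieAlg B a P k g ω) (LieSubmodule.Quotient.mk x) ^ n) (LieSubmodule.Quotient.mk y) := by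
  induction n with
  | zero => simp
  | succ n ih =>
    rw [pow_succ', pow_succ', Module.End.mul_apply, Module.End.mul_apply, ad_apply, ad_apply, ← ih]
    exact LieSubmodule.Quotient.mk_bracket (R := ℂ) (I := ellIdeal B a P k g ω) _ _

theorem ell_rel {z : FreeLieAlgebra ℂ (EllGen a P k g)} (hz : z ∈ ellRels B a P k g ω) :
    (LieSubmodule.Quotient.mk z : EllipticLieAlg B a P k g ω) = 0 := by
  rw [LieSubmodule.Quotient.mk_eq_zero']
  exact LieSubmodule.subset_lieSpan hz

theorem ell_ell : Ell B a P k g ω (hbar B a P k g ω) (ebar B a P k g ω) where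
  s1 x y σ τ := by
    have := ell_rel (B := B) (ω := ω) (z := x • hFree a P k g σ + y • hFree a P k g τ - hFree a P k g (x • σ + y • τ))
      (by iterate 8 left
          exact ⟨x, y, σ, τ, rfl⟩)
    exact sub_eq_zero.1 this
  s2 σ τ := ell_rel (B := B) (ω := ω) (z := ⁅hFree a P k g σ, hFree a P k g τ⁆)
      (by iterate 7 left
          right; exact ⟨σ, τ, rfl⟩)
  s3 σ μ hμ := by
    have := ell_rel (B := B) (ω := ω) (z := ⁅hFree a P k g σ, eFree a P k g μ⁆
      - (LinearMap.BilinForm.baseChange ℂ B σ ((1 : ℂ) ⊗ₜ[ℝ] μ)) • eFree a P k g μ)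
      (by iterate 6 left
          right; exact ⟨σ, μ, hμ, rfl⟩)
    exact sub_eq_zero.1 this
  s4 μ hμ := by
    have := ell_rel (B := B) (ω := ω) (z := ⁅eFree a P k g μ, eFree a P k g (-μ)⁆
      - hFree a P k g ((1 : ℂ) ⊗ₜ[ℝ] vee B μ))
      (by iterate 5 left
          right; exact ⟨μ, hμ, rfl⟩)
    exact sub_eq_zero.1 this
  s5 μ hμ ν hν h1 h2 := by
    rw [ebar, ebar, ← mk_ad_pow]
    exact ell_rel (by iterate 4 left
                      right; exact ⟨μ, hμ, ν, hν, h1, h2, rfl⟩)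
  s6 α hα β hβ h := by
    simp only [ebar, ← mk_ad_pow]
    exact sub_eq_zero.1 (ell_rel (B := B) (ω := ω) (by
      iterate 3 left
      right; exact ⟨α, hα, β, hβ, h, rfl⟩))
  s7 α hα β hβ h := by
    simp only [ebar, ← mk_ad_pow]
    exact sub_eq_zero.1 (ell_rel (B := B) (ω := ω) (by
      iterate 2 left
      right; exact ⟨α, hα, β, hβ, h, rfl⟩))
  s8 α hα β hβ h i h1 h2 := by
    simp only [ebar, ← mk_ad_pow]
    exact (ell_rel (B := B) (ω := ω) (by
      left; right; exact ⟨α, hα, β, hβ, h, i, h1, h2, rfl⟩))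
  s9 α hα β hβ h i h1 h2 := by
    simp only [ebar, ← mk_ad_pow]
    exact (ell_rel (B := B) (ω := ω) (by
      right; exact ⟨α, hα, β, hβ, h, i, h1, h2, rfl⟩))

theorem ell_gen : LieSubalgebra.lieSpan ℂ (EllipticLieAlg B a P k g ω)
    (range (hbar B a P k g ω) ∪ ebar B a P k g ω '' bfull a P k g) = ⊤ := by
  set S := LieSubalgebra.lieSpan ℂ (EllipticLieAlg B a P k g ω)
    (range (hbar B a P k g ω) ∪ ebar B a P k g ω '' bfull a P k g) with hS
  let f : EllGen a P k g → S := fun x => match x with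
    | Sum.inl σ => ⟨hbar B a P k g ω σ, LieSubalgebra.subset_lieSpan (Or.inl ⟨σ, rfl⟩)⟩
    | Sum.inr μ => ⟨ebar B a P k g ω μ, LieSubalgebra.subset_lieSpan (Or.inr ⟨μ, μ.2, rfl⟩)⟩
  let q : FreeLieAlgebra ℂ (EllGen a P k g) →ₗ⁅ℂ⁆ EllipticLieAlg B a P k g ω :=
    { toFun := fun x => LieSubmodule.Quotient.mk x
      map_add' := fun _ _ => rfl
      map_smul' := fun _ _ => rfl
      map_lie' := rfl }
  have h : q = S.incl.comp (FreeLieAlgebra.lift ℂ f) := by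
    ext x
    simp only [LieHom.comp_apply, FreeLieAlgebra.lift_of_apply, Function.comp]
    rcases x with σ | μ
    · rfl
    · show LieSubmodule.Quotient.mk _ = ebar B a P k g ω μ
      rw [ebar, eFree, dif_pos μ.2]
  rw [eq_top_iff]
  intro x _
  obtain ⟨y, rfl⟩ := LieSubmodule.Quotient.surjective_mk' _ x
  have := congrArg (fun u => u y) h
  have h2 : q y = ((FreeLieAlgebra.lift ℂ f y : S) : EllipticLieAlg B a P k g ω) := this
  show q y ∈ S
  rw [h2]; exact SetLike.coe_mem _

/-- Universal property. -/
theorem ell_lift {L : Type*} [LieRing L] [LieAlgebra ℂ L] {hb : Vc V → L} {eb : V → L}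
    (E : Ell B a P k g ω hb eb) : ∃ φ : EllipticLieAlg B a P k g ω →ₗ⁅ℂ⁆ L,
      (∀ σ, φ (hbar B a P k g ω σ) = hb σ) ∧ ∀ μ ∈ bfull a P k g, φ (ebar B a P k g ω μ) = eb μ := by
  let f : EllGen a P k g → L := fun x => match x with
    | Sum.inl σ => hb σ
    | Sum.inr μ => eb μ
  let F := FreeLieAlgebra.lift ℂ f
  have Fh : ∀ σ, F (hFree a P k g σ) = hb σ := fun σ => FreeLieAlgebra.lift_of_apply _ _
  have Fe : ∀ μ ∈ bfull a P k g, F (eFree a P k g μ) = eb μ := by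
    intro μ hμ; rw [eFree, dif_pos hμ]; exact FreeLieAlgebra.lift_of_apply _ _
  have bp : ∀ μ ∈ bplus a P k g, μ ∈ bfull a P k g := fun μ h => Or.inl h
  have bn : ∀ μ ∈ bplus a P k g, -μ ∈ bfull a P k g := fun μ h => Or.inr (by simpa using h)
  have p1 : ∀ α ∈ P, α ∈ bplus a P k g := fun α h => Or.inl h
  have p2 : ∀ α ∈ P, starMap a k g α ∈ bplus a P k g := fun α h => Or.inr ⟨α, h, rfl⟩
  have Fp : ∀ (x y : FreeLieAlgebra ℂ (EllGen a P k g)) (n : ℕ),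
      F ((ad ℂ _ x ^ n) y) = (ad ℂ L (F x) ^ n) (F y) := by
    intro x y n
    induction n with
    | zero => simp
    | succ n ih =>
      rw [pow_succ', pow_succ', Module.End.mul_apply, Module.End.mul_apply, ad_apply, ad_apply, ← ih,
        LieHom.map_lie]
  have hker : ellIdeal B a P k g ω ≤ F.ker := by
    rw [ellIdeal, LieSubmodule.lieSpan_le]
    intro z hz
    show z ∈ F.ker
    rw [LieHom.mem_ker]
    rcases hz with ((((((((⟨x, y, σ, τ, rfl⟩ | ⟨σ, τ, rfl⟩) | ⟨σ, μ, hμ, rfl⟩) | ⟨μ, hμ, rfl⟩) |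
      ⟨μ, hμ, ν, hν, h1, h2, rfl⟩) | ⟨α, hα, β, hβ, h, rfl⟩) | ⟨α, hα, β, hβ, h, rfl⟩) |
      ⟨α, hα, β, hβ, h, i, h1, h2, rfl⟩) | ⟨α, hα, β, hβ, h, i, h1, h2, rfl⟩)
    · rw [map_sub, map_add, map_smul, map_smul, Fh, Fh, Fh, E.s1, sub_self]
    · rw [LieHom.map_lie, Fh, Fh, E.s2]
    · rw [map_sub, map_smul, LieHom.map_lie, Fh, Fe _ hμ, E.s3 _ _ hμ, sub_self]
    · rw [map_sub, LieHom.map_lie, Fh, Fe _ (bp _ hμ), Fe _ (bn _ hμ), E.s4 _ hμ, sub_self]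
    · rw [Fp, Fe _ hμ, Fe _ hν, E.s5 _ hμ _ hν h1 h2]
    · rw [map_sub, map_smul, map_smul, Fp, Fp, Fe _ (bp _ (p1 _ hα)), Fe _ (bp _ (p1 _ hβ)),
        Fe _ (bp _ (p2 _ hα)), Fe _ (bp _ (p2 _ hβ)), E.s6 _ hα _ hβ h, sub_self]
    · rw [map_sub, map_smul, map_smul, Fp, Fp, Fe _ (bn _ (p1 _ hα)), Fe _ (bn _ (p1 _ hβ)),
        Fe _ (bn _ (p2 _ hα)), Fe _ (bn _ (p2 _ hβ)), E.s7 _ hα _ hβ h, sub_self]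
    · rw [Fp, Fp, Fe _ (bp _ (p1 _ hα)), Fe _ (bp _ (p1 _ hβ)),
        Fe _ (bp _ (p2 _ hα)), E.s8 _ hα _ hβ h i h1 h2]
    · rw [Fp, Fp, Fe _ (bn _ (p1 _ hα)), Fe _ (bn _ (p1 _ hβ)),
        Fe _ (bn _ (p2 _ hα)), E.s9 _ hα _ hβ h i h1 h2]
  let q : EllipticLieAlg B a P k g ω →ₗ[ℂ] L :=
    Submodule.liftQ (ellIdeal B a P k g ω).toSubmodule (F : _ →ₗ[ℂ] L) (fun x hx => LinearMap.mem_ker.2 (F.mem_ker.1 (hker hx)))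
  refine ⟨{ q with map_lie' := ?_ }, fun σ => Fh σ, fun μ hμ => Fe μ hμ⟩
  intro x y
  obtain ⟨x, rfl⟩ := LieSubmodule.Quotient.surjective_mk' _ x
  obtain ⟨y, rfl⟩ := LieSubmodule.Quotient.surjective_mk' _ y
  exact F.map_lie x y

end EllAlg

open Set LieAlgebra TensorProduct

section BC
variable {V : Type*} [AddCommGroup V] [Module ℝ V]

/-- pairing of `V^ℂ` with `V` -/
noncomputable def bc (B : LinearMap.BilinForm ℝ V) (σ : Vc V) (v : V) : ℂ :=
  LinearMap.BilinForm.baseChange ℂ B σ ((1 : ℂ) ⊗ₜ[ℝ] v)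

variable {B : LinearMap.BilinForm ℝ V}

theorem bc_add (σ : Vc V) (v w : V) : bc B σ (v + w) = bc B σ v + bc B σ w := by
  rw [bc, tmul_add, map_add]; rfl

theorem bc_smul (σ : Vc V) (x : ℝ) (v : V) : bc B σ (x • v) = x * bc B σ v := by
  have : (1:ℂ) ⊗ₜ[ℝ] (x • v) = (x:ℂ) • ((1:ℂ) ⊗ₜ[ℝ] v) := by
    rw [tmul_smul, TensorProduct.smul_tmul', TensorProduct.smul_tmul']
    congr 1
  rw [bc, this, map_smul]; rfl

theorem bc_neg (σ : Vc V) (v : V) : bc B σ (-v) = -bc B σ v := by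
  have := bc_smul (B := B) σ (-1) v
  simpa using this

theorem bc_one (u v : V) : bc B ((1:ℂ) ⊗ₜ[ℝ] u) v = (B u v : ℂ) := by
  rw [bc, LinearMap.BilinForm.baseChange_tmul]; simp

theorem bc_zero' (v : V) (h : ∀ u, B u v = 0) (σ : Vc V) : bc B σ v = 0 := by
  induction σ using TensorProduct.induction_on with
  | zero => simp [bc]
  | tmul z u => rw [bc, LinearMap.BilinForm.baseChange_tmul, h]; simp
  | add x y h1 h2 =>
    have : bc B (x + y) v = bc B x v + bc B y v := by simp [bc]
    rw [this, h1, h2, add_zero]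

theorem bc_sub_left (σ τ : Vc V) (v : V) : bc B (σ - τ) v = bc B σ v - bc B τ v := by simp [bc]
theorem bc_smul_left (z : ℂ) (σ : Vc V) (v : V) : bc B (z • σ) v = z * bc B σ v := by simp [bc]

theorem cast_tmul (x : ℝ) (v : V) : (1:ℂ) ⊗ₜ[ℝ] (x • v) = (x:ℂ) • ((1:ℂ) ⊗ₜ[ℝ] v) := by
  rw [tmul_smul, TensorProduct.smul_tmul', TensorProduct.smul_tmul']
  congr 1

end BC

section Loops
variable {V : Type*} [AddCommGroup V] [Module ℝ V] {B : LinearMap.BilinForm ℝ V} {R : Set V}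
    {l : ℕ} {P : Set V} {a : V} {k : V → ℕ} {g : V → Bool} {ω : V → V → ℂ}
    {L : Type*} [LieRing L] [LieAlgebra ℂ L] {hb : Vc V → L} {eb : V → L}

namespace Setup

theorem bc_a (S : Setup B R l P a k g) (σ : Vc V) : bc B σ a = 0 := bc_zero' a S.Ba' σ

theorem mem_i (i : P) : (i:V) ∈ bfull a P k g := Or.inl (Or.inl i.2)
theorem mem_ni (i : P) : -(i:V) ∈ bfull a P k g := Or.inr (by rw [Set.mem_neg, neg_neg]; exact Or.inl i.2)
theorem mem_s (i : P) : starMap a k g i ∈ bfull a P k g := Or.inl (Or.inr ⟨i, i.2, rfl⟩)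
theorem mem_ns (i : P) : -starMap a k g i ∈ bfull a P k g :=
  Or.inr (by rw [Set.mem_neg, neg_neg]; exact Or.inr ⟨i, i.2, rfl⟩)

theorem star_eq (i : P) : starMap a k g (i:V) = (cMap g (i:V) : ℝ) • (i:V) + (k i : ℝ) • a := by
  rw [starMap, ← Int.cast_smul_eq_zsmul ℝ, ← Int.cast_smul_eq_zsmul ℝ]; simp

theorem bform {μ : V} (h : μ ∈ bfull a P k g) : ∃ (i : P) (x r : ℝ), x ≠ 0 ∧ μ = x • (i:V) + r • a ∧
    (μ = i ∨ μ = -(i:V) ∨ μ = starMap a k g i ∨ μ = -starMap a k g i) := by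
  have c0 : ∀ i : P, (cMap g (i:V) : ℝ) ≠ 0 := by intro i; rw [cMap]; split <;> norm_num
  rcases h with (h | ⟨α, h, rfl⟩) | h
  · exact ⟨⟨μ, h⟩, 1, 0, one_ne_zero, by simp, by simp⟩
  · exact ⟨⟨α, h⟩, _, _, c0 ⟨α, h⟩, star_eq ⟨α, h⟩, by simp⟩
  · rw [Set.mem_neg] at h
    rcases h with h | ⟨α, h, h2⟩
    · exact ⟨⟨-μ, h⟩, -1, 0, by norm_num, by simp, by simp⟩
    · refine ⟨⟨α, h⟩, -(cMap g α), -(k α), neg_ne_zero.2 (c0 ⟨α, h⟩), ?_, ?_⟩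
      · have := star_eq (a := a) (k := k) (g := g) ⟨α, h⟩
        simp only at this
        rw [h2] at this
        rw [← neg_neg μ, this]; module
      · right; right; right; simp [h2]

theorem B_form (S : Setup B R l P a k g) (u v : V) (x y r s : ℝ) :
    B (x • u + r • a) (y • v + s • a) = x * y * B u v := by
  simp [S.Ba, S.Ba']; ring

theorem bpos (S : Setup B R l P a k g) {μ : V} (h : μ ∈ bfull a P k g) : 0 < B μ μ := by
  obtain ⟨i, x, r, hx, rfl, _⟩ := bform h
  rw [S.B_form]
  exact mul_pos (mul_self_pos.2 hx) (S.posP i)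

theorem ne_same (S : Setup B R l P a k g) (i : P) {x r x' r' : ℝ} (h : r ≠ r') :
    x • (i:V) + r • a ≠ x' • (i:V) + r' • a := fun e => h (S.one_lc e).2

theorem ne_diff (S : Setup B R l P a k g) {i j : P} (hij : i ≠ j) {x r x' r' : ℝ} (hx : x ≠ 0) :
    x • (i:V) + r • a ≠ x' • (j:V) + r' • a := by
  intro e
  have : x • (i:V) + (0:ℝ) • (j:V) + r • a = (0:ℝ) • (i:V) + x' • (j:V) + r' • a := by simpa using e
  exact hx (S.two_lc hij this).1

theorem ne_pm (S : Setup B R l P a k g) {i j : P} {x r x' r' : ℝ}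
    (h : (i ≠ j ∧ x ≠ 0) ∨ (i = j ∧ r ≠ r' ∧ r ≠ -r')) :
    x • (i:V) + r • a ≠ x' • (j:V) + r' • a ∧ x' • (j:V) + r' • a ≠ -(x • (i:V) + r • a) := by
  have e : -(x • (i:V) + r • a) = (-x) • (i:V) + (-r) • a := by module
  rw [e]
  rcases h with ⟨h1, h2⟩ | ⟨rfl, h1, h2⟩
  · exact ⟨S.ne_diff h1 h2, (S.ne_diff h1 (neg_ne_zero.2 h2)).symm⟩
  · exact ⟨S.ne_same i h1, S.ne_same i (fun h => h2 (by linarith))⟩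

theorem serre (S : Setup B R l P a k g) (E : Ell B a P k g ω hb eb) {μ ν : V}
    (hμ : μ ∈ bfull a P k g) (hν : ν ∈ bfull a P k g) {i j : P} {x r x' r' : ℝ}
    (e1 : μ = x • (i:V) + r • a) (e2 : ν = x' • (j:V) + r' • a)
    (h : (i ≠ j ∧ x ≠ 0) ∨ (i = j ∧ r ≠ r' ∧ r ≠ -r')) (q : ℕ)
    (hq : -(q * (x * x * B (i:V) i)) ≤ 2 * (x * x' * B (i:V) j)) :
    (ad ℂ L (eb μ) ^ (q+1)) (eb ν) = 0 := by
  have ne := S.ne_pm (x' := x') h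
  rw [← e1, ← e2] at ne
  have h1 := E.s5 μ hμ ν hν ne.1 ne.2
  have p := S.bpos hμ
  have le : xExp B μ ν ≤ q + 1 := by
    rw [xExp, add_comm]
    apply Nat.add_le_add_right
    rw [Nat.ceil_le, neg_le, le_div_iff₀ p, e1, e2, S.B_form, S.B_form]
    linarith
  obtain ⟨d, hd⟩ := Nat.exists_eq_add_of_le le
  rw [hd, add_comm, pow_add, Module.End.mul_apply, h1, map_zero]

theorem hb_add (E : Ell B a P k g ω hb eb) (σ τ : Vc V) : hb (σ + τ) = hb σ + hb τ := by
  simpa using (E.s1 1 1 σ τ).symm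
theorem hb_smul (E : Ell B a P k g ω hb eb) (z : ℂ) (σ : Vc V) : hb (z • σ) = z • hb σ := by
  simpa using (E.s1 z 0 σ 0).symm

theorem hbe (E : Ell B a P k g ω hb eb) (σ : Vc V) {μ : V} (h : μ ∈ bfull a P k g) :
    ⁅hb σ, eb μ⁆ = bc B σ μ • eb μ := E.s3 σ μ h

theorem nil (S : Setup B R l P a k g) (E : Ell B a P k g ω hb eb)
    (hgen : LieSubalgebra.lieSpan ℂ L (range hb ∪ eb '' bfull a P k g) = ⊤) {μ : V}
    (hμ : μ ∈ bfull a P k g) (v : L) : ∃ n : ℕ, (ad ℂ L (eb μ) ^ n) v = 0 := by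
  have hh : ∀ σ, ⁅eb μ, ⁅eb μ, hb σ⁆⁆ = 0 := by
    intro σ
    rw [← lie_skew (eb μ) (hb σ), hbe E σ hμ, lie_neg, lie_smul, lie_self, smul_zero, neg_zero]
  apply locNil_of_gen _ _ hgen _ v
  rintro _ (⟨σ, rfl⟩ | ⟨ν, hν, rfl⟩)
  · exact ⟨2, by rw [pow_two]; exact hh σ⟩
  · by_cases h1 : μ = ν
    · subst h1; exact ⟨1, by simp⟩
    by_cases h2 : ν = -μ
    · refine ⟨3, ?_⟩
      show ⁅eb μ, ⁅eb μ, ⁅eb μ, eb ν⁆⁆⁆ = 0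
      rcases hμ with hμ' | hμ'
      · rw [h2, E.s4 μ hμ', hh]
      · have := E.s4 (-μ) hμ'
        rw [neg_neg] at this
        rw [h2, ← lie_skew (eb μ) (eb (-μ)), this, lie_neg, lie_neg, hh, neg_zero]
    · exact ⟨_, E.s5 μ hμ ν hν h1 h2⟩

theorem sl_of (S : Setup B R l P a k g) (E : Ell B a P k g ω hb eb)
    (hgen : LieSubalgebra.lieSpan ℂ L (range hb ∪ eb '' bfull a P k g) = ⊤) {μ : V}
    (hμ : μ ∈ bplus a P k g) : SLTwo (eb μ) (eb (-μ)) (hb ((1:ℂ) ⊗ₜ[ℝ] vee B μ)) := by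
  have m1 : μ ∈ bfull a P k g := Or.inl hμ
  have m2 : -μ ∈ bfull a P k g := Or.inr (by simpa using hμ)
  have p := (S.bpos m1).ne'
  have b2 : bc B ((1:ℂ) ⊗ₜ[ℝ] vee B μ) μ = 2 := by
    rw [bc_one, vee, map_smul, LinearMap.smul_apply, smul_eq_mul, div_mul_cancel₀ _ p]; norm_num
  refine ⟨E.s4 μ hμ, ?_, ?_, S.nil E hgen m1, S.nil E hgen m2⟩
  · rw [hbe E _ m1, b2]
  · rw [hbe E _ m2, bc_neg, b2, neg_smul]

theorem central (S : Setup B R l P a k g) (E : Ell B a P k g ω hb eb)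
    (hgen : LieSubalgebra.lieSpan ℂ L (range hb ∪ eb '' bfull a P k g) = ⊤) (x : ℝ) (v : L) :
    ⁅hb ((1:ℂ) ⊗ₜ[ℝ] (x • a)), v⁆ = 0 := by
  set c := hb ((1:ℂ) ⊗ₜ[ℝ] (x • a)) with hc
  let C : LieSubalgebra ℂ L :=
    { LinearMap.ker (ad ℂ L c) with
      lie_mem' := by
        intro y z hy hz
        have hy' : ⁅c, y⁆ = 0 := hy
        have hz' : ⁅c, z⁆ = 0 := hz
        show ⁅c, ⁅y, z⁆⁆ = 0
        rw [leibniz_lie, hy', hz', zero_lie, lie_zero, add_zero] }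
  have : LieSubalgebra.lieSpan ℂ L (range hb ∪ eb '' bfull a P k g) ≤ C := by
    rw [LieSubalgebra.lieSpan_le]
    rintro _ (⟨σ, rfl⟩ | ⟨ν, hν, rfl⟩)
    · exact E.s2 _ _
    · show ⁅c, eb ν⁆ = 0
      rw [hc, hbe E _ hν, bc_one, map_smul, LinearMap.smul_apply, S.Ba]; simp
  rw [hgen] at this
  exact this (LieSubalgebra.mem_top v)

end Setup

/-- The loops attached to a simple root. -/
structure LoopData (B : LinearMap.BilinForm ℝ V) {P : Set V} (a : V) (k : V → ℕ) (g : V → Bool)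
    (hb : Vc V → L) (eb : V → L) (i : P) (e f h : ℤ → L) : Prop where
  loop : Loop (if g i = true then 6 else 2) e f h (hb ((1:ℂ) ⊗ₜ[ℝ] ((2 * k i / B (i:V) i) • a)))
  e0 : e 0 = eb i
  f0 : f 0 = eb (-(i:V))
  h0 : h 0 = hb ((1:ℂ) ⊗ₜ[ℝ] vee B (i:V))
  e1 : g i = false → e 1 = eb (starMap a k g i)
  f1 : g i = false → f (-1) = eb (-starMap a k g i)
  e1' : g i = true → e 1 = ⁅eb (-(i:V)), eb (starMap a k g i)⁆
  f1' : g i = true → f (-1) = ⁅eb (-starMap a k g i), eb i⁆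
  z1 : g i = true → ⁅e 0, e 1⁆ = (4:ℂ) • eb (starMap a k g i)
  z2 : g i = true → ⁅f 0, f (-1)⁆ = -((4:ℂ) • eb (-starMap a k g i))

namespace Setup

theorem hz_eq (S : Setup B R l P a k g) (E : Ell B a P k g ω hb eb) (i : P) :
    hb ((1:ℂ) ⊗ₜ[ℝ] vee B (starMap a k g i)) = ((cMap g i : ℂ))⁻¹ • hb ((1:ℂ) ⊗ₜ[ℝ] vee B (i:V)) +
      ((cMap g i : ℂ)⁻¹ * (cMap g i : ℂ)⁻¹) • hb ((1:ℂ) ⊗ₜ[ℝ] ((2 * k i / B (i:V) i) • a)) := by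
  have p := (S.posP i).ne'
  have c0 : (cMap g (i:V) : ℝ) ≠ 0 := by rw [cMap]; split <;> norm_num
  rw [← hb_smul E, ← hb_smul E, ← hb_add E]
  congr 1
  have : ∀ (x : ℝ), (x:ℂ)⁻¹ = ((x⁻¹ : ℝ) : ℂ) := fun x => by push_cast; rfl
  rw [← Complex.ofReal_natCast, this, ← Complex.ofReal_mul, ← cast_tmul, ← cast_tmul, ← tmul_add]
  congr 1
  rw [vee, vee, star_eq, S.B_form, smul_add, smul_smul, smul_smul, smul_smul, smul_smul]
  congr 2 <;> field_simp

theorem exists_loop (S : Setup B R l P a k g) (E : Ell B a P k g ω hb eb)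
    (hgen : LieSubalgebra.lieSpan ℂ L (range hb ∪ eb '' bfull a P k g) = ⊤) (i : P) :
    ∃ e f h : ℤ → L, LoopData B a k g hb eb i e f h := by
  have p := S.posP i
  have kp : (0:ℝ) < k i := by exact_mod_cast S.k_pos i
  have sa := S.sl_of E hgen (μ := (i:V)) (Or.inl i.2)
  have sz := S.sl_of E hgen (μ := starMap a k g i) (Or.inr ⟨i, i.2, rfl⟩)
  have cc := S.central E hgen (2 * k i / B (i:V) i)
  have hz := S.hz_eq E i
  have st := star_eq (a := a) (k := k) (g := g) i
  have nst : -starMap a k g (i:V) = (-(cMap g (i:V) : ℝ)) • (i:V) + (-(k i : ℝ)) • a := by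
    rw [st]; module
  have u1 : (i:V) = (1:ℝ) • (i:V) + (0:ℝ) • a := by module
  have u2 : -(i:V) = (-1:ℝ) • (i:V) + (0:ℝ) • a := by module
  rcases hg : g i with _ | _
  · have c1 : cMap g (i:V) = 1 := by simp [cMap, hg]
    rw [c1] at hz st nst
    rw [hz] at sz
    simp only [Nat.cast_one, inv_one, one_smul, mul_one] at sz
    have q1 := S.serre E (mem_i i) (mem_s i) u1 st (Or.inr ⟨rfl, by linarith, by linarith⟩) 0
      (by push_cast; nlinarith)
    have q2 := S.serre E (mem_ni i) (mem_ns i) u2 nst (Or.inr ⟨rfl, by linarith, by linarith⟩) 0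
      (by push_cast; nlinarith)
    obtain ⟨e, f, h, hl, a1, a2, a3, a4, a5⟩ := exists_loop_one _ _ _ _ _ _ cc sa sz
      (by simpa using q1) (by simpa using q2)
    exact ⟨e, f, h, ⟨by simpa [hg] using hl, a1, a2, a3, fun _ => a4, fun _ => a5, by simp [hg], by simp [hg],
      by simp [hg], by simp [hg]⟩⟩
  · have c1 : cMap g (i:V) = 2 := by simp [cMap, hg]
    rw [c1] at hz st nst
    push_cast at hz st nst
    have t1 := S.serre E (mem_i i) (mem_s i) u1 st (Or.inr ⟨rfl, by linarith, by linarith⟩) 0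
      (by push_cast; nlinarith)
    have t2 := S.serre E (mem_ni i) (mem_ns i) u2 nst (Or.inr ⟨rfl, by linarith, by linarith⟩) 0
      (by push_cast; nlinarith)
    have t3 := S.serre E (mem_i i) (mem_ns i) u1 nst (Or.inr ⟨rfl, by linarith, by linarith⟩) 4
      (by push_cast; nlinarith)
    have t4 := S.serre E (mem_ni i) (mem_s i) u2 st (Or.inr ⟨rfl, by linarith, by linarith⟩) 4
      (by push_cast; nlinarith)
    have t5 := S.serre E (mem_s i) (mem_ni i) st u2 (Or.inr ⟨rfl, by linarith, by linarith⟩) 1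
      (by push_cast; nlinarith)
    have t6 := S.serre E (mem_ns i) (mem_i i) nst u1 (Or.inr ⟨rfl, by linarith, by linarith⟩) 1
      (by push_cast; nlinarith)
    obtain ⟨e, f, h, hl, a1, a2, a3, a4, a5, a6, a7, _, _⟩ := exists_loop_two _ _ _ _ _ _ _ cc sa sz
      (by rw [hz]; congr 2; norm_num) (by simpa using t1) (by simpa using t2) t3 t4 t5 t6
    exact ⟨e, f, h, ⟨by simpa [hg] using hl, a1, a2, a3, by simp [hg], by simp [hg], fun _ => a4, fun _ => a5,
      fun _ => a6, fun _ => a7⟩⟩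

theorem weight (S : Setup B R l P a k g) (E : Ell B a P k g ω hb eb) {i : P} {e f h : ℤ → L}
    (D : LoopData B a k g hb eb i e f h) (σ : Vc V) (n : ℤ) :
    ⁅hb σ, e n⁆ = bc B σ i • e n ∧ ⁅hb σ, f n⁆ = -(bc B σ i • f n) := by
  have p := (S.posP i).ne'
  have hv : bc B ((1:ℂ) ⊗ₜ[ℝ] vee B (i:V)) i = 2 := by
    rw [bc_one, vee, map_smul, LinearMap.smul_apply, smul_eq_mul, div_mul_cancel₀ _ p]; norm_num
  have bs : ∀ τ, bc B τ (starMap a k g i) = cMap g i * bc B τ i := by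
    intro τ; rw [star_eq, bc_add, bc_smul, bc_smul, S.bc_a]; simp
  have w1 : ∀ τ, ⁅hb τ, f (-1)⁆ = -(bc B τ i • f (-1)) := by
    intro τ
    rcases hg : g i with _ | _
    · rw [D.f1 hg, hbe E _ (mem_ns i), bc_neg, bs]; simp [cMap, hg]
    · rw [D.f1' hg, leibniz_lie, hbe E _ (mem_ns i), hbe E _ (mem_i i), bc_neg, bs, smul_lie, lie_smul]
      simp only [cMap, hg]; push_cast; module
  have w0 : ∀ τ, ⁅hb τ, e 0⁆ = bc B τ i • e 0 := by
    intro τ; rw [D.e0, hbe E _ (mem_i i)]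
  have key := D.loop.cent (hb σ - (bc B σ i / 2) • h 0) (by
      rw [sub_lie, smul_lie, D.loop.s0.he, w0]; module) (by
      rw [sub_lie, smul_lie, D.h0, w1, w1, hv]; module) (by
      rw [D.h0, sub_lie, smul_lie, E.s2, E.s2]; simp) n
  rw [sub_lie, sub_lie, smul_lie, smul_lie, D.loop.he, D.loop.hf, zero_add, sub_eq_zero, sub_eq_zero] at key
  rw [key.1, key.2]
  have : dd (if g i = true then 6 else 2) 0 = 2 := by simp [dd]
  rw [this]; constructor <;> module

end Setup
end Loops

open Set LieAlgebra TensorProduct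

section Pairs
variable {V : Type*} [AddCommGroup V] [Module ℝ V] {B : LinearMap.BilinForm ℝ V} {R : Set V}
    {l : ℕ} {P : Set V} {a : V} {k : V → ℕ} {g : V → Bool} {ω : V → V → ℂ}
    {L : Type*} [LieRing L] [LieAlgebra ℂ L] {hb : Vc V → L} {eb : V → L}

namespace Setup

theorem u1 (a : V) (i : P) : (i:V) = (1:ℝ) • (i:V) + (0:ℝ) • a := by module
theorem u2 (a : V) (i : P) : -(i:V) = (-1:ℝ) • (i:V) + (0:ℝ) • a := by module
theorem u4 (i : P) : -starMap a k g (i:V) = (-(cMap g (i:V) : ℝ)) • (i:V) + (-(k i : ℝ)) • a := by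
  rw [star_eq]; module
theorem cpos (g : V → Bool) (α : V) : 0 < (cMap g α : ℝ) := by rw [cMap]; split <;> norm_num

theorem opp (S : Setup B R l P a k g) (E : Ell B a P k g ω hb eb) {i j : P} (hij : i ≠ j) {μ ν : V}
    (hμ : μ ∈ bfull a P k g) (hν : ν ∈ bfull a P k g) {x r x' r' : ℝ}
    (e1 : μ = x • (i:V) + r • a) (e2 : ν = x' • (j:V) + r' • a) (hx : x ≠ 0) (h : x * x' ≤ 0) :
    ⁅eb μ, eb ν⁆ = 0 := by
  have := S.serre E hμ hν e1 e2 (Or.inl ⟨hij, hx⟩) 0 (by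
    have := S.B_nonpos hij
    push_cast; nlinarith)
  simpa using this

theorem pair_or (S : Setup B R l P a k g) (E : Ell B a P k g ω hb eb) (hω : IsTuning B P ω)
    (hgen : LieSubalgebra.lieSpan ℂ L (range hb ∪ eb '' bfull a P k g) = ⊤)
    {i j : P} (hij : i ≠ j) {m : ℕ} (hm : m = 1 ∨ m = 2 ∨ m = 3)
    (h1 : 2 * B (i:V) j = -(B (j:V) j)) (h2 : 2 * B (i:V) j = -(m * B (i:V) i))
    {e f h e' f' h' : ℤ → L} (D : LoopData B a k g hb eb i e f h)
    (D' : LoopData B a k g hb eb j e' f' h') : PairConcl e f h e' f' h' := by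
  obtain ⟨kk, gj, gi⟩ := S.k_data hij hm h1 h2
  have pi := S.posP i
  have pj := S.posP j
  have ki := S.k_pos i
  have w0 : ω i j ≠ 0 := (hω i i.2 j j.2).1 h1
  have ci := cpos g (i:V)
  have cj := cpos g (j:V)
  have sy := S.hE.symm j i
  have b1 : bc B ((1:ℂ) ⊗ₜ[ℝ] vee B (i:V)) j = -m := by
    rw [bc_one, vee, map_smul, LinearMap.smul_apply, smul_eq_mul]
    have : 2 / B (i:V) i * B (i:V) j = -m := by field_simp; linarith
    rw [this]; push_cast; rfl
  have b2 : bc B ((1:ℂ) ⊗ₜ[ℝ] vee B (j:V)) i = -1 := by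
    rw [bc_one, vee, map_smul, LinearMap.smul_apply, smul_eq_mul]
    have : 2 / B (j:V) j * B (j:V) i = -1 := by rw [sy]; field_simp; linarith
    rw [this]; push_cast; rfl
  have E1 := D'.e1 gj
  have F1 := D'.f1 gj
  have base : PairBase (if g i = true then 6 else 2) m e f h
      (hb ((1:ℂ) ⊗ₜ[ℝ] ((2 * k i / B (i:V) i) • a))) e' f' h'
      (hb ((1:ℂ) ⊗ₜ[ℝ] ((2 * k j / B (j:V) j) • a))) := by
    refine ⟨D.loop, by simpa [gj] using D'.loop, fun n => ?_, fun n => ?_, fun n => ?_, fun n => ?_,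
      ?_, ?_, ?_, ?_⟩
    · rw [D.h0, (S.weight E D' _ n).1, b1]; module
    · rw [D.h0, (S.weight E D' _ n).2, b1]; module
    · rw [D'.h0, (S.weight E D _ n).1, b2]; module
    · rw [D'.h0, (S.weight E D _ n).2, b2]; module
    · rw [D.e0, D'.f0]; exact S.opp E hij (mem_i i) (mem_ni j) (u1 a i) (u2 a j) (by norm_num) (by norm_num)
    · rw [D.f0, D'.e0]; exact S.opp E hij (mem_ni i) (mem_i j) (u2 a i) (u1 a j) (by norm_num) (by norm_num)
    · rw [D.f0, E1]; exact S.opp E hij (mem_ni i) (mem_s j) (u2 a i) (star_eq j) (by norm_num) (by linarith)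
    · rw [D.e0, F1]; exact S.opp E hij (mem_i i) (mem_ns j) (u1 a i) (u4 j) (by norm_num) (by linarith)
  have Y1 : ⁅eb (starMap a k g i), f' 0⁆ = 0 := by
    rw [D'.f0]; exact S.opp E hij (mem_s i) (mem_ni j) (star_eq i) (u2 a j) ci.ne' (by linarith)
  have Y2 : ⁅eb (starMap a k g i), f' (-1)⁆ = 0 := by
    rw [F1]; exact S.opp E hij (mem_s i) (mem_ns j) (star_eq i) (u4 j) ci.ne' (by nlinarith)
  have Y3 : ⁅eb (-starMap a k g i), e' 0⁆ = 0 := by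
    rw [D'.e0]; exact S.opp E hij (mem_ns i) (mem_i j) (u4 i) (u1 a j) (by linarith) (by linarith)
  have Y4 : ⁅eb (-starMap a k g i), e' 1⁆ = 0 := by
    rw [E1]; exact S.opp E hij (mem_ns i) (mem_s j) (u4 i) (star_eq j) (by linarith) (by nlinarith)
  have s6 := E.s6 i i.2 j j.2 h1
  have s7 := E.s7 i i.2 j j.2 h1
  rcases hg : g i with _ | _
  · have c1 : cMap g (i:V) = 1 := by simp [cMap, hg]
    have c1' : cMap g (j:V) = 1 := by simp [cMap, gj]
    have e1 := D.e1 hg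
    have f1 := D.f1 hg
    rw [hg] at base
    simp only [Bool.false_eq_true, if_false] at base
    rw [c1] at s6 s7
    rw [← E1, ← D.e0, ← e1, ← D'.e0] at s6
    rw [← F1, ← D.f0, ← f1, ← D'.f0] at s7
    have caseA : k j = k i → PairConcl e f h e' f' h' := by
      intro hk
      rw [hk, Nat.div_self ki] at s6 s7
      have p : PairA m (ω i j) e f h _ e' f' h' _ :=
        { base with
          y1 := by rw [e1, Y1]
          y2 := by rw [e1, Y2]
          y3 := by rw [f1, Y3]
          y4 := by rw [f1, Y4]
          w0 := w0
          th := by simpa using s6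
          th' := by simpa using s7 }
      exact p.concl (by omega)
    rcases kk with hk | hk
    · exact caseA hk
    · by_cases hm1 : m = 1
      · subst hm1; exact caseA (by simpa using hk)
      have s8 := E.s8 i i.2 j j.2 h1
      have s9 := E.s9 i i.2 j j.2 h1
      have hkm : k j / k i = m := by rw [hk, Nat.mul_div_cancel _ ki]
      rw [hkm] at s6 s7 s8 s9
      rw [← e1, ← D.e0, ← D'.e0] at s8
      rw [← f1, ← D.f0, ← D'.f0] at s9
      have q5 := S.serre E (mem_s i) (mem_i j) (star_eq i) (u1 a j) (Or.inl ⟨hij, ci.ne'⟩) m (by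
        rw [c1]; push_cast; linarith)
      have q5' := S.serre E (mem_ns i) (mem_ni j) (u4 i) (u2 a j) (Or.inl ⟨hij, by linarith⟩) m (by
        rw [c1]; push_cast; linarith)
      have p : PairC m (ω i j) e f h _ e' f' h' _ :=
        { base with
          hm := by omega
          w0 := w0
          s6 := by simpa using s6
          s7 := by simpa using s7
          s8 := s8
          s9 := s9
          q5 := by rw [e1, D'.e0]; exact q5
          q5' := by rw [f1, D'.f0]; exact q5' }
      exact p.concl
  · obtain ⟨rfl, hk⟩ := gi hg
    have c1 : cMap g (i:V) = 2 := by simp [cMap, hg]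
    have c1' : cMap g (j:V) = 1 := by simp [cMap, gj]
    rw [hg] at base
    simp only [if_true] at base
    rw [c1, hk, Nat.div_self ki] at s6 s7
    rw [← E1, ← D.e0, ← D'.e0] at s6
    rw [← F1, ← D.f0, ← D'.f0] at s7
    have t1 := S.serre E (mem_i i) (mem_s j) (u1 a i) (star_eq j) (Or.inl ⟨hij, by norm_num⟩) 2 (by
        rw [c1']; push_cast at h2 ⊢; linarith)
    have t2 := S.serre E (mem_ni i) (mem_ns j) (u2 a i) (u4 j) (Or.inl ⟨hij, by norm_num⟩) 2 (by
        rw [c1']; push_cast at h2 ⊢; linarith)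
    have p : PairB (ω i j) (eb (starMap a k g i)) (eb (-starMap a k g i))
        (hb ((1:ℂ) ⊗ₜ[ℝ] vee B (starMap a k g i))) e f h _ e' f' h' _ :=
      { base with
        w0 := w0
        sz := S.sl_of E hgen (Or.inr ⟨i, i.2, rfl⟩)
        hz := fun v => by
          rw [S.hz_eq E, add_lie, smul_lie, smul_lie, S.central E hgen, c1, D.h0]; simp
        e1 := by rw [D.e1' hg, D.f0]
        f1 := by rw [D.f1' hg, D.e0]
        z1 := D.z1 hg
        z2 := D.z2 hg
        y1 := Y1
        y2 := Y2
        y3 := Y3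
        y4 := Y4
        s6 := by simpa [pow_two] using s6
        s7 := by
          have : ((-1:ℂ)^(2+1) * ((2:ℕ):ℂ)) = -2 := by norm_num
          rw [this] at s7
          simpa [pow_two] using s7
        s5 := by rw [D.e0, E1]; exact t1
        s5' := by rw [D.f0, F1]; exact t2 }
    exact p.concl

theorem pair_concl (S : Setup B R l P a k g) (E : Ell B a P k g ω hb eb) (hω : IsTuning B P ω)
    (hgen : LieSubalgebra.lieSpan ℂ L (range hb ∪ eb '' bfull a P k g) = ⊤)
    {i j : P} (hij : i ≠ j) {e f h e' f' h' : ℤ → L} (D : LoopData B a k g hb eb i e f h)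
    (D' : LoopData B a k g hb eb j e' f' h') : PairConcl e f h e' f' h' := by
  by_cases hb0 : B (i:V) j = 0
  · have hb1 : B (j:V) i = 0 := by rw [S.hE.symm, hb0]
    have z : ∀ {μ ν : V}, μ ∈ bfull a P k g → ν ∈ bfull a P k g → (∃ x r : ℝ, x ≠ 0 ∧ μ = x • (j:V) + r • a) →
        (∃ x r : ℝ, x ≠ 0 ∧ ν = x • (i:V) + r • a) → ⁅eb μ, eb ν⁆ = 0 := by
      rintro μ ν hμ hν ⟨x, r, hx, e1⟩ ⟨y, s, hy, e2⟩
      have := S.serre E hμ hν e1 e2 (Or.inl ⟨hij.symm, hx⟩) 0 (by rw [hb1]; simp)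
      simpa using this
    have sk : ∀ {x y : L}, ⁅x, y⁆ = 0 → ⁅y, x⁆ = 0 := fun h => by rw [← lie_skew, h, neg_zero]
    have ex : ∀ {i : P} {e f h : ℤ → L}, LoopData B a k g hb eb i e f h → ∀ (Y : L),
        (∀ μ ∈ bfull a P k g, (∃ x r : ℝ, x ≠ 0 ∧ μ = x • (i:V) + r • a) → ⁅Y, eb μ⁆ = 0) →
        ⁅Y, e 0⁆ = 0 ∧ ⁅Y, f (-1)⁆ = 0 := by
      intro i e f h D Y hY
      have q1 := hY _ (mem_i i) ⟨_, _, one_ne_zero, u1 a i⟩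
      have q2 := hY _ (mem_ns i) ⟨_, _, neg_ne_zero.2 (cpos g _).ne', u4 i⟩
      refine ⟨by rw [D.e0, q1], ?_⟩
      rcases hg : g i with _ | _
      · rw [D.f1 hg, q2]
      · rw [D.f1' hg, leibniz_lie, q1, q2]; simp
    have hv : ∀ {i j : P} {h : Vc V}, h = ((1:ℂ) ⊗ₜ[ℝ] vee B (i:V)) → B (i:V) j = 0 → bc B h j = 0 := by
      rintro i j _ rfl h0
      rw [bc_one, vee, map_smul, LinearMap.smul_apply, h0]; simp
    have hw : ∀ {i j : P} {e f h : ℤ → L} {σ : Vc V}, LoopData B a k g hb eb j e f h →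
        σ = ((1:ℂ) ⊗ₜ[ℝ] vee B (i:V)) → B (i:V) j = 0 → ∀ n, ⁅hb σ, e n⁆ = 0 ∧ ⁅hb σ, f n⁆ = 0 := by
      intro i j e f h σ D hσ h0 n
      have := S.weight E D σ n
      rw [hv hσ h0] at this
      simpa using this
    apply pairU_concl D.loop D'.loop
    have key : ∀ Y : L, (∀ μ ∈ bfull a P k g, (∃ x r : ℝ, x ≠ 0 ∧ μ = x • (j:V) + r • a) → ⁅eb μ, Y⁆ = 0) →
      ⁅e' 0, Y⁆ = 0 ∧ ⁅f' (-1), Y⁆ = 0 := by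
      intro Y hY
      have := ex D' Y (fun μ h1 h2 => sk (hY μ h1 h2))
      exact ⟨sk this.1, sk this.2⟩
    have k2 := fun (μ : V) h1 h2 => ex D (eb μ) (fun ν h3 h4 => z (μ := μ) h1 h3 h2 h4)
    have k3 := key (e 0) (fun μ h1 h2 => (k2 μ h1 h2).1)
    have k4 := key (f (-1)) (fun μ h1 h2 => (k2 μ h1 h2).2)
    intro x hx y hy
    simp only [mem_insert_iff, mem_singleton_iff] at hx hy
    rcases hx with rfl | rfl | rfl
    · rcases hy with rfl | rfl | rfl
      · exact k3.1
      · exact k3.2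
      · rw [D'.h0]; exact (hw D rfl hb1 0).1
    · rcases hy with rfl | rfl | rfl
      · exact k4.1
      · exact k4.2
      · rw [D'.h0]; exact (hw D rfl hb1 (-1)).2
    · rcases hy with rfl | rfl | rfl
      · apply sk; rw [D.h0]; exact (hw D' rfl hb0 0).1
      · apply sk; rw [D.h0]; exact (hw D' rfl hb0 (-1)).2
      · rw [D.h0, D'.h0]; exact E.s2 _ _
  · rcases S.linked hij hb0 with ⟨m, hm, h1, h2⟩ | ⟨m, hm, h1, h2⟩
    · exact S.pair_or E hω hgen hij hm h1 h2 D D'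
    · exact (S.pair_or E hω hgen hij.symm hm h1 h2 D' D).symm

end Setup
end Pairs

open Set LieAlgebra TensorProduct

section Tri
variable {V : Type*} [AddCommGroup V] [Module ℝ V] {B : LinearMap.BilinForm ℝ V} {R : Set V}
    {l : ℕ} {P : Set V} {a : V} {k : V → ℕ} {g : V → Bool} {ω : V → V → ℂ}
    {L : Type*} [LieRing L] [LieAlgebra ℂ L] {hb : Vc V → L} {eb : V → L}
    {e f h : P → ℤ → L}

/-- The span of all Cartan-type elements. -/
def hSpan {V : Type*} [AddCommGroup V] [Module ℝ V] {P : Set V}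
    {L : Type*} [LieRing L] [LieAlgebra ℂ L] (hb : Vc V → L) (h : P → ℤ → L) : Submodule ℂ L :=
  Submodule.span ℂ (range hb ∪ range (fun p : P × ℤ => h p.1 p.2))

/-- Degree of `e i n`. -/
def dg {V : Type*} [AddCommGroup V] [Module ℝ V] {P : Set V} (a : V) (k : V → ℕ) (p : P × ℤ) : V :=
  (p.1 : V) + ((p.2 : ℝ) * k p.1) • a

/-- Degree of a word. -/
def wdeg {V : Type*} [AddCommGroup V] [Module ℝ V] {P : Set V} (a : V) (k : V → ℕ)
    (p : (P × ℤ) × List (P × ℤ)) : V := dg a k p.1 + (p.2.map (dg a k)).sum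

namespace Setup

theorem tri (S : Setup B R l P a k g) (E : Ell B a P k g ω hb eb) (hω : IsTuning B P ω)
    (hgen : LieSubalgebra.lieSpan ℂ L (range hb ∪ eb '' bfull a P k g) = ⊤)
    (D : ∀ i, LoopData B a k g hb eb i (e i) (f i) (h i)) :
    wdSpan (fun p : P × ℤ => e p.1 p.2) ⊔ hSpan hb h ⊔ wdSpan (fun p : P × ℤ => f p.1 (-p.2)) = ⊤ := by
  set xe : P × ℤ → L := fun p => e p.1 p.2 with xe_def
  set xf : P × ℤ → L := fun p => f p.1 (-p.2) with xf_def
  have me : ∀ i n, e i n ∈ range xe := fun i n => ⟨(i, n), rfl⟩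
  have mf : ∀ i n, f i n ∈ range xf := fun i n => ⟨(i, -n), by simp [xf_def]⟩
  have hbm : ∀ σ, hb σ ∈ hSpan hb h := fun σ => Submodule.subset_span (Or.inl ⟨σ, rfl⟩)
  have hm : ∀ i n, h i n ∈ hSpan hb h := fun i n => Submodule.subset_span (Or.inr ⟨(i, n), rfl⟩)
  have re : ∀ i, Submodule.span ℂ (range (e i)) ≤ Submodule.span ℂ (range xe) := fun i =>
    Submodule.span_mono (by rintro _ ⟨n, rfl⟩; exact me i n)
  have rf : ∀ i, Submodule.span ℂ (range (f i)) ≤ Submodule.span ℂ (range xf) := fun i =>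
    Submodule.span_mono (by rintro _ ⟨n, rfl⟩; exact mf i n)
  have pc : ∀ {i j}, i ≠ j → PairConcl (e i) (f i) (h i) (e j) (f j) (h j) := fun hij =>
    S.pair_concl E hω hgen hij (D _) (D _)
  have hef : ∀ i m j n, ⁅e i m, f j n⁆ ∈ hSpan hb h := by
    intro i m j n
    by_cases hij : i = j
    · subst hij
      rw [(D i).loop.ef]
      refine add_mem (hm _ _) ?_
      split_ifs
      · exact Submodule.smul_mem _ _ (hbm _)
      · exact zero_mem _
    · rw [(pc hij).ef]; exact zero_mem _
  have hie : ∀ i m j n, ⁅h i m, e j n⁆ ∈ Submodule.span ℂ (range xe) := by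
    intro i m j n
    by_cases hij : i = j
    · subst hij
      rw [(D i).loop.he]
      exact Submodule.smul_mem _ _ (Submodule.subset_span (me _ _))
    · exact re j ((pc hij).he m n)
  have hif : ∀ i m j n, ⁅h i m, f j n⁆ ∈ Submodule.span ℂ (range xf) := by
    intro i m j n
    by_cases hij : i = j
    · subst hij
      rw [(D i).loop.hf]
      exact Submodule.neg_mem _ (Submodule.smul_mem _ _ (Submodule.subset_span (mf _ _)))
    · exact rf j ((pc hij).hf m n)
  have ind : ∀ {x : L} {N : Submodule ℂ L} , (∀ σ, ⁅hb σ, x⁆ ∈ N) → (∀ i n, ⁅h i n, x⁆ ∈ N) →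
      ∀ y ∈ hSpan hb h, ⁅y, x⁆ ∈ N := by
    intro x N h1 h2 y hy
    induction hy using Submodule.span_induction with
    | mem z hz => rcases hz with ⟨σ, rfl⟩ | ⟨p, rfl⟩
                  · exact h1 σ
                  · exact h2 _ _
    | zero => simp
    | add u v _ _ h1 h2 => rw [add_lie]; exact add_mem h1 h2
    | smul c u _ h1 => rw [smul_lie]; exact Submodule.smul_mem _ _ h1
  have sk : ∀ {x y : L} {N : Submodule ℂ L}, ⁅x, y⁆ ∈ N → ⁅y, x⁆ ∈ N := fun h => by
    rw [← lie_skew]; exact Submodule.neg_mem _ h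
  have hbh : ∀ σ i n, ⁅hb σ, h i n⁆ = 0 := by
    intro σ i n
    rw [(D i).loop.hdef, leibniz_lie, (S.weight E (D i) σ n).1, (S.weight E (D i) σ 0).2, smul_lie, lie_neg,
      lie_smul]; simp
  have spe : ∀ x ∈ Submodule.span ℂ (range xe), ∀ i n, ⁅x, f i n⁆ ∈ hSpan hb h := by
    intro x hx i n
    induction hx using Submodule.span_induction with
    | mem z hz => obtain ⟨p, rfl⟩ := hz; exact hef _ _ _ _
    | zero => simp
    | add u v _ _ h1 h2 => rw [add_lie]; exact add_mem h1 h2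
    | smul c u _ h1 => rw [smul_lie]; exact Submodule.smul_mem _ _ h1
  have spf : ∀ x ∈ Submodule.span ℂ (range xf), ∀ i n, ⁅e i n, x⁆ ∈ hSpan hb h := by
    intro x hx i n
    induction hx using Submodule.span_induction with
    | mem z hz => obtain ⟨p, rfl⟩ := hz; exact hef _ _ _ _
    | zero => simp
    | add u v _ _ h1 h2 => rw [lie_add]; exact add_mem h1 h2
    | smul c u _ h1 => rw [lie_smul]; exact Submodule.smul_mem _ _ h1
  have hih : ∀ i m j n, ⁅h i m, h j n⁆ ∈ hSpan hb h := by
    intro i m j n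
    rw [(D j).loop.hdef, leibniz_lie]
    exact add_mem (spe _ (hie _ _ _ _) _ _) (spf _ (hif _ _ _ _) _ _)
  refine triangular xe xf (hSpan hb h) _ hgen ?_ (fun i j => hef _ _ _ _) ?_ ?_ ?_
  · rintro x (⟨σ, rfl⟩ | ⟨μ, hμ, rfl⟩)
    · exact Or.inl ((le_sup_right.trans le_sup_left : hSpan hb h ≤ _) (hbm σ))
    · have ce : ∀ i n, e i n ∈ Submodule.span ℂ (range xe) ⊔ hSpan hb h ⊔ Submodule.span ℂ (range xf) :=
        fun i n => (le_sup_left.trans le_sup_left : Submodule.span ℂ (range xe) ≤ _)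
          (Submodule.subset_span (me i n))
      have cf : ∀ i n, f i n ∈ Submodule.span ℂ (range xe) ⊔ hSpan hb h ⊔ Submodule.span ℂ (range xf) :=
        fun i n => (le_sup_right : Submodule.span ℂ (range xf) ≤ _)
          (Submodule.subset_span (mf i n))
      rcases hμ with (hμ | ⟨α, hα, rfl⟩) | (hμ | ⟨α, hα, hh⟩)
      · left; rw [← (D ⟨μ, hμ⟩).e0]; exact ce _ _
      · rcases hg : g α with _ | _
        · left; rw [← (D ⟨α, hα⟩).e1 hg]; exact ce _ _
        · right; refine ⟨_, _, Or.inl ⟨me ⟨α, hα⟩ 0, me ⟨α, hα⟩ 1⟩, 1/4, ?_⟩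
          rw [(D ⟨α, hα⟩).z1 hg]; module
      · left
        have := (D ⟨-μ, hμ⟩).f0
        rw [neg_neg] at this
        rw [← this]; exact cf _ _
      · have hh' : μ = -starMap a k g α := by rw [hh, neg_neg]
        rw [hh']
        rcases hg : g α with _ | _
        · left; rw [← (D ⟨α, hα⟩).f1 hg]; exact cf _ _
        · right; refine ⟨_, _, Or.inr ⟨mf ⟨α, hα⟩ 0, mf ⟨α, hα⟩ (-1)⟩, -1/4, ?_⟩
          rw [(D ⟨α, hα⟩).z2 hg]; module
  · intro y hy i
    refine ind (fun σ => ?_) (fun _ _ => hie _ _ _ _) y hy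
    rw [(S.weight E (D i.1) σ i.2).1]; exact Submodule.smul_mem _ _ (Submodule.subset_span ⟨i, rfl⟩)
  · intro y hy i
    refine ind (fun σ => ?_) (fun _ _ => hif _ _ _ _) y hy
    rw [(S.weight E (D i.1) σ (-i.2)).2]; exact Submodule.neg_mem _ (Submodule.smul_mem _ _ (Submodule.subset_span ⟨i, rfl⟩))
  · intro y hy z hz
    refine ind (fun σ => sk (ind (fun τ => ?_) (fun i n => sk ?_) z hz))
      (fun i m => sk (ind (fun τ => ?_) (fun j n => hih _ _ _ _) z hz)) y hy
    · rw [E.s2]; exact zero_mem _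
    · rw [hbh]; exact zero_mem _
    · rw [hbh]; exact zero_mem _

/-- degrees of the loop elements -/
theorem loop_deg (S : Setup B R l P a k g) {gr : V → Submodule ℂ L}
    (hm : ∀ σ τ : V, ∀ x ∈ gr σ, ∀ y ∈ gr τ, ⁅x, y⁆ ∈ gr (σ + τ))
    (he : ∀ μ ∈ bfull a P k g, eb μ ∈ gr μ) {i : P} {e f h : ℤ → L}
    (D : LoopData B a k g hb eb i e f h) (n : ℤ) :
    e n ∈ gr (dg a k (i, n)) ∧ f (-n) ∈ gr (-dg a k (i, n)) ∧ h n ∈ gr (((n:ℝ) * k i) • a) := by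
  have mm : ∀ {σ τ ρ : V} {x y : L}, x ∈ gr σ → y ∈ gr τ → ρ = σ + τ → ⁅x, y⁆ ∈ gr ρ := by
    intro σ τ ρ x y h1 h2 h3; rw [h3]; exact hm _ _ _ h1 _ h2
  have e0 : e 0 ∈ gr (i:V) := by rw [D.e0]; exact he _ (mem_i i)
  have f0 : f 0 ∈ gr (-(i:V)) := by rw [D.f0]; exact he _ (mem_ni i)
  have h1 : h 1 ∈ gr ((k i : ℝ) • a) ∧ h (-1) ∈ gr (-((k i : ℝ) • a)) := by
    have st := star_eq (a := a) (k := k) (g := g) i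
    have hm1 : h (-1) = ⁅e 0, f (-1)⁆ := by rw [D.loop.ef]; simp
    rw [D.loop.hdef 1, hm1]
    rcases hg : g i with _ | _
    · have c1 : cMap g (i:V) = 1 := by simp [cMap, hg]
      rw [c1] at st; push_cast at st
      rw [D.e1 hg, D.f1 hg]
      exact ⟨mm (he _ (mem_s i)) f0 (by rw [st]; module), mm e0 (he _ (mem_ns i)) (by rw [st]; module)⟩
    · have c1 : cMap g (i:V) = 2 := by simp [cMap, hg]
      rw [c1] at st; push_cast at st
      rw [D.e1' hg, D.f1' hg]
      exact ⟨mm (mm (he _ (mem_ni i)) (he _ (mem_s i)) rfl) f0 (by rw [st]; module),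
        mm e0 (mm (he _ (mem_ns i)) (he _ (mem_i i)) rfl) (by rw [st]; module)⟩
  have dn : ∀ n, dd (if g i = true then 6 else 2) n ≠ 0 := by
    intro n; rw [dd]; split_ifs <;> norm_num
  have up : ∀ n, e (n+1) = (dd (if g i = true then 6 else 2) 1)⁻¹ • ⁅h 1, e n⁆ := by
    intro n; rw [D.loop.he, smul_smul, inv_mul_cancel₀ (dn _), one_smul, add_comm]
  have dw : ∀ n, e (n-1) = (dd (if g i = true then 6 else 2) (-1))⁻¹ • ⁅h (-1), e n⁆ := by
    intro n; rw [D.loop.he, smul_smul, inv_mul_cancel₀ (dn _), one_smul]; congr 1; ring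
  have upf : ∀ n, f (n+1) = (-(dd (if g i = true then 6 else 2) 1)⁻¹) • ⁅h 1, f n⁆ := by
    intro n; rw [D.loop.hf, neg_smul, smul_neg, neg_neg, smul_smul, inv_mul_cancel₀ (dn _), one_smul, add_comm]
  have dwf : ∀ n, f (n-1) = (-(dd (if g i = true then 6 else 2) (-1))⁻¹) • ⁅h (-1), f n⁆ := by
    intro n; rw [D.loop.hf, neg_smul, smul_neg, neg_neg, smul_smul, inv_mul_cancel₀ (dn _), one_smul]
    congr 1; ring
  have ef : ∀ n, e n ∈ gr (dg a k (i, n)) ∧ f n ∈ gr (-(i:V) + ((n:ℝ) * k i) • a) := by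
    intro n
    induction n using Int.induction_on with
    | zero => simpa [dg] using ⟨e0, f0⟩
    | succ n ih =>
      rw [up, upf]
      exact ⟨Submodule.smul_mem _ _ (mm h1.1 ih.1 (by simp only [dg]; push_cast; module)),
        Submodule.smul_mem _ _ (mm h1.1 ih.2 (by push_cast; module))⟩
    | pred n ih =>
      rw [dw, dwf]
      exact ⟨Submodule.smul_mem _ _ (mm h1.2 ih.1 (by simp only [dg]; push_cast; module)),
        Submodule.smul_mem _ _ (mm h1.2 ih.2 (by push_cast; module))⟩
  refine ⟨(ef n).1, ?_, ?_⟩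
  · have := (ef (-n)).2
    convert this using 2
    simp only [dg]; push_cast; module
  · rw [D.loop.hdef]; exact mm (ef n).1 f0 (by simp only [dg]; module)

end Setup

theorem wd_deg {gr : V → Submodule ℂ L}
    (hm : ∀ σ τ : V, ∀ x ∈ gr σ, ∀ y ∈ gr τ, ⁅x, y⁆ ∈ gr (σ + τ)) (x : P × ℤ → L) (ε : ℝ)
    (hx : ∀ p, x p ∈ gr (ε • dg a k p)) (p : (P × ℤ) × List (P × ℤ)) :
    wd x p.1 p.2 ∈ gr (ε • wdeg a k p) := by
  obtain ⟨i, w⟩ := p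
  induction w generalizing i with
  | nil => simpa [wdeg, wd] using hx i
  | cons j w ih =>
    have := hm _ _ _ (hx i) _ (ih j)
    rw [← smul_add] at this
    simpa [wd, wdeg] using this

end Tri

open Set LieAlgebra TensorProduct

section Gr
variable {V : Type*} [AddCommGroup V] [Module ℝ V] {B : LinearMap.BilinForm ℝ V} {R : Set V}
    {l : ℕ} {P : Set V} {a : V} {k : V → ℕ} {g : V → Bool} {ω : V → V → ℂ}
    {L : Type*} [LieRing L] [LieAlgebra ℂ L] {hb : Vc V → L} {eb : V → L}
    {e f h : P → ℤ → L} {gr : V → Submodule ℂ L}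

open scoped Classical in
/-- Abstract form of the grading hypotheses. -/
structure GrHyp {V : Type*} [AddCommGroup V] [Module ℝ V] (a : V) (P : Set V) (k : V → ℕ) (g : V → Bool)
    {L : Type*} [LieRing L] [LieAlgebra ℂ L] (hb : Vc V → L) (eb : V → L) (gr : V → Submodule ℂ L) : Prop where
  int : DirectSum.IsInternal gr
  mul : ∀ σ τ : V, ∀ x ∈ gr σ, ∀ y ∈ gr τ, ⁅x, y⁆ ∈ gr (σ + τ)
  h0 : ∀ σ, hb σ ∈ gr 0
  he : ∀ μ ∈ bfull a P k g, eb μ ∈ gr μ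

/-- Everything we need in `𝔤`. -/
structure GrAll {V : Type*} [AddCommGroup V] [Module ℝ V] (B : LinearMap.BilinForm ℝ V) (R : Set V)
    (l : ℕ) (P : Set V) (a : V) (k : V → ℕ) (g : V → Bool) (ω : V → V → ℂ)
    {L : Type*} [LieRing L] [LieAlgebra ℂ L] (hb : Vc V → L) (eb : V → L) (gr : V → Submodule ℂ L)
    (e f h : P → ℤ → L) : Prop where
  S : Setup B R l P a k g
  E : Ell B a P k g ω hb eb
  hω : IsTuning B P ω
  hgen : LieSubalgebra.lieSpan ℂ L (range hb ∪ eb '' bfull a P k g) = ⊤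
  D : ∀ i, LoopData B a k g hb eb i (e i) (f i) (h i)
  G : GrHyp a P k g hb eb gr

theorem wdeg_lc [Fintype P] [DecidableEq P] (p : (P × ℤ) × List (P × ℤ)) : ∃ z : ℤ, wdeg a k p =
    lc a (fun j => (((p.1 :: p.2).countP (fun q => q.1 = j) : ℕ) : ℝ)) (z:ℝ) := by
  obtain ⟨i, w⟩ := p
  have one : ∀ q : P × ℤ, dg a k q = lc a (fun j => if q.1 = j then (1:ℝ) else 0) (((q.2 * k q.1 : ℤ)) : ℝ) := by
    intro q
    have : (fun j => if q.1 = j then (1:ℝ) else 0) = Pi.single q.1 (1:ℝ) := by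
      funext j; simp [Pi.single_apply, eq_comm]
    rw [this, Setup.lc_single, dg]; push_cast; simp
  induction w generalizing i with
  | nil =>
    refine ⟨i.2 * k i.1, ?_⟩
    simp only [wdeg, List.map_nil, List.sum_nil, add_zero, one, List.countP_cons, List.countP_nil, zero_add]
    simp
  | cons j w ih =>
    obtain ⟨z, hz⟩ := ih j
    refine ⟨i.2 * k i.1 + z, ?_⟩
    have : wdeg a k (i, j :: w) = dg a k i + wdeg a k (j, w) := by simp [wdeg]
    rw [this, hz, one, Setup.lc_add]
    congr 1
    · funext t
      simp only [Pi.add_apply, List.countP_cons]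
      push_cast
      simp only [decide_eq_true_eq]
      ring
    · push_cast; ring

/-- Words of a given degree. -/
def wsp {V : Type*} [AddCommGroup V] [Module ℝ V] {P : Set V} (a : V) (k : V → ℕ)
    {L : Type*} [LieRing L] [LieAlgebra ℂ L] (x : P × ℤ → L) (τ : V) : Submodule ℂ L :=
  Submodule.span ℂ ((fun p : (P × ℤ) × List (P × ℤ) => wd x p.1 p.2) '' {p | wdeg a k p = τ})

theorem swap_lemma {u : ℤ → L} (hs : ∀ m n, ⁅u (m+1), u n⁆ = -⁅u m, u (n+1)⁆) (m n : ℤ) :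
    ⁅u m, u n⁆ ∈ Submodule.span ℂ {⁅u 0, u (m+n)⁆} := by
  induction m using Int.induction_on generalizing n with
  | zero => rw [zero_add]; exact Submodule.mem_span_singleton_self _
  | succ m ih =>
    rw [hs]; have := ih (n+1)
    rw [show (m:ℤ) + 1 + n = m + (n+1) by ring]
    exact neg_mem this
  | pred m ih =>
    have h1 := hs (-m-1) (n-1)
    rw [sub_add_cancel, sub_add_cancel] at h1
    have := ih (n-1)
    rw [h1, show (-(m:ℤ)) + (n-1) = -m - 1 + n by ring] at this
    simpa using neg_mem this

theorem Setup.wbase (S : Setup B R l P a k g) (x : P × ℤ → L) (i : P)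
    (h1 : ∀ m n, (g i = false ∨ Even (m+n)) → ⁅x (i, m), x (i, n)⁆ = 0)
    (h2 : ∀ m n, ⁅x (i, m+1), x (i, n)⁆ = -⁅x (i, m), x (i, n+1)⁆)
    (h3 : ∀ q m n, ⁅x (i, q), ⁅x (i, m), x (i, n)⁆⁆ = 0) (q s : ℝ) :
    (wsp a k x (q • (i:V) + s • a) ≠ ⊥ → q • (i:V) + s • a ∈ R) ∧
    ∃ v, wsp a k x (q • (i:V) + s • a) ≤ Submodule.span ℂ {v} := by
  classical
  haveI : Fintype P := S.hfs.2.2.2.2.1.fintype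
  have kp : (0:ℝ) < k i := by exact_mod_cast S.k_pos i
  have key : ∀ p : (P × ℤ) × List (P × ℤ), wdeg a k p = q • (i:V) + s • a → wd x p.1 p.2 ≠ 0 →
      (q = 1 ∧ ∃ n : ℤ, s = n * k i ∧ wd x p.1 p.2 = x (i, n)) ∨
      (q = 2 ∧ g i = true ∧ ∃ m n : ℤ, Odd (m+n) ∧ s = ((m+n : ℤ):ℝ) * k i ∧
        wd x p.1 p.2 = ⁅x (i, m), x (i, n)⁆) := by
    rintro ⟨⟨j, n⟩, w⟩ hw hne
    obtain ⟨z, hz⟩ := wdeg_lc (a := a) (k := k) ((j, n), w)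
    rw [hw, ← Setup.lc_single] at hz
    have hz := (S.lc_inj hz).1
    have all : ∀ y ∈ ((j, n) :: w), y.1 = i := by
      intro y hy
      by_contra hc
      have := congrFun hz y.1
      rw [Pi.single_eq_of_ne hc] at this
      have h0 : ((j, n) :: w).countP (fun q => decide (q.1 = y.1)) = 0 := by exact_mod_cast this.symm
      rw [List.countP_eq_zero] at h0
      exact h0 y hy (by simp)
    have hj : j = i := all (j, n) (by simp)
    subst hj
    rcases w with _ | ⟨⟨j2, m⟩, w⟩
    · left
      simp only [wdeg, List.map_nil, List.sum_nil, add_zero, dg] at hw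
      have := S.one_lc (i := j) (x := 1) (x' := q) (r := n * k j) (r' := s) (by rw [one_smul]; exact hw)
      exact ⟨this.1.symm, n, this.2.symm, rfl⟩
    · have hj2 : j2 = j := all (j2, m) (by simp)
      subst hj2
      rcases w with _ | ⟨⟨j3, m'⟩, w⟩
      · right
        simp only [wdeg, List.map_nil, List.sum_nil, add_zero, dg, List.map_cons, List.sum_cons] at hw
        have := S.one_lc (i := j2) (x := 2) (x' := q) (r := ((n+m:ℤ):ℝ) * k j2) (r' := s) (by
          rw [← hw]; push_cast; module)
        simp only [wd] at hne
        have ng : ¬ (g j2 = false ∨ Even (n+m)) := fun h => hne (h1 _ _ h)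
        rw [not_or, Int.not_even_iff_odd] at ng
        exact ⟨this.1.symm, by simpa using ng.1, n, m, ng.2, this.2.symm, rfl⟩
      · exfalso
        have hj3 : j3 = j2 := all (j3, m') (by simp)
        subst hj3
        apply hne
        have z3 : ∀ (w : List (P × ℤ)) (n m m' : ℤ), (∀ y ∈ w, y.1 = j3) →
            wd x (j3, n) ((j3, m) :: (j3, m') :: w) = 0 := by
          intro w
          induction w with
          | nil => intro n m m' _; exact h3 _ _ _
          | cons y w ih =>
            intro n m m' hy
            obtain ⟨y1, y2⟩ := y
            have : y1 = j3 := hy (y1, y2) (by simp)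
            subst this
            rw [wd, ih m m' y2 (fun y h => hy y (by simp [h])), lie_zero]
        exact z3 w n m m' (fun y h => all y (by simp [h]))
  constructor
  · intro hne
    have : ∃ p : (P × ℤ) × List (P × ℤ), wdeg a k p = q • (i:V) + s • a ∧ wd x p.1 p.2 ≠ 0 := by
      by_contra! hc
      apply hne
      rw [wsp, Submodule.span_eq_bot]
      rintro _ ⟨p, hp, rfl⟩; exact hc p hp
    obtain ⟨p, hp, hn⟩ := this
    rcases key p hp hn with ⟨rfl, n, rfl, _⟩ | ⟨rfl, hg, m, n, ho, rfl, _⟩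
    · rw [one_smul]; exact S.mem_one i n
    · rw [S.line_iff]
      right
      refine ⟨hg, 1, m+n, Or.inl rfl, ho, ?_⟩
      rw [← Int.cast_smul_eq_zsmul ℝ, ← Int.cast_smul_eq_zsmul ℝ]; push_cast; module
  · by_cases hs : ∃ n : ℤ, s = n * k i
    · obtain ⟨n0, rfl⟩ := hs
      have inj : ∀ n : ℤ, (n0:ℝ) * k i = n * k i → n = n0 := fun n h => by
        have := mul_right_cancel₀ kp.ne' h; exact_mod_cast this.symm
      refine ⟨if q = 1 then x (i, n0) else ⁅x (i, 0), x (i, n0)⁆, ?_⟩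
      rw [wsp, Submodule.span_le]
      rintro _ ⟨p, hp, rfl⟩
      dsimp only
      by_cases h0 : wd x p.1 p.2 = 0
      · rw [h0]; exact zero_mem _
      rcases key p hp h0 with ⟨rfl, n, hn, hw⟩ | ⟨rfl, hg, m, n, ho, hn, hw⟩
      · rw [hw, if_pos rfl, inj n hn]; exact Submodule.mem_span_singleton_self _
      · rw [hw, if_neg (by norm_num), ← inj _ hn]
        exact swap_lemma (u := fun n => x (i, n)) h2 m n
    · refine ⟨0, ?_⟩
      rw [wsp, Submodule.span_le]
      rintro _ ⟨p, hp, rfl⟩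
      dsimp only
      by_cases h0 : wd x p.1 p.2 = 0
      · rw [h0]; exact zero_mem _
      rcases key p hp h0 with ⟨rfl, n, hn, hw⟩ | ⟨rfl, hg, m, n, ho, hn, hw⟩
      · exact absurd ⟨n, hn⟩ hs
      · exact absurd ⟨_, hn⟩ hs

namespace GrAll

/-- spanning family -/
def tfam {V : Type*} [AddCommGroup V] [Module ℝ V] {P : Set V}
    {L : Type*} [LieRing L] [LieAlgebra ℂ L] (hb : Vc V → L) (e f h : P → ℤ → L) :
    (((P × ℤ) × List (P × ℤ)) ⊕ (Vc V ⊕ (P × ℤ))) ⊕ ((P × ℤ) × List (P × ℤ)) → L :=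
  Sum.elim (Sum.elim (fun p => wd (fun p : P × ℤ => e p.1 p.2) p.1 p.2)
    (Sum.elim hb (fun p => h p.1 p.2))) (fun p => wd (fun p : P × ℤ => f p.1 (-p.2)) p.1 p.2)

/-- degrees of the spanning family -/
def tdeg {V : Type*} [AddCommGroup V] [Module ℝ V] {P : Set V} (a : V) (k : V → ℕ) :
    (((P × ℤ) × List (P × ℤ)) ⊕ (Vc V ⊕ (P × ℤ))) ⊕ ((P × ℤ) × List (P × ℤ)) → V :=
  Sum.elim (Sum.elim (wdeg a k)
    (Sum.elim (fun _ => 0) (fun p => ((p.2:ℝ) * k p.1) • a))) (fun p => -wdeg a k p)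

theorem gr_span (A : GrAll B R l P a k g ω hb eb gr e f h) (σ : V) :
    gr σ = Submodule.span ℂ (tfam hb e f h '' {x | tdeg a k x = σ}) := by
  classical
  apply gr_eq_span (by convert A.G.int)
  · rintro ((p | σ | p) | p)
    · have := wd_deg (a := a) (k := k) A.G.mul (fun p : P × ℤ => e p.1 p.2) 1 (fun p => by
        rw [one_smul]; exact (A.S.loop_deg A.G.mul A.G.he (A.D p.1) p.2).1) p
      rw [one_smul] at this
      exact this
    · exact A.G.h0 σ
    · exact (A.S.loop_deg A.G.mul A.G.he (A.D p.1) p.2).2.2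
    · have := wd_deg (a := a) (k := k) A.G.mul (fun p : P × ℤ => f p.1 (-p.2)) (-1) (fun p => by
        rw [neg_one_smul]; exact (A.S.loop_deg A.G.mul A.G.he (A.D p.1) p.2).2.1) p
      rw [neg_one_smul] at this
      exact this
  · rw [← A.S.tri A.E A.hω A.hgen A.D, tfam, Sum.elim_range, Sum.elim_range, Sum.elim_range,
      Submodule.span_union, Submodule.span_union]
    rfl

theorem form (A : GrAll B R l P a k g ω hb eb gr e f h) [Fintype P] {σ : V} (hσ : gr σ ≠ ⊥) :
    ∃ ε : ℝ, (ε = 1 ∨ ε = -1) ∧ ∃ (n : P → ℕ) (z : ℤ), σ = ε • lc a (fun i => (n i : ℝ)) (z:ℝ) := by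
  classical
  have : ∃ x, tdeg (P := P) a k x = σ := by
    by_contra! hc
    apply hσ
    rw [A.gr_span, Submodule.span_eq_bot]
    rintro _ ⟨x, hx, rfl⟩; exact absurd hx (hc x)
  obtain ⟨x, rfl⟩ := this
  rcases x with ((p | σ | p) | p)
  · obtain ⟨z, hz⟩ := wdeg_lc (a := a) (k := k) p
    exact ⟨1, Or.inl rfl, _, z, by rw [one_smul]; exact hz⟩
  · exact ⟨1, Or.inl rfl, 0, 0, by simp [tdeg, lc]⟩
  · exact ⟨1, Or.inl rfl, 0, p.2 * k p.1, by simp [tdeg, lc]⟩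
  · obtain ⟨z, hz⟩ := wdeg_lc (a := a) (k := k) p
    exact ⟨-1, Or.inr rfl, _, z, by rw [neg_one_smul, ← hz]; rfl⟩

theorem gr_a (A : GrAll B R l P a k g ω hb eb gr e f h) (r : ℝ) :
    gr (r • a) ≤ Submodule.span ℂ ({y | r = 0 ∧ y ∈ range hb} ∪
      (fun p : P × ℤ => h p.1 p.2) '' {p | r = (p.2:ℝ) * k p.1}) := by
  classical
  haveI : Fintype P := A.S.hfs.2.2.2.2.1.fintype
  have nw : ∀ (p : (P × ℤ) × List (P × ℤ)) (r : ℝ), wdeg a k p ≠ r • a := by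
    intro p r hp
    obtain ⟨z, hz⟩ := wdeg_lc (a := a) (k := k) p
    have h0 : r • a = lc a (fun _ : P => (0:ℝ)) r := by simp [lc]
    rw [hp, h0] at hz
    have := congrFun (A.S.lc_inj hz).1 p.1.1
    simp only [List.countP_cons, decide_true, if_true] at this
    push_cast at this
    have h2 : (0:ℝ) ≤ (List.countP (fun q => decide (q.1 = p.1.1)) p.2 : ℝ) := by positivity
    linarith
  rw [A.gr_span, Submodule.span_le]
  rintro _ ⟨((p | σ | p) | p), hx, rfl⟩
  · exact absurd hx (nw p r)
  · refine Submodule.subset_span (Or.inl ⟨?_, σ, rfl⟩)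
    have : (0:V) = r • a := hx
    rcases smul_eq_zero.1 this.symm with h | h
    · exact h
    · exact absurd h A.S.a0
  · refine Submodule.subset_span (Or.inr ⟨p, ?_, rfl⟩)
    have : ((p.2:ℝ) * k p.1) • a = r • a := hx
    exact (smul_left_injective ℝ A.S.a0 this).symm
  · have : -wdeg a k p = r • a := hx
    exact absurd (by rw [neg_smul, ← this, neg_neg]) (nw p (-r))

theorem gr_wsp (A : GrAll B R l P a k g ω hb eb gr e f h) (i : P) (q s : ℝ) (hq : 0 < q) :
    gr (q • (i:V) + s • a) ≤ wsp a k (fun p : P × ℤ => e p.1 p.2) (q • (i:V) + s • a) ∧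
    gr (-(q • (i:V) + s • a)) ≤ wsp a k (fun p : P × ℤ => f p.1 (-p.2)) (q • (i:V) + s • a) := by
  classical
  haveI : Fintype P := A.S.hfs.2.2.2.2.1.fintype
  have nw : ∀ (p : (P × ℤ) × List (P × ℤ)), wdeg a k p ≠ -(q • (i:V) + s • a) := by
    intro p hp
    obtain ⟨z, hz⟩ := wdeg_lc (a := a) (k := k) p
    rw [hp, ← Setup.lc_single, ← neg_one_smul ℝ, Setup.lc_smul] at hz
    have := congrFun (A.S.lc_inj hz).1 i
    simp only [Pi.smul_apply, Pi.single_eq_same, smul_eq_mul] at this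
    have h2 : (0:ℝ) ≤ (List.countP (fun q => decide (q.1 = i)) (p.1 :: p.2) : ℝ) := by positivity
    linarith
  have na : ∀ r q' s' : ℝ, q' ≠ 0 → r • a ≠ q' • (i:V) + s' • a := by
    intro r q' s' h0 h1
    exact h0 (A.S.one_lc (i := i) (x := 0) (r := r) (by rw [zero_smul, zero_add]; exact h1)).1.symm
  have ng : -(q • (i:V) + s • a) = (-q) • (i:V) + (-s) • a := by module
  constructor
  · rw [A.gr_span, Submodule.span_le]
    rintro _ ⟨((p | σ | p) | p), hx, rfl⟩
    · exact Submodule.subset_span ⟨p, hx, rfl⟩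
    · exact absurd ((zero_smul ℝ a).trans hx) (na _ _ _ hq.ne')
    · exact absurd hx (na _ _ _ hq.ne')
    · have : -wdeg a k p = q • (i:V) + s • a := hx
      exact absurd (by rw [← this, neg_neg]) (nw p)
  · rw [A.gr_span, Submodule.span_le]
    rintro _ ⟨((p | σ | p) | p), hx, rfl⟩
    · exact absurd hx (nw p)
    · rw [ng] at hx
      exact absurd ((zero_smul ℝ a).trans hx) (na _ (-q) (-s) (by linarith))
    · rw [ng] at hx
      exact absurd hx (na _ _ _ (by linarith))
    · exact Submodule.subset_span ⟨p, neg_injective hx, rfl⟩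

theorem base (A : GrAll B R l P a k g ω hb eb gr e f h) (i : P) (q s : ℝ) (hq : q ≠ 0) :
    (gr (q • (i:V) + s • a) ≠ ⊥ → q • (i:V) + s • a ∈ R) ∧
    ∃ v, gr (q • (i:V) + s • a) ≤ Submodule.span ℂ {v} := by
  have D2 : ∀ m n : ℤ, (g i = false ∨ Even (m+n)) → ((if g i = true then 6 else 2) = 2 ∨ Even (m+n)) := by
    rintro m n (h | h)
    · left; simp [h]
    · exact Or.inr h
  haveI : Fintype P := A.S.hfs.2.2.2.2.1.fintype
  have dn : dd (if g i = true then 6 else 2) 1 ≠ 0 := by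
    rw [dd]; split_ifs <;> norm_num
  have dm : dd (if g i = true then 6 else 2) (-1) ≠ 0 := by
    rw [dd]; split_ifs <;> norm_num
  have hp := A.D i
  have ee1 : ∀ m n : ℤ, (g i = false ∨ Even (m+n)) → ⁅e i m, e i n⁆ = 0 := fun m n h =>
    hp.loop.ee m n (D2 m n h)
  have ff1 : ∀ m n : ℤ, (g i = false ∨ Even (m+n)) → ⁅f i m, f i n⁆ = 0 := fun m n h =>
    hp.loop.ff m n (D2 m n h)
  have ee2 : ∀ m n : ℤ, ⁅e i (m+1), e i n⁆ = -⁅e i m, e i (n+1)⁆ := by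
    intro m n
    rcases Int.even_or_odd (m+n) with ho | ho
    · have h1 := congrArg (fun y => ⁅h i 1, y⁆) (ee1 m n (Or.inr ho))
      simp only [lie_zero] at h1
      rw [leibniz_lie, hp.loop.he, hp.loop.he, smul_lie, lie_smul, ← smul_add] at h1
      have h1 := (smul_eq_zero.1 h1).resolve_left dn
      rw [add_comm m, add_comm n]; exact eq_neg_of_add_eq_zero_left h1
    · rw [ee1 (m+1) n (Or.inr (by rw [add_right_comm]; exact ho.add_one)),
        ee1 m (n+1) (Or.inr (by rw [← add_assoc]; exact ho.add_one)), neg_zero]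
  have ff2 : ∀ m n : ℤ, ⁅f i (m-1), f i n⁆ = -⁅f i m, f i (n-1)⁆ := by
    intro m n
    rcases Int.even_or_odd (m+n) with ho | ho
    · have h1 := congrArg (fun y => ⁅h i (-1), y⁆) (ff1 m n (Or.inr ho))
      simp only [lie_zero] at h1
      rw [leibniz_lie, hp.loop.hf, hp.loop.hf, neg_lie, lie_neg, smul_lie, lie_smul, ← neg_add, ← smul_add,
        neg_eq_zero] at h1
      have h1 := (smul_eq_zero.1 h1).resolve_left dm
      rw [sub_eq_neg_add m, sub_eq_neg_add n]; exact eq_neg_of_add_eq_zero_left h1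
    · rw [ff1 (m-1) n (Or.inr (by rw [sub_add_eq_add_sub]; exact ho.sub_odd odd_one)),
        ff1 m (n-1) (Or.inr (by rw [← add_sub_assoc]; exact ho.sub_odd odd_one)), neg_zero]
  rcases lt_or_gt_of_ne hq with hq | hq
  · obtain ⟨v1, v, v2⟩ := A.S.wbase (fun p : P × ℤ => f p.1 (-p.2)) i
      (fun m n h => ff1 _ _ (h.imp id (fun h => by rw [← neg_add]; exact h.neg)))
      (fun m n => by
        have := ff2 (-m) (-n)
        dsimp only
        rw [show -(m+1) = -m-1 by ring, show -(n+1) = -n-1 by ring]; exact this)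
      (fun _ _ _ => hp.loop.fff _ _ _) (-q) (-s)
    have := (A.gr_wsp i (-q) (-s) (by linarith)).2
    have ng : -((-q) • (i:V) + (-s) • a) = q • (i:V) + s • a := by module
    rw [ng] at this
    refine ⟨fun hn => ?_, v, this.trans v2⟩
    have h2 := v1 (fun h0 => hn (by rw [h0] at this; exact le_bot_iff.1 this))
    rw [← ng]; exact A.S.neg_mem h2
  · obtain ⟨v1, v, v2⟩ := A.S.wbase (fun p : P × ℤ => e p.1 p.2) i ee1 ee2
      (fun _ _ _ => hp.loop.eee _ _ _) q s
    have := (A.gr_wsp i q s hq).1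
    exact ⟨fun hn => v1 (fun h0 => hn (by rw [h0] at this; exact le_bot_iff.1 this)), v, this.trans v2⟩

end GrAll
end Gr

open Set LieAlgebra TensorProduct

section Upper
variable {V : Type*} [AddCommGroup V] [Module ℝ V] {B : LinearMap.BilinForm ℝ V} {R : Set V}
    {l : ℕ} {P : Set V} {a : V} {k : V → ℕ} {g : V → Bool} {ω : V → V → ℂ}
    {L : Type*} [LieRing L] [LieAlgebra ℂ L] {hb : Vc V → L} {eb : V → L}
    {e f h : P → ℤ → L} {gr : V → Submodule ℂ L}

namespace GrAll

theorem wd_weight (A : GrAll B R l P a k g ω hb eb gr e f h) (x : P × ℤ → L) (ε : ℂ) (σ : Vc V)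
    (hx : ∀ p, ⁅hb σ, x p⁆ = (ε * bc B σ p.1) • x p) (p : (P × ℤ) × List (P × ℤ)) :
    ⁅hb σ, wd x p.1 p.2⁆ = (ε * bc B σ (wdeg a k p)) • wd x p.1 p.2 := by
  obtain ⟨i, w⟩ := p
  have d1 : ∀ q : P × ℤ, bc B σ (dg a k q) = bc B σ q.1 := by
    intro q; rw [dg, bc_add, bc_smul, A.S.bc_a, mul_zero, add_zero]
  induction w generalizing i with
  | nil => simp only [wd, wdeg, List.map_nil, List.sum_nil, add_zero, hx, d1]
  | cons j w ih =>
    have e1 : wdeg a k (i, j :: w) = dg a k i + wdeg a k (j, w) := by simp [wdeg]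
    simp only [wd]
    rw [leibniz_lie, hx, ih j, e1, bc_add, d1, smul_lie, lie_smul]
    module

theorem weight (A : GrAll B R l P a k g ω hb eb gr e f h) (σ : Vc V) (τ : V) {x : L} (hx : x ∈ gr τ) :
    ⁅hb σ, x⁆ = bc B σ τ • x := by
  rw [A.gr_span] at hx
  induction hx using Submodule.span_induction with
  | mem z hz =>
    obtain ⟨y, hy, rfl⟩ := hz
    have hy : tdeg a k y = τ := hy
    rw [← hy]
    have b0 : bc B σ 0 = 0 := by simp [bc]
    rcases y with ((p | τ | p) | p)
    · have := A.wd_weight (fun p : P × ℤ => e p.1 p.2) 1 σ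
        (fun p => by rw [one_mul]; exact (A.S.weight A.E (A.D p.1) σ p.2).1) p
      rw [one_mul] at this; exact this
    · simp only [tfam, tdeg, Sum.elim_inl, Sum.elim_inr, A.E.s2, b0, zero_smul]
    · simp only [tfam, tdeg, Sum.elim_inl, Sum.elim_inr, bc_smul, A.S.bc_a, mul_zero, zero_smul]
      rw [(A.D p.1).loop.hdef, leibniz_lie, (A.S.weight A.E (A.D p.1) σ _).1,
        (A.S.weight A.E (A.D p.1) σ 0).2, smul_lie, lie_neg, lie_smul, add_neg_cancel]
    · have := A.wd_weight (fun p : P × ℤ => f p.1 (-p.2)) (-1) σ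
        (fun p => by rw [neg_one_mul, neg_smul]; exact (A.S.weight A.E (A.D p.1) σ (-p.2)).2) p
      simp only [tfam, tdeg, Sum.elim_inr, bc_neg]
      rw [neg_one_mul] at this; exact this
  | zero => simp
  | add u v _ _ h1 h2 => rw [lie_add, h1, h2, smul_add]
  | smul c u _ h1 => rw [lie_smul, h1, smul_comm]

theorem transport (A : GrAll B R l P a k g ω hb eb gr e f h) (i : P) (σ : V) :
    ∃ F : L →ₗ[ℂ] L, (∀ x ∈ gr σ, F x ∈ gr (srefl B i σ)) ∧ ∀ x ∈ gr σ, F x = 0 → x = 0 := by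
  classical
  haveI : Fintype P := A.S.hfs.2.2.2.2.1.fintype
  by_cases h0 : gr σ = ⊥
  · refine ⟨0, fun x _ => zero_mem _, fun x hx _ => ?_⟩
    rw [h0] at hx; simpa using hx
  have pi := A.S.posP i
  obtain ⟨N, hN⟩ : ∃ N : ℤ, 2 * B (i:V) σ = N * B (i:V) i := by
    obtain ⟨ε, hε, n, z, rfl⟩ := A.form h0
    have hc : ∀ j : P, ∃ c : ℤ, 2 * B (i:V) j = c * B (i:V) i := fun j =>
      A.S.hE.integral i (A.S.PR i.2) j (A.S.PR j.2)
    choose c hc using hc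
    have s : ∑ j, (n j:ℝ) * B (i:V) j * 2 = (∑ j, (n j : ℝ) * c j) * B (i:V) i := by
      rw [Finset.sum_mul]; apply Finset.sum_congr rfl; intro j _
      have := hc j; linear_combination (n j : ℝ) * this
    rw [map_smul, A.S.B_lc, smul_eq_mul]
    rw [← Finset.sum_mul] at s
    rcases hε with rfl | rfl
    · refine ⟨∑ j, (n j : ℤ) * c j, ?_⟩
      push_cast; linarith
    · refine ⟨-∑ j, (n j : ℤ) * c j, ?_⟩
      push_cast; linarith
  have sr : srefl B i σ = σ - (N:ℝ) • (i:V) := by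
    rw [srefl_apply]; congr 2; field_simp; linarith
  have s0 := (A.D i).loop.s0
  have wt : ∀ x ∈ gr σ, ⁅h i 0, x⁆ = (N:ℂ) • x := by
    intro x hx
    rw [(A.D i).h0, A.weight _ _ hx, bc_one, vee, map_smul, LinearMap.smul_apply, smul_eq_mul]
    have : 2 / B (i:V) i * B (i:V) σ = N := by field_simp; linarith
    rw [this]; push_cast; rfl
  have e0 : e i 0 ∈ gr (i:V) := by rw [(A.D i).e0]; exact A.G.he _ (Setup.mem_i i)
  have f0 : f i 0 ∈ gr (-(i:V)) := by rw [(A.D i).f0]; exact A.G.he _ (Setup.mem_ni i)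
  have pw : ∀ {u : L} {υ : V}, u ∈ gr υ → ∀ (n : ℕ), ∀ x ∈ gr σ, (ad ℂ L u ^ n) x ∈ gr (σ + (n:ℝ) • υ) := by
    intro u υ hu n
    induction n with
    | zero => intro x hx; simpa using hx
    | succ n ih =>
      intro x hx
      rw [pow_succ', Module.End.mul_apply, ad_apply]
      convert A.G.mul _ _ _ hu _ (ih x hx) using 2
      push_cast; module
  obtain ⟨n, rfl | rfl⟩ := N.eq_nat_or_neg
  · refine ⟨ad ℂ L (f i 0) ^ n, fun x hx => ?_, fun x hx => s0.inj' n (by rw [wt x hx]; push_cast; rfl)⟩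
    rw [sr]; convert pw f0 n x hx using 2; push_cast; module
  · refine ⟨ad ℂ L (e i 0) ^ n, fun x hx => ?_, fun x hx => s0.inj n (by rw [wt x hx]; push_cast; rfl)⟩
    rw [sr]; convert pw e0 n x hx using 2; push_cast; module

theorem transport_ne (A : GrAll B R l P a k g ω hb eb gr e f h) (i : P) {σ : V} (h0 : gr σ ≠ ⊥) :
    gr (srefl B i σ) ≠ ⊥ := by
  obtain ⟨F, h1, h2⟩ := A.transport i σ
  intro hb
  apply h0
  rw [Submodule.eq_bot_iff]
  intro x hx
  have := h1 x hx
  rw [hb] at this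
  exact h2 x hx (by simpa using this)

theorem B_srefl (S : Setup B R l P a k g) (i : P) (σ : V) : B (srefl B i σ) (srefl B i σ) = B σ σ := by
  have := (S.posP i).ne'
  rw [srefl_apply]
  simp only [map_sub, map_smul, LinearMap.sub_apply, LinearMap.smul_apply, smul_eq_mul]
  rw [S.hE.symm σ i]
  field_simp
  ring

theorem upper (A : GrAll B R l P a k g ω hb eb gr e f h) (σ : V) (h0 : gr σ ≠ ⊥) (hn : B σ σ ≠ 0) :
    σ ∈ R ∧ ∀ x ∈ gr σ, ∀ y ∈ gr σ, ∃ s t : ℂ, (s ≠ 0 ∨ t ≠ 0) ∧ s • x + t • y = 0 := by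
  haveI : Fintype P := A.S.hfs.2.2.2.2.1.fintype
  refine A.S.descent (fun σ => gr σ ≠ ⊥ ∧ B σ σ ≠ 0) (fun σ => σ ∈ R ∧ ∀ x ∈ gr σ, ∀ y ∈ gr σ,
    ∃ s t : ℂ, (s ≠ 0 ∨ t ≠ 0) ∧ s • x + t • y = 0) (fun σ h => h.2) (fun σ h => ?_) (fun σ h i => ?_)
    (fun σ h i hp => ?_) (fun i p r h => ?_) σ ⟨h0, hn⟩
  · obtain ⟨ε, hε, n, z, hz⟩ := A.form h.1
    exact ⟨ε, hε, n, z, hz⟩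
  · exact ⟨A.transport_ne i h.1, by rw [B_srefl A.S]; exact h.2⟩
  · refine ⟨?_, fun x hx y hy => ?_⟩
    · rw [← A.S.srefl_inv (A.S.PR i.2) σ]; exact A.S.refl_mem (A.S.PR i.2) hp.1
    · obtain ⟨F, h1, h2⟩ := A.transport i σ
      obtain ⟨s, t, hst, he⟩ := hp.2 (F x) (h1 x hx) (F y) (h1 y hy)
      refine ⟨s, t, hst, h2 _ (add_mem (Submodule.smul_mem _ _ hx) (Submodule.smul_mem _ _ hy)) ?_⟩
      rw [map_add, map_smul, map_smul, he]
  · have hp : p ≠ 0 := by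
      rintro rfl
      apply h.2
      simp [A.S.Ba]
    obtain ⟨b1, v, b2⟩ := A.base i p r hp
    refine ⟨b1 h.1, fun x hx y hy => ?_⟩
    obtain ⟨s, rfl⟩ := Submodule.mem_span_singleton.1 (b2 hx)
    obtain ⟨t, rfl⟩ := Submodule.mem_span_singleton.1 (b2 hy)
    by_cases hs : s = 0
    · exact ⟨1, 0, Or.inl one_ne_zero, by simp [hs]⟩
    · exact ⟨t, -s, Or.inr (neg_ne_zero.2 hs), by module⟩

theorem lower_base (A : GrAll B R l P a k g ω hb eb gr e f h) (i : P)
    (ne : ∀ i n, e i n ≠ 0 ∧ f i n ≠ 0) (p r : ℝ) (hR : p • (i:V) + r • a ∈ R) :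
    gr (p • (i:V) + r • a) ≠ ⊥ := by
  rw [A.S.line_iff] at hR
  have mem : ∀ {x : L} {τ : V}, x ∈ gr τ → x ≠ 0 → gr τ ≠ ⊥ := by
    intro x τ h1 h2 h3
    rw [h3] at h1; exact h2 (by simpa using h1)
  have de := fun n => (A.S.loop_deg A.G.mul A.G.he (A.D i) n).1
  have df := fun n => (A.S.loop_deg A.G.mul A.G.he (A.D i) n).2.1
  have dd0 : dd (if g i = true then 6 else 2) 0 = 2 := by simp [dd]
  rcases hR with ⟨ε, m, hε, hR⟩ | ⟨hg, ε, m, hε, ho, hR⟩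
  · rw [hR]
    rcases hε with rfl | rfl
    · refine mem (x := e i m) ?_ (ne i m).1
      convert de m using 2
      rw [dg, ← Int.cast_smul_eq_zsmul ℝ, ← Int.cast_smul_eq_zsmul ℝ]; push_cast; module
    · refine mem (x := f i m) ?_ (ne i m).2
      have dm := df (-m)
      rw [neg_neg] at dm
      convert dm using 2
      rw [dg, ← Int.cast_smul_eq_zsmul ℝ, ← Int.cast_smul_eq_zsmul ℝ]; push_cast; module
  · rw [hR]
    have dd2 : dd (if g i = true then 6 else 2) m = 6 := by
      rw [dd, if_neg (Int.not_even_iff_odd.2 ho), if_pos hg]; norm_num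
    have sk : ∀ x y : L, ⁅x, y⁆ = -⁅y, x⁆ := fun x y => (lie_skew x y).symm
    rcases hε with rfl | rfl
    · refine mem (x := ⁅e i 0, e i m⁆) ?_ ?_
      · convert A.G.mul _ _ _ (de 0) _ (de m) using 2
        rw [dg, dg, ← Int.cast_smul_eq_zsmul ℝ, ← Int.cast_smul_eq_zsmul ℝ]; push_cast; module
      · intro h0
        have h1 := congrArg (fun y => ⁅f i 0, y⁆) h0
        simp only [lie_zero] at h1
        have h3 : ⁅f i 0, e i 0⁆ = -h i 0 := by rw [sk, (A.D i).loop.hdef]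
        have h4 : ⁅f i 0, e i m⁆ = -h i m := by rw [sk, (A.D i).loop.hdef]
        rw [leibniz_lie, h3, neg_lie, (A.D i).loop.he, h4, lie_neg, sk (e i 0), (A.D i).loop.he,
          add_zero, zero_add, dd2, dd0, neg_neg, neg_add_eq_sub, ← sub_smul] at h1
        exact (ne i m).1 ((smul_eq_zero.1 h1).resolve_left (by norm_num))
    · refine mem (x := ⁅f i 0, f i m⁆) ?_ ?_
      · have d0 := df 0
        have dm := df (-m)
        rw [neg_zero] at d0; rw [neg_neg] at dm
        convert A.G.mul _ _ _ d0 _ dm using 2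
        rw [dg, dg, ← Int.cast_smul_eq_zsmul ℝ, ← Int.cast_smul_eq_zsmul ℝ]; push_cast; module
      · intro h0
        have h1 := congrArg (fun y => ⁅e i 0, y⁆) h0
        simp only [lie_zero] at h1
        have h3 : ⁅e i 0, f i 0⁆ = h i 0 := by rw [(A.D i).loop.hdef]
        have h4 : ⁅e i 0, f i m⁆ = h i m := by
          rw [(A.D i).loop.ef, zero_add]; simp
        rw [leibniz_lie, h3, (A.D i).loop.hf, h4, sk (f i 0), (A.D i).loop.hf,
          add_zero, zero_add, dd2, dd0, neg_neg, neg_add_eq_sub, ← sub_smul] at h1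
        exact (ne i m).2 ((smul_eq_zero.1 h1).resolve_left (by norm_num))

theorem lower (A : GrAll B R l P a k g ω hb eb gr e f h) (hinj : Function.Injective hb) (σ : V) (h0 : σ ∈ R) :
    gr σ ≠ ⊥ := by
  haveI : Fintype P := A.S.hfs.2.2.2.2.1.fintype
  have hb0 : hb 0 = 0 := by simpa using Setup.hb_smul A.E 0 0
  have ne : ∀ i n, e i n ≠ 0 ∧ f i n ≠ 0 := by
    intro i n
    have key : ∀ m : ℤ, ⁅e i m, f i (-m)⁆ ≠ 0 := by
      intro m h0
      rw [(A.D i).loop.ef, add_neg_cancel, if_pos rfl, (A.D i).h0, ← Setup.hb_smul A.E, ← Setup.hb_add A.E,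
        ← hb0] at h0
      have h1 := congrArg (fun τ => bc B τ i) (hinj h0)
      have pi := (A.S.posP i).ne'
      have b0 : bc B 0 (i:V) = 0 := by simp [bc]
      have badd : ∀ σ τ : Vc V, bc B (σ + τ) i = bc B σ i + bc B τ i := fun σ τ => by simp [bc]
      simp only [badd, bc_smul_left, bc_one, b0, vee, map_smul, LinearMap.smul_apply, A.S.Ba, smul_eq_mul,
        mul_zero, div_mul_cancel₀ _ pi] at h1
      norm_num at h1
    constructor
    · intro h; apply key n; rw [h, zero_lie]
    · intro h; apply key (-n); rw [neg_neg, h, lie_zero]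
  refine A.S.descent (fun σ => σ ∈ R) (fun σ => gr σ ≠ ⊥) (fun σ h => A.S.hE.root_nonisotropic σ h)
    (fun σ h => A.S.root_form h) (fun σ h i => A.S.refl_mem (A.S.PR i.2) h)
    (fun σ h i hp => ?_) (fun i p r h => ?_) σ h0
  · rw [← A.S.srefl_inv (A.S.PR i.2) σ]; exact A.transport_ne i hp
  · exact lower_base A i ne p r h

theorem final (A : GrAll B R l P a k g ω hb eb gr e f h) (hinj : Function.Injective hb)
    (hlin : LinearIndependent ℂ (fun p : {p : P × ℤ // p.2 ≠ 0} => h p.1.1 p.1.2))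
    (δ : V) (hδ : IsDelta B P δ) :
    {σ : V | gr σ ≠ ⊥ ∧ B σ σ ≠ 0} = R ∧
    (∀ μ ∈ R, Module.finrank ℂ (gr μ) = 1) ∧
    (gr 0 : Set L) = Set.range hb ∧
    Module.finrank ℂ (gr 0) = l + 2 ∧
    (∀ σ : V, gr σ ≠ ⊥ → B σ σ = 0 → ∃ m r : ℤ, σ = m • δ + r • a) ∧
    (∀ m : ℤ, m ≠ 0 →
      Module.finrank ℂ (gr (m • a)) = (P ∩ {α : V | (k α : ℤ) ∣ m}).ncard) := by
  classical
  haveI : Fintype P := A.S.hfs.2.2.2.2.1.fintype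
  let hbl : Vc V →ₗ[ℂ] L := { toFun := hb, map_add' := Setup.hb_add A.E, map_smul' := Setup.hb_smul A.E }
  have g0 : gr 0 = LinearMap.range hbl := by
    apply le_antisymm
    · have := A.gr_a 0
      rw [zero_smul] at this
      refine this.trans ?_
      rw [Submodule.span_le]
      rintro y (⟨_, hy⟩ | ⟨p, hp, rfl⟩)
      · exact hy
      · have hp : (0:ℝ) = (p.2:ℝ) * k p.1 := hp
        have kp : (k p.1 : ℝ) ≠ 0 := by exact_mod_cast (A.S.k_pos p.1).ne'
        have h2 : p.2 = 0 := by
          rcases mul_eq_zero.1 hp.symm with h | h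
          · exact_mod_cast h
          · exact absurd h kp
        dsimp only
        rw [h2, (A.D p.1).h0]; exact ⟨_, rfl⟩
    · rintro _ ⟨σ, rfl⟩; exact A.G.h0 σ
  refine ⟨?_, fun μ hμ => ?_, ?_, ?_, fun σ h1 h2 => ?_, fun m hm => ?_⟩
  · ext σ
    exact ⟨fun h => (A.upper σ h.1 h.2).1, fun h => ⟨A.lower hinj σ h, A.S.hE.root_nonisotropic σ h⟩⟩
  · have hne := A.lower hinj μ hμ
    obtain ⟨v, hv, v0⟩ := Submodule.exists_mem_ne_zero_of_ne_bot hne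
    rw [finrank_eq_one_iff_of_nonzero' (⟨v, hv⟩ : gr μ) (by simpa using v0)]
    rintro ⟨w, hw⟩
    obtain ⟨s, t, hst, he⟩ := (A.upper μ hne (A.S.hE.root_nonisotropic μ hμ)).2 v hv w hw
    have ht : t ≠ 0 := by
      rintro rfl
      rw [zero_smul, add_zero] at he
      rcases smul_eq_zero.1 he with h | h
      · simp [h] at hst
      · exact v0 h
    refine ⟨-(t⁻¹ * s), ?_⟩
    ext
    have h3 : t • w = -(s • v) := (neg_eq_of_add_eq_zero_right he).symm
    have h4 : w = t⁻¹ • (t • w) := by rw [smul_smul, inv_mul_cancel₀ ht, one_smul]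
    change (-(t⁻¹ * s)) • v = w
    rw [h4, h3]; module
  · rw [g0]; rfl
  · rw [g0, LinearMap.finrank_range_of_inj hinj, Module.finrank_baseChange, A.S.hE.dim_eq]
  · obtain ⟨ε, hε, n, z, rfl⟩ := A.form h1
    have hs : ∃ z' : ℤ, ε • lc a (fun i => (n i : ℝ)) (z:ℝ) = (ε • ∑ i : P, (n i:ℝ) • (i:V)) + z' • a := by
      rcases hε with rfl | rfl
      · exact ⟨z, by rw [lc, ← Int.cast_smul_eq_zsmul ℝ]; module⟩
      · exact ⟨-z, by rw [lc, ← Int.cast_smul_eq_zsmul ℝ]; push_cast; module⟩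
    obtain ⟨z', hz'⟩ := hs
    rw [hz'] at h2 ⊢
    have hcl : ε • ∑ i : P, (n i:ℝ) • (i:V) ∈ AddSubgroup.closure P := by
      have : ∑ i : P, (n i:ℝ) • (i:V) ∈ AddSubgroup.closure P := by
        apply AddSubgroup.sum_mem
        intro i _
        rw [Nat.cast_smul_eq_nsmul]
        exact AddSubgroup.nsmul_mem _ (AddSubgroup.subset_closure i.2) _
      rcases hε with rfl | rfl
      · rw [one_smul]; exact this
      · rw [neg_one_smul]; exact AddSubgroup.neg_mem _ this
    have hnull : B (ε • ∑ i : P, (n i:ℝ) • (i:V)) (ε • ∑ i : P, (n i:ℝ) • (i:V)) = 0 := by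
      rw [← Int.cast_smul_eq_zsmul ℝ] at h2
      simpa only [map_add, LinearMap.add_apply, map_smul, LinearMap.smul_apply, A.S.Ba, A.S.Ba', smul_zero,
        add_zero] using h2
    have : ε • ∑ i : P, (n i:ℝ) • (i:V) ∈ (AddSubgroup.closure {δ} : Set V) := by
      rw [hδ.2]; exact ⟨hcl, hnull⟩
    obtain ⟨m, hm⟩ := AddSubgroup.mem_closure_singleton.1 this
    exact ⟨m, z', by rw [hm]⟩
  · let J := {i : P // (k i : ℤ) ∣ m}
    have kp : ∀ i : P, (k i : ℤ) ≠ 0 := fun i => by exact_mod_cast (A.S.k_pos i).ne'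
    have q0 : ∀ i : J, m / k i.1 ≠ 0 := by
      rintro ⟨i, c, hc⟩ h0
      dsimp only at h0
      rw [hc, Int.mul_ediv_cancel_left _ (kp i)] at h0
      rw [h0] at hc; simp at hc; exact hm hc
    let u : J → {p : P × ℤ // p.2 ≠ 0} := fun i => ⟨(i.1, m / k i.1), q0 i⟩
    have ui : Function.Injective u := by
      intro i j hij
      have := congrArg (fun p => p.1.1) hij
      exact Subtype.ext this
    have li := hlin.comp u ui
    have gm : gr (m • a) = Submodule.span ℂ (range ((fun p : {p : P × ℤ // p.2 ≠ 0} => h p.1.1 p.1.2) ∘ u)) := by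
      apply le_antisymm
      · have := A.gr_a (m:ℝ)
        rw [Int.cast_smul_eq_zsmul] at this
        refine this.trans (Submodule.span_mono ?_)
        rintro y (⟨h0, _⟩ | ⟨⟨i, n⟩, hp, rfl⟩)
        · exact absurd (by exact_mod_cast h0) hm
        · have hp : (m:ℝ) = (n:ℝ) * k i := hp
          have hp : m = n * k i := by exact_mod_cast hp
          refine ⟨⟨i, ⟨n, by rw [hp, mul_comm]⟩⟩, ?_⟩
          simp only [u, Function.comp]
          rw [hp, Int.mul_ediv_cancel _ (kp i)]
      · rw [Submodule.span_le]
        rintro _ ⟨i, rfl⟩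
        have := (A.S.loop_deg A.G.mul A.G.he (A.D i.1) (m / k i.1)).2.2
        have h2 : m = m / (k i.1) * k i.1 := (Int.ediv_mul_cancel i.2).symm
        have h3 : (((m / k i.1 : ℤ) : ℝ) * k i.1) • a = m • a := by
          rw [← Int.cast_smul_eq_zsmul ℝ m]
          congr 1
          exact_mod_cast h2.symm
        rw [h3] at this
        exact this
    rw [gm, finrank_span_eq_card li, ← Nat.card_eq_fintype_card]
    have e1 : P ∩ {α : V | (k α : ℤ) ∣ m} = (fun i : P => (i:V)) '' {i : P | (k i : ℤ) ∣ m} := by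
      ext v; constructor
      · rintro ⟨h1, h2⟩; exact ⟨⟨v, h1⟩, h2, rfl⟩
      · rintro ⟨i, hi, rfl⟩; exact ⟨i.2, hi⟩
    rw [e1, Set.ncard_image_of_injective _ Subtype.val_injective, ← Nat.card_coe_set_eq]
    rfl

end GrAll
end Upper

open LieAlgebra

section TPair
variable {L : Type*} [LieRing L] [LieAlgebra ℂ L]

/-- the sign `(-1)^m` -/
noncomputable def sg (m : ℤ) : ℂ := if Even m then 1 else -1

/-- indicator of divisibility -/
noncomputable def dv (r : ℕ) (s : ℤ) : ℂ := if (r:ℤ) ∣ s then 1 else 0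

theorem dv_add (r : ℕ) (s n : ℤ) : dv r (s + r * n) = dv r s := by
  simp only [dv, (Int.dvd_add_left (Dvd.intro n rfl) : (r:ℤ) ∣ s + r*n ↔ _)]

/-- One family of positive operators for which vanishing can be tested by the negative ones. -/
structure TO (D : ℕ) (X Y : ℤ → L) (N : LieSubalgebra ℂ L) : Prop where
  act : ∀ q p n, ⁅⁅Y q, X p⁆, X n⁆ = -(dd D (p+q) • X (p+q+n))
  mem : ∀ n, X n ∈ N
  T : ∀ θ ∈ N, (∀ t, ⁅Y t, θ⁆ = 0) → θ = 0

namespace TO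
variable {D : ℕ} {X Y : ℤ → L} {N : LieSubalgebra ℂ L}

theorem yXX (o : TO D X Y N) (t p q : ℤ) :
    ⁅Y t, ⁅X p, X q⁆⁆ = (dd D (q+t) - dd D (p+t)) • X (p+q+t) := by
  rw [leibniz_lie, o.act, ← lie_skew (X p) ⁅Y t, X q⁆, o.act]
  rw [show p + t + q = p + q + t by ring, show q + t + p = p + q + t by ring]; module

theorem eqT (o : TO D X Y N) {u v : L} (hu : u ∈ N) (hv : v ∈ N) (h : ∀ t, ⁅Y t, u⁆ = ⁅Y t, v⁆) : u = v := by
  refine sub_eq_zero.1 (o.T _ (sub_mem hu hv) fun t => ?_)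
  rw [lie_sub, h, sub_self]

theorem XX (o : TO D X Y N) (m n : ℤ) (h : D = 2 ∨ Even (m+n)) : ⁅X m, X n⁆ = 0 := by
  refine o.T _ (LieSubalgebra.lie_mem _ (o.mem _) (o.mem _)) fun t => ?_
  have : dd D (n+t) = dd D (m+t) := by
    rcases h with rfl | h
    · simp [dd]
    · rw [Int.even_add] at h
      simp only [dd, Int.even_add, h]
  rw [o.yXX, this, sub_self, zero_smul]

theorem XXodd (o : TO 6 X Y N) (m n : ℤ) : ⁅X m, X n⁆ = sg m • ⁅X 0, X (m+n)⁆ := by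
  refine o.eqT (LieSubalgebra.lie_mem _ (o.mem _) (o.mem _))
    (N.smul_mem _ (LieSubalgebra.lie_mem _ (o.mem _) (o.mem _))) fun t => ?_
  rw [lie_smul, o.yXX, o.yXX, smul_smul, zero_add, zero_add]
  congr 1
  simp only [dd, sg, Int.even_add]
  by_cases hm : Even m <;> by_cases hn : Even n <;> by_cases ht : Even t <;> simp [hm, hn, ht] <;> norm_num

theorem cubic (o : TO D X Y N) (hD : D = 2 ∨ D = 6) (p m n : ℤ) : ⁅X p, ⁅X m, X n⁆⁆ = 0 := by
  rcases hD with rfl | rfl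
  · rw [o.XX m n (Or.inl rfl), lie_zero]
  by_cases hmn : Even (m+n)
  · rw [o.XX m n (Or.inr hmn), lie_zero]
  refine o.T _ (LieSubalgebra.lie_mem _ (o.mem _) (LieSubalgebra.lie_mem _ (o.mem _) (o.mem _))) fun t => ?_
  rw [leibniz_lie, o.yXX, lie_smul, leibniz_lie, o.act, o.act, ← neg_smul, ← neg_smul, smul_lie, lie_smul,
    o.XXodd (p+t+m) n, o.XXodd m (p+t+n), o.XXodd p]
  rw [show p + t + m + n = p + (m + n + t) by ring, show m + (p + t + n) = p + (m + n + t) by ring,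
    smul_smul, smul_smul, smul_smul, ← add_smul, ← add_smul]
  by_cases hpt : Even (p+t)
  swap
  · rw [o.XX 0 _ (Or.inr (by simp only [Int.even_add] at *; tauto)), smul_zero]
  convert zero_smul ℂ _
  simp only [dd, sg, Int.even_add] at hmn hpt ⊢
  by_cases hm : Even m <;> by_cases hn : Even n <;> by_cases ht : Even t <;> by_cases hp : Even p <;>
    simp [hm, hn, ht, hp] at hmn hpt ⊢ <;> norm_num
end TO

/-- A linked pair: `X` short, `b` long. -/
structure TP (m r D : ℕ) (X Y b c : ℤ → L) (N Na Nb : LieSubalgebra ℂ L) : Prop where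
  oa : TO D X Y Na
  ob : TO 2 b c Nb
  r0 : r ≠ 0
  bH : ∀ q p n, ⁅⁅Y q, X p⁆, b n⁆ = (m * dv r (p+q)) • b (n+(p+q)/r)
  XH : ∀ q p n, ⁅⁅c q, b p⁆, X n⁆ = X (n+r*(p+q))
  Yb : ∀ q p, ⁅Y q, b p⁆ = 0
  cX : ∀ q p, ⁅c q, X p⁆ = 0
  mX : ∀ n, X n ∈ N
  mb : ∀ n, b n ∈ N
  T : ∀ θ ∈ N, (∀ t, ⁅Y t, θ⁆ = 0) → (∀ t, ⁅c t, θ⁆ = 0) → θ = 0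

namespace TP
variable {m r D : ℕ} {X Y b c : ℤ → L} {N Na Nb : LieSubalgebra ℂ L}

theorem eqT (o : TP m r D X Y b c N Na Nb) {u v : L} (hu : u ∈ N) (hv : v ∈ N)
    (h : ∀ t, ⁅Y t, u⁆ = ⁅Y t, v⁆) (h' : ∀ t, ⁅c t, u⁆ = ⁅c t, v⁆) : u = v := by
  refine sub_eq_zero.1 (o.T _ (sub_mem hu hv) (fun t => ?_) fun t => ?_)
  · rw [lie_sub, h, sub_self]
  · rw [lie_sub, h', sub_self]

theorem mXX (o : TP m r D X Y b c N Na Nb) (p : ℤ) {u : L} (h : u ∈ N) : ⁅X p, u⁆ ∈ N :=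
  LieSubalgebra.lie_mem _ (o.mX p) h

/-- level one element -/
theorem Y1 (o : TP m r D X Y b c N Na Nb) (t p n : ℤ) :
    ⁅Y t, ⁅X p, b n⁆⁆ = (m * dv r (p+t)) • b (n+(p+t)/r) := by
  rw [leibniz_lie, o.Yb, lie_zero, add_zero, o.bH]

theorem c1 (o : TP m r D X Y b c N Na Nb) (t p n : ℤ) : ⁅c t, ⁅X p, b n⁆⁆ = -X (p+r*(n+t)) := by
  rw [leibniz_lie, o.cX, zero_lie, zero_add, ← lie_skew, o.XH]

theorem L1 (o : TP m r D X Y b c N Na Nb) (p n : ℤ) : ⁅X p, b n⁆ = ⁅X (p+r*n), b 0⁆ := by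
  have r0 : (r:ℤ) ≠ 0 := by exact_mod_cast o.r0
  refine o.eqT (o.mXX _ (o.mb _)) (o.mXX _ (o.mb _)) (fun t => ?_) fun t => ?_
  · rw [o.Y1, o.Y1, show p + r*n + t = (p+t) + r*n by ring, Int.add_mul_ediv_left _ _ r0]
    rw [dv_add, show n + (p+t)/r = 0 + ((p+t)/r + n) by ring]
  · rw [o.c1, o.c1]; congr 2; ring

theorem bb (o : TP m r D X Y b c N Na Nb) (p n q : ℤ) : ⁅b q, ⁅X p, b n⁆⁆ = 0 := by
  refine o.T _ (LieSubalgebra.lie_mem _ (o.mb _) (o.mXX _ (o.mb _))) (fun t => ?_) fun t => ?_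
  · rw [leibniz_lie, o.Yb, zero_lie, o.Y1, lie_smul, o.ob.XX _ _ (Or.inl rfl)]; simp
  · rw [leibniz_lie, o.c1, leibniz_lie, o.XH, o.ob.act, o.L1, lie_neg, lie_smul, o.L1 p,
      lie_neg, lie_skew (X _) (b q), o.L1 _ q]
    have : dd 2 (q+t) = 2 := by simp [dd]
    rw [this, show p + r * (q+t) + r * n = p + r * (q+t+n) by ring, show p + r * (n+t) + r * q = p + r * (q+t+n) by ring]
    module

theorem dvb (o : TP m r D X Y b c N Na Nb) (p n : ℤ) :
    dv r n • ⁅X p, b (n/r)⁆ = dv r n • ⁅X (p+n), b 0⁆ := by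
  by_cases h : (r:ℤ) ∣ n
  · rw [o.L1, Int.mul_ediv_cancel' h]
  · simp [dv, h]

theorem hv (o : TP m r D X Y b c N Na Nb) (t p n : ℤ) : ⁅⁅Y t, X p⁆, ⁅X n, b 0⁆⁆ =
    (m * dv r (p+t) - dd D (p+t)) • ⁅X (n+p+t), b 0⁆ := by
  rw [leibniz_lie, o.oa.act, o.bH, lie_smul, mul_smul, zero_add, o.dvb, neg_lie, smul_lie]
  rw [show p + t + n = n + p + t by ring, show n + (p + t) = n + p + t by ring]
  module

theorem Y2 (o : TP m r D X Y b c N Na Nb) (t p n : ℤ) : ⁅Y t, ⁅X p, ⁅X n, b 0⁆⁆⁆ =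
    (m * dv r (p+t) - dd D (p+t) + m * dv r (n+t)) • ⁅X (p+n+t), b 0⁆ := by
  rw [leibniz_lie, o.hv, o.Y1, zero_add, lie_smul, mul_smul, o.dvb]
  rw [show n + p + t = p + n + t by ring, show p + (n + t) = p + n + t by ring]
  module

theorem c2 (o : TP m r D X Y b c N Na Nb) (t p n : ℤ) :
    ⁅c t, ⁅X p, ⁅X n, b 0⁆⁆⁆ = -⁅X p, X (n + r*t)⁆ := by
  rw [leibniz_lie, o.cX, zero_lie, zero_add, o.c1, lie_neg, zero_add]

theorem c3 (o : TP m r D X Y b c N Na Nb) (hD : D = 2 ∨ D = 6) (t q p n : ℤ) :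
    ⁅c t, ⁅X q, ⁅X p, ⁅X n, b 0⁆⁆⁆⁆ = 0 := by
  rw [leibniz_lie, o.cX, zero_lie, zero_add, o.c2, lie_neg, o.oa.cubic hD, neg_zero]

theorem c4 (o : TP m r D X Y b c N Na Nb) (hD : D = 2 ∨ D = 6) (t s q p n : ℤ) :
    ⁅c t, ⁅X s, ⁅X q, ⁅X p, ⁅X n, b 0⁆⁆⁆⁆⁆ = 0 := by
  rw [leibniz_lie, o.cX, zero_lie, zero_add, o.c3 hD, lie_zero]

/-- Serre relation, `r = 1`, reduced case. -/
theorem serre1 (o : TP m 1 2 X Y b c N Na Nb) (hm : m ≠ 0) (p n : ℤ) :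
    (ad ℂ L (X p) ^ (m+1)) (b n) = 0 := by
  have suc : ∀ j n, (ad ℂ L (X p) ^ (j+1)) (b n) = ⁅X p, (ad ℂ L (X p) ^ j) (b n)⁆ := by
    intro j n; rw [pow_succ', Module.End.mul_apply, ad_apply]
  have h1 : ∀ j q n, ⁅X q, (ad ℂ L (X p) ^ j) (b n)⁆ = (ad ℂ L (X p) ^ (j+1)) (b (n+q-p)) := by
    intro j
    induction j with
    | zero =>
      intro q n
      rw [suc, pow_zero, Module.End.one_apply, Module.End.one_apply, o.L1, o.L1 p, show q + ((1:ℕ):ℤ) * n = p + ((1:ℕ):ℤ) * (n+q-p) by push_cast; ring]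
    | succ j ih =>
      intro q n
      rw [suc, leibniz_lie, o.oa.XX _ _ (Or.inl rfl), zero_lie, zero_add, ih, ← suc]
  have dv1 : ∀ s, dv 1 s = 1 := by intro s; simp [dv]
  have dd2 : ∀ s, dd 2 s = 2 := by intro s; simp [dd]
  have h2 : ∀ (j : ℕ) (t q n : ℤ), ⁅⁅Y t, X q⁆, (ad ℂ L (X p) ^ j) (b n)⁆ =
      ((m:ℂ) - 2*j) • (ad ℂ L (X p) ^ j) (b (n+q+t)) := by
    intro j
    induction j with
    | zero => intro t q n; rw [pow_zero, Module.End.one_apply, Module.End.one_apply, o.bH, dv1]; simp [add_assoc]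
    | succ j ih =>
      intro t q n
      rw [suc, leibniz_lie, o.oa.act, ih, lie_smul, ← suc, neg_lie, smul_lie, h1, dd2]
      rw [show n + (q+t+p) - p = n + q + t by ring]; push_cast; module
  have h3 : ∀ (j : ℕ) (t n : ℤ), ⁅Y t, (ad ℂ L (X p) ^ (j+1)) (b n)⁆ =
      (((j:ℂ)+1)*(m-j)) • (ad ℂ L (X p) ^ j) (b (n+p+t)) := by
    intro j
    induction j with
    | zero =>
      intro t n; rw [suc, leibniz_lie, h2, pow_zero, Module.End.one_apply, Module.End.one_apply, o.Yb]; simp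
    | succ j ih => intro t n; rw [suc, leibniz_lie, h2, ih, lie_smul, ← suc]; push_cast; module
  have h4 : ∀ j t n, ⁅c t, (ad ℂ L (X p) ^ (j+2)) (b n)⁆ = 0 := by
    intro j
    induction j with
    | zero =>
      intro t n
      rw [suc, suc, leibniz_lie, o.cX, zero_lie, pow_zero, Module.End.one_apply, o.c1, lie_neg,
        o.oa.XX _ _ (Or.inl rfl)]; simp
    | succ j ih => intro t n; rw [suc, leibniz_lie, o.cX, zero_lie, ih, lie_zero, add_zero]
  have h5 : ∀ j n, (ad ℂ L (X p) ^ j) (b n) ∈ N := by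
    intro j
    induction j with
    | zero => intro n; exact o.mb n
    | succ j ih => intro n; rw [suc]; exact o.mXX _ (ih n)
  refine o.T _ (h5 _ _) (fun t => ?_) fun t => ?_
  · rw [h3, sub_self, mul_zero, zero_smul]
  · obtain ⟨j, rfl⟩ := Nat.exists_eq_succ_of_ne_zero hm
    exact h4 _ _ _

/-- the case `r = 1`, `D = 6`. -/
theorem six2 (o : TP 2 1 6 X Y b c N Na Nb) (p n : ℤ) :
    ⁅X p, ⁅X n, b 0⁆⁆ = sg p • ⁅X 0, ⁅X (p+n), b 0⁆⁆ := by
  refine o.eqT (o.mXX _ (o.mXX _ (o.mb _))) (N.smul_mem _ (o.mXX _ (o.mXX _ (o.mb _)))) (fun t => ?_) fun t => ?_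
  · rw [lie_smul, o.Y2, o.Y2, smul_smul, zero_add, zero_add]
    congr 1
    simp only [dd, sg, dv, Int.even_add]
    by_cases hp : Even p <;> by_cases ht : Even t <;> simp [hp, ht] <;> norm_num
  · rw [lie_smul, o.c2, o.c2, o.oa.XXodd p, smul_neg, add_assoc]

theorem six3 (o : TP 2 1 6 X Y b c N Na Nb) (q p n : ℤ) : ⁅X q, ⁅X p, ⁅X n, b 0⁆⁆⁆ = 0 := by
  refine o.T _ (o.mXX _ (o.mXX _ (o.mXX _ (o.mb _)))) (fun t => ?_) fun t => o.c3 (Or.inr rfl) _ _ _ _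
  rw [leibniz_lie, o.Y2, leibniz_lie, o.hv, o.oa.act, lie_smul, lie_smul, o.six2 q, o.six2 p, ← neg_smul, smul_lie,
    o.six2 (q+t+p)]
  rw [show q + (p + n + t) = p + (n + q + t) by ring, show q + t + p + n = p + (n + q + t) by ring,
    smul_smul, smul_smul, smul_smul, ← add_smul, ← add_smul]
  convert zero_smul ℂ _
  simp only [dd, sg, dv, Int.even_add]
  by_cases hp : Even p <;> by_cases ht : Even t <;> by_cases hq : Even q <;> simp [hp, ht, hq] <;> norm_num

/-- the case `r = 2`. -/
theorem two2 (o : TP 2 2 2 X Y b c N Na Nb) (p n : ℤ) :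
    ⁅X p, ⁅X n, b 0⁆⁆ = (dv 2 (p+n) * sg p) • ⁅X 0, ⁅X (p+n), b 0⁆⁆ := by
  refine o.eqT (o.mXX _ (o.mXX _ (o.mb _))) (N.smul_mem _ (o.mXX _ (o.mXX _ (o.mb _)))) (fun t => ?_) fun t => ?_
  · rw [lie_smul, o.Y2, o.Y2, smul_smul, zero_add, zero_add]
    congr 1
    simp only [dd, sg, dv, Nat.cast_ofNat, ← even_iff_two_dvd, Int.even_add]
    by_cases hp : Even p <;> by_cases ht : Even t <;> by_cases hn : Even n <;> simp [hp, ht, hn]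
  · rw [lie_smul, o.c2, o.c2, o.oa.XX _ _ (Or.inl rfl), o.oa.XX _ _ (Or.inl rfl)]; simp

theorem two3 (o : TP 2 2 2 X Y b c N Na Nb) (q p n : ℤ) : ⁅X q, ⁅X p, ⁅X n, b 0⁆⁆⁆ = 0 := by
  refine o.T _ (o.mXX _ (o.mXX _ (o.mXX _ (o.mb _)))) (fun t => ?_) fun t => o.c3 (Or.inl rfl) _ _ _ _
  rw [leibniz_lie, o.Y2, leibniz_lie, o.hv, o.oa.act, lie_smul, lie_smul, o.two2 q, o.two2 p, ← neg_smul, smul_lie,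
    o.two2 (q+t+p)]
  rw [show q + (p + n + t) = p + (n + q + t) by ring, show q + t + p + n = p + (n + q + t) by ring,
    smul_smul, smul_smul, smul_smul, ← add_smul, ← add_smul]
  convert zero_smul ℂ _
  simp only [dd, sg, dv, Nat.cast_ofNat, ← even_iff_two_dvd, Int.even_add]
  by_cases hp : Even p <;> by_cases ht : Even t <;> by_cases hq : Even q <;> by_cases hn : Even n <;>
    simp [hp, ht, hq, hn] <;> norm_num

/-- residue indicator -/
def dz (z : ZMod 3) : ℤ := if z = 0 then 1 else 0

theorem dv3 (s : ℤ) : dv 3 s = (dz (s : ZMod 3) : ℂ) := by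
  have h := ZMod.intCast_zmod_eq_zero_iff_dvd s 3
  rw [dv, dz]
  by_cases hs : ((3:ℕ):ℤ) ∣ s
  · rw [if_pos hs, if_pos (h.2 hs)]; simp
  · rw [if_neg hs, if_neg (fun h' => hs (h.1 h'))]; simp

/-- the case `r = 3`. -/
theorem three2 (o : TP 3 3 2 X Y b c N Na Nb) (p n : ℤ) :
    (2:ℂ) • ⁅X p, ⁅X n, b 0⁆⁆ = (3 * dv 3 (p-n) - 1) • ⁅X (-(p+n)), ⁅X (2*(p+n)), b 0⁆⁆ := by
  refine o.eqT (N.smul_mem _ (o.mXX _ (o.mXX _ (o.mb _)))) (N.smul_mem _ (o.mXX _ (o.mXX _ (o.mb _))))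
    (fun t => ?_) fun t => ?_
  · have dd2 : ∀ s, dd 2 s = 2 := by intro s; simp [dd]
    rw [lie_smul, lie_smul, o.Y2, o.Y2, smul_smul, smul_smul, show -(p+n) + 2*(p+n) + t = p + n + t by ring]
    congr 1
    have key : ∀ p n t : ZMod 3, 2 * (3 * dz (p+t) - 2 + 3 * dz (n+t)) =
      (3 * dz (p-n) - 1) * (3 * dz (-(p+n)+t) - 2 + 3 * dz (2*(p+n)+t)) := by decide
    have h2 := congrArg (Int.cast : ℤ → ℂ) (key p n t)
    simp only [dv3, dd2]
    push_cast at h2 ⊢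
    exact h2
  · rw [lie_smul, lie_smul, o.c2, o.c2, o.oa.XX _ _ (Or.inl rfl), o.oa.XX _ _ (Or.inl rfl)]; simp

theorem half_eq {u v : L} {z : ℂ} (h : (2:ℂ) • u = z • v) : u = (z/2) • v := by
  have : u = (1/2:ℂ) • ((2:ℂ) • u) := by rw [smul_smul]; norm_num
  rw [this, h, smul_smul]; congr 1; ring

theorem Y3 (o : TP 3 3 2 X Y b c N Na Nb) (q n t : ℤ) : ⁅Y t, ⁅X q, ⁅X (-n), ⁅X (2*n), b 0⁆⁆⁆⁆ =
      (3 * dv 3 (q+n)) • ⁅X (-(q+n+t)), ⁅X (2*(q+n+t)), b 0⁆⁆ := by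
  have dd2 : ∀ s, dd 2 s = 2 := by intro s; simp [dd]
  rw [leibniz_lie, o.Y2, leibniz_lie, o.hv, o.oa.act, lie_smul, lie_smul, half_eq (o.three2 q _),
    half_eq (o.three2 (-n) _), ← neg_smul, smul_lie, half_eq (o.three2 (q+t+-n) _)]
  rw [show q + (-n + 2*n + t) = q+n+t by ring, show q + t + -n + 2*n = q+n+t by ring,
    show -n + (2*n+q+t) = q+n+t by ring, smul_smul, smul_smul, smul_smul, ← add_smul, ← add_smul]
  congr 1
  have key : ∀ q n t : ZMod 3, -2 * (3 * dz (q + t + -n - 2*n) - 1) + (3 * dz (q+t) - 2) * (3 * dz (-n-(2*n+q+t)) - 1)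
    + (3 * dz (-n+t) - 2 + 3 * dz (2*n+t)) * (3 * dz (q-(-n+2*n+t)) - 1) = 2 * (3 * dz (q+n)) := by decide
  have h2 := congrArg (Int.cast : ℤ → ℂ) (key q n t)
  simp only [dv3, dd2]
  push_cast at h2 ⊢
  linear_combination h2 / 2

theorem three3 (o : TP 3 3 2 X Y b c N Na Nb) (q n : ℤ) :
    ⁅X q, ⁅X (-n), ⁅X (2*n), b 0⁆⁆⁆ = dv 3 (q+n) • ⁅X 0, ⁅X (-(q+n)), ⁅X (2*(q+n)), b 0⁆⁆⁆ := by
  refine o.eqT (o.mXX _ (o.mXX _ (o.mXX _ (o.mb _)))) (N.smul_mem _ (o.mXX _ (o.mXX _ (o.mXX _ (o.mb _)))))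
    (fun t => ?_) fun t => by rw [lie_smul, o.c3 (Or.inl rfl), o.c3 (Or.inl rfl), smul_zero]
  rw [lie_smul, o.Y3, o.Y3, smul_smul, zero_add]
  congr 1
  simp only [dv]
  split_ifs <;> norm_num

theorem three4 (o : TP 3 3 2 X Y b c N Na Nb) (p q n : ℤ) :
    ⁅X p, ⁅X q, ⁅X (-n), ⁅X (2*n), b 0⁆⁆⁆⁆ = 0 := by
  have dd2 : ∀ s, dd 2 s = 2 := by intro s; simp [dd]
  suffices h : ∀ M : ℤ, (3:ℤ) ∣ M → ⁅X p, ⁅X 0, ⁅X (-M), ⁅X (2*M), b 0⁆⁆⁆⁆ = 0 by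
    rw [o.three3, lie_smul]
    by_cases hs : (3:ℤ) ∣ q + n
    · rw [h _ hs, smul_zero]
    · rw [dv, if_neg (by exact_mod_cast hs), zero_smul]
  intro M hM
  refine o.T _ (o.mXX _ (o.mXX _ (o.mXX _ (o.mXX _ (o.mb _))))) (fun t => ?_) fun t => o.c4 (Or.inl rfl) _ _ _ _ _
  rw [leibniz_lie, o.Y3, leibniz_lie, leibniz_lie ⁅Y t, X p⁆, o.hv, o.oa.act, o.oa.act, lie_smul, lie_smul,
    half_eq (o.three2 (-M) (2*M+p+t)), ← neg_smul, ← neg_smul, smul_lie, smul_lie, half_eq (o.three2 (p+t+-M) _)]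
  rw [show p + t + -M + 2*M = p + t + M by ring, show -M + (2*M + p + t) = p + t + M by ring,
    smul_smul, smul_smul, ← add_smul]
  rw [lie_smul, o.three3 0 (p+t+M), o.three3 (p+t+0) M, o.three3 p]
  rw [show p + t + 0 + M = p + t + M by ring, show 0 + (p + t + M) = p + t + M by ring,
    show p + (0 + M + t) = p + t + M by ring, smul_smul, smul_smul, smul_smul, ← add_smul, ← add_smul]
  convert zero_smul ℂ _
  have hM' : (M : ZMod 3) = 0 := (ZMod.intCast_zmod_eq_zero_iff_dvd M 3).2 (by exact_mod_cast hM)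
  have key : ∀ p t : ZMod 3, -4 * dz (p+t) + (-2 * (3 * dz (p+t) - 1) + (3 * dz (p+t) - 2) * (3 * dz (-(p+t)) - 1)) * dz (p+t)
    + 6 * dz (p+t) = 0 := by decide
  have h2 := congrArg (Int.cast : ℤ → ℂ) (key p t)
  simp only [dv3, dd2]
  push_cast at h2 ⊢
  rw [hM']
  have z0 : dz 0 = 1 := by decide
  simp only [mul_zero, neg_zero, add_zero, zero_add, sub_zero, z0, zero_sub] at h2 ⊢
  push_cast
  linear_combination h2 / 2

end TP
end TPair

open LieAlgebra

/-- Endomorphisms as a Lie algebra. -/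
def EndL (F : Type*) [AddCommGroup F] [Module ℂ F] : Type _ := Module.End ℂ F

namespace EndL
variable {F : Type*} [AddCommGroup F] [Module ℂ F]

noncomputable instance : LieRing (EndL F) := LieRing.ofAssociativeRing (A := Module.End ℂ F)
noncomputable instance : LieAlgebra ℂ (EndL F) :=
  letI : LieRing (Module.End ℂ F) := LieRing.ofAssociativeRing
  LieAlgebra.ofAssociativeAlgebra (A := Module.End ℂ F)
instance : FunLike (EndL F) F F := inferInstanceAs (FunLike (Module.End ℂ F) F F)
instance : LinearMapClass (EndL F) ℂ F F := inferInstanceAs (LinearMapClass (Module.End ℂ F) ℂ F F)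

theorem lie_apply (f g : EndL F) (v : F) : ⁅f, g⁆ v = f (g v) - g (f v) := rfl
theorem add_apply (f g : EndL F) (v : F) : (f + g) v = f v + g v := rfl
theorem sub_apply (f g : EndL F) (v : F) : (f - g) v = f v - g v := rfl
theorem neg_apply (f : EndL F) (v : F) : (-f) v = -f v := rfl
theorem zero_apply (v : F) : (0 : EndL F) v = 0 := rfl
theorem smul_apply (c : ℂ) (f : EndL F) (v : F) : (c • f) v = c • f v := rfl
theorem ext {f g : EndL F} (h : ∀ v, f v = g v) : f = g := DFunLike.ext f g h
def mk (f : F → F) (h1 : ∀ u v, f (u + v) = f u + f v) (h2 : ∀ (c : ℂ) u, f (c • u) = c • f u) : EndL F :=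
  ({ toFun := f, map_add' := h1, map_smul' := h2 } : Module.End ℂ F)
theorem mk_apply (f : F → F) (h1 : ∀ u v, f (u + v) = f u + f v) (h2 : ∀ (c : ℂ) u, f (c • u) = c • f u) (v : F) :
  mk f h1 h2 v = f v := rfl
end EndL

/-- Data for the module from which the lower bound is obtained. -/
structure MData (X J M : Type*) [AddCommGroup M] [Module ℂ M] where
  ρ : J → EndL M
  a : J → X → ℂ
  τ : J → X → X
  κ : X → X → J
  z : J
  ψ : J → J → ℂ
  hρ : ∀ j j', ⁅ρ j, ρ j'⁆ = ψ j j' • ρ z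
  aτ : ∀ j j' p, a j (τ j' p) = a j p
  ττ : ∀ j j' p, τ j (τ j' p) = τ j' (τ j p)
  az : ∀ p, a z p = 0
  cons : ∀ j p q, ψ j (κ p q) • ρ z = a j p • ρ (κ (τ j p) q) - a j q • ρ (κ p (τ j q))
  cons' : ∀ j p q r, a j p * a (κ (τ j p) q) r = a j q * a (κ p (τ j q)) r
  cons'' : ∀ j p q r, a j p * a (κ (τ j p) q) r ≠ 0 → τ (κ (τ j p) q) r = τ (κ p (τ j q)) r


namespace MData
variable {X J M : Type*} [AddCommGroup M] [Module ℂ M] (S : MData X J M)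

def hraw (j : J) : (List X → M) → List X → M
  | φ, [] => S.ρ j (φ [])
  | φ, p :: w => hraw j (fun v => φ (p :: v)) w - S.a j p • φ (S.τ j p :: w)

def yraw (q : X) : (List X → M) → List X → M
  | _, [] => 0
  | φ, p :: w => yraw q (fun v => φ (p :: v)) w + S.hraw (S.κ p q) φ w

theorem hraw_add (j : J) (w : List X) : ∀ φ φ' : List X → M,
    S.hraw j (φ + φ') w = S.hraw j φ w + S.hraw j φ' w := by
  induction w with
  | nil => intro φ φ'; simp [hraw]
  | cons p w ih =>
    intro φ φ'
    simp only [hraw]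
    rw [show (fun v => (φ + φ') (p :: v)) = (fun v => φ (p :: v)) + (fun v => φ' (p :: v)) from rfl, ih]
    simp only [Pi.add_apply]; module

theorem hraw_smul (j : J) (c : ℂ) (w : List X) : ∀ φ : List X → M,
    S.hraw j (c • φ) w = c • S.hraw j φ w := by
  induction w with
  | nil => intro φ; simp [hraw]
  | cons p w ih =>
    intro φ
    simp only [hraw]
    rw [show (fun v => (c • φ) (p :: v)) = c • (fun v => φ (p :: v)) from rfl, ih]
    simp only [Pi.smul_apply]; module

theorem yraw_add (q : X) (w : List X) : ∀ φ φ' : List X → M,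
    S.yraw q (φ + φ') w = S.yraw q φ w + S.yraw q φ' w := by
  induction w with
  | nil => intro φ φ'; simp [yraw]
  | cons p w ih =>
    intro φ φ'
    simp only [yraw]
    rw [show (fun v => (φ + φ') (p :: v)) = (fun v => φ (p :: v)) + (fun v => φ' (p :: v)) from rfl, ih,
      hraw_add]
    module

theorem yraw_smul (q : X) (c : ℂ) (w : List X) : ∀ φ : List X → M,
    S.yraw q (c • φ) w = c • S.yraw q φ w := by
  induction w with
  | nil => intro φ; simp [yraw]
  | cons p w ih =>
    intro φ
    simp only [yraw]
    rw [show (fun v => (c • φ) (p :: v)) = c • (fun v => φ (p :: v)) from rfl, ih, hraw_smul]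
    module

variable (M) in
def xop (p : X) : EndL (List X → M) :=
  EndL.mk (fun φ w => φ (p :: w)) (fun _ _ => rfl) fun _ _ => rfl

def hop (j : J) : EndL (List X → M) :=
  EndL.mk (S.hraw j) (fun φ φ' => funext fun w => S.hraw_add j w φ φ') fun c φ => funext fun w => S.hraw_smul j c w φ

def yop (q : X) : EndL (List X → M) :=
  EndL.mk (S.yraw q) (fun φ φ' => funext fun w => S.yraw_add q w φ φ') fun c φ => funext fun w => S.yraw_smul q c w φ

theorem xop_apply (p : X) (φ : List X → M) (w : List X) : xop M p φ w = φ (p :: w) := rfl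

theorem hop_nil (j : J) (φ : List X → M) : S.hop j φ [] = S.ρ j (φ []) := by
  simp [hop, hraw, EndL.mk_apply]

theorem yop_nil (q : X) (φ : List X → M) : S.yop q φ [] = 0 := by
  simp [yop, yraw, EndL.mk_apply]

theorem hx (j : J) (p : X) : ⁅S.hop j, xop M p⁆ = S.a j p • xop M (S.τ j p) := by
  refine EndL.ext fun φ => funext fun w => ?_
  simp only [EndL.sub_apply, EndL.lie_apply, Pi.sub_apply, EndL.smul_apply, Pi.smul_apply]
  rw [xop_apply, xop_apply]
  simp only [hop, EndL.mk_apply, hraw, xop]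
  abel

theorem xy (p q : X) : ⁅xop M p, S.yop q⁆ = S.hop (S.κ p q) := by
  refine EndL.ext fun φ => funext fun w => ?_
  simp only [EndL.sub_apply, EndL.lie_apply, Pi.sub_apply]
  rw [xop_apply]
  simp only [hop, yop, EndL.mk_apply, yraw, xop]
  abel

theorem detect (K : EndL (List X → M)) (h0 : ∀ φ, K φ [] = 0) (h : ∀ p : X, ⁅xop M p, K⁆ = 0) : K = 0 := by
  have : ∀ (w : List X) φ, K φ w = 0 := by
    intro w
    induction w with
    | nil => exact h0
    | cons p w ih =>
      intro φ
      have h1 := congrFun (DFunLike.congr_fun (h p) φ) w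
      rw [EndL.lie_apply, Pi.sub_apply, ih, xop_apply, EndL.zero_apply] at h1
      simpa using h1
  refine EndL.ext fun φ => funext fun w => ?_
  exact this w φ

theorem xh (j : J) (p : X) : ⁅xop M p, S.hop j⁆ = -(S.a j p • xop M (S.τ j p)) := by
  rw [← S.hx, lie_skew]

theorem hz_x (p : X) : ⁅xop M p, S.hop S.z⁆ = 0 := by rw [S.xh, S.az]; simp

theorem hh (j j' : J) : ⁅S.hop j, S.hop j'⁆ = S.ψ j j' • S.hop S.z := by
  refine sub_eq_zero.1 (detect _ (fun φ => ?_) fun p => ?_)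
  · have := DFunLike.congr_fun (S.hρ j j') (φ [])
    simp only [EndL.sub_apply, EndL.lie_apply, EndL.smul_apply] at this
    simp only [EndL.sub_apply, EndL.lie_apply, Pi.sub_apply, EndL.smul_apply, Pi.smul_apply,
      hop_nil]
    rw [this, sub_self]
  · rw [lie_sub, lie_smul, S.hz_x, smul_zero, leibniz_lie, S.xh, S.xh, ← neg_smul, ← neg_smul, smul_lie, lie_smul, S.xh, S.hx,
      S.aτ, S.aτ, S.ττ j j']
    module

theorem cons_op (j : J) (p q : X) : S.ψ j (S.κ p q) • S.hop S.z =
    S.a j p • S.hop (S.κ (S.τ j p) q) - S.a j q • S.hop (S.κ p (S.τ j q)) := by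
  refine sub_eq_zero.1 (detect _ (fun φ => ?_) fun r => ?_)
  · have := DFunLike.congr_fun (S.cons j p q) (φ [])
    simp only [EndL.sub_apply, EndL.smul_apply] at this
    simp only [EndL.sub_apply, Pi.sub_apply, EndL.smul_apply, Pi.smul_apply, hop_nil]
    rw [this, sub_self]
  · rw [lie_sub, lie_sub, lie_smul, lie_smul, lie_smul, S.hz_x, S.xh, S.xh, smul_neg, smul_neg, smul_smul, smul_smul,
      ← S.cons' j p q r]
    by_cases h : S.a j p * S.a (S.κ (S.τ j p) q) r = 0
    · rw [h]; simp
    · rw [S.cons'' j p q r h]; simp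

theorem hy (j : J) (q : X) : ⁅S.hop j, S.yop q⁆ = -(S.a j q • S.yop (S.τ j q)) := by
  rw [← sub_eq_zero, sub_neg_eq_add]
  refine detect _ (fun φ => ?_) fun p => ?_
  · simp only [EndL.add_apply, Pi.add_apply, EndL.sub_apply, EndL.lie_apply, Pi.sub_apply,
      EndL.smul_apply, Pi.smul_apply, hop_nil, yop_nil]
    simp
  · rw [lie_add, lie_smul, leibniz_lie, S.xh, S.xy, S.xy, S.hh, S.cons_op, ← neg_smul, smul_lie, S.xy]
    module

open Classical in
variable (X) in
noncomputable def incl (m : M) : List X → M := fun w => if w = [] then m else 0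

theorem x_incl (p : X) (m : M) : xop M p (incl X m) = 0 := by
  ext w; simp [xop, incl, EndL.mk_apply]

theorem h_incl (j : J) (m : M) : S.hop j (incl X m) = incl X (S.ρ j m) := by
  ext w
  cases w with
  | nil => rw [hop_nil]; simp [incl]
  | cons p w =>
    have h := congrFun (DFunLike.congr_fun (S.xh j p) (incl X m)) w
    simp only [EndL.sub_apply, EndL.lie_apply, x_incl, map_zero, EndL.neg_apply,
      EndL.smul_apply, smul_zero, neg_zero, sub_zero, xop_apply] at h
    rw [h]; simp [incl]

inductive GQ : (List X → M) → Prop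
  | base (m : M) : GQ (incl X m)
  | step (q : X) (φ : List X → M) : GQ φ → GQ (S.yop q φ)

def Q : Submodule ℂ (List X → M) := Submodule.span ℂ {φ | S.GQ φ}

theorem Q_ind (T : EndL (List X → M)) (h : ∀ φ, S.GQ φ → T φ ∈ S.Q) : ∀ φ ∈ S.Q, T φ ∈ S.Q := by
  intro φ hφ
  have : S.Q ≤ S.Q.comap (T : (List X → M) →ₗ[ℂ] (List X → M)) := Submodule.span_le.2 fun φ hφ => h φ hφ
  exact this hφ

theorem Qy (q : X) : ∀ φ ∈ S.Q, S.yop q φ ∈ S.Q :=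
  S.Q_ind _ fun φ h => Submodule.subset_span (GQ.step q φ h)

theorem Qincl (m : M) : incl X m ∈ S.Q := Submodule.subset_span (GQ.base m)

theorem Qh (j : J) : ∀ φ ∈ S.Q, S.hop j φ ∈ S.Q := by
  refine S.Q_ind _ fun φ h => ?_
  induction h generalizing j with
  | base m => rw [S.h_incl]; exact S.Qincl _
  | step q φ _ ih =>
    have h := DFunLike.congr_fun (S.hy j q) φ
    simp only [EndL.sub_apply, EndL.lie_apply, EndL.neg_apply, EndL.smul_apply] at h
    rw [sub_eq_iff_eq_add.1 h]
    refine add_mem (neg_mem (Submodule.smul_mem _ _ ?_)) (S.Qy _ _ (ih j))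
    exact Submodule.subset_span (GQ.step _ φ ‹_›)

theorem Qx (p : X) : ∀ φ ∈ S.Q, xop M p φ ∈ S.Q := by
  refine S.Q_ind _ fun φ h => ?_
  induction h with
  | base m => rw [x_incl]; exact zero_mem _
  | step q φ _ ih =>
    have h := DFunLike.congr_fun (S.xy p q) φ
    simp only [EndL.sub_apply, EndL.lie_apply] at h
    rw [sub_eq_iff_eq_add.1 h]
    exact add_mem (S.Qh _ _ (Submodule.subset_span ‹_›)) (S.Qy _ _ ih)

/-- The Lie algebra in which the model lives. -/
abbrev LQ : Type _ := EndL S.Q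

def restr (T : EndL (List X → M)) (h : ∀ φ ∈ S.Q, T φ ∈ S.Q) : S.LQ :=
  LinearMap.restrict (T : (List X → M) →ₗ[ℂ] (List X → M)) h

def x (p : X) : S.LQ := S.restr (xop M p) (S.Qx p)
def y (q : X) : S.LQ := S.restr (S.yop q) (S.Qy q)
def H (j : J) : S.LQ := S.restr (S.hop j) (S.Qh j)

theorem restrict_eq {K K' : S.LQ} (h : ∀ φ : S.Q, (K φ : List X → M) = K' φ) : K = K' :=
  EndL.ext fun φ => Subtype.ext (h φ)

theorem HX (j : J) (p : X) : ⁅S.H j, S.x p⁆ = S.a j p • S.x (S.τ j p) :=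
  S.restrict_eq fun φ => DFunLike.congr_fun (S.hx j p) φ.1

theorem HY (j : J) (q : X) : ⁅S.H j, S.y q⁆ = -(S.a j q • S.y (S.τ j q)) :=
  S.restrict_eq fun φ => DFunLike.congr_fun (S.hy j q) φ.1

theorem XY (p q : X) : ⁅S.x p, S.y q⁆ = S.H (S.κ p q) :=
  S.restrict_eq fun φ => DFunLike.congr_fun (S.xy p q) φ.1

theorem HH (j j' : J) : ⁅S.H j, S.H j'⁆ = S.ψ j j' • S.H S.z :=
  S.restrict_eq fun φ => DFunLike.congr_fun (S.hh j j') φ.1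

noncomputable def inq (m : M) : S.Q := ⟨incl X m, S.Qincl m⟩

/-- annihilates the vacuum vectors -/
def Pos : LieSubalgebra ℂ S.LQ where
  carrier := {θ | ∀ m, θ (S.inq m) = 0}
  add_mem' {u v} hu hv m := by rw [EndL.add_apply, hu, hv, add_zero]
  zero_mem' m := rfl
  smul_mem' c u hu m := by rw [EndL.smul_apply, hu, smul_zero]
  lie_mem' {u v} hu hv m := by
    rw [EndL.lie_apply, hu, hv]; simp

/-- has no vacuum component -/
def Neg : LieSubalgebra ℂ S.LQ where
  carrier := {θ | ∀ φ, (θ φ : List X → M) [] = 0}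
  add_mem' {u v} hu hv φ := by simp [EndL.add_apply, hu φ, hv φ]
  zero_mem' m := rfl
  smul_mem' c u hu m := by simp [EndL.smul_apply, hu m]
  lie_mem' {u v} hu hv φ := by
    rw [EndL.lie_apply]
    simp [hu (v φ), hv (u φ)]

theorem x_Pos (p : X) : S.x p ∈ S.Pos := fun m => Subtype.ext (x_incl p m)
theorem y_Neg (q : X) : S.y q ∈ S.Neg := fun φ => S.yop_nil q φ

theorem T_Neg (θ : S.LQ) (h0 : θ ∈ S.Neg) (h : ∀ p, ⁅S.x p, θ⁆ = 0) : θ = 0 := by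
  have : ∀ (w : List X) φ, (θ φ : List X → M) w = 0 := by
    intro w
    induction w with
    | nil => exact h0
    | cons p w ih =>
      intro φ
      have h1 := congrFun (congrArg Subtype.val (DFunLike.congr_fun (h p) φ)) w
      rw [EndL.lie_apply] at h1
      have h2 : (θ φ : List X → M) (p :: w) - (θ (S.x p φ) : List X → M) w = 0 := h1
      rw [ih] at h2
      simpa using h2
  exact S.restrict_eq fun φ => funext fun w => this w φ

theorem T_Pos (θ : S.LQ) (h0 : θ ∈ S.Pos) (h : ∀ q, ⁅S.y q, θ⁆ = 0) : θ = 0 := by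
  have key : ∀ φ (hφ : S.GQ φ), θ ⟨φ, Submodule.subset_span hφ⟩ = 0 := by
    intro φ hφ
    induction hφ with
    | base m => exact h0 m
    | step q φ hφ ih =>
      have h1 := DFunLike.congr_fun (h q) ⟨φ, Submodule.subset_span hφ⟩
      rw [EndL.lie_apply, ih, map_zero, zero_sub] at h1
      exact neg_eq_zero.1 h1
  refine EndL.ext fun φ => ?_
  obtain ⟨φ, hφ⟩ := φ
  induction hφ using Submodule.span_induction with
  | mem φ h => exact key φ h
  | zero => exact map_zero θ
  | add u v hu hv h1 h2 =>
    have : (⟨u + v, add_mem hu hv⟩ : S.Q) = ⟨u, hu⟩ + ⟨v, hv⟩ := rfl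
    rw [this, map_add, h1, h2]; simp [EndL.zero_apply]
  | smul c u hu h1 =>
    have : (⟨c • u, Submodule.smul_mem _ c hu⟩ : S.Q) = c • ⟨u, hu⟩ := rfl
    rw [this, map_smul, h1]; simp [EndL.zero_apply]

/-- vacuum expectation -/
noncomputable def ev : S.LQ →ₗ[ℂ] (M → M) where
  toFun θ := fun m => (θ (S.inq m) : List X → M) []
  map_add' _ _ := rfl
  map_smul' _ _ := rfl

theorem ev_H (j : J) : S.ev (S.H j) = S.ρ j := by
  funext m
  have : (S.H j (S.inq m) : List X → M) = incl X (S.ρ j m) := S.h_incl j m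
  have h2 : S.ev (S.H j) m = (S.H j (S.inq m) : List X → M) [] := rfl
  rw [h2, this]; simp [incl]

/-- linear relations between the `H j` -/
theorem H_add (j1 j2 j3 : J) (c d : ℂ) (hρ : c • S.ρ j1 + d • S.ρ j2 = S.ρ j3)
    (ha : ∀ p, c * S.a j1 p + d * S.a j2 p = S.a j3 p)
    (h1 : ∀ p, S.τ j1 p = p) (h2 : ∀ p, S.τ j2 p = p) (h3 : ∀ p, S.τ j3 p = p) :
    c • S.H j1 + d • S.H j2 = S.H j3 := by
  refine sub_eq_zero.1 (S.T_Neg _ (fun φ => ?_) fun p => ?_)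
  · have := DFunLike.congr_fun hρ ((φ : List X → M) [])
    have e : ∀ j, (S.H j φ : List X → M) [] = S.ρ j ((φ : List X → M) []) := fun j => S.hop_nil j φ
    simp only [EndL.sub_apply, EndL.add_apply, EndL.smul_apply, Submodule.coe_sub, Submodule.coe_add,
      Submodule.coe_smul, Pi.sub_apply, Pi.add_apply, Pi.smul_apply, e] at this ⊢
    rw [this, sub_self]
  · rw [← lie_skew, sub_lie, add_lie, smul_lie, smul_lie, S.HX, S.HX, S.HX, h1, h2, h3, ← ha]
    module
end MData

open LieAlgebra TensorProduct

section MdlSec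
universe u
variable {V : Type u} [AddCommGroup V] [Module ℝ V]

open Classical in
/-- the structure constants `[h_i(p), x_j(n)] = A i j p • x_j(n + p k_i / k_j)` -/
noncomputable def cA (B : LinearMap.BilinForm ℝ V) {P : Set V} (k : V → ℕ) (g : V → Bool) (Ω : V → V → ℂ)
    (i j : P) (p : ℤ) : ℂ :=
  if i = j then dd (if g i = true then 6 else 2) p else
  if (k j : ℤ) ∣ p * k i then ((2 * B (i:V) j / B (i:V) i : ℝ) : ℂ) * Ω i j ^ (p * k i / (Nat.lcm (k i) (k j) : ℤ)) else 0

/-- The Lie algebra of operators of the model. -/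
structure Mdl {L : Type*} [LieRing L] [LieAlgebra ℂ L] (B : LinearMap.BilinForm ℝ V) (P : Set V) (a : V) (k : V → ℕ)
    (g : V → Bool) (Ω : V → V → ℂ) (hb : Vc V → L) (x y H : P → ℤ → L) (Pos Neg : LieSubalgebra ℂ L) : Prop where
  s1 : ∀ (x y : ℂ) (σ τ : Vc V), x • hb σ + y • hb τ = hb (x • σ + y • τ)
  s2 : ∀ σ τ : Vc V, ⁅hb σ, hb τ⁆ = 0
  hx : ∀ σ (i : P) n, ⁅hb σ, x i n⁆ = bc B σ i • x i n
  hy : ∀ σ (i : P) n, ⁅hb σ, y i n⁆ = -(bc B σ i • y i n)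
  HX : ∀ (i j : P) m n, ⁅H i m, x j n⁆ = cA B k g Ω i j m • x j (n + m * k i / k j)
  HY : ∀ (i j : P) m n, ⁅H i m, y j n⁆ = -(cA B k g Ω i j m • y j (n + m * k i / k j))
  xy : ∀ (i : P) m n, m + n ≠ 0 → ⁅x i m, y i n⁆ = H i (m+n)
  xy0 : ∀ (i : P) m n, m + n = 0 → ⁅x i m, y i n⁆ = hb ((1:ℂ) ⊗ₜ[ℝ] vee B ((i:V) + ((m * k i : ℤ) : ℝ) • a))
  xy' : ∀ i j, i ≠ j → ∀ m n, ⁅x i m, y j n⁆ = 0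
  hinj : Function.Injective hb
  hlin : LinearIndependent ℂ (fun p : P × ℤ => H p.1 p.2)
  xPos : ∀ i n, x i n ∈ Pos
  yNeg : ∀ i n, y i n ∈ Neg
  TPos : ∀ θ ∈ Pos, (∀ i n, ⁅y i n, θ⁆ = 0) → θ = 0
  TNeg : ∀ θ ∈ Neg, (∀ i n, ⁅x i n, θ⁆ = 0) → θ = 0

variable {B : LinearMap.BilinForm ℝ V} {R : Set V} {l : ℕ} {P : Set V} {a : V} {k : V → ℕ} {g : V → Bool}
  {Ω : V → V → ℂ}

namespace Setup

theorem cA_zero (S : Setup B R l P a k g) (i j : P) : cA B k g Ω i j 0 = ((2 * B (i:V) j / B (i:V) i : ℝ) : ℂ) := by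
  rw [cA]
  by_cases h : i = j
  · rw [if_pos h]
    subst h
    have := (S.posP i).ne'
    rw [dd_zero]; push_cast
    have : (B (i:V) i : ℂ) ≠ 0 := by exact_mod_cast this
    field_simp
  · rw [if_neg h]; simp

theorem cA_dvd {i j : P} {m : ℤ} (h : cA B k g Ω i j m ≠ 0) : (k j : ℤ) ∣ m * k i := by
  rw [cA] at h
  by_cases h1 : i = j
  · subst h1; exact Dvd.intro_left m rfl
  · by_contra h2
    rw [if_neg h1, if_neg h2] at h
    exact h rfl

theorem cA_symm (S : Setup B R l P a k g) (hΩ : ∀ i j : P, Ω i j * Ω j i = 1) {i j : P} {m n : ℤ}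
    (h : m * k i + n * k j = 0) : cA B k g Ω i j m / (B (j:V) j : ℂ) = cA B k g Ω j i n / (B (i:V) i : ℂ) := by
  have kp : ∀ i : P, (k i : ℤ) ≠ 0 := fun i => by exact_mod_cast (S.k_pos i).ne'
  by_cases hij : i = j
  · subst hij
    have : n = -m := by
      have : (m + n) * k i = 0 := by linear_combination h
      rcases mul_eq_zero.1 this with h | h
      · omega
      · exact absurd h (kp i)
    subst this
    rw [cA, if_pos rfl, cA, if_pos rfl, dd_neg]
  rw [cA, if_neg hij, if_pos ⟨-n, by linear_combination h⟩, cA, if_neg (Ne.symm hij), if_pos ⟨-m, by linear_combination h⟩]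
  have hi : (B (i:V) i : ℂ) ≠ 0 := by exact_mod_cast (S.posP i).ne'
  have hj : (B (j:V) j : ℂ) ≠ 0 := by exact_mod_cast (S.posP j).ne'
  have e : Ω j i = (Ω i j)⁻¹ := eq_inv_of_mul_eq_one_right (hΩ i j)
  have e2 : n * k j / (Nat.lcm (k j) (k i) : ℤ) = -(m * k i / (Nat.lcm (k i) (k j) : ℤ)) := by
    rw [show n * k j = -(m * k i) by linear_combination h, Nat.lcm_comm, Int.neg_ediv_of_dvd]
    rw [Int.natCast_dvd]
    refine Nat.lcm_dvd ?_ ?_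
    · exact Int.natCast_dvd.1 (Dvd.intro_left m rfl)
    · exact Int.natCast_dvd.1 ⟨-n, by linear_combination h⟩
  rw [e2, e, inv_zpow', neg_neg, S.hE.symm (j:V) i]
  push_cast
  field_simp

/-- vector space carrying the Heisenberg algebra -/
abbrev MM (V : Type*) [AddCommGroup V] [Module ℝ V] (P : Set V) : Type _ := (Vc V × (P × ℤ →₀ ℂ)) × ℂ

open Classical in
variable (B P a k g Ω) in
noncomputable def mψ : Vc V ⊕ (P × ℤ) → Vc V ⊕ (P × ℤ) → ℂ
  | Sum.inr p, Sum.inr q => if p.2 * k p.1 + q.2 * k q.1 = 0 then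
      cA B k g Ω p.1 q.1 p.2 * (2 * (p.2 * k p.1 : ℤ) / (B (q.1:V) q.1 : ℂ)) else 0
  | _, _ => 0

variable (B P a k g Ω) in
noncomputable def mρ : Vc V ⊕ (P × ℤ) → EndL (MM V P)
  | Sum.inl σ => EndL.mk (fun m => ((m.2 • σ, 0), 0)) (fun u v => by ext <;> simp [add_smul])
      (fun c u => by simp [mul_smul])
  | Sum.inr q => EndL.mk (fun m => (((2:ℂ)⁻¹ • Finsupp.linearCombination ℂ (fun q' => mψ B P k g Ω (Sum.inr q) (Sum.inr q')) m.1.2 • ((1:ℂ) ⊗ₜ[ℝ] a),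
        m.2 • Finsupp.single q 1), 0)) (fun u v => by simp [add_smul, -Finsupp.smul_single])
      (fun c u => by simp [mul_smul, smul_comm c, -Finsupp.smul_single])

variable (B P k g Ω) in
noncomputable def ma : Vc V ⊕ (P × ℤ) → P × ℤ → ℂ
  | Sum.inl σ, q => bc B σ q.1
  | Sum.inr p, q => cA B k g Ω p.1 q.1 p.2

variable (P k) in
noncomputable def mτ : Vc V ⊕ (P × ℤ) → P × ℤ → P × ℤ
  | Sum.inl _, q => q
  | Sum.inr p, q => (q.1, q.2 + p.2 * k p.1 / k q.1)

open Classical in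
variable (B P a k) in
noncomputable def mκ (p q : P × ℤ) : Vc V ⊕ (P × ℤ) :=
  if p.1 = q.1 then
    if p.2 + q.2 = 0 then Sum.inl ((1:ℂ) ⊗ₜ[ℝ] vee B ((p.1:V) + ((p.2 * k p.1 : ℤ) : ℝ) • a)) else Sum.inr (p.1, p.2 + q.2)
  else Sum.inl 0

theorem vee_shift (S : Setup B R l P a k g) (i : P) (r : ℝ) :
    vee B ((i:V) + r • a) = vee B (i:V) + (2 * r / B (i:V) i) • a := by
  have h : B ((i:V) + r • a) ((i:V) + r • a) = B (i:V) i := by simp [S.Ba, S.Ba']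
  rw [vee, vee, h, smul_add, smul_smul]
  congr 2; ring

theorem bc_vee_shift (S : Setup B R l P a k g) (i : P) (r : ℝ) (v : V) :
    bc B ((1:ℂ) ⊗ₜ[ℝ] vee B ((i:V) + r • a)) v = ((2 * B (i:V) v / B (i:V) i : ℝ) : ℂ) := by
  rw [bc_one, S.vee_shift, vee]
  congr 1
  simp [S.Ba]; ring

theorem ρ_zero : mρ B P a k g Ω (Sum.inl 0) = 0 := by
  refine EndL.ext fun v => ?_
  simp [mρ, EndL.mk_apply, EndL.zero_apply]

noncomputable def mdata (S : Setup B R l P a k g) (hΩ : ∀ i j : P, Ω i j * Ω j i = 1) :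
    MData (P × ℤ) (Vc V ⊕ (P × ℤ)) (MM V P) where
  ρ := mρ B P a k g Ω
  a := ma B P k g Ω
  τ := mτ P k
  κ := mκ B P a k
  z := Sum.inl ((1:ℂ) ⊗ₜ[ℝ] a)
  ψ := mψ B P k g Ω
  hρ j j' := by
    refine EndL.ext fun v => ?_
    rw [EndL.lie_apply, EndL.smul_apply]
    rcases j with σ | q <;> rcases j' with σ' | q'
    · simp [mρ, EndL.mk_apply, mψ]
    · simp [mρ, EndL.mk_apply, mψ]
    · simp [mρ, EndL.mk_apply, mψ]
    · have hs : mψ B P k g Ω (Sum.inr q') (Sum.inr q) = - mψ B P k g Ω (Sum.inr q) (Sum.inr q') := by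
        simp only [mψ]
        by_cases h : q.2 * k q.1 + q'.2 * k q'.1 = 0
        · rw [if_pos h, if_pos (by linear_combination h)]
          have := S.cA_symm hΩ h
          have e : ((q'.2 * k q'.1 : ℤ) : ℂ) = -((q.2 * k q.1 : ℤ) : ℂ) := by
            rw [← Int.cast_neg]; congr 1; linear_combination h
          rw [e]
          linear_combination (2 * ((q.2 * k q.1 : ℤ) : ℂ)) * this
        · rw [if_neg h, if_neg (by rwa [add_comm]), neg_zero]
      simp [mρ, EndL.mk_apply, hs, smul_smul]
      module
  aτ j j' p := by rcases j with σ | q <;> rcases j' with σ' | q' <;> simp [ma, mτ]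
  ττ j j' p := by
    rcases j with σ | q <;> rcases j' with σ' | q' <;> simp [mτ]
    ring
  az p := by simp [ma, bc_one, S.Ba]
  cons j p q := by
    obtain ⟨i, n⟩ := p
    obtain ⟨i', n'⟩ := q
    by_cases hi : i = i'
    swap
    · rcases j with σ | u <;> simp [mκ, mτ, hi, ρ_zero, mψ]
    subst hi
    rcases j with σ | u
    · simp [mκ, mτ, ma, mψ]
    obtain ⟨i', m⟩ := u
    by_cases hA : cA B k g Ω i' i m = 0
    · simp only [mκ, ma, hA, zero_smul, sub_self, if_true]
      split_ifs <;> simp [mψ, hA]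
    obtain ⟨s, hs⟩ := cA_dvd hA
    have kp : (k i : ℤ) ≠ 0 := by exact_mod_cast (S.k_pos i).ne'
    have hd : m * k i' / k i = s := by rw [hs]; exact Int.mul_ediv_cancel_left _ kp
    simp only [mκ, ma, mτ, if_true, hd]
    by_cases h1 : n + s + n' = 0
    · rw [if_pos h1, if_pos (show n + (n' + s) = 0 by linarith), ← smul_sub]
      have e0 : ∀ σ σ', mρ B P a k g Ω (Sum.inl σ) - mρ B P a k g Ω (Sum.inl σ') = mρ B P a k g Ω (Sum.inl (σ - σ')) := by
        intro σ σ'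
        refine EndL.ext fun v => ?_
        simp [mρ, EndL.mk_apply, EndL.sub_apply, smul_sub]
      have e1 : ∀ (c : ℂ) σ, c • mρ B P a k g Ω (Sum.inl σ) = mρ B P a k g Ω (Sum.inl (c • σ)) := by
        intro c σ
        refine EndL.ext fun v => ?_
        simp [mρ, EndL.mk_apply, EndL.smul_apply, smul_smul, mul_comm]
      rw [e0, e1, e1]
      congr 2
      rw [S.vee_shift, S.vee_shift, ← tmul_sub, add_sub_add_left_eq_sub, ← sub_smul, cast_tmul, smul_smul]
      congr 1
      by_cases h2 : n + n' = 0
      · have : s = 0 := by linarith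
        subst this
        simp [h2, mψ]
      · simp only [h2, if_false, mψ]
        rw [if_pos (by rw [hs]; linear_combination (k i : ℤ) * h1), hs]
        have hi : (B (i:V) i : ℂ) ≠ 0 := by exact_mod_cast (S.posP i).ne'
        push_cast
        field_simp
        ring
    · rw [if_neg h1, if_neg (show ¬ n + (n' + s) = 0 by intro h; apply h1; linarith), add_right_comm n s n', add_assoc n n' s, sub_self]
      split_ifs with h2
      · simp [mψ]
      · simp only [mψ]
        rw [if_neg, zero_smul]
        rw [hs]
        intro h
        have : (k i : ℤ) * (n + s + n') = 0 := by linear_combination h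
        rcases mul_eq_zero.1 this with h | h
        · exact kp h
        · exact h1 h
  cons' j p q r := by
    obtain ⟨i, n⟩ := p
    obtain ⟨i', n'⟩ := q
    by_cases hi : i = i'
    swap
    · rcases j with σ | u <;> simp [mκ, mτ, hi, ma, bc]
    subst hi
    rcases j with σ | u
    · simp [mκ, mτ, ma]
    simp only [mκ, ma, mτ, if_true, add_right_comm n _ n', ← add_assoc]
    split_ifs
    · change _ * bc B _ _ = _ * bc B _ _
      rw [S.bc_vee_shift, S.bc_vee_shift]
    · rfl
  cons'' j p q r := by
    obtain ⟨i, n⟩ := p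
    obtain ⟨i', n'⟩ := q
    intro _
    by_cases hi : i = i'
    swap
    · rcases j with σ | u <;> simp [mκ, mτ, hi]
    subst hi
    rcases j with σ | u
    · simp [mκ, mτ]
    simp only [mκ, mτ, if_true, add_right_comm n _ n', ← add_assoc]
    split_ifs <;> rfl

theorem exists_mdl (S : Setup B R l P a k g) (hΩ : ∀ i j : P, Ω i j * Ω j i = 1) :
    ∃ (L : Type u) (_ : LieRing L) (_ : LieAlgebra ℂ L) (hb : Vc V → L) (x y H : P → ℤ → L) (Pos Neg : LieSubalgebra ℂ L),
      Mdl B P a k g Ω hb x y H Pos Neg := by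
  let D := S.mdata (Ω := Ω) hΩ
  have ek : ∀ p q, D.κ p q = mκ B P a k p q := fun _ _ => rfl
  have evσ : ∀ σ, D.ev (D.H (Sum.inl σ)) ((0,0),1) = ((σ,0),0) := by
    intro σ
    rw [D.ev_H]
    change mρ B P a k g Ω (Sum.inl σ) _ = _
    simp [mρ, EndL.mk_apply]
  have evq : ∀ q, D.ev (D.H (Sum.inr q)) ((0,0),1) = ((0, Finsupp.single q 1),0) := by
    intro q
    rw [D.ev_H]
    change mρ B P a k g Ω (Sum.inr q) _ = _
    simp [mρ, EndL.mk_apply]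
  refine ⟨D.LQ, inferInstance, inferInstance, fun σ => D.H (Sum.inl σ), fun i n => D.x (i, n), fun i n => D.y (i, n),
    fun i n => D.H (Sum.inr (i, n)), D.Pos, D.Neg, ?_⟩
  exact {
    s1 := fun x y σ τ => by
      refine D.H_add _ _ _ x y ?_ ?_ (fun _ => rfl) (fun _ => rfl) (fun _ => rfl)
      · refine EndL.ext fun v => ?_
        change (x • mρ B P a k g Ω (Sum.inl σ) + y • mρ B P a k g Ω (Sum.inl τ)) v = mρ B P a k g Ω (Sum.inl (x • σ + y • τ)) v
        simp [mρ, EndL.mk_apply, EndL.add_apply, EndL.smul_apply, smul_smul, mul_comm]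
      · intro p
        change x * bc B σ p.1 + y * bc B τ p.1 = bc B (x • σ + y • τ) p.1
        simp [bc]
    s2 := fun σ τ => by
      rw [D.HH]
      exact zero_smul _ _
    hx := fun σ i n => D.HX _ _
    hy := fun σ i n => D.HY _ _
    HX := fun i j m n => D.HX _ _
    HY := fun i j m n => D.HY _ _
    xy := fun i m n h => by rw [D.XY, ek, mκ]; simp [h]
    xy0 := fun i m n h => by rw [D.XY, ek, mκ]; simp [h]
    xy' := fun i j h m n => by
      rw [D.XY, ek, mκ, if_neg h]
      have := D.H_add (Sum.inl 0) (Sum.inl 0) (Sum.inl 0) 0 0 (by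
        change (0:ℂ) • mρ B P a k g Ω (Sum.inl 0) + (0:ℂ) • mρ B P a k g Ω (Sum.inl 0) = mρ B P a k g Ω (Sum.inl 0)
        rw [ρ_zero]; simp) (fun p => by
        change 0 * bc B 0 p.1 + 0 * bc B 0 p.1 = bc B 0 p.1
        simp [bc]) (fun _ => rfl) (fun _ => rfl) (fun _ => rfl)
      rw [← this]; simp
    hinj := fun σ τ h => by
      have h1 := congrArg (fun θ => D.ev θ ((0,0),1)) h
      simp only [evσ] at h1
      exact (Prod.mk.inj (Prod.mk.inj h1).1).1
    hlin := by
      let F : D.LQ →ₗ[ℂ] (P × ℤ →₀ ℂ) :=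
        (LinearMap.snd ℂ (Vc V) (P × ℤ →₀ ℂ) ∘ₗ LinearMap.fst ℂ _ ℂ) ∘ₗ
          (LinearMap.proj (R := ℂ) (φ := fun _ : MM V P => MM V P) ((0,0),1)) ∘ₗ D.ev
      refine LinearIndependent.of_comp F ?_
      have : (F ∘ fun p : P × ℤ => D.H (Sum.inr (p.1, p.2))) = fun p => Finsupp.single p 1 := by
        funext p
        change (D.ev (D.H (Sum.inr (p.1, p.2))) ((0,0),1)).1.2 = _
        rw [evq]
      rw [this]
      exact Finsupp.linearIndependent_single_one ℂ (P × ℤ)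
    xPos := fun i n => D.x_Pos _
    yNeg := fun i n => D.y_Neg _
    TPos := fun θ h h' => D.T_Pos θ h fun q => h' q.1 q.2
    TNeg := fun θ h h' => D.T_Neg θ h fun q => h' q.1 q.2 }
end Setup
end MdlSec

open LieAlgebra

section HalfSec
variable {V : Type*} [AddCommGroup V] [Module ℝ V] {L : Type*} [LieRing L] [LieAlgebra ℂ L]

theorem lieSpan_comm {s : Set L} {z : L} (h : ∀ u ∈ s, ⁅z, u⁆ = 0) {θ : L} (hθ : θ ∈ LieSubalgebra.lieSpan ℂ L s) :
    ⁅z, θ⁆ = 0 := by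
  induction hθ using LieSubalgebra.lieSpan_induction with
  | mem u hu => exact h u hu
  | zero => exact lie_zero _
  | add u v _ _ hu hv => rw [lie_add, hu, hv, add_zero]
  | smul c u _ hu => rw [lie_smul, hu, smul_zero]
  | lie u v _ _ hu hv => rw [leibniz_lie, hu, hv, zero_lie, lie_zero, add_zero]

/-- half of the model: the positive part tested by the negative one -/
structure HalfM (B : LinearMap.BilinForm ℝ V) (P : Set V) (k : V → ℕ) (g : V → Bool) (Ω : V → V → ℂ)
    (x y : P → ℤ → L) (Pos : LieSubalgebra ℂ L) : Prop where
  act : ∀ (i j : P) m n p, ⁅⁅x i m, y i n⁆, x j p⁆ = cA B k g Ω i j (m+n) • x j (p + (m+n) * k i / k j)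
  actY : ∀ (i : P) m n p, ⁅⁅x i m, y i n⁆, y i p⁆ = -(dd (if g i = true then 6 else 2) (m+n) • y i (p + (m+n)))
  xy' : ∀ i j, i ≠ j → ∀ m n, ⁅x i m, y j n⁆ = 0
  xPos : ∀ i n, x i n ∈ Pos
  T : ∀ θ ∈ Pos, (∀ i n, ⁅y i n, θ⁆ = 0) → θ = 0

variable {B : LinearMap.BilinForm ℝ V} {R : Set V} {l : ℕ} {P : Set V} {a : V} {k : V → ℕ} {g : V → Bool}
  {Ω : V → V → ℂ} {hb : Vc V → L} {x y H : P → ℤ → L} {Pos Neg : LieSubalgebra ℂ L}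

theorem cA_neg (i j : P) (p : ℤ) : cA B k g Ω i j (-p) = cA B k g (fun u v => (Ω u v)⁻¹) i j p := by
  rw [cA, cA]
  by_cases h : i = j
  · rw [if_pos h, if_pos h, dd_neg]
  rw [if_neg h, if_neg h]
  by_cases h2 : (k j : ℤ) ∣ p * k i
  · rw [if_pos h2, if_pos (by rw [neg_mul]; exact (Int.dvd_neg).2 h2)]
    have : (Nat.lcm (k i) (k j) : ℤ) ∣ p * k i := by
      rw [Int.natCast_dvd] at h2 ⊢
      exact Nat.lcm_dvd (Int.natCast_dvd.1 (Dvd.intro_left p rfl)) h2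
    rw [neg_mul, Int.neg_ediv_of_dvd this, inv_zpow']
  · rw [if_neg h2, if_neg (by rw [neg_mul]; exact fun h => h2 ((Int.dvd_neg).1 h))]

namespace Mdl

theorem act (S : Setup B R l P a k g) (M : Mdl B P a k g Ω hb x y H Pos Neg) (i j : P) (m n p : ℤ) :
    ⁅⁅x i m, y i n⁆, x j p⁆ = cA B k g Ω i j (m+n) • x j (p + (m+n) * k i / k j) := by
  by_cases h : m + n = 0
  · rw [M.xy0 i m n h, M.hx, S.bc_vee_shift, h, S.cA_zero, zero_mul, Int.zero_ediv, add_zero]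
  · rw [M.xy i m n h, M.HX]

theorem act' (S : Setup B R l P a k g) (M : Mdl B P a k g Ω hb x y H Pos Neg) (i j : P) (m n p : ℤ) :
    ⁅⁅x i m, y i n⁆, y j p⁆ = -(cA B k g Ω i j (m+n) • y j (p + (m+n) * k i / k j)) := by
  by_cases h : m + n = 0
  · rw [M.xy0 i m n h, M.hy, S.bc_vee_shift, h, S.cA_zero, zero_mul, Int.zero_ediv, add_zero]
  · rw [M.xy i m n h, M.HY]

theorem self_div (S : Setup B R l P a k g) (i : P) (m : ℤ) : m * (k i : ℤ) / k i = m :=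
  Int.mul_ediv_cancel _ (by exact_mod_cast (S.k_pos i).ne')

theorem half (S : Setup B R l P a k g) (M : Mdl B P a k g Ω hb x y H Pos Neg) : HalfM B P k g Ω x y Pos where
  act := M.act S
  actY i m n p := by rw [M.act' S, self_div S, cA, if_pos rfl]
  xy' := M.xy'
  xPos := M.xPos
  T := M.TPos

theorem half' (S : Setup B R l P a k g) (M : Mdl B P a k g Ω hb x y H Pos Neg) :
    HalfM B P k g (fun u v => (Ω u v)⁻¹) (fun i n => y i (-n)) (fun i n => x i (-n)) Neg where
  act i j m n p := by
    rw [← lie_skew (y i (-m)) (x i (-n)), neg_lie, M.act' S, neg_neg, ← cA_neg, show -n + -m = -(m+n) by ring]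
    by_cases h : cA B k g Ω i j (-(m+n)) = 0
    · rw [h, zero_smul, zero_smul]
    · have hd : (k j : ℤ) ∣ (m+n) * k i := by
        have := Setup.cA_dvd h
        rw [neg_mul] at this
        exact (Int.dvd_neg).1 this
      rw [neg_mul, Int.neg_ediv_of_dvd hd, neg_add p]
  actY i m n p := by
    rw [← lie_skew (y i (-m)) (x i (-n)), neg_lie, M.act S, self_div S, cA, if_pos rfl,
      show -n + -m = -(m+n) by ring, dd_neg, neg_add p]
  xy' i j h m n := by rw [← lie_skew (y i (-m)) (x j (-n)), M.xy' j i (Ne.symm h), neg_zero]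
  xPos i n := M.yNeg i _
  T θ h h' := M.TNeg θ h fun i n => by simpa using h' i (-n)

end Mdl

namespace HalfM

theorem yx (M : HalfM B P k g Ω x y Pos) {i j : P} (h : i ≠ j) (m n : ℤ) : ⁅y i m, x j n⁆ = 0 := by
  rw [← lie_skew (y i m) (x j n), M.xy' j i h.symm, neg_zero]

/-- the subalgebra generated by one family -/
def N1 (x : P → ℤ → L) (i : P) : LieSubalgebra ℂ L := LieSubalgebra.lieSpan ℂ L (Set.range (x i))

/-- the subalgebra generated by two families -/
def N2 (x : P → ℤ → L) (i j : P) : LieSubalgebra ℂ L := LieSubalgebra.lieSpan ℂ L (Set.range (x i) ∪ Set.range (x j))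

theorem T1 (M : HalfM B P k g Ω x y Pos) (i : P) {θ : L} (h : θ ∈ N1 x i) (h' : ∀ t, ⁅y i t, θ⁆ = 0) : θ = 0 := by
  refine M.T θ (LieSubalgebra.lieSpan_le.2 ?_ h) fun j n => ?_
  · rintro _ ⟨n, rfl⟩; exact M.xPos _ _
  by_cases hij : j = i
  · subst hij; exact h' n
  refine lieSpan_comm ?_ h
  rintro _ ⟨t, rfl⟩
  exact M.yx hij _ _

theorem T2 (M : HalfM B P k g Ω x y Pos) (i j : P) {θ : L} (h : θ ∈ N2 x i j) (h' : ∀ t, ⁅y i t, θ⁆ = 0)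
    (h'' : ∀ t, ⁅y j t, θ⁆ = 0) : θ = 0 := by
  refine M.T θ (LieSubalgebra.lieSpan_le.2 ?_ h) fun u n => ?_
  · rintro _ (⟨n, rfl⟩ | ⟨n, rfl⟩) <;> exact M.xPos _ _
  by_cases hij : u = i
  · subst hij; exact h' n
  by_cases hij' : u = j
  · subst hij'; exact h'' n
  refine lieSpan_comm ?_ h
  rintro _ (⟨t, rfl⟩ | ⟨t, rfl⟩)
  · exact M.yx hij _ _
  · exact M.yx hij' _ _

theorem act1 (S : Setup B R l P a k g) (M : HalfM B P k g Ω x y Pos) (i : P) (q p n : ℤ) :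
    ⁅⁅y i q, x i p⁆, x i n⁆ = -(dd (if g i = true then 6 else 2) (p+q) • x i (p+q+n)) := by
  rw [← lie_skew (y i q) (x i p), neg_lie, M.act, Mdl.self_div S, cA, if_pos rfl, add_comm n]

theorem to1 (S : Setup B R l P a k g) (M : HalfM B P k g Ω x y Pos) (i : P) :
    TO (if g i = true then 6 else 2) (x i) (y i) (N1 x i) where
  act := M.act1 S i
  mem n := LieSubalgebra.subset_lieSpan ⟨n, rfl⟩
  T θ h h' := M.T1 i h h'

/-- orthogonal simple roots -/
theorem comm (S : Setup B R l P a k g) (M : HalfM B P k g Ω x y Pos) {i j : P} (hij : i ≠ j) (h : B (i:V) j = 0)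
    (m n : ℤ) : ⁅x i m, x j n⁆ = 0 := by
  have m1 : ∀ n, x i n ∈ N2 x i j := fun n => LieSubalgebra.subset_lieSpan (Or.inl ⟨n, rfl⟩)
  have m2 : ∀ n, x j n ∈ N2 x i j := fun n => LieSubalgebra.subset_lieSpan (Or.inr ⟨n, rfl⟩)
  refine M.T2 i j (LieSubalgebra.lie_mem _ (m1 m) (m2 n)) (fun t => ?_) (fun t => ?_)
  · rw [leibniz_lie, M.yx hij, lie_zero, add_zero, ← lie_skew (y i t) (x i m), neg_lie, M.act, cA, if_neg hij, h]
    simp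
  · rw [leibniz_lie, M.yx hij.symm, zero_lie, zero_add, ← lie_skew (y j t) (x j n), lie_neg, lie_skew, M.act, cA,
      if_neg hij.symm, S.hE.symm (j:V) i, h]
    simp

theorem tp (S : Setup B R l P a k g) (M : HalfM B P k g Ω x y Pos) (hΩ : ∀ i j : P, Ω i j * Ω j i = 1)
    {i j : P} (hij : i ≠ j) {m r : ℕ} (h1 : 2 * B (i:V) j = -(B (j:V) j)) (h2 : 2 * B (i:V) j = -(m * B (i:V) i))
    (hk : k j = r * k i) (hg : g j = false) :
    TP m r (if g i = true then 6 else 2) (x i) (y i) (fun n => Ω i j ^ n • x j n) (fun n => Ω i j ^ n • y j n)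
      (N2 x i j) (N1 x i) (N1 x j) := by
  have w0 : Ω i j ≠ 0 := left_ne_zero_of_mul_eq_one (hΩ i j)
  have ki : (k i : ℤ) ≠ 0 := by exact_mod_cast (S.k_pos i).ne'
  have hkz : (k j : ℤ) = r * k i := by rw [hk]; push_cast; ring
  have r0 : r ≠ 0 := by
    rintro rfl
    have := S.k_pos j
    rw [hk] at this; omega
  have hlcm : Nat.lcm (k i) (k j) = k j := Nat.lcm_eq_right (by rw [hk]; exact Dvd.intro_left r rfl)
  have pi := (S.posP i).ne'
  have pj := (S.posP j).ne'
  have e : Ω j i = (Ω i j)⁻¹ := eq_inv_of_mul_eq_one_right (hΩ i j)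
  refine ⟨M.to1 S i, ⟨?_, ?_, ?_⟩, r0, ?_, ?_, ?_, ?_, ?_, ?_, ?_⟩
  · intro q p n
    simp only [smul_lie, lie_smul]
    rw [M.act1 S j, hg, smul_neg, smul_neg, smul_neg, smul_smul, smul_smul, smul_smul, smul_smul]
    rw [zpow_add₀ w0, zpow_add₀ w0]
    simp only [Bool.false_eq_true, if_false]
    congr 2; ring
  · intro n
    exact LieSubalgebra.smul_mem _ _ (LieSubalgebra.subset_lieSpan ⟨n, rfl⟩)
  · intro θ h h'
    refine M.T1 j h fun t => ?_
    have := h' t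
    rw [smul_lie] at this
    exact (smul_eq_zero.1 this).resolve_left (zpow_ne_zero _ w0)
  · intro q p n
    have c1 : cA B k g Ω i j (p+q) = -(m * dv r (p+q)) * Ω i j ^ ((p+q)/r) := by
      rw [cA, if_neg hij, dv]
      have hd : (k j : ℤ) ∣ (p+q) * k i ↔ (r:ℤ) ∣ p + q := by
        rw [hkz]; exact Int.mul_dvd_mul_iff_right ki
      have he : (p+q) * k i / (k j : ℤ) = (p+q)/r := by
        rw [hkz]; exact Int.mul_ediv_mul_of_pos_left _ _ (by exact_mod_cast S.k_pos i)
      have hn : 2 * B (i:V) j / B (i:V) i = -m := by rw [h2]; field_simp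
      by_cases h : (r:ℤ) ∣ p + q
      · rw [if_pos (hd.2 h), if_pos h, hlcm, he, hn]; push_cast; ring
      · rw [if_neg (fun h' => h (hd.1 h')), if_neg h]; simp
    have he : (p+q) * k i / (k j : ℤ) = (p+q)/r := by
      rw [hkz]; exact Int.mul_ediv_mul_of_pos_left _ _ (by exact_mod_cast S.k_pos i)
    rw [lie_smul, ← lie_skew (y i q) (x i p), neg_lie, M.act, c1, he, smul_neg, smul_smul, smul_smul, ← neg_smul,
      zpow_add₀ w0]
    congr 1; ring
  · intro q p n
    have c1 : cA B k g Ω j i (p+q) = -(Ω i j ^ (p+q))⁻¹ := by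
      rw [cA, if_neg hij.symm, if_pos (by rw [hkz]; exact ⟨(p+q)*r, by ring⟩), Nat.lcm_comm, hlcm, e,
        S.hE.symm (j:V) i, h1, Int.mul_ediv_cancel _ (by exact_mod_cast (S.k_pos j).ne'), inv_zpow,
        neg_div, div_self pj]
      simp
    have he : (p+q) * k j / (k i : ℤ) = r * (p+q) := by
      rw [hkz, ← mul_assoc, Int.mul_ediv_cancel _ ki]; ring
    simp only [smul_lie, lie_smul]
    rw [← lie_skew (y j q) (x j p), neg_lie, M.act, c1, he, smul_neg, smul_neg, neg_smul, smul_neg, smul_neg, neg_neg,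
      smul_smul, smul_smul, zpow_add₀ w0]
    have := zpow_ne_zero p w0
    have := zpow_ne_zero q w0
    rw [show Ω i j ^ p * Ω i j ^ q * (Ω i j ^ p * Ω i j ^ q)⁻¹ = 1 by field_simp, one_smul]
  · intro q p
    rw [lie_smul, M.yx hij, smul_zero]
  · intro q p
    rw [smul_lie, M.yx hij.symm, smul_zero]
  · exact fun n => LieSubalgebra.subset_lieSpan (Or.inl ⟨n, rfl⟩)
  · exact fun n => LieSubalgebra.smul_mem _ _ (LieSubalgebra.subset_lieSpan (Or.inr ⟨n, rfl⟩))
  · intro θ h h' h''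
    refine M.T2 i j h h' fun t => ?_
    have := h'' t
    rw [smul_lie] at this
    exact (smul_eq_zero.1 this).resolve_left (zpow_ne_zero _ w0)

end HalfM
end HalfSec

open LieAlgebra

section SerSec
variable {L : Type*} [LieRing L] [LieAlgebra ℂ L]

theorem pow_vanish {u v : L} {m q : ℕ} (h : (ad ℂ L u ^ m) v = 0) (hq : m ≤ q) : (ad ℂ L u ^ q) v = 0 := by
  obtain ⟨d, rfl⟩ := Nat.exists_eq_add_of_le hq
  rw [add_comm, pow_add, Module.End.mul_apply, h, map_zero]

theorem ad1 (u v : L) : (ad ℂ L u ^ 1) v = ⁅u, v⁆ := by rw [pow_one, ad_apply]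
theorem ad2 (u v : L) : (ad ℂ L u ^ 2) v = ⁅u, ⁅u, v⁆⁆ := by rw [pow_succ', Module.End.mul_apply, ad1, ad_apply]
theorem ad3 (u v : L) : (ad ℂ L u ^ 3) v = ⁅u, ⁅u, ⁅u, v⁆⁆⁆ := by rw [pow_succ', Module.End.mul_apply, ad2, ad_apply]
theorem ad4 (u v : L) : (ad ℂ L u ^ 4) v = ⁅u, ⁅u, ⁅u, ⁅u, v⁆⁆⁆⁆ := by
  rw [pow_succ', Module.End.mul_apply, ad3, ad_apply]
theorem ad5 (u v : L) : (ad ℂ L u ^ 5) v = ⁅u, ⁅u, ⁅u, ⁅u, ⁅u, v⁆⁆⁆⁆⁆ := by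
  rw [pow_succ', Module.End.mul_apply, ad4, ad_apply]

namespace TP
variable {m r D : ℕ} {X Y b c : ℤ → L} {N Na Nb : LieSubalgebra ℂ L}

theorem ser2 (o : TP 2 2 2 X Y b c N Na Nb) (p n : ℤ) : (ad ℂ L (X p) ^ 3) (b n) = 0 := by
  rw [ad3, o.L1, o.two3]

theorem ser3 (o : TP 3 3 2 X Y b c N Na Nb) (p n : ℤ) : (ad ℂ L (X p) ^ 4) (b n) = 0 := by
  rw [ad4, o.L1, half_eq (o.three2 _ _), lie_smul, lie_smul, o.three4, smul_zero]

theorem ser6 (o : TP 2 1 6 X Y b c N Na Nb) (p n : ℤ) : (ad ℂ L (X p) ^ 3) (b n) = 0 := by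
  rw [ad3, o.L1, o.six3]

theorem serZ (o : TP 2 1 6 X Y b c N Na Nb) (n : ℤ) :
    (ad ℂ L ((1/4:ℂ) • ⁅X 0, X 1⁆) ^ 2) (b n) = 0 := by
  have e : ∀ u : L, ⁅(1/4:ℂ) • ⁅X 0, X 1⁆, u⁆ = (1/4:ℂ) • (⁅X 0, ⁅X 1, u⁆⁆ - ⁅X 1, ⁅X 0, u⁆⁆) := by
    intro u; rw [smul_lie, lie_lie]
  rw [ad2, e (b n), o.L1 1, o.L1 0, lie_smul, lie_sub, e, e]
  simp only [o.six3, lie_zero, sub_zero, smul_zero]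

theorem longser (o : TP m r D X Y b c N Na Nb) (p n : ℤ) : (ad ℂ L (b n) ^ 2) (X p) = 0 := by
  rw [ad2, ← lie_skew (b n) (X p), lie_neg, o.bb, neg_zero]

theorem longserZ (o : TP m r D X Y b c N Na Nb) (n : ℤ) (z : ℂ) : (ad ℂ L (b n) ^ 3) (z • ⁅X 0, X 1⁆) = 0 := by
  have h : ∀ p, ⁅b n, ⁅b n, X p⁆⁆ = 0 := fun p => by rw [← ad2]; exact o.longser p n
  rw [map_smul, ad3, leibniz_lie (b n) (X 0) (X 1), lie_add, leibniz_lie (b n) ⁅b n, X 0⁆ (X 1), leibniz_lie (b n) (X 0) ⁅b n, X 1⁆, h, h]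
  simp only [zero_lie, lie_zero, zero_add, add_zero]
  rw [lie_add, leibniz_lie, h, h]
  simp

theorem r1_6 (o : TP m 1 D X Y b c N Na Nb) : ⁅X 1, b 0⁆ = ⁅X 0, b 1⁆ := by
  rw [o.L1 0 1]; simp

theorem z_6 (o : TP 2 1 6 X Y b c N Na Nb) : (2:ℂ) • ⁅(1/4:ℂ) • ⁅X 0, X 1⁆, b 0⁆ = ⁅X 0, ⁅X 0, b 1⁆⁆ := by
  rw [smul_lie, lie_lie, o.six2 1 0, o.L1 0 1]
  have : sg 1 = -1 := by simp [sg]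
  rw [this]
  simp only [Nat.cast_one, mul_one, zero_add, add_zero]
  module

theorem r2_6 (o : TP 2 2 2 X Y b c N Na Nb) : ⁅X 1, ⁅X 1, b 0⁆⁆ = -⁅X 0, ⁅X 0, b 1⁆⁆ := by
  rw [o.two2 1 1, o.L1 0 1]
  have : sg 1 = -1 := by simp [sg]
  rw [this]
  simp [dv]

theorem r2_8 (o : TP 2 2 2 X Y b c N Na Nb) : ⁅X 0, ⁅X 1, b 0⁆⁆ = 0 := by
  rw [o.two2 0 1]
  simp [dv]

theorem r3_6 (o : TP 3 3 2 X Y b c N Na Nb) : ⁅X 1, ⁅X 1, ⁅X 1, b 0⁆⁆⁆ = ⁅X 0, ⁅X 0, ⁅X 0, b 1⁆⁆⁆ := by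
  rw [half_eq (o.three2 1 1), lie_smul, o.three3, o.L1 0 1, half_eq (o.three2 0 _), lie_smul]
  norm_num [dv]

theorem r3_8 (o : TP 3 3 2 X Y b c N Na Nb) : ⁅X 0, ⁅X 1, ⁅X 1, b 0⁆⁆⁆ = 0 := by
  rw [half_eq (o.three2 1 1), lie_smul, o.three3]
  norm_num [dv]

theorem r3_8' (o : TP 3 3 2 X Y b c N Na Nb) : ⁅X 0, ⁅X 0, ⁅X 1, b 0⁆⁆⁆ = 0 := by
  rw [half_eq (o.three2 0 1), lie_smul, o.three3]
  norm_num [dv]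
end TP

variable {V : Type*} [AddCommGroup V] [Module ℝ V]
  {B : LinearMap.BilinForm ℝ V} {R : Set V} {l : ℕ} {P : Set V} {a : V} {k : V → ℕ} {g : V → Bool}
  {Ω : V → V → ℂ} {hb : Vc V → L} {x y H : P → ℤ → L} {Pos Neg : LieSubalgebra ℂ L}

/-- images of the generators -/
noncomputable def GG (g : V → Bool) (x : P → ℤ → L) (i : P) (s : Bool) : L :=
  if s = true then (if g i = true then (1/4:ℂ) • ⁅x i 0, x i 1⁆ else x i 1) else x i 0

/-- coefficients of the roots -/
noncomputable def ww (g : V → Bool) (i : P) (s : Bool) : ℝ := if s = true then (cMap g (i:V) : ℝ) else 1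

theorem GG_f (i : P) : GG g x i false = x i 0 := by simp [GG]
theorem GG_t {i : P} (h : g i = false) : GG g x i true = x i 1 := by simp [GG, h]
theorem GG_z {i : P} (h : g i = true) : GG g x i true = (1/4:ℂ) • ⁅x i 0, x i 1⁆ := by simp [GG, h]
theorem GG_x {i : P} (h : g i = false) (s : Bool) : ∃ n, GG g x i s = x i n := by
  cases s
  · exact ⟨0, GG_f i⟩
  · exact ⟨1, GG_t h⟩
theorem ww_f (i : P) : ww g i false = 1 := by simp [ww]
theorem ww_t {i : P} (h : g i = false) (s : Bool) : ww g i s = 1 := by cases s <;> simp [ww, cMap, h]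
theorem ww_z {i : P} (h : g i = true) : ww g i true = 2 := by simp [ww, cMap, h]
theorem ww_pos (i : P) (s : Bool) : 0 < ww g i s := by
  cases s <;> cases h : g i <;> simp [ww, cMap, h]

namespace HalfM

theorem GG_mem (i : P) (s : Bool) : GG g x i s ∈ N1 x i := by
  have m1 : ∀ n, x i n ∈ N1 x i := fun n => LieSubalgebra.subset_lieSpan ⟨n, rfl⟩
  rw [GG]
  split_ifs
  · exact LieSubalgebra.smul_mem _ _ (LieSubalgebra.lie_mem _ (m1 _) (m1 _))
  · exact m1 _
  · exact m1 _

theorem N1_comm {u v : ℤ → L} (h : ∀ m n, ⁅u m, v n⁆ = 0) {θ η : L}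
    (hθ : θ ∈ LieSubalgebra.lieSpan ℂ L (Set.range u)) (hη : η ∈ LieSubalgebra.lieSpan ℂ L (Set.range v)) : ⁅θ, η⁆ = 0 := by
  refine lieSpan_comm (s := Set.range v) ?_ hη
  rintro _ ⟨n, rfl⟩
  rw [← lie_skew θ (v n), neg_eq_zero]
  refine lieSpan_comm (s := Set.range u) ?_ hθ
  rintro _ ⟨m, rfl⟩
  rw [← lie_skew (v n) (u m), h, neg_zero]

theorem cases (S : Setup B R l P a k g) {i j : P} (hij : i ≠ j) {m : ℕ} (hm : m = 1 ∨ m = 2 ∨ m = 3)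
    (h1 : 2 * B (i:V) j = -(B (j:V) j)) (h2 : 2 * B (i:V) j = -(m * B (i:V) i)) :
    g j = false ∧ ((g i = false ∧ k j = 1 * k i) ∨ (g i = false ∧ m = 2 ∧ k j = 2 * k i) ∨
      (g i = false ∧ m = 3 ∧ k j = 3 * k i) ∨ (g i = true ∧ m = 2 ∧ k j = 1 * k i)) := by
  obtain ⟨h3, h4, h5⟩ := S.k_data hij hm h1 h2
  refine ⟨h4, ?_⟩
  cases hg : g i
  · rcases h3 with h3 | h3
    · left; exact ⟨rfl, by rw [h3, one_mul]⟩
    · rcases hm with rfl | rfl | rfl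
      · left; exact ⟨rfl, h3⟩
      · right; left; exact ⟨rfl, rfl, h3⟩
      · right; right; left; exact ⟨rfl, rfl, h3⟩
  · right; right; right
    exact ⟨rfl, (h5 hg).1, by rw [(h5 hg).2, one_mul]⟩

theorem unscale {z : ℂ} (hz : z ≠ 0) {u v : L} {n : ℕ} (h : (ad ℂ L u ^ n) (z • v) = 0) : (ad ℂ L u ^ n) v = 0 := by
  rw [map_smul] at h
  exact (smul_eq_zero.1 h).resolve_left hz

theorem unscale' {z : ℂ} (hz : z ≠ 0) {u v : L} {n : ℕ} (h : (ad ℂ L (z • u) ^ n) v = 0) : (ad ℂ L u ^ n) v = 0 := by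
  rw [map_smul, smul_pow, LinearMap.smul_apply] at h
  exact (smul_eq_zero.1 h).resolve_left (pow_ne_zero _ hz)

theorem serre_pos (S : Setup B R l P a k g) (M : HalfM B P k g Ω x y Pos) (hΩ : ∀ i j : P, Ω i j * Ω j i = 1)
    {i j : P} {s t : Bool} (hne : ¬ (i = j ∧ s = t)) {q : ℕ}
    (hq : -(2 * (ww g i s * ww g j t * B (i:V) j)) ≤ q * (ww g i s * ww g i s * B (i:V) i)) :
    (ad ℂ L (GG g x i s) ^ (q+1)) (GG g x j t) = 0 := by
  have w0 : ∀ i j : P, ∀ n : ℤ, Ω i j ^ n ≠ 0 := fun i j n => zpow_ne_zero _ (left_ne_zero_of_mul_eq_one (hΩ i j))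
  have triv : ⁅GG g x i s, GG g x j t⁆ = 0 → (ad ℂ L (GG g x i s) ^ (q+1)) (GG g x j t) = 0 := fun h =>
    pow_vanish (m := 1) (by rw [ad1, h]) (by omega)
  have pi := S.posP i
  have pj := S.posP j
  have sy := S.hE.symm (j:V) i
  by_cases hij : i = j
  · subst hij
    apply triv
    have hD : (if g i = true then 6 else 2) = 2 ∨ (if g i = true then 6 else 2) = 6 := by split <;> simp
    have key : ⁅GG g x i false, GG g x i true⁆ = 0 := by
      rw [GG_f]
      cases hg : g i
      · rw [GG_t hg, (M.to1 S i).XX]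
        simp [hg]
      · rw [GG_z hg, lie_smul, (M.to1 S i).cubic hD, smul_zero]
    cases s <;> cases t
    · simp at hne
    · exact key
    · rw [← lie_skew (GG g x i true) (GG g x i false), key, neg_zero]
    · simp at hne
  by_cases h0 : B (i:V) j = 0
  · exact triv (N1_comm (M.comm S hij h0) (GG_mem i s) (GG_mem j t))
  rcases S.linked hij h0 with ⟨m, hm, h1, h2⟩ | ⟨m, hm, h1, h2⟩
  · obtain ⟨hg, hc⟩ := HalfM.cases S hij hm h1 h2
    obtain ⟨n, hn⟩ := GG_x (x := x) hg t
    rw [hn]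
    rw [ww_t hg] at hq
    apply unscale (w0 i j n)
    have mq : g i = false → m ≤ q := by
      intro h
      rw [ww_t h] at hq
      have : (m:ℝ) * B (i:V) i ≤ q * B (i:V) i := by linarith
      exact_mod_cast le_of_mul_le_mul_right this pi
    rcases hc with ⟨hgi, hk⟩ | ⟨hgi, rfl, hk⟩ | ⟨hgi, rfl, hk⟩ | ⟨hgi, rfl, hk⟩
    · obtain ⟨p, hp⟩ := GG_x (x := x) hgi s
      have o := M.tp S hΩ hij h1 h2 hk hg
      simp only [hgi, Bool.false_eq_true, if_false] at o
      rw [hp]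
      exact pow_vanish (o.serre1 (by omega) p n) (by have := mq hgi; omega)
    · obtain ⟨p, hp⟩ := GG_x (x := x) hgi s
      have o := M.tp S hΩ hij h1 h2 hk hg
      simp only [hgi, Bool.false_eq_true, if_false] at o
      rw [hp]
      exact pow_vanish (o.ser2 p n) (by have := mq hgi; omega)
    · obtain ⟨p, hp⟩ := GG_x (x := x) hgi s
      have o := M.tp S hΩ hij h1 h2 hk hg
      simp only [hgi, Bool.false_eq_true, if_false] at o
      rw [hp]
      exact pow_vanish (o.ser3 p n) (by have := mq hgi; omega)
    · have o := M.tp S hΩ hij h1 h2 hk hg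
      simp only [hgi, if_true] at o
      cases s
      · rw [GG_f]
        rw [ww_f] at hq
        have : (2:ℝ) * B (i:V) i ≤ q * B (i:V) i := by push_cast at h2; linarith
        have : 2 ≤ q := by exact_mod_cast le_of_mul_le_mul_right this pi
        exact pow_vanish (o.ser6 0 n) (by omega)
      · rw [GG_z hgi]
        rw [ww_z hgi] at hq
        have : (1:ℝ) * B (i:V) i ≤ q * B (i:V) i := by push_cast at h2; linarith
        have : 1 ≤ q := by exact_mod_cast le_of_mul_le_mul_right this pi
        exact pow_vanish (o.serZ n) (by omega)
  · obtain ⟨hg, hc⟩ := HalfM.cases S (Ne.symm hij) hm h1 h2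
    obtain ⟨n, hn⟩ := GG_x (x := x) hg s
    rw [hn]
    rw [ww_t hg] at hq
    apply unscale' (w0 j i n)
    rw [sy] at h1
    have q1 : ww g j t ≤ q := by
      have : ww g j t * B (i:V) i ≤ q * B (i:V) i := by
        have : -(2 * (1 * ww g j t * B (i:V) j)) = ww g j t * B (i:V) i := by linear_combination (-(ww g j t)) * h1
        linarith
      exact le_of_mul_le_mul_right this pi
    obtain ⟨r, hk⟩ : ∃ r, k j = k j ∧ k i = r * k j := by
      rcases hc with ⟨_, h⟩ | ⟨_, _, h⟩ | ⟨_, _, h⟩ | ⟨_, _, h⟩ <;> exact ⟨_, rfl, h⟩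
    have o := M.tp S hΩ (Ne.symm hij) (by rw [sy]; exact h1) h2 hk.2 hg
    have hX : ∀ p, 1 ≤ q → (ad ℂ L (Ω j i ^ n • x i n) ^ (q+1)) (x j p) = 0 := fun p h =>
      pow_vanish (o.longser p n) (by omega)
    cases hgj : g j
    · obtain ⟨p, hp⟩ := GG_x (x := x) hgj t
      rw [ww_t hgj] at q1
      rw [hp]
      exact hX p (by exact_mod_cast q1)
    · cases t
      · rw [ww_f] at q1
        rw [GG_f]
        exact hX 0 (by exact_mod_cast q1)
      · rw [ww_z hgj] at q1
        rw [GG_z hgj]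
        have : 2 ≤ q := by exact_mod_cast q1
        exact pow_vanish (o.longserZ n (1/4)) (by omega)

theorem sr6 (S : Setup B R l P a k g) (M : HalfM B P k g Ω x y Pos) (hΩ : ∀ i j : P, Ω i j * Ω j i = 1)
    {i j : P} (h1 : 2 * B (i:V) j = -(B (j:V) j)) :
    (cMap g (i:V) : ℂ) • (ad ℂ L (GG g x i true) ^ (k j / k i)) (x j 0) =
      (if k j = 2 * k i then -Ω i j else Ω i j) • (ad ℂ L (x i 0) ^ (cMap g (i:V) * (k j / k i))) (GG g x j true) ∧
    ∀ s : ℕ, 1 ≤ s → s ≤ k j / k i - 1 →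
      (ad ℂ L (x i 0) ^ s) ((ad ℂ L (GG g x i true) ^ (k j / k i - s)) (x j 0)) = 0 := by
  have pi := S.posP i
  have pj := S.posP j
  have ki := S.k_pos i
  have hij : i ≠ j := by rintro rfl; linarith
  have h0 : B (i:V) j ≠ 0 := by intro h; rw [h] at h1; linarith
  obtain ⟨m, hm, h2⟩ : ∃ m : ℕ, (m = 1 ∨ m = 2 ∨ m = 3) ∧ 2 * B (i:V) j = -(m * B (i:V) i) := by
    rcases S.linked hij h0 with ⟨m, hm, h3, h4⟩ | ⟨m, hm, h3, h4⟩
    · exact ⟨m, hm, h4⟩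
    · refine ⟨1, Or.inl rfl, ?_⟩
      rw [S.hE.symm (j:V) i] at h3
      rw [h3]; simp
  obtain ⟨hg, hc⟩ := HalfM.cases S hij hm h1 h2
  have dv : ∀ r, k j = r * k i → k j / k i = r := fun r h => by rw [h]; exact Nat.mul_div_cancel _ ki
  rw [GG_t hg]
  rcases hc with ⟨hgi, hk⟩ | ⟨hgi, rfl, hk⟩ | ⟨hgi, rfl, hk⟩ | ⟨hgi, rfl, hk⟩
  · have o := M.tp S hΩ hij h1 h2 hk hg
    simp only [hgi, Bool.false_eq_true, if_false] at o
    rw [dv 1 hk, GG_t hgi, if_neg (by omega)]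
    refine ⟨?_, fun s h h' => by omega⟩
    have := o.r1_6
    simp only [zpow_zero, one_smul, zpow_one, lie_smul] at this
    simp only [cMap, hgi, Bool.false_eq_true, if_false, mul_one, Nat.cast_one, one_smul, ad1]
    exact this
  · have o := M.tp S hΩ hij h1 h2 hk hg
    simp only [hgi, Bool.false_eq_true, if_false] at o
    rw [dv 2 hk, GG_t hgi, if_pos (by omega)]
    constructor
    · have := o.r2_6
      simp only [zpow_zero, one_smul, zpow_one, lie_smul] at this
      simp only [cMap, hgi, Bool.false_eq_true, if_false, one_mul, Nat.cast_one, one_smul, ad2, neg_smul]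
      exact this
    · intro s h h'
      obtain rfl : s = 1 := by omega
      have := o.r2_8
      simp only [zpow_zero, one_smul] at this
      rw [ad1, show 2 - 1 = 1 from rfl, ad1, this]
  · have o := M.tp S hΩ hij h1 h2 hk hg
    simp only [hgi, Bool.false_eq_true, if_false] at o
    rw [dv 3 hk, GG_t hgi, if_neg (by omega)]
    constructor
    · have := o.r3_6
      simp only [zpow_zero, one_smul, zpow_one, lie_smul] at this
      simp only [cMap, hgi, Bool.false_eq_true, if_false, one_mul, Nat.cast_one, one_smul, ad3]
      exact this
    · intro s h h'
      have e1 := o.r3_8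
      have e2 := o.r3_8'
      simp only [zpow_zero, one_smul] at e1 e2
      obtain rfl | rfl : s = 1 ∨ s = 2 := by omega
      · rw [ad1, show 3 - 1 = 2 from rfl, ad2, e1]
      · rw [ad2, show 3 - 2 = 1 from rfl, ad1, e2]
  · have o := M.tp S hΩ hij h1 h2 hk hg
    simp only [hgi, if_true] at o
    rw [dv 1 hk, GG_z hgi, if_neg (by omega)]
    refine ⟨?_, fun s h h' => by omega⟩
    have := o.z_6
    simp only [zpow_zero, one_smul, zpow_one, lie_smul] at this
    simp only [cMap, hgi, if_true, mul_one, Nat.cast_ofNat, ad1, ad2]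
    exact this

/-- opposite signs -/
theorem serre_opp (S : Setup B R l P a k g) (M : HalfM B P k g Ω x y Pos)
    {i j : P} {s t : Bool} (hne : ¬ (i = j ∧ s = t)) {q : ℕ}
    (hq : 2 * (ww g i s * ww g j t * B (i:V) j) ≤ q * (ww g i s * ww g i s * B (i:V) i)) :
    (ad ℂ L (GG g x i s) ^ (q+1)) (GG g (fun i n => y i (-n)) j t) = 0 := by
  have pi := S.posP i
  by_cases hij : i = j
  swap
  · refine pow_vanish (m := 1) ?_ (by omega)
    rw [ad1]
    exact N1_comm (u := x i) (v := fun n => y j (-n)) (fun m n => M.xy' i j hij m (-n)) (GG_mem (x := x) i s)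
      (GG_mem (x := fun i n => y i (-n)) j t)
  subst hij
  have o := M.to1 S i
  have a0 := M.act i i
  simp only [Mdl.self_div S, cA, if_true] at a0
  have aY := M.actY i
  cases hg : g i
  · have q2 : 2 ≤ q := by
      rw [ww_t hg, ww_t hg] at hq
      have : (2:ℝ) * B (i:V) i ≤ q * B (i:V) i := by linarith
      exact_mod_cast le_of_mul_le_mul_right this pi
    obtain ⟨n, hn⟩ := GG_x (x := x) hg s
    obtain ⟨n', hn'⟩ := GG_x (x := fun i n => y i (-n)) hg t
    rw [hn, hn']
    refine pow_vanish (m := 3) ?_ (by omega)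
    rw [ad3, ← lie_skew (x i n) ⁅x i n, y i (-n')⁆, a0, lie_neg, lie_smul, o.XX _ _ (by simp [hg]), smul_zero, neg_zero]
  · simp only [hg, if_true] at o a0 aY
    have d0 : dd 6 0 = 2 := dd_zero 6
    have d1 : dd 6 1 = 6 := by simp [dd]
    have d1' : dd 6 (-1) = 6 := by rw [dd_neg, d1]
    cases s <;> cases t
    · simp at hne
    · rw [ww_f, ww_z hg] at hq
      have : (4:ℝ) * B (i:V) i ≤ q * B (i:V) i := by linarith
      have : 4 ≤ q := by exact_mod_cast le_of_mul_le_mul_right this pi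
      rw [GG_f, GG_z hg]
      refine pow_vanish (m := 5) ?_ (by omega)
      have e1 : ⁅x i 0, (1/4:ℂ) • ⁅y i (-0), y i (-1)⁆⁆ = y i (-1) := by
        rw [lie_smul, leibniz_lie, aY, ← lie_skew (y i (-0)) ⁅x i 0, y i (-1)⁆, aY, neg_zero, add_zero, zero_add, d0, d1']
        simp only [zero_add, add_zero]
        module
      rw [ad5, e1, ← lie_skew (x i 0) ⁅x i 0, y i (-1)⁆, a0, lie_neg, lie_smul, lie_neg, lie_smul,
        o.cubic (Or.inr rfl), smul_zero, neg_zero]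
    · rw [ww_f, ww_z hg] at hq
      have : (1:ℝ) * B (i:V) i ≤ q * B (i:V) i := by linarith
      have : 1 ≤ q := by exact_mod_cast le_of_mul_le_mul_right this pi
      rw [GG_f, GG_z hg]
      refine pow_vanish (m := 2) ?_ (by omega)
      rw [ad2, ← lie_skew _ (y i (-0)), lie_smul, o.yXX, lie_neg, lie_smul, lie_smul, smul_lie,
        ← lie_skew ⁅x i 0, x i 1⁆ (x i _), o.cubic (Or.inr rfl)]
      simp
    · simp at hne
end HalfM
end SerSec

open LieAlgebra TensorProduct

section MEllSec
variable {L : Type*} [LieRing L] [LieAlgebra ℂ L] {V : Type*} [AddCommGroup V] [Module ℝ V]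
  {B : LinearMap.BilinForm ℝ V} {R : Set V} {l : ℕ} {P : Set V} {a : V} {k : V → ℕ} {g : V → Bool}
  {Ω ω : V → V → ℂ} {hb : Vc V → L} {x y H : P → ℤ → L} {Pos Neg : LieSubalgebra ℂ L}

/-- the roots `α`, `α*` -/
noncomputable def vv (a : V) (k : V → ℕ) (g : V → Bool) (p : P × Bool) : V :=
  if p.2 = true then starMap a k g (p.1:V) else (p.1:V)

theorem vv_eq (p : P × Bool) : vv a k g p = ww g p.1 p.2 • (p.1:V) + (if p.2 = true then (k p.1 : ℝ) else 0) • a := by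
  obtain ⟨i, s⟩ := p
  cases s
  · simp [vv, ww]
  · simp [vv, ww, Setup.star_eq]

/-- the signs in the negative part -/
noncomputable def ee (g : V → Bool) (p : P × Bool) : ℂ := if p.2 = true then (if g p.1 = true then -1 else 1) else 1

theorem ee_ne (p : P × Bool) : ee g p ≠ 0 := by rw [ee]; split_ifs <;> simp

open Classical in
/-- images of the generators -/
noncomputable def ebM (a : V) (k : V → ℕ) (g : V → Bool) (x y : P → ℤ → L) (μ : V) : L :=
  if h : ∃ p : P × Bool, μ = vv a k g p then GG g x h.choose.1 h.choose.2
  else if h : ∃ p : P × Bool, μ = -vv a k g p then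
    ee g h.choose • GG g (fun i n => y i (-n)) h.choose.1 h.choose.2
  else 0

namespace Setup

theorem vv_inj (S : Setup B R l P a k g) {p q : P × Bool} (h : vv a k g p = vv a k g q) : p = q := by
  rw [vv_eq, vv_eq] at h
  have h1 : p.1 = q.1 := by
    by_contra hne
    exact S.ne_diff hne (ww_pos _ _).ne' h
  obtain ⟨i, s⟩ := p
  obtain ⟨j, t⟩ := q
  simp only at h1
  subst h1
  have h2 := (S.one_lc h).2
  have : (k i : ℝ) ≠ 0 := by exact_mod_cast (S.k_pos i).ne'
  cases s <;> cases t
  · rfl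
  · exact absurd (by simpa using h2.symm) (S.k_pos i).ne'
  · exact absurd (by simpa using h2) (S.k_pos i).ne'
  · rfl

theorem vv_ne (S : Setup B R l P a k g) (p q : P × Bool) : vv a k g p ≠ -vv a k g q := by
  intro h
  rw [vv_eq, vv_eq, neg_add, ← neg_smul, ← neg_smul] at h
  have h1 : p.1 = q.1 := by
    by_contra hne
    exact S.ne_diff hne (ww_pos _ _).ne' h
  obtain ⟨i, s⟩ := p
  obtain ⟨j, t⟩ := q
  simp only at h1
  subst h1
  have h2 := (S.one_lc h).1
  have := ww_pos (g := g) i s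
  have := ww_pos (g := g) i t
  simp only at h2
  linarith

theorem ebM_pos (S : Setup B R l P a k g) (p : P × Bool) : ebM a k g x y (vv a k g p) = GG g x p.1 p.2 := by
  have h : ∃ q : P × Bool, vv a k g p = vv a k g q := ⟨p, rfl⟩
  rw [ebM, dif_pos h, ← S.vv_inj h.choose_spec]

theorem ebM_neg (S : Setup B R l P a k g) (p : P × Bool) :
    ebM a k g x y (-vv a k g p) = ee g p • GG g (fun i n => y i (-n)) p.1 p.2 := by
  have h : ∃ q : P × Bool, -vv a k g p = -vv a k g q := ⟨p, rfl⟩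
  rw [ebM, dif_neg (fun ⟨q, hq⟩ => S.vv_ne q p hq.symm), dif_pos h, ← S.vv_inj (neg_injective h.choose_spec)]

theorem bplus_vv {μ : V} (h : μ ∈ bplus a P k g) : ∃ p : P × Bool, μ = vv a k g p := by
  rcases h with h | ⟨α, h, rfl⟩
  · exact ⟨(⟨μ, h⟩, false), by simp [vv]⟩
  · exact ⟨(⟨α, h⟩, true), by simp [vv]⟩

theorem bfull_vv {μ : V} (h : μ ∈ bfull a P k g) : ∃ p : P × Bool, μ = vv a k g p ∨ μ = -vv a k g p := by
  rcases h with h | h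
  · obtain ⟨p, hp⟩ := bplus_vv h
    exact ⟨p, Or.inl hp⟩
  · obtain ⟨p, hp⟩ := bplus_vv h
    exact ⟨p, Or.inr (by rw [← hp, neg_neg])⟩

theorem adj_data (S : Setup B R l P a k g) {i j : P} (h1 : 2 * B (i:V) j = -(B (j:V) j)) :
    g j = false ∧ (g i = true → k j / k i = 1) := by
  have pi := S.posP i
  have pj := S.posP j
  have hij : i ≠ j := by rintro rfl; linarith
  have h0 : B (i:V) j ≠ 0 := by intro h; rw [h] at h1; linarith
  obtain ⟨m, hm, h2⟩ : ∃ m : ℕ, (m = 1 ∨ m = 2 ∨ m = 3) ∧ 2 * B (i:V) j = -(m * B (i:V) i) := by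
    rcases S.linked hij h0 with ⟨m, hm, h3, h4⟩ | ⟨m, hm, h3, h4⟩
    · exact ⟨m, hm, h4⟩
    · refine ⟨1, Or.inl rfl, ?_⟩
      rw [S.hE.symm (j:V) i] at h3
      rw [h3]; simp
  obtain ⟨h3, h4, h5⟩ := S.k_data hij hm h1 h2
  exact ⟨h4, fun h => by rw [(h5 h).2]; exact Nat.div_self (S.k_pos i)⟩

end Setup

theorem ad_scale {u v : L} {n : ℕ} (z w : ℂ) (h : (ad ℂ L u ^ n) v = 0) : (ad ℂ L (z • u) ^ n) (w • v) = 0 := by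
  rw [map_smul, map_smul, smul_pow, LinearMap.smul_apply, h, smul_zero, smul_zero]

namespace Mdl

theorem hGG (M : Mdl B P a k g Ω hb x y H Pos Neg) (σ : Vc V) (i : P) (s : Bool) :
    ⁅hb σ, GG g x i s⁆ = ((ww g i s : ℂ) * bc B σ i) • GG g x i s := by
  cases s
  · rw [GG_f, ww_f, M.hx]; simp
  · cases hg : g i
    · rw [GG_t hg, ww_t hg, M.hx]; simp
    · rw [GG_z hg, ww_z hg, lie_smul, leibniz_lie, M.hx, M.hx, smul_lie, lie_smul]; push_cast; module

theorem hGG' (M : Mdl B P a k g Ω hb x y H Pos Neg) (σ : Vc V) (i : P) (s : Bool) :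
    ⁅hb σ, GG g (fun i n => y i (-n)) i s⁆ = -(((ww g i s : ℂ) * bc B σ i) • GG g (fun i n => y i (-n)) i s) := by
  cases s
  · rw [GG_f, ww_f, M.hy]; simp
  · cases hg : g i
    · rw [GG_t hg, ww_t hg, M.hy]; simp
    · rw [GG_z hg, ww_z hg, lie_smul, leibniz_lie, M.hy, M.hy, neg_lie, lie_neg, smul_lie, lie_smul]; push_cast; module

theorem sr4 (S : Setup B R l P a k g) (M : Mdl B P a k g Ω hb x y H Pos Neg) (p : P × Bool) :
    ⁅GG g x p.1 p.2, ee g p • GG g (fun i n => y i (-n)) p.1 p.2⁆ = hb ((1:ℂ) ⊗ₜ[ℝ] vee B (vv a k g p)) := by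
  obtain ⟨i, s⟩ := p
  cases s
  · simp only
    have e : ee g (i, false) = 1 := by simp [ee]
    rw [GG_f, GG_f, e, one_smul, neg_zero, M.xy0 i 0 0 (by simp)]
    simp [vv]
  cases hg : g i
  · simp only
    rw [GG_t hg, GG_t hg, lie_smul, M.xy0 i 1 _ (by simp), vv_eq, ww_t hg]
    simp [ee, hg]
  · have o := (M.half S).to1 S i
    simp only [hg, if_true] at o
    have d0 : dd 6 0 = 2 := dd_zero 6
    have d1 : dd 6 1 = 6 := by simp [dd]
    have d1' : dd 6 (-1) = 6 := by rw [dd_neg, d1]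
    simp only
    have e1 : ⁅⁅x i 0, x i 1⁆, y i 0⁆ = -((4:ℂ) • x i 1) := by
      rw [← lie_skew ⁅x i 0, x i 1⁆ (y i 0), o.yXX, add_zero, add_zero, zero_add, d0, d1]; norm_num
    have e2 : ⁅⁅x i 0, x i 1⁆, y i (-1)⁆ = (4:ℂ) • x i 0 := by
      rw [← lie_skew ⁅x i 0, x i 1⁆ (y i (-1)), o.yXX, zero_add, zero_add, add_neg_cancel, d0, d1', ← neg_smul]; norm_num
    have hh : ∀ (z : ℂ) (σ τ : Vc V), z • hb σ + z • hb τ = hb (z • (σ + τ)) := by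
      intro z σ τ; rw [M.s1, smul_add]
    have xx := M.xy0 i 1 (-1) (by simp)
    have xx0 := M.xy0 i 0 0 (by simp)
    rw [GG_z hg, GG_z hg, lie_smul, smul_lie, lie_smul, neg_zero, leibniz_lie, e1, e2, neg_lie, smul_lie, lie_smul,
      ← lie_skew (y i 0) (x i 0), xx, xx0]
    have : ee g (i, true) = -1 := by simp [ee, hg]
    rw [this]
    trans hb (((1/4:ℂ)) • ((1:ℂ) ⊗ₜ[ℝ] vee B ((i:V) + ((1 * k i : ℤ) : ℝ) • a) + (1:ℂ) ⊗ₜ[ℝ] vee B ((i:V) + ((0 * k i : ℤ) : ℝ) • a)))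
    · rw [← hh]; module
    · congr 1
      rw [← tmul_add, show (1/4:ℂ) = ((1/4:ℝ):ℂ) by push_cast; rfl, ← cast_tmul]
      congr 1
      rw [S.vee_shift, S.vee_shift, vv_eq, ww_z hg, vee, vee, S.B_form]
      have := (S.posP i).ne'
      simp only [if_true, smul_add, smul_smul]
      push_cast
      match_scalars <;> field_simp <;> ring

theorem GG_negneg (i : P) (s : Bool) : GG g (fun i n => (fun i n => x i (-n)) i (-n)) i s = GG g x i s := by
  simp only [neg_neg]

theorem ell (S : Setup B R l P a k g) (M : Mdl B P a k g Ω hb x y H Pos Neg) (hΩ : ∀ i j : P, Ω i j * Ω j i = 1)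
    (hω : ∀ i j : P, 2 * B (i:V) j = -(B (j:V) j) → ω i j = if k j = 2 * k i then -Ω i j else Ω i j) :
    Ell B a P k g ω hb (ebM a k g x y) := by
  have hΩ' : ∀ i j : P, (Ω i j)⁻¹ * (Ω j i)⁻¹ = 1 := fun i j => by rw [← mul_inv, hΩ, inv_one]
  have ei : ∀ i : P, ebM a k g x y i = x i 0 := fun i => by
    have := S.ebM_pos (x := x) (y := y) (i, false)
    simpa [vv, GG] using this
  have es : ∀ i : P, ebM a k g x y (starMap a k g i) = GG g x i true := fun i => by
    have := S.ebM_pos (x := x) (y := y) (i, true)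
    simpa [vv] using this
  have eni : ∀ i : P, ebM a k g x y (-i) = y i 0 := fun i => by
    have := S.ebM_neg (x := x) (y := y) (i, false)
    simpa [vv, GG, ee] using this
  have ens : ∀ i : P, ebM a k g x y (-starMap a k g i) = ee g (i, true) • GG g (fun i n => y i (-n)) i true := fun i => by
    have := S.ebM_neg (x := x) (y := y) (i, true)
    simpa [vv] using this
  have een : ∀ i : P, g i = false → ee g (i, true) = 1 := fun i h => by simp [ee, h]
  have eep : ∀ i : P, g i = true → ee g (i, true) = -1 := fun i h => by simp [ee, h]
  have bcv : ∀ σ (p : P × Bool), bc B σ (vv a k g p) = (ww g p.1 p.2 : ℂ) * bc B σ p.1 := by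
    intro σ p
    rw [vv_eq, bc_add, bc_smul, bc_smul, S.bc_a, mul_zero, add_zero]
  have sr7 : ∀ i j : P, 2 * B (i:V) j = -(B (j:V) j) → _ := fun i j h => (M.half' S).sr6 S hΩ' h
  refine ⟨M.s1, M.s2, ?_, ?_, ?_, ?_, ?_, ?_, ?_⟩
  · intro σ μ hμ
    change ⁅_, _⁆ = bc B σ μ • _
    obtain ⟨p, rfl | rfl⟩ := Setup.bfull_vv hμ
    · rw [S.ebM_pos, M.hGG, bcv]
    · rw [S.ebM_neg, lie_smul, M.hGG', bc_neg, bcv, neg_smul, smul_neg, smul_comm]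
  · intro μ hμ
    obtain ⟨p, rfl⟩ := Setup.bplus_vv hμ
    rw [S.ebM_pos, S.ebM_neg, M.sr4 S]
  · intro μ hμ ν hν h1 h2
    have key : ∀ p q : P × Bool, (B (vv a k g p) (vv a k g q) = ww g p.1 p.2 * ww g q.1 q.2 * B (p.1:V) q.1) := by
      intro p q; rw [vv_eq, vv_eq, S.B_form]
    have pv : ∀ p : P × Bool, 0 < ww g p.1 p.2 * ww g p.1 p.2 * B (p.1:V) p.1 := fun p =>
      mul_pos (mul_pos (ww_pos _ _) (ww_pos _ _)) (S.posP _)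
    rw [xExp, add_comm]
    have lc := Nat.le_ceil (-(2 * B μ ν / B μ μ))
    set q := ⌈-(2 * B μ ν / B μ μ)⌉₊
    have hp : 0 < B μ μ := S.bpos hμ
    have lc2 : -(2 * B μ ν) ≤ q * B μ μ := by
      rw [← neg_div, div_le_iff₀ hp] at lc
      exact lc
    obtain ⟨p, rfl | rfl⟩ := Setup.bfull_vv hμ <;> obtain ⟨p', rfl | rfl⟩ := Setup.bfull_vv hν
    · rw [S.ebM_pos, S.ebM_pos]
      refine (M.half S).serre_pos S hΩ (fun h => h1 (by rw [Prod.ext h.1 h.2])) ?_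
      rw [key, key] at lc2
      linarith
    · rw [S.ebM_pos, S.ebM_neg, map_smul, (M.half S).serre_opp S (fun h => h2 (by rw [Prod.ext h.1 h.2])) ?_, smul_zero]
      rw [map_neg, key, key] at lc2
      linarith
    · rw [S.ebM_neg, S.ebM_pos, ← GG_negneg p'.1 p'.2]
      have := ad_scale (ee g p) 1 ((M.half' S).serre_opp S (i := p.1) (j := p'.1) (s := p.2) (t := p'.2) (q := q)
        (fun h => h2 (by rw [neg_neg, Prod.ext h.1 h.2])) ?_)
      · rwa [one_smul] at this
      · simp only [map_neg, LinearMap.neg_apply] at lc2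
        rw [key, key] at lc2
        linarith
    · rw [S.ebM_neg, S.ebM_neg]
      refine ad_scale _ _ ((M.half' S).serre_pos S hΩ' (fun h => h1 (by rw [Prod.ext h.1 h.2])) ?_)
      simp only [map_neg, LinearMap.neg_apply] at lc2
      rw [key, key] at lc2
      linarith
  · intro α hα β hβ h
    have h6 := (M.half S).sr6 S hΩ (i := ⟨α, hα⟩) (j := ⟨β, hβ⟩) h
    have := hω ⟨α, hα⟩ ⟨β, hβ⟩ h
    simp only at this h6
    rw [this]
    rw [← es ⟨α, hα⟩, ← es ⟨β, hβ⟩, ← ei ⟨α, hα⟩, ← ei ⟨β, hβ⟩] at h6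
    exact h6.1
  · intro α hα β hβ h
    have h6 := (M.half' S).sr6 S hΩ' (i := ⟨α, hα⟩) (j := ⟨β, hβ⟩) h
    have h7 := hω ⟨α, hα⟩ ⟨β, hβ⟩ h
    obtain ⟨hg, hd⟩ := S.adj_data (i := ⟨α, hα⟩) (j := ⟨β, hβ⟩) h
    have e1 := ens ⟨α, hα⟩
    have e2 := ens ⟨β, hβ⟩
    have e3 := eni ⟨α, hα⟩
    have e4 := eni ⟨β, hβ⟩
    simp only [neg_zero] at h7 h6 e1 e2 e3 e4 hg hd
    rw [h7, e1, e2, e3, e4, een ⟨β, hβ⟩ hg, one_smul]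
    have h8 := h6.1
    have hi : (if k β = 2 * k α then -Ω α β else Ω α β)⁻¹ = if k β = 2 * k α then -(Ω α β)⁻¹ else (Ω α β)⁻¹ := by
      split_ifs
      · rw [inv_neg]
      · rfl
    rw [hi, ← h8]
    cases hgi : g α
    · rw [een ⟨α, hα⟩ hgi, one_smul]; simp [cMap, hgi]
    · rw [eep ⟨α, hα⟩ hgi, hd hgi, ad1, ad1, smul_lie, smul_smul]
      simp only [cMap, hgi, if_true]
      norm_num
  · intro α hα β hβ h
    have h6 := (M.half S).sr6 S hΩ (i := ⟨α, hα⟩) (j := ⟨β, hβ⟩) h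
    rw [← es ⟨α, hα⟩, ← es ⟨β, hβ⟩, ← ei ⟨α, hα⟩, ← ei ⟨β, hβ⟩] at h6
    exact h6.2
  · intro α hα β hβ h s hs hs'
    have h6 := ((M.half' S).sr6 S hΩ' (i := ⟨α, hα⟩) (j := ⟨β, hβ⟩) h).2 s hs hs'
    have e1 := ens ⟨α, hα⟩
    have e3 := eni ⟨α, hα⟩
    have e4 := eni ⟨β, hβ⟩
    simp only [neg_zero] at h6 e1 e3 e4
    rw [e1, e3, e4]
    have : (ad ℂ L (ee g ((⟨α, hα⟩ : P), true) • GG g (fun i n => y i (-n)) (⟨α, hα⟩ : P) true)) =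
      ee g ((⟨α, hα⟩ : P), true) • ad ℂ L (GG g (fun i n => y i (-n)) (⟨α, hα⟩ : P) true) := map_smul _ _ _
    rw [this, smul_pow, LinearMap.smul_apply, map_smul, h6, smul_zero]

end Mdl
end MEllSec

open LieAlgebra TensorProduct

section FinalSec

/-- a homomorphism is determined on loops by the first few values -/
theorem loop_map {L L' : Type*} [LieRing L] [LieAlgebra ℂ L] [LieRing L'] [LieAlgebra ℂ L'] {D : ℕ}
    {e f h : ℤ → L} {c : L} (p : Loop D e f h c) (φ : L →ₗ⁅ℂ⁆ L') {X Y K : ℤ → L'}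
    (e0 : φ (e 0) = X 0) (e1 : φ (e 1) = X 1) (f0 : φ (f 0) = Y 0) (f1 : φ (f (-1)) = Y (-1))
    (xy : ∀ m n : ℤ, m + n ≠ 0 → ⁅X m, Y n⁆ = K (m + n))
    (kx : ∀ m n : ℤ, ⁅K m, X n⁆ = dd D m • X (n + m)) (n : ℤ) (hn : n ≠ 0) : φ (h n) = K n := by
  have h1 : φ (h 1) = K 1 := by
    rw [p.hdef, LieHom.map_lie, e1, f0, xy 1 0 (by norm_num), add_zero]
  have h1' : φ (h (-1)) = K (-1) := by
    have := p.ef 0 (-1)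
    rw [if_neg (by norm_num), add_zero, zero_add] at this
    rw [← this, LieHom.map_lie, e0, f1, xy 0 (-1) (by norm_num), zero_add]
  have key : ∀ n : ℤ, φ (e n) = X n := by
    intro n
    induction n using Int.induction_on with
    | zero => exact e0
    | succ i ih =>
      have h2 := congrArg φ (p.he 1 i)
      rw [LieHom.map_lie, map_smul, h1, ih, kx, add_comm (1:ℤ)] at h2
      exact (smul_right_injective _ (dd_ne p.Dpos 1) h2).symm
    | pred i ih =>
      have h2 := congrArg φ (p.he (-1) (-i))
      rw [LieHom.map_lie, map_smul, h1', ih, kx, add_comm (-1:ℤ)] at h2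
      exact (smul_right_injective _ (dd_ne p.Dpos (-1)) h2).symm
  rw [p.hdef, LieHom.map_lie, key, f0, xy n 0 (by simpa using hn), add_zero]

section
variable {V : Type*} [AddCommGroup V] [Module ℝ V]
  {B : LinearMap.BilinForm ℝ V} {R : Set V} {l : ℕ} {P : Set V} {a : V} {k : V → ℕ} {g : V → Bool}
  {ω : V → V → ℂ}

/-- normalised tuning -/
noncomputable def tOm (k : V → ℕ) (ω : V → V → ℂ) (i j : V) : ℂ := if k j = 2 * k i then -ω i j else ω i j

open Classical in
/-- the full matrix of structure constants attached to a tuning -/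
noncomputable def bOm (B : LinearMap.BilinForm ℝ V) (k : V → ℕ) (ω : V → V → ℂ) (i j : V) : ℂ :=
  if 2 * B i j = -(B j j) then tOm k ω i j else if 2 * B j i = -(B i i) then (tOm k ω j i)⁻¹ else 1

namespace Setup

theorem bOm_mul (S : Setup B R l P a k g) (hω : IsTuning B P ω) (i j : P) : bOm B k ω i j * bOm B k ω j i = 1 := by
  have tne : ∀ i j : P, 2 * B (i:V) j = -(B (j:V) j) → tOm k ω i j ≠ 0 := by
    intro i j h
    have := (hω i i.2 j j.2).1 h
    rw [tOm]; split_ifs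
    · exact neg_ne_zero.2 this
    · exact this
  by_cases h1 : 2 * B (i:V) j = -(B (j:V) j) <;> by_cases h2 : 2 * B (j:V) i = -(B (i:V) i)
  · have h3 : 2 * B (i:V) j = -(B (i:V) i) := by rw [S.hE.symm (i:V) j]; exact h2
    have hij : i ≠ j := by
      rintro rfl
      have := S.posP i
      linarith
    have hk : k j = k i := by
      have := (S.k_data hij (m := 1) (Or.inl rfl) h1 (by simpa using h3)).1
      simpa using this
    have kp := S.k_pos i
    rw [bOm, bOm, if_pos h1, if_pos h2, tOm, tOm, if_neg (by omega), if_neg (by omega)]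
    exact (hω i i.2 j j.2).2 h1 h3
  · rw [bOm, bOm, if_pos h1, if_neg h2, if_pos h1, mul_inv_cancel₀ (tne i j h1)]
  · rw [bOm, bOm, if_neg h1, if_pos h2, if_pos h2, inv_mul_cancel₀ (tne j i h2)]
  · rw [bOm, bOm, if_neg h1, if_neg h2, if_neg h1, if_neg h2, mul_one]

theorem bOm_tun (S : Setup B R l P a k g) (i j : P) (h : 2 * B (i:V) j = -(B (j:V) j)) :
    ω i j = if k j = 2 * k i then -bOm B k ω i j else bOm B k ω i j := by
  rw [bOm, if_pos h, tOm]
  split_ifs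
  · rw [neg_neg]
  · rfl

end Setup

/-- the image of the loops in the model -/
theorem Mdl.image {L L' : Type*} [LieRing L] [LieAlgebra ℂ L] [LieRing L'] [LieAlgebra ℂ L']
    {Ω : V → V → ℂ} {hb : Vc V → L} {eb : V → L} {hb' : Vc V → L'}
    {x y H : P → ℤ → L'} {Pos Neg : LieSubalgebra ℂ L'}
    (S : Setup B R l P a k g) (M : Mdl B P a k g Ω hb' x y H Pos Neg) (φ : L →ₗ⁅ℂ⁆ L')
    (hφ : ∀ μ ∈ bfull a P k g, φ (eb μ) = ebM a k g x y μ) {i : P} {e f h : ℤ → L}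
    (D : LoopData B a k g hb eb i e f h) (n : ℤ) (hn : n ≠ 0) : φ (h n) = H i n := by
  have ei : φ (eb i) = x i 0 := by
    have := S.ebM_pos (x := x) (y := y) (i, false)
    rw [hφ _ (Setup.mem_i i)]
    simpa [vv, GG] using this
  have es : φ (eb (starMap a k g i)) = GG g x i true := by
    have := S.ebM_pos (x := x) (y := y) (i, true)
    rw [hφ _ (Setup.mem_s i)]
    simpa [vv] using this
  have eni : φ (eb (-(i:V))) = y i 0 := by
    have := S.ebM_neg (x := x) (y := y) (i, false)
    rw [hφ _ (Setup.mem_ni i)]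
    simpa [vv, GG, ee] using this
  have ens : φ (eb (-starMap a k g i)) = ee g (i, true) • GG g (fun i n => y i (-n)) i true := by
    have := S.ebM_neg (x := x) (y := y) (i, true)
    rw [hφ _ (Setup.mem_ns i)]
    simpa [vv] using this
  refine loop_map D.loop φ (X := x i) (Y := y i) (K := H i) (by rw [D.e0, ei]) ?_ (by rw [D.f0, eni]) ?_
    (fun m n h => M.xy i m n h) ?_ n hn
  · cases hg : g i
    · rw [D.e1 hg, es, GG_t hg]
    · have o := (M.half S).to1 S i
      simp only [hg, if_true] at o
      have d0 : dd 6 0 = 2 := dd_zero 6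
      have d1 : dd 6 1 = 6 := by simp [dd]
      rw [D.e1' hg, LieHom.map_lie, es, eni, GG_z hg, lie_smul, o.yXX, add_zero, add_zero, zero_add, d0, d1, smul_smul]
      norm_num
  · cases hg : g i
    · rw [D.f1 hg, ens, GG_t hg]; simp [ee, hg]
    · have o := (M.half' S).to1 S i
      simp only [hg, if_true] at o
      have d0 : dd 6 0 = 2 := dd_zero 6
      have d1 : dd 6 1 = 6 := by simp [dd]
      have h1 := o.yXX 0 0 1
      simp only [neg_zero, add_zero, zero_add] at h1
      have e1 : ee g (i, true) = -1 := by simp [ee, hg]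
      rw [D.f1' hg, LieHom.map_lie, ei, ens, GG_z hg, e1, smul_lie, smul_lie]
      simp only [neg_zero]
      rw [← lie_skew _ (x i 0), h1, d0, d1]
      module
  · intro m n
    rw [M.HX, Mdl.self_div S, cA, if_pos rfl]

end
end FinalSec

/-- For the elliptic Lie algebra `𝔤^ω` of a reduced elliptic root
system of rank `l ≥ 2`: the non-isotropic part of `ℛ^ω` is `R`, all root spaces of
roots in `R` are one-dimensional, `𝔤^ω_0 = 𝔥^ω` has dimension `l+2`, the isotropic
part of `ℛ^ω` lies in `ℤδ ⊕ ℤa`, and `dim 𝔤^ω_{ma} = |{α ∈ Π : k(α) ∣ m}|`. -/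
theorem stmt15 {V : Type*} [AddCommGroup V] [Module ℝ V]
    (B : LinearMap.BilinForm ℝ V) (R : Set V) (l : ℕ) (hl : 2 ≤ l)
    (hE : IsEARS B R l 2) (hred : IsReducedRS R)
    (P : Set V) (a : V) (hfs : IsFundamentalSet B R l P a)
    (k : V → ℕ) (g : V → Bool) (hkg : IsKG R a P k g)
    (ω : V → V → ℂ) (hω : IsTuning B P ω)
    (δ : V) (hδ : IsDelta B P δ)
    (gr : V → Submodule ℂ (EllipticLieAlg B a P k g ω))
    (hgr : IsEllGrading B R a P k g ω gr) :
    {σ : V | gr σ ≠ ⊥ ∧ B σ σ ≠ 0} = R ∧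
    (∀ μ ∈ R, Module.finrank ℂ (gr μ) = 1) ∧
    (gr 0 : Set (EllipticLieAlg B a P k g ω)) = Set.range (hbar B a P k g ω) ∧
    Module.finrank ℂ (gr 0) = l + 2 ∧
    (∀ σ : V, gr σ ≠ ⊥ → B σ σ = 0 → ∃ m r : ℤ, σ = m • δ + r • a) ∧
    (∀ m : ℤ, m ≠ 0 →
      Module.finrank ℂ (gr (m • a)) = (P ∩ {α : V | (k α : ℤ) ∣ m}).ncard) := by
  have S : Setup B R l P a k g := ⟨hl, hE, hred, hfs, hkg⟩
  have E := ell_ell (B := B) (P := P) (a := a) (k := k) (g := g) (ω := ω)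
  choose e f h D using fun i : P => S.exists_loop E ell_gen i
  have A : GrAll B R l P a k g ω (hbar B a P k g ω) (ebar B a P k g ω) gr e f h :=
    ⟨S, E, hω, ell_gen, D, ⟨hgr.1, hgr.2.1, hgr.2.2.2.1, hgr.2.2.2.2⟩⟩
  have hΩ : ∀ i j : P, bOm B k ω i j * bOm B k ω j i = 1 := S.bOm_mul hω
  obtain ⟨L, _, _, hb, x, y, H, Pos, Neg, M⟩ := S.exists_mdl hΩ
  obtain ⟨φ, φh, φe⟩ := ell_lift (M.ell S hΩ S.bOm_tun)
  refine A.final ?_ ?_ δ hδ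
  · intro σ τ h
    apply M.hinj
    rw [← φh, ← φh, h]
  · apply LinearIndependent.of_comp (φ : EllipticLieAlg B a P k g ω →ₗ[ℂ] L)
    have := M.hlin.comp (fun p : {p : P × ℤ // p.2 ≠ 0} => p.1) Subtype.val_injective
    have e : (φ : EllipticLieAlg B a P k g ω →ₗ[ℂ] L) ∘ (fun p : {p : P × ℤ // p.2 ≠ 0} => h p.1.1 p.1.2) =
        (fun p : P × ℤ => H p.1 p.2) ∘ (fun p : {p : P × ℤ // p.2 ≠ 0} => p.1) :=
      funext fun p => M.image S φ φe (D p.1.1) p.1.2 p.2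
    exact e ▸ this
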